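/- Let 𝔸 and 𝔹 be generalized algebraic theories and let h ≥ 0. If the pair (𝔸,𝔹) is h-derivable, then it is (h+1)-derivable. -/

import Mathlib

set_option linter.unusedVariables false

/-! # Syntax of generalized algebraic theories (following Cartmell / the paper's appendix) -/

namespace GATPaper

/-- A sort-and-term alphabet: a countably infinite set of variables, a set of sort
symbols and a set of term symbols. -/
structure Alphabet : Type 1 where
  Var : Type
  SortSym : Type
  TermSym : Type
  var_infinite : Infinite Var
  var_countable : Countable Var

attribute [instance] Alphabet.var_infinite Alphabet.var_countable

variable {A B : Alphabet}

/-- Term expressions over an alphabet. -/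
inductive Expr (A : Alphabet) : Type where
  | var : A.Var → Expr A
  | app : A.TermSym → List (Expr A) → Expr A

/-- Sort expressions: a sort symbol applied to a list of term expressions. -/
structure SortE (A : Alphabet) : Type where
  head : A.SortSym
  args : List (Expr A)

/-- Occurrence of a variable in a term expression. -/
inductive Occurs (x : A.Var) : Expr A → Prop where
  | var : Occurs x (Expr.var x)
  | app {t : A.TermSym} {es : List (Expr A)} {e : Expr A} :
      e ∈ es → Occurs x e → Occurs x (Expr.app t es)

/-- Occurrence of a variable in a sort expression. -/
def SOccurs (x : A.Var) (U : SortE A) : Prop := ∃ e ∈ U.args, Occurs x e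

/-- Simultaneous substitution along a function on variables. -/
def Expr.subst (σ : A.Var → Expr A) : Expr A → Expr A
  | .var x => σ x
  | .app t es => .app t (es.attach.map fun e => Expr.subst σ e.1)
termination_by e => sizeOf e
decreasing_by
  have := List.sizeOf_lt_of_mem e.2
  simp only [Expr.app.sizeOf_spec]
  omega

def SortE.subst (σ : A.Var → Expr A) (U : SortE A) : SortE A :=
  ⟨U.head, U.args.map (Expr.subst σ)⟩

open Classical in
/-- The function on variables determined by a finite list of substitution pairs
`(zᵢ, uᵢ)` (substituting `uᵢ` for `zᵢ`, first matching pair winning, all other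
variables unchanged). -/
noncomputable def lookupV : List (A.Var × Expr A) → A.Var → Expr A
  | [], x => .var x
  | p :: ps, x => if p.1 = x then p.2 else lookupV ps x

/-- The simultaneous substitution `e[u₁ | z₁, …, u_k | z_k]` where
`ps = [(z₁,u₁),…,(z_k,u_k)]`. -/
noncomputable def Expr.substL (e : Expr A) (ps : List (A.Var × Expr A)) : Expr A :=
  e.subst (lookupV ps)

noncomputable def SortE.substL (U : SortE A) (ps : List (A.Var × Expr A)) : SortE A :=
  U.subst (lookupV ps)

/-- A (pre)context is a finite list of (variable, sort expression) pairs. -/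
abbrev PreCtx (A : Alphabet) := List (A.Var × SortE A)

/-- The list of variables of a precontext, as term expressions. -/
def ctxVars (X : PreCtx A) : List (Expr A) := X.map fun p => Expr.var p.1

/-- The scoping condition of a precontext: the `i`-th sort expression only contains
variables among the first `i` variables. -/
def IsPreCtx (X : PreCtx A) : Prop :=
  ∀ i (hi : i < X.length) (v : A.Var),
    SOccurs v (X[i]'hi).2 → v ∈ (X.take i).map Prod.fst

/-- Substitution pairs sending the variables of `X` to the entries of `f`. -/
def mkSub (X : PreCtx A) (f : List (Expr A)) : List (A.Var × Expr A) :=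
  (X.map Prod.fst).zip f

/-- `Xᵢ[f₁ | x₁, …, f_{i-1} | x_{i-1}]` (0-based: the `i`-th sort of `X`
substituted along the first `i` entries of `f`). -/
noncomputable def subPre (X : PreCtx A) (f : List (Expr A)) (i : ℕ) (hi : i < X.length) :
    SortE A :=
  ((X[i]'hi).2).substL (mkSub (X.take i) (f.take i))

/-- Judgments: context judgments and the four kinds of standard judgments. -/
inductive Judg (A : Alphabet) : Type where
  | ctx (X : PreCtx A)
  | sort (X : PreCtx A) (U : SortE A)
  | term (X : PreCtx A) (u : Expr A) (U : SortE A)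
  | sortEq (X : PreCtx A) (U V : SortE A)
  | termEq (X : PreCtx A) (u v : Expr A) (U : SortE A)

/-- The context of a judgment. -/
def Judg.ctxOf : Judg A → PreCtx A
  | .ctx X => X
  | .sort X _ => X
  | .term X _ _ => X
  | .sortEq X _ _ => X
  | .termEq X _ _ _ => X

/-- The judgment introducing a sort symbol over the context `X`. -/
def introSort (X : PreCtx A) (S : A.SortSym) : Judg A := .sort X ⟨S, ctxVars X⟩

/-- The judgment introducing a term symbol over the context `X`, with sort `U`. -/
def introTerm (X : PreCtx A) (t : A.TermSym) (U : SortE A) : Judg A :=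
  .term X (.app t (ctxVars X)) U

/-- A set of axioms is a pretheory if: no axiom is a context judgment, every
axiom's context is a precontext, every sort symbol has a unique introducing sort
axiom and there are no other sort axioms, and likewise for term symbols. -/
structure IsPretheory (Ax : Set (Judg A)) : Prop where
  no_ctx : ∀ X : PreCtx A, Judg.ctx X ∉ Ax
  wf_ctx : ∀ J ∈ Ax, IsPreCtx J.ctxOf
  sort_intro : ∀ S : A.SortSym, ∃! X : PreCtx A, introSort X S ∈ Ax
  sort_shape : ∀ (X : PreCtx A) (U : SortE A), Judg.sort X U ∈ Ax → U.args = ctxVars X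
  term_intro : ∀ t : A.TermSym, ∃! p : PreCtx A × SortE A, introTerm p.1 t p.2 ∈ Ax
  term_shape : ∀ (X : PreCtx A) (u : Expr A) (U : SortE A), Judg.term X u U ∈ Ax →
      ∃ t : A.TermSym, u = Expr.app t (ctxVars X)

/-- One inference step of the paper's system: `Step Ax D J` holds when `J` is the
conclusion of an instance of one of the sixteen rules all of whose premises
satisfy `D`. -/
inductive Step (Ax : Set (Judg A)) (D : Judg A → Prop) : Judg A → Prop where
  | ctx_nil : Step Ax D (.ctx [])
  | ctx_cons {X : PreCtx A} {U : SortE A} {x : A.Var}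
      (hs : D (.sort X U)) (hfresh : ∀ p ∈ X, p.1 ≠ x)
      (hpre : IsPreCtx (X ++ [(x, U)])) :
      Step Ax D (.ctx (X ++ [(x, U)]))
  | s1 {X : PreCtx A} {U : SortE A} (h : D (.sort X U)) : Step Ax D (.sortEq X U U)
  | s2 {X : PreCtx A} {U V : SortE A} (h : D (.sortEq X U V)) : Step Ax D (.sortEq X V U)
  | s3 {X : PreCtx A} {U V W : SortE A}
      (h1 : D (.sortEq X U V)) (h2 : D (.sortEq X V W)) : Step Ax D (.sortEq X U W)
  | t1 {X : PreCtx A} {u : Expr A} {U : SortE A}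
      (h : D (.term X u U)) : Step Ax D (.termEq X u u U)
  | t2 {X : PreCtx A} {u v : Expr A} {U : SortE A}
      (h : D (.termEq X u v U)) : Step Ax D (.termEq X v u U)
  | t3 {X : PreCtx A} {u v w : Expr A} {U : SortE A}
      (h1 : D (.termEq X u v U)) (h2 : D (.termEq X v w U)) : Step Ax D (.termEq X u w U)
  | seqt {X : PreCtx A} {U U' : SortE A} {u : Expr A}
      (h1 : D (.sortEq X U U')) (h2 : D (.term X u U)) : Step Ax D (.term X u U')
  | seqteq {X : PreCtx A} {U U' : SortE A} {u u' : Expr A}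
      (h1 : D (.sortEq X U U')) (h2 : D (.termEq X u u' U))
      (h3 : D (.term X u U')) (h4 : D (.term X u' U')) : Step Ax D (.termEq X u u' U')
  | var {X : PreCtx A} {i : ℕ} (hi : i < X.length)
      (h : D (.sort X (X[i]'hi).2)) :
      Step Ax D (.term X (.var (X[i]'hi).1) (X[i]'hi).2)
  | sA {X : PreCtx A} {U : SortE A} (hax : Judg.sort X U ∈ Ax) (h : D (.ctx X))
      (hv : ∀ i (hi : i < X.length), D (.term X (.var (X[i]'hi).1) (X[i]'hi).2)) :
      Step Ax D (.sort X U)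
  | tA {X : PreCtx A} {u : Expr A} {U : SortE A} (hax : Judg.term X u U ∈ Ax)
      (h : D (.sort X U))
      (hv : ∀ i (hi : i < X.length), D (.term X (.var (X[i]'hi).1) (X[i]'hi).2)) :
      Step Ax D (.term X u U)
  | seqA {X : PreCtx A} {U U' : SortE A} (hax : Judg.sortEq X U U' ∈ Ax)
      (h1 : D (.sort X U)) (h2 : D (.sort X U')) : Step Ax D (.sortEq X U U')
  | teqA {X : PreCtx A} {u u' : Expr A} {U : SortE A} (hax : Judg.termEq X u u' U ∈ Ax)
      (h1 : D (.term X u U)) (h2 : D (.term X u' U)) : Step Ax D (.termEq X u u' U)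
  | sSub {X : PreCtx A} {S : A.SortSym} (hax : introSort X S ∈ Ax)
      {Y : PreCtx A} (hY : IsPreCtx Y) {f : List (Expr A)} (hlen : f.length = X.length)
      (hJ : D (introSort X S)) (hYc : D (.ctx Y))
      (hargs : ∀ i (hi : i < X.length) (hif : i < f.length),
        D (.term Y (f[i]'hif) (subPre X f i hi))) :
      Step Ax D (.sort Y ⟨S, f⟩)
  | tSub {X : PreCtx A} {t : A.TermSym} {U : SortE A} (hax : introTerm X t U ∈ Ax)
      {Y : PreCtx A} (hY : IsPreCtx Y) {f : List (Expr A)} (hlen : f.length = X.length)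
      (hJ : D (introTerm X t U))
      (hU : D (.sort Y (U.substL (mkSub X f))))
      (hargs : ∀ i (hi : i < X.length) (hif : i < f.length),
        D (.term Y (f[i]'hif) (subPre X f i hi))) :
      Step Ax D (.term Y (.app t f) (U.substL (mkSub X f)))
  | seqSub1 {X : PreCtx A} {U U' : SortE A} (hax : Judg.sortEq X U U' ∈ Ax)
      {Y : PreCtx A} (hY : IsPreCtx Y) {f : List (Expr A)} (hlen : f.length = X.length)
      (hJ : D (.sortEq X U U'))
      (h1 : D (.sort Y (U.substL (mkSub X f)))) (h2 : D (.sort Y (U'.substL (mkSub X f))))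
      (hargs : ∀ i (hi : i < X.length) (hif : i < f.length),
        D (.term Y (f[i]'hif) (subPre X f i hi))) :
      Step Ax D (.sortEq Y (U.substL (mkSub X f)) (U'.substL (mkSub X f)))
  | seqSub2 {X : PreCtx A} {S : A.SortSym} (hax : introSort X S ∈ Ax)
      {Y : PreCtx A} (hY : IsPreCtx Y) {f g : List (Expr A)}
      (hlf : f.length = X.length) (hlg : g.length = X.length)
      (hJ : D (introSort X S))
      (h1 : D (.sort Y ⟨S, f⟩)) (h2 : D (.sort Y ⟨S, g⟩))
      (hargs : ∀ i (hi : i < X.length) (hif : i < f.length) (hig : i < g.length),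
        D (.termEq Y (f[i]'hif) (g[i]'hig) (subPre X f i hi))) :
      Step Ax D (.sortEq Y ⟨S, f⟩ ⟨S, g⟩)
  | teqSub1 {X : PreCtx A} {u u' : Expr A} {U : SortE A}
      (hax : Judg.termEq X u u' U ∈ Ax)
      {Y : PreCtx A} (hY : IsPreCtx Y) {f : List (Expr A)} (hlen : f.length = X.length)
      (hJ : D (.termEq X u u' U))
      (h1 : D (.term Y (u.substL (mkSub X f)) (U.substL (mkSub X f))))
      (h2 : D (.term Y (u'.substL (mkSub X f)) (U.substL (mkSub X f))))
      (hargs : ∀ i (hi : i < X.length) (hif : i < f.length),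
        D (.term Y (f[i]'hif) (subPre X f i hi))) :
      Step Ax D (.termEq Y (u.substL (mkSub X f)) (u'.substL (mkSub X f))
        (U.substL (mkSub X f)))
  | teqSub2 {X : PreCtx A} {t : A.TermSym} {U : SortE A} (hax : introTerm X t U ∈ Ax)
      {Y : PreCtx A} (hY : IsPreCtx Y) {f g : List (Expr A)}
      (hlf : f.length = X.length) (hlg : g.length = X.length)
      (hJ : D (introTerm X t U))
      (h1 : D (.term Y (.app t f) (U.substL (mkSub X f))))
      (h2 : D (.term Y (.app t g) (U.substL (mkSub X f))))
      (hargs : ∀ i (hi : i < X.length) (hif : i < f.length) (hig : i < g.length),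
        D (.termEq Y (f[i]'hif) (g[i]'hig) (subPre X f i hi))) :
      Step Ax D (.termEq Y (.app t f) (.app t g) (U.substL (mkSub X f)))

/-- `DerAt Ax n J`: `J` is the conclusion of an inference step in the `n`-th stage
`𝒟ₙ` of the recursive construction of the derivable judgments. -/
def DerAt (Ax : Set (Judg A)) : ℕ → Judg A → Prop
  | 0, _ => False
  | n + 1, J => DerAt Ax n J ∨ Step Ax (DerAt Ax n) J

/-- A judgment is derivable if it is the conclusion of a step of some stage. -/
def Derivable (Ax : Set (Judg A)) (J : Judg A) : Prop := ∃ n, DerAt Ax n J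

/-- The height of a (derivable) judgment: the least stage at which it appears. -/
noncomputable def ht (Ax : Set (Judg A)) (J : Judg A) : ℕ := sInf {n | DerAt Ax n J}

/-- The height of a context: `0` for the empty context, and the height of
`∂X ⊢ Xₙ sort` otherwise. -/
noncomputable def htCtx (Ax : Set (Judg A)) (X : PreCtx A) : ℕ :=
  match X with
  | [] => 0
  | p :: X' =>
      ht Ax (.sort ((p :: X').dropLast) (((p :: X').getLast (List.cons_ne_nil p X')).2))

/-- A generalized algebraic theory: a pretheory all of whose axioms are derivable. -/
def IsGAT (Ax : Set (Judg A)) : Prop := IsPretheory Ax ∧ ∀ J ∈ Ax, Derivable Ax J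

/-- The partial term judgment `X ⊢ u term` is derivable. -/
def DerTerm (Ax : Set (Judg A)) (X : PreCtx A) (u : Expr A) : Prop :=
  ∃ U, Derivable Ax (.term X u U)

/-- The partial term equality judgment `X ⊢ u ≡ v term` is derivable. -/
def DerTermEq (Ax : Set (Judg A)) (X : PreCtx A) (u v : Expr A) : Prop :=
  ∃ U, Derivable Ax (.termEq X u v U)

/-- Height of a derivable partial term judgment: the minimum of the heights of
`X ⊢ u : U` over all `U`. -/
noncomputable def htTerm (Ax : Set (Judg A)) (X : PreCtx A) (u : Expr A) : ℕ :=
  sInf {n | ∃ U, DerAt Ax n (.term X u U)}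

/-- `f` is a context morphism from `X` to `Y`. -/
def IsMor (Ax : Set (Judg A)) (X Y : PreCtx A) (f : List (Expr A)) : Prop :=
  Derivable Ax (.ctx X) ∧ Derivable Ax (.ctx Y) ∧ f.length = Y.length ∧
  ∀ i (hi : i < Y.length) (hif : i < f.length),
    Derivable Ax (.term X (f[i]'hif) (subPre Y f i hi))

/-- The morphism equality `f ≡ g : X → Y` is derivable. -/
def MorEq (Ax : Set (Judg A)) (X Y : PreCtx A) (f g : List (Expr A)) : Prop :=
  IsMor Ax X Y f ∧ IsMor Ax X Y g ∧
  ∀ i (hi : i < Y.length) (hif : i < f.length) (hig : i < g.length),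
    Derivable Ax (.termEq X (f[i]'hif) (g[i]'hig) (subPre Y f i hi))

/-- The context equality `X ≡ Y ctx` is derivable. -/
def CtxEq (Ax : Set (Judg A)) (X Y : PreCtx A) : Prop :=
  X.length = Y.length ∧ Derivable Ax (.ctx X) ∧ Derivable Ax (.ctx Y) ∧
  ∀ i (hX : i < X.length) (hY : i < Y.length),
    Derivable Ax (.sortEq (X.take i) (X[i]'hX).2
      (((Y[i]'hY).2).substL (mkSub (Y.take i) (ctxVars (X.take i)))))

/-- Height of a context morphism. -/
noncomputable def htMor (Ax : Set (Judg A)) (X Y : PreCtx A) (f : List (Expr A)) : ℕ :=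
  max (htCtx Ax X) (max (htCtx Ax Y)
    ((Finset.range Y.length).sup fun i =>
      if h : i < Y.length ∧ i < f.length then
        ht Ax (.term X (f[i]'h.2) (subPre Y f i h.1))
      else 0))

/-- Height of a morphism equality. -/
noncomputable def htMorEq (Ax : Set (Judg A)) (X Y : PreCtx A) (f g : List (Expr A)) : ℕ :=
  max (htMor Ax X Y f) (max (htMor Ax X Y g)
    ((Finset.range Y.length).sup fun i =>
      if h : i < Y.length ∧ i < f.length ∧ i < g.length then
        ht Ax (.termEq X (f[i]'h.2.1) (g[i]'h.2.2) (subPre Y f i h.1))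
      else 0))

/-- The composite `g ∘ f` of tuples of term expressions, where `f : X → Y` and
`g : Y → Z`: the `i`-th entry is `gᵢ[f]`. -/
noncomputable def compMor (Y : PreCtx A) (f g : List (Expr A)) : List (Expr A) :=
  g.map fun e => e.substL (mkSub Y f)

/-- The canonical sort `𝒮(u)` of a term in a context (as a relation). -/
inductive CanonSort (Ax : Set (Judg A)) (X : PreCtx A) : Expr A → SortE A → Prop where
  | var {i : ℕ} (hi : i < X.length) : CanonSort Ax X (.var (X[i]'hi).1) (X[i]'hi).2
  | app {t : A.TermSym} {f : List (Expr A)} {Xa : PreCtx A} {V : SortE A}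
      (hax : introTerm Xa t V ∈ Ax) :
      CanonSort Ax X (.app t f) (V.substL (mkSub Xa f))


/-! ## The tensor product of generalized algebraic theories (§2 of the paper) -/

/-- The tensor product of two sort-and-term alphabets. -/
abbrev Alphabet.tensor (A B : Alphabet) : Alphabet :=
  { Var := A.Var × B.Var
    SortSym := A.SortSym × B.SortSym
    TermSym := (A.SortSym × B.TermSym) ⊕ (A.TermSym × B.SortSym)
    var_infinite := inferInstance
    var_countable := inferInstance }

/-- An input for the tensor term operations `⊗_t`, `●_t`: a derivable term judgment
`X ⊢ u : U` (notation `u^U`), or an augmented derivable sort judgment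
`(X ⊢ U sort, x)` (notation `x^U`), represented with `tm = var x`. -/
structure TArg (A : Alphabet) : Type where
  ctx : PreCtx A
  tm : Expr A
  srt : SortE A

/-- `L` is the lexicographically ordered `m × n` grid whose `(i,j)` entry is `M i j`. -/
def IsGrid {γ : Type} (m n : ℕ) (M : ℕ → ℕ → γ) (L : List γ) : Prop :=
  L.length = m * n ∧
  ∀ i j (hi : i < m) (hj : j < n) (h : i * n + j < L.length), L[i * n + j]'h = M i j

/-- Substitution pairs `[g 1 | x y₁, …, g n | x yₙ]` where the `yⱼ` are the
variables of `Y`. -/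
def pairsR (x : A.Var) (Y : PreCtx B) (g : ℕ → Expr (A.tensor B)) :
    List ((A.tensor B).Var × Expr (A.tensor B)) :=
  (List.finRange Y.length).map fun j => ((x, (Y.get j).1), g j.1)

/-- Substitution pairs `[g 1 | x₁ y, …, g m | x_m y]` where the `xᵢ` are the
variables of `X`. -/
def pairsL (X : PreCtx A) (y : B.Var) (g : ℕ → Expr (A.tensor B)) :
    List ((A.tensor B).Var × Expr (A.tensor B)) :=
  (List.finRange X.length).map fun i => (((X.get i).1, y), g i.1)

variable {A B : Alphabet}

/-- The graph of the tensor term operation on pairs of (augmented sort / term)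
judgments: `TTg TA TB false a b e` means `e = a ⊗_t b` and
`TTg TA TB true a b e` means `e = a ⊗*_t b` (the variant of §8 in which the two
defining substitution formulas for non-variable terms are interchanged). -/
inductive TTg (TA : Set (Judg A)) (TB : Set (Judg B)) :
    Bool → TArg A → TArg B → Expr (A.tensor B) → Prop where
  | varvar {b : Bool} {X : PreCtx A} {U : SortE A} {x : A.Var}
      {Y : PreCtx B} {V : SortE B} {y : B.Var} :
      TTg TA TB b ⟨X, .var x, U⟩ ⟨Y, .var y, V⟩ (.var (x, y))
  | varapp {b : Bool} {X : PreCtx A} {x : A.Var} {S : A.SortSym} {ss : List (Expr A)}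
      {Y : PreCtx B} {t : B.TermSym} {ts : List (Expr B)} {V : SortE B}
      (SS : ℕ → SortE A) (TSf : ℕ → SortE B)
      (hSS : ∀ i (hi : i < ss.length), CanonSort TA X (ss[i]'hi) (SS i))
      (hTS : ∀ j (hj : j < ts.length), CanonSort TB Y (ts[j]'hj) (TSf j))
      (M : ℕ → ℕ → Expr (A.tensor B)) (out : List (Expr (A.tensor B)))
      (hM : ∀ i (hi : i < ss.length), ∀ j (hj : j < ts.length),
          TTg TA TB b ⟨X, ss[i]'hi, SS i⟩ ⟨Y, ts[j]'hj, TSf j⟩ (M i j))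
      (hMx : ∀ j (hj : j < ts.length),
          TTg TA TB b ⟨X, .var x, ⟨S, ss⟩⟩ ⟨Y, ts[j]'hj, TSf j⟩ (M ss.length j))
      (hout : IsGrid (ss.length + 1) ts.length M out) :
      TTg TA TB b ⟨X, .var x, ⟨S, ss⟩⟩ ⟨Y, .app t ts, V⟩ (.app (Sum.inl (S, t)) out)
  | appvar {b : Bool} {X : PreCtx A} {s : A.TermSym} {ss : List (Expr A)} {U : SortE A}
      {Y : PreCtx B} {y : B.Var} {T : B.SortSym} {ts : List (Expr B)}
      (SS : ℕ → SortE A) (TSf : ℕ → SortE B)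
      (hSS : ∀ i (hi : i < ss.length), CanonSort TA X (ss[i]'hi) (SS i))
      (hTS : ∀ j (hj : j < ts.length), CanonSort TB Y (ts[j]'hj) (TSf j))
      (M : ℕ → ℕ → Expr (A.tensor B)) (out : List (Expr (A.tensor B)))
      (hM : ∀ i (hi : i < ss.length), ∀ j (hj : j < ts.length),
          TTg TA TB b ⟨X, ss[i]'hi, SS i⟩ ⟨Y, ts[j]'hj, TSf j⟩ (M i j))
      (hMy : ∀ i (hi : i < ss.length),
          TTg TA TB b ⟨X, ss[i]'hi, SS i⟩ ⟨Y, .var y, ⟨T, ts⟩⟩ (M i ts.length))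
      (hout : IsGrid ss.length (ts.length + 1) M out) :
      TTg TA TB b ⟨X, .app s ss, U⟩ ⟨Y, .var y, ⟨T, ts⟩⟩ (.app (Sum.inr (s, T)) out)
  | appapp_base {X : PreCtx A} {s : A.TermSym} {ss : List (Expr A)} {U : SortE A}
      {Y : PreCtx B} {t : B.TermSym} {ts : List (Expr B)} {V : SortE B} {x : A.Var}
      (hx : ∀ p ∈ X, p.1 ≠ x)
      (e0 : Expr (A.tensor B))
      (h0 : TTg TA TB false ⟨X, .var x, U⟩ ⟨Y, .app t ts, V⟩ e0)
      (g : ℕ → Expr (A.tensor B))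
      (hg : ∀ j (hj : j < Y.length),
          TTg TA TB false ⟨X, .app s ss, U⟩
            ⟨Y.take j, .var (Y[j]'hj).1, (Y[j]'hj).2⟩ (g j)) :
      TTg TA TB false ⟨X, .app s ss, U⟩ ⟨Y, .app t ts, V⟩ (e0.substL (pairsR x Y g))
  | appapp_star {X : PreCtx A} {s : A.TermSym} {ss : List (Expr A)} {U : SortE A}
      {Y : PreCtx B} {t : B.TermSym} {ts : List (Expr B)} {V : SortE B} {y : B.Var}
      (hy : ∀ p ∈ Y, p.1 ≠ y)
      (e0 : Expr (A.tensor B))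
      (h0 : TTg TA TB true ⟨X, .app s ss, U⟩ ⟨Y, .var y, V⟩ e0)
      (g : ℕ → Expr (A.tensor B))
      (hg : ∀ i (hi : i < X.length),
          TTg TA TB true ⟨X.take i, .var (X[i]'hi).1, (X[i]'hi).2⟩
            ⟨Y, .app t ts, V⟩ (g i)) :
      TTg TA TB true ⟨X, .app s ss, U⟩ ⟨Y, .app t ts, V⟩ (e0.substL (pairsL X y g))

/-- The graph of the operation `●_t` (flag `false`), resp. of `●*_t` (flag `true`). -/
inductive TTd (TA : Set (Judg A)) (TB : Set (Judg B)) :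
    Bool → TArg A → TArg B → Expr (A.tensor B) → Prop where
  | varL {b : Bool} {X : PreCtx A} {x : A.Var} {U : SortE A} {bArg : TArg B}
      {e : Expr (A.tensor B)}
      (h : TTg TA TB b ⟨X, .var x, U⟩ bArg e) : TTd TA TB b ⟨X, .var x, U⟩ bArg e
  | varR {b : Bool} {aArg : TArg A} {Y : PreCtx B} {y : B.Var} {V : SortE B}
      {e : Expr (A.tensor B)}
      (h : TTg TA TB b aArg ⟨Y, .var y, V⟩ e) : TTd TA TB b aArg ⟨Y, .var y, V⟩ e
  | appapp_base {X : PreCtx A} {s : A.TermSym} {ss : List (Expr A)} {U : SortE A}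
      {Y : PreCtx B} {t : B.TermSym} {ts : List (Expr B)} {V : SortE B} {y : B.Var}
      (hy : ∀ p ∈ Y, p.1 ≠ y)
      (e0 : Expr (A.tensor B))
      (h0 : TTg TA TB false ⟨X, .app s ss, U⟩ ⟨Y, .var y, V⟩ e0)
      (g : ℕ → Expr (A.tensor B))
      (hg : ∀ i (hi : i < X.length),
          TTg TA TB false ⟨X.take i, .var (X[i]'hi).1, (X[i]'hi).2⟩
            ⟨Y, .app t ts, V⟩ (g i)) :
      TTd TA TB false ⟨X, .app s ss, U⟩ ⟨Y, .app t ts, V⟩ (e0.substL (pairsL X y g))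
  | appapp_star {X : PreCtx A} {s : A.TermSym} {ss : List (Expr A)} {U : SortE A}
      {Y : PreCtx B} {t : B.TermSym} {ts : List (Expr B)} {V : SortE B} {x : A.Var}
      (hx : ∀ p ∈ X, p.1 ≠ x)
      (e0 : Expr (A.tensor B))
      (h0 : TTg TA TB true ⟨X, .var x, U⟩ ⟨Y, .app t ts, V⟩ e0)
      (g : ℕ → Expr (A.tensor B))
      (hg : ∀ j (hj : j < Y.length),
          TTg TA TB true ⟨X, .app s ss, U⟩
            ⟨Y.take j, .var (Y[j]'hj).1, (Y[j]'hj).2⟩ (g j)) :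
      TTd TA TB true ⟨X, .app s ss, U⟩ ⟨Y, .app t ts, V⟩ (e0.substL (pairsR x Y g))

/-- The graph of the tensor sort operation `⊗_s` (resp. `⊗*_s` for flag `true`):
`TSo TA TB b X x U Y y V W` means `W = U^x ⊗ V^y`. -/
inductive TSo (TA : Set (Judg A)) (TB : Set (Judg B)) :
    Bool → PreCtx A → A.Var → SortE A → PreCtx B → B.Var → SortE B →
    SortE (A.tensor B) → Prop where
  | mk {b : Bool} {X : PreCtx A} {x : A.Var} {S : A.SortSym} {ss : List (Expr A)}
      {Y : PreCtx B} {y : B.Var} {T : B.SortSym} {ts : List (Expr B)}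
      (hx : ∀ p ∈ X, p.1 ≠ x) (hy : ∀ p ∈ Y, p.1 ≠ y)
      (SS : ℕ → SortE A) (TSf : ℕ → SortE B)
      (hSS : ∀ i (hi : i < ss.length), CanonSort TA X (ss[i]'hi) (SS i))
      (hTS : ∀ j (hj : j < ts.length), CanonSort TB Y (ts[j]'hj) (TSf j))
      (M : ℕ → ℕ → Expr (A.tensor B)) (out : List (Expr (A.tensor B)))
      (hM : ∀ i (hi : i < ss.length), ∀ j (hj : j < ts.length),
          TTg TA TB b ⟨X, ss[i]'hi, SS i⟩ ⟨Y, ts[j]'hj, TSf j⟩ (M i j))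
      (hMx : ∀ j (hj : j < ts.length),
          TTg TA TB b ⟨X, .var x, ⟨S, ss⟩⟩ ⟨Y, ts[j]'hj, TSf j⟩ (M ss.length j))
      (hMy : ∀ i (hi : i < ss.length),
          TTg TA TB b ⟨X, ss[i]'hi, SS i⟩ ⟨Y, .var y, ⟨T, ts⟩⟩ (M i ts.length))
      (hout : IsGrid (ss.length + 1) (ts.length + 1) M out) :
      TSo TA TB b X x ⟨S, ss⟩ Y y ⟨T, ts⟩ ⟨(S, T), out.dropLast⟩

/-- The tensor precontext `Z = X ⊗ Y`, with entries `xᵢyⱼ : Xᵢ ⊗ Yⱼ` ordered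
lexicographically. -/
def TCtx (TA : Set (Judg A)) (TB : Set (Judg B)) (b : Bool)
    (X : PreCtx A) (Y : PreCtx B) (Z : PreCtx (A.tensor B)) : Prop :=
  Z.length = X.length * Y.length ∧
  ∀ i j (hi : i < X.length) (hj : j < Y.length) (h : i * Y.length + j < Z.length),
    (Z[i * Y.length + j]'h).1 = ((X[i]'hi).1, (Y[j]'hj).1) ∧
    TSo TA TB b (X.take i) (X[i]'hi).1 (X[i]'hi).2
      (Y.take j) (Y[j]'hj).1 (Y[j]'hj).2 (Z[i * Y.length + j]'h).2

/-- The graph of the tensor operation `⊙` on pairs of judgments of the admissible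
kinds of Table 1 (flag `false`), resp. of the interchanged operation `⊙*` of §8
(flag `true`).  `chA` and `chB` are the functions choosing, for each context, a
variable not occurring in it. -/
inductive TJudg (TA : Set (Judg A)) (TB : Set (Judg B))
    (chA : PreCtx A → A.Var) (chB : PreCtx B → B.Var) :
    Bool → Judg A → Judg B → Judg (A.tensor B) → Prop where
  /- sort ⊙ sort -/
  | ss {b : Bool} {X : PreCtx A} {U : SortE A} {Y : PreCtx B} {V : SortE B}
      {Z : PreCtx (A.tensor B)} {W : SortE (A.tensor B)}
      (hZ : TCtx TA TB b (X ++ [(chA X, U)]) (Y ++ [(chB Y, V)]) Z)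
      (hW : TSo TA TB b X (chA X) U Y (chB Y) V W) :
      TJudg TA TB chA chB b (.sort X U) (.sort Y V) (.sort Z.dropLast W)
  /- sort ⊙ term -/
  | st {b : Bool} {X : PreCtx A} {U : SortE A} {Y : PreCtx B} {v : Expr B} {V : SortE B}
      {Z : PreCtx (A.tensor B)} {e : Expr (A.tensor B)} {W : SortE (A.tensor B)}
      {g : ℕ → Expr (A.tensor B)}
      (hZ : TCtx TA TB b (X ++ [(chA X, U)]) Y Z)
      (he : TTg TA TB b ⟨X, .var (chA X), U⟩ ⟨Y, v, V⟩ e)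
      (hW : TSo TA TB b X (chA X) U Y (chB Y) V W)
      (hg : ∀ i (hi : i < X.length),
          TTg TA TB b ⟨X.take i, .var (X[i]'hi).1, (X[i]'hi).2⟩ ⟨Y, v, V⟩ (g i)) :
      TJudg TA TB chA chB b (.sort X U) (.term Y v V)
        (.term Z e (W.substL (pairsL X (chB Y) g)))
  /- term ⊙ sort -/
  | ts {b : Bool} {X : PreCtx A} {u : Expr A} {U : SortE A} {Y : PreCtx B} {V : SortE B}
      {Z : PreCtx (A.tensor B)} {e : Expr (A.tensor B)} {W : SortE (A.tensor B)}
      {g : ℕ → Expr (A.tensor B)}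
      (hZ : TCtx TA TB b X (Y ++ [(chB Y, V)]) Z)
      (he : TTg TA TB b ⟨X, u, U⟩ ⟨Y, .var (chB Y), V⟩ e)
      (hW : TSo TA TB b X (chA X) U Y (chB Y) V W)
      (hg : ∀ j (hj : j < Y.length),
          TTg TA TB b ⟨X, u, U⟩ ⟨Y.take j, .var (Y[j]'hj).1, (Y[j]'hj).2⟩ (g j)) :
      TJudg TA TB chA chB b (.term X u U) (.sort Y V)
        (.term Z e (W.substL (pairsR (chA X) Y g)))
  /- term ⊙ term -/
  | tt {b : Bool} {X : PreCtx A} {u : Expr A} {U : SortE A}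
      {Y : PreCtx B} {v : Expr B} {V : SortE B}
      {Z : PreCtx (A.tensor B)} {e1 e2 : Expr (A.tensor B)} {W : SortE (A.tensor B)}
      {gx gy : ℕ → Expr (A.tensor B)}
      (hZ : TCtx TA TB b X Y Z)
      (he1 : TTg TA TB b ⟨X, u, U⟩ ⟨Y, v, V⟩ e1)
      (he2 : TTd TA TB b ⟨X, u, U⟩ ⟨Y, v, V⟩ e2)
      (hW : TSo TA TB b X (chA X) U Y (chB Y) V W)
      (hgx : ∀ i (hi : i < X.length),
          TTg TA TB b ⟨X.take i, .var (X[i]'hi).1, (X[i]'hi).2⟩ ⟨Y, v, V⟩ (gx i))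
      (hgy : ∀ j (hj : j < Y.length),
          TTg TA TB b ⟨X, u, U⟩ ⟨Y.take j, .var (Y[j]'hj).1, (Y[j]'hj).2⟩ (gy j)) :
      TJudg TA TB chA chB b (.term X u U) (.term Y v V)
        (.termEq Z e1 e2 (W.substL (pairsL X (chB Y) gx ++ pairsR (chA X) Y gy)))
  /- sort ⊙ sort equality -/
  | sseq {b : Bool} {X : PreCtx A} {U : SortE A} {Y : PreCtx B} {V V' : SortE B}
      {Z : PreCtx (A.tensor B)} {W W' : SortE (A.tensor B)}
      (hZ : TCtx TA TB b (X ++ [(chA X, U)]) (Y ++ [(chB Y, V)]) Z)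
      (hW : TSo TA TB b X (chA X) U Y (chB Y) V W)
      (hW' : TSo TA TB b X (chA X) U Y (chB Y) V' W') :
      TJudg TA TB chA chB b (.sort X U) (.sortEq Y V V') (.sortEq Z.dropLast W W')
  /- sort equality ⊙ sort -/
  | seqs {b : Bool} {X : PreCtx A} {U U' : SortE A} {Y : PreCtx B} {V : SortE B}
      {Z : PreCtx (A.tensor B)} {W W' : SortE (A.tensor B)}
      (hZ : TCtx TA TB b (X ++ [(chA X, U)]) (Y ++ [(chB Y, V)]) Z)
      (hW : TSo TA TB b X (chA X) U Y (chB Y) V W)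
      (hW' : TSo TA TB b X (chA X) U' Y (chB Y) V W') :
      TJudg TA TB chA chB b (.sortEq X U U') (.sort Y V) (.sortEq Z.dropLast W W')
  /- sort ⊙ term equality -/
  | steq {b : Bool} {X : PreCtx A} {U : SortE A} {Y : PreCtx B} {v v' : Expr B}
      {V : SortE B} {Z : PreCtx (A.tensor B)} {e e' : Expr (A.tensor B)}
      {W : SortE (A.tensor B)} {g : ℕ → Expr (A.tensor B)}
      (hZ : TCtx TA TB b (X ++ [(chA X, U)]) Y Z)
      (he : TTg TA TB b ⟨X, .var (chA X), U⟩ ⟨Y, v, V⟩ e)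
      (he' : TTg TA TB b ⟨X, .var (chA X), U⟩ ⟨Y, v', V⟩ e')
      (hW : TSo TA TB b X (chA X) U Y (chB Y) V W)
      (hg : ∀ i (hi : i < X.length),
          TTg TA TB b ⟨X.take i, .var (X[i]'hi).1, (X[i]'hi).2⟩ ⟨Y, v, V⟩ (g i)) :
      TJudg TA TB chA chB b (.sort X U) (.termEq Y v v' V)
        (.termEq Z e e' (W.substL (pairsL X (chB Y) g)))
  /- term equality ⊙ sort -/
  | teqs {b : Bool} {X : PreCtx A} {u u' : Expr A} {U : SortE A} {Y : PreCtx B}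
      {V : SortE B} {Z : PreCtx (A.tensor B)} {e e' : Expr (A.tensor B)}
      {W : SortE (A.tensor B)} {g : ℕ → Expr (A.tensor B)}
      (hZ : TCtx TA TB b X (Y ++ [(chB Y, V)]) Z)
      (he : TTg TA TB b ⟨X, u, U⟩ ⟨Y, .var (chB Y), V⟩ e)
      (he' : TTg TA TB b ⟨X, u', U⟩ ⟨Y, .var (chB Y), V⟩ e')
      (hW : TSo TA TB b X (chA X) U Y (chB Y) V W)
      (hg : ∀ j (hj : j < Y.length),
          TTg TA TB b ⟨X, u, U⟩ ⟨Y.take j, .var (Y[j]'hj).1, (Y[j]'hj).2⟩ (g j)) :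
      TJudg TA TB chA chB b (.termEq X u u' U) (.sort Y V)
        (.termEq Z e e' (W.substL (pairsR (chA X) Y g)))
  /- sort equality ⊙ term -/
  | seqt {b : Bool} {X : PreCtx A} {U U' : SortE A} {Y : PreCtx B} {v : Expr B}
      {V : SortE B} {Z : PreCtx (A.tensor B)} {e e' : Expr (A.tensor B)}
      {W : SortE (A.tensor B)} {g : ℕ → Expr (A.tensor B)}
      (hZ : TCtx TA TB b (X ++ [(chA X, U)]) Y Z)
      (he : TTg TA TB b ⟨X, .var (chA X), U⟩ ⟨Y, v, V⟩ e)
      (he' : TTg TA TB b ⟨X, .var (chA X), U'⟩ ⟨Y, v, V⟩ e')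
      (hW : TSo TA TB b X (chA X) U Y (chB Y) V W)
      (hg : ∀ i (hi : i < X.length),
          TTg TA TB b ⟨X.take i, .var (X[i]'hi).1, (X[i]'hi).2⟩ ⟨Y, v, V⟩ (g i)) :
      TJudg TA TB chA chB b (.sortEq X U U') (.term Y v V)
        (.termEq Z e e' (W.substL (pairsL X (chB Y) g)))
  /- term ⊙ sort equality -/
  | tseq {b : Bool} {X : PreCtx A} {u : Expr A} {U : SortE A} {Y : PreCtx B}
      {V V' : SortE B} {Z : PreCtx (A.tensor B)} {e e' : Expr (A.tensor B)}
      {W : SortE (A.tensor B)} {g : ℕ → Expr (A.tensor B)}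
      (hZ : TCtx TA TB b X (Y ++ [(chB Y, V)]) Z)
      (he : TTg TA TB b ⟨X, u, U⟩ ⟨Y, .var (chB Y), V⟩ e)
      (he' : TTg TA TB b ⟨X, u, U⟩ ⟨Y, .var (chB Y), V'⟩ e')
      (hW : TSo TA TB b X (chA X) U Y (chB Y) V W)
      (hg : ∀ j (hj : j < Y.length),
          TTg TA TB b ⟨X, u, U⟩ ⟨Y.take j, .var (Y[j]'hj).1, (Y[j]'hj).2⟩ (g j)) :
      TJudg TA TB chA chB b (.term X u U) (.sortEq Y V V')
        (.termEq Z e e' (W.substL (pairsR (chA X) Y g)))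

/-- A choice, for every precontext, of a variable not contained in it. -/
def FreshCh {A : Alphabet} (ch : PreCtx A → A.Var) : Prop :=
  ∀ X : PreCtx A, ∀ p ∈ X, p.1 ≠ ch X

/-- The set of axioms of the pretheory `𝔸 ⊗ 𝔹`: the judgments `J ⊙ J'` for `J` an
axiom of `𝔸` and `J'` an axiom of `𝔹`. -/
def tensorAx (TA : Set (Judg A)) (TB : Set (Judg B))
    (chA : PreCtx A → A.Var) (chB : PreCtx B → B.Var) : Set (Judg (A.tensor B)) :=
  {K | ∃ J J', J ∈ TA ∧ J' ∈ TB ∧ TJudg TA TB chA chB false J J' K}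

/-- The pair `(𝔸, 𝔹)` is `h`-derivable: `J ⊙ J'` is derivable in the pretheory
`𝔸 ⊗ 𝔹` whenever `J`, `J'` are derivable judgments of `𝔸`, `𝔹` (of admissible
kinds) with `ht J * ht J' ≤ h`. -/
def hDerivable (TA : Set (Judg A)) (TB : Set (Judg B))
    (chA : PreCtx A → A.Var) (chB : PreCtx B → B.Var) (h : ℕ) : Prop :=
  ∀ (J : Judg A) (J' : Judg B) (K : Judg (A.tensor B)),
    Derivable TA J → Derivable TB J' → ht TA J * ht TB J' ≤ h →
    TJudg TA TB chA chB false J J' K → Derivable (tensorAx TA TB chA chB) K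

/-- The tensor `out = f ⊗ g` of two tuples of derivable terms, each entry being
the tensor of terms taken at their canonical sorts, ordered lexicographically. -/
def TMor (TA : Set (Judg A)) (TB : Set (Judg B)) (b : Bool)
    (X : PreCtx A) (f : List (Expr A)) (Y : PreCtx B) (g : List (Expr B))
    (out : List (Expr (A.tensor B))) : Prop :=
  out.length = f.length * g.length ∧
  ∀ i j (hi : i < f.length) (hj : j < g.length) (h : i * g.length + j < out.length),
    ∃ U V, CanonSort TA X (f[i]'hi) U ∧ CanonSort TB Y (g[j]'hj) V ∧
      TTg TA TB b ⟨X, f[i]'hi, U⟩ ⟨Y, g[j]'hj, V⟩ (out[i * g.length + j]'h)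

/-- The tensor `out = f ⊗ Y` of a tuple of derivable terms of `𝔸` with a context
of `𝔹`: entries `fᵢ^{𝒮(fᵢ)} ⊗ yⱼ^{Yⱼ}`. -/
def TMorCtx (TA : Set (Judg A)) (TB : Set (Judg B)) (b : Bool)
    (X : PreCtx A) (f : List (Expr A)) (Y : PreCtx B)
    (out : List (Expr (A.tensor B))) : Prop :=
  out.length = f.length * Y.length ∧
  ∀ i j (hi : i < f.length) (hj : j < Y.length) (h : i * Y.length + j < out.length),
    ∃ U, CanonSort TA X (f[i]'hi) U ∧
      TTg TA TB b ⟨X, f[i]'hi, U⟩ ⟨Y.take j, .var (Y[j]'hj).1, (Y[j]'hj).2⟩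
        (out[i * Y.length + j]'h)

/-- The tensor `out = X ⊗ g` of a context of `𝔸` with a tuple of derivable terms
of `𝔹`: entries `xᵢ^{Xᵢ} ⊗ gⱼ^{𝒮(gⱼ)}`. -/
def TCtxMor (TA : Set (Judg A)) (TB : Set (Judg B)) (b : Bool)
    (X : PreCtx A) (Y : PreCtx B) (g : List (Expr B))
    (out : List (Expr (A.tensor B))) : Prop :=
  out.length = X.length * g.length ∧
  ∀ i j (hi : i < X.length) (hj : j < g.length) (h : i * g.length + j < out.length),
    ∃ V, CanonSort TB Y (g[j]'hj) V ∧
      TTg TA TB b ⟨X.take i, .var (X[i]'hi).1, (X[i]'hi).2⟩ ⟨Y, g[j]'hj, V⟩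
        (out[i * g.length + j]'h)

/-- The tensor `out = (x₁,…,x_m,u^U) ⊗ Y` of the section determined by a term
`X ⊢ u : U` with a context of `𝔹`. -/
def TSecL (TA : Set (Judg A)) (TB : Set (Judg B)) (b : Bool)
    (X : PreCtx A) (u : Expr A) (U : SortE A) (Y : PreCtx B)
    (out : List (Expr (A.tensor B))) : Prop :=
  out.length = (X.length + 1) * Y.length ∧
  (∀ i j (hi : i < X.length) (hj : j < Y.length) (h : i * Y.length + j < out.length),
      TTg TA TB b ⟨X.take i, .var (X[i]'hi).1, (X[i]'hi).2⟩
        ⟨Y.take j, .var (Y[j]'hj).1, (Y[j]'hj).2⟩ (out[i * Y.length + j]'h)) ∧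
  (∀ j (hj : j < Y.length) (h : X.length * Y.length + j < out.length),
      TTg TA TB b ⟨X, u, U⟩ ⟨Y.take j, .var (Y[j]'hj).1, (Y[j]'hj).2⟩
        (out[X.length * Y.length + j]'h))

/-- The tensor `out = X ⊗ (y₁,…,yₙ,v^V)` of a context of `𝔸` with the section
determined by a term `Y ⊢ v : V` of `𝔹`. -/
def TSecR (TA : Set (Judg A)) (TB : Set (Judg B)) (b : Bool)
    (X : PreCtx A) (Y : PreCtx B) (v : Expr B) (V : SortE B)
    (out : List (Expr (A.tensor B))) : Prop :=
  out.length = X.length * (Y.length + 1) ∧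
  (∀ i j (hi : i < X.length) (hj : j < Y.length)
      (h : i * (Y.length + 1) + j < out.length),
      TTg TA TB b ⟨X.take i, .var (X[i]'hi).1, (X[i]'hi).2⟩
        ⟨Y.take j, .var (Y[j]'hj).1, (Y[j]'hj).2⟩ (out[i * (Y.length + 1) + j]'h)) ∧
  (∀ i (hi : i < X.length) (h : i * (Y.length + 1) + Y.length < out.length),
      TTg TA TB b ⟨X.take i, .var (X[i]'hi).1, (X[i]'hi).2⟩ ⟨Y, v, V⟩
        (out[i * (Y.length + 1) + Y.length]'h))

section Metatheory

variable {A : Alphabet}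

theorem Expr.induct {P : Expr A → Prop} (hv : ∀ x, P (.var x))
    (ha : ∀ t es, (∀ e ∈ es, P e) → P (.app t es)) : ∀ e, P e
  | .var x => hv x
  | .app t es => ha t es fun e he => Expr.induct hv ha e
termination_by e => sizeOf e
decreasing_by
  have := List.sizeOf_lt_of_mem he
  simp only [Expr.app.sizeOf_spec]
  omega

@[simp] theorem Expr.subst_var (σ : A.Var → Expr A) (x : A.Var) :
    (Expr.var x).subst σ = σ x := by
  rw [Expr.subst]

@[simp] theorem Expr.subst_app (σ : A.Var → Expr A) (t : A.TermSym) (es : List (Expr A)) :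
    (Expr.app t es).subst σ = .app t (es.map (Expr.subst σ)) := by
  rw [Expr.subst]
  simp

@[simp] theorem occurs_var {x y : A.Var} : Occurs x (Expr.var y) ↔ x = y := by
  constructor
  · rintro ⟨⟩; rfl
  · rintro rfl; exact .var

@[simp] theorem occurs_app {x : A.Var} {t : A.TermSym} {es : List (Expr A)} :
    Occurs x (Expr.app t es) ↔ ∃ e ∈ es, Occurs x e := by
  constructor
  · rintro ⟨⟩; exact ⟨_, ‹_›, ‹_›⟩
  · rintro ⟨e, he, h⟩; exact .app he h

theorem Expr.subst_congr {σ τ : A.Var → Expr A} {e : Expr A}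
    (h : ∀ x, Occurs x e → σ x = τ x) : e.subst σ = e.subst τ := by
  induction e using Expr.induct with
  | hv x => simpa using h x .var
  | ha t es ih =>
    simp only [subst_app, Expr.app.injEq, true_and]
    exact List.map_congr_left fun e he => ih e he fun x hx => h x (.app he hx)

theorem Expr.subst_subst (σ τ : A.Var → Expr A) (e : Expr A) :
    (e.subst σ).subst τ = e.subst fun x => (σ x).subst τ := by
  induction e using Expr.induct with
  | hv x => simp
  | ha t es ih =>
    simp only [subst_app, List.map_map, Expr.app.injEq, true_and]
    exact List.map_congr_left fun e he => ih e he

@[simp] theorem Expr.subst_id (e : Expr A) : e.subst Expr.var = e := by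
  induction e using Expr.induct with
  | hv x => simp
  | ha t es ih =>
    simp only [subst_app, Expr.app.injEq, true_and]
    exact (List.map_congr_left ih).trans (List.map_id _)

@[simp] theorem SortE.subst_mk (σ : A.Var → Expr A) (S : A.SortSym) (es : List (Expr A)) :
    SortE.subst σ ⟨S, es⟩ = ⟨S, es.map (Expr.subst σ)⟩ := rfl

theorem SortE.subst_congr {σ τ : A.Var → Expr A} {U : SortE A}
    (h : ∀ x, SOccurs x U → σ x = τ x) : U.subst σ = U.subst τ := by
  unfold SortE.subst
  congr 1
  exact List.map_congr_left fun e he => Expr.subst_congr fun x hx => h x ⟨e, he, hx⟩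

theorem SortE.subst_subst (σ τ : A.Var → Expr A) (U : SortE A) :
    (U.subst σ).subst τ = U.subst fun x => (σ x).subst τ := by
  unfold SortE.subst
  simp only [List.map_map, SortE.mk.injEq, true_and]
  exact List.map_congr_left fun e he => Expr.subst_subst σ τ e

@[simp] theorem SortE.subst_id (U : SortE A) : U.subst Expr.var = U := by
  unfold SortE.subst
  congr 1
  exact (List.map_congr_left fun e _ => Expr.subst_id e).trans (List.map_id _)

/-- The substitution function determined by a precontext and a tuple. -/
noncomputable def sb (X : PreCtx A) (f : List (Expr A)) : A.Var → Expr A := lookupV (mkSub X f)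

theorem sb_cons (p : A.Var × SortE A) (X : PreCtx A) (e : Expr A) (f : List (Expr A))
    (y : A.Var) [Decidable (p.1 = y)] :
    sb (p :: X) (e :: f) y = if p.1 = y then e else sb X f y := by
  simp only [sb, mkSub, List.map_cons, List.zip_cons_cons, lookupV]

@[simp] theorem sb_nil (f : List (Expr A)) (y : A.Var) : sb ([] : PreCtx A) f y = .var y := by
  simp [sb, mkSub, lookupV]

@[simp] theorem sb_nil_right (X : PreCtx A) (y : A.Var) : sb X [] y = .var y := by
  simp [sb, mkSub, lookupV]

theorem sb_not_mem {X : PreCtx A} {f : List (Expr A)} {y : A.Var}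
    (h : y ∉ X.map Prod.fst) : sb X f y = .var y := by
  classical
  induction X generalizing f with
  | nil => simp
  | cons p X ih =>
    cases f with
    | nil => simp
    | cons e f =>
      simp only [List.map_cons, List.mem_cons, not_or] at h
      rw [sb_cons, if_neg (Ne.symm h.1), ih h.2]

theorem map_sb {X : PreCtx A} {f : List (Expr A)} (hX : (X.map Prod.fst).Nodup)
    (hl : f.length = X.length) : X.map (fun p => sb X f p.1) = f := by
  classical
  induction X generalizing f with
  | nil => cases f <;> simp_all
  | cons p X ih =>
    cases f with
    | nil => simp at hl
    | cons e f =>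
      simp only [List.map_cons, List.nodup_cons, List.length_cons, add_left_inj] at hX hl ⊢
      rw [sb_cons, if_pos rfl]
      congr 1
      refine (List.map_congr_left fun q hq => ?_).trans (ih hX.2 hl)
      rw [sb_cons, if_neg]
      intro h
      exact hX.1 (h ▸ List.mem_map_of_mem hq)

theorem sb_map_apply {X : PreCtx A} (σ : A.Var → Expr A) {y : A.Var} (hy : y ∈ X.map Prod.fst) :
    sb X (X.map fun p => σ p.1) y = σ y := by
  classical
  induction X with
  | nil => simp at hy
  | cons p X ih =>
    simp only [List.map_cons, List.mem_cons] at hy ⊢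
    rw [sb_cons]
    split_ifs with h
    · rw [h]
    · exact ih (hy.resolve_left (Ne.symm h))

theorem sb_ctxVars (X : PreCtx A) : sb X (ctxVars X) = Expr.var := by
  funext y
  by_cases hy : y ∈ X.map Prod.fst
  · exact sb_map_apply Expr.var hy
  · exact sb_not_mem hy

theorem sb_take {X : PreCtx A} {f : List (Expr A)} (hl : f.length = X.length) (i : ℕ) {y : A.Var}
    (hy : y ∈ (X.take i).map Prod.fst) : sb (X.take i) (f.take i) y = sb X f y := by
  classical
  induction X generalizing f i with
  | nil => simp
  | cons p X ih =>
    cases f with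
    | nil => simp at hl
    | cons e f =>
      cases i with
      | zero => simp at hy
      | succ i =>
        simp only [List.take_succ_cons, List.map_cons, List.mem_cons] at hy ⊢
        rw [sb_cons, sb_cons]
        split_ifs with h
        · rfl
        · exact ih (by simpa using hl) i (hy.resolve_left (Ne.symm h))

theorem sb_map {X : PreCtx A} {f : List (Expr A)} (hl : f.length = X.length)
    (τ : A.Var → Expr A) {y : A.Var} (hy : y ∈ X.map Prod.fst) :
    sb X (f.map (Expr.subst τ)) y = (sb X f y).subst τ := by
  classical
  induction X generalizing f with
  | nil => simp at hy
  | cons p X ih =>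
    cases f with
    | nil => simp at hl
    | cons e f =>
      simp only [List.map_cons, List.mem_cons] at hy ⊢
      rw [sb_cons, sb_cons]
      split_ifs with h
      · rfl
      · exact ih (by simpa using hl) (hy.resolve_left (Ne.symm h))

theorem isPreCtx_nil : IsPreCtx ([] : PreCtx A) := by
  intro i hi; simp at hi

theorem IsPreCtx.mem {X : PreCtx A} (h : IsPreCtx X) {p : A.Var × SortE A} (hp : p ∈ X)
    {v : A.Var} (hv : SOccurs v p.2) : v ∈ X.map Prod.fst := by
  obtain ⟨i, hi, rfl⟩ := List.getElem_of_mem hp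
  have := h i hi v hv
  rw [List.map_take] at this
  exact List.mem_of_mem_take this

theorem isPreCtx_snoc {X : PreCtx A} {x : A.Var} {U : SortE A} :
    IsPreCtx (X ++ [(x, U)]) ↔ IsPreCtx X ∧ ∀ v, SOccurs v U → v ∈ X.map Prod.fst := by
  constructor
  · intro h
    constructor
    · intro i hi v hv
      have := h i (by simp; omega) v (by simpa [List.getElem_append_left hi] using hv)
      rwa [List.take_append_of_le_length hi.le] at this
    · intro v hv
      have := h X.length (by simp) v (by simpa using hv)
      simpa using this
  · rintro ⟨h, hU⟩ i hi v hv
    rcases Nat.lt_or_ge i X.length with h' | h'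
    · rw [List.take_append_of_le_length h'.le]
      exact h i h' v (by simpa [List.getElem_append_left h'] using hv)
    · have : i = X.length := by simp at hi; omega
      subst this
      simpa using hU v (by simpa using hv)

theorem subPre_eq {X : PreCtx A} (hX : IsPreCtx X) {f : List (Expr A)}
    (hl : f.length = X.length) {i : ℕ} (hi : i < X.length) :
    subPre X f i hi = (X[i]'hi).2.subst (sb X f) :=
  SortE.subst_congr fun v hv => sb_take hl i (hX i hi v hv)

/-- The conditions on the arguments of a substitution rule, in terms of membership. -/
theorem args_iff {X : PreCtx A} (hX : IsPreCtx X) (hn : (X.map Prod.fst).Nodup)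
    {f : List (Expr A)} (hl : f.length = X.length) {P : Expr A → SortE A → Prop} :
    (∀ i (hi : i < X.length) (hif : i < f.length), P (f[i]'hif) (subPre X f i hi)) ↔
      ∀ p ∈ X, P (sb X f p.1) (p.2.subst (sb X f)) := by
  have key : ∀ i (hi : i < X.length) (hif : i < f.length), f[i]'hif = sb X f (X[i]'hi).1 := by
    intro i hi hif
    have := map_sb hn hl
    conv_lhs => rw [List.getElem_of_eq this.symm hif]
    simp
  constructor
  · intro h p hp
    obtain ⟨i, hi, rfl⟩ := List.getElem_of_mem hp
    have := h i hi (hl ▸ hi)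
    rwa [subPre_eq hX hl, key i hi] at this
  · intro h i hi hif
    rw [subPre_eq hX hl, key i hi]
    exact h _ (List.getElem_mem hi)

theorem args_iff₂ {X : PreCtx A} (hX : IsPreCtx X) (hn : (X.map Prod.fst).Nodup)
    {f g : List (Expr A)} (hl : f.length = X.length) (hg : g.length = X.length)
    {P : Expr A → Expr A → SortE A → Prop} :
    (∀ i (hi : i < X.length) (hif : i < f.length) (hig : i < g.length),
      P (f[i]'hif) (g[i]'hig) (subPre X f i hi)) ↔
      ∀ p ∈ X, P (sb X f p.1) (sb X g p.1) (p.2.subst (sb X f)) := by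
  have key : ∀ (f : List (Expr A)) (hl : f.length = X.length) i (hi : i < X.length)
      (hif : i < f.length), f[i]'hif = sb X f (X[i]'hi).1 := by
    intro f hl i hi hif
    have := map_sb hn hl
    conv_lhs => rw [List.getElem_of_eq this.symm hif]
    simp
  constructor
  · intro h p hp
    obtain ⟨i, hi, rfl⟩ := List.getElem_of_mem hp
    have := h i hi (hl ▸ hi) (hg ▸ hi)
    rwa [subPre_eq hX hl, key f hl i hi, key g hg i hi] at this
  · intro h i hi hif hig
    rw [subPre_eq hX hl, key f hl i hi, key g hg i hi]
    exact h _ (List.getElem_mem hi)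

/-- The part of the definition of a pretheory used in the metatheory. -/
structure Pre (Ax : Set (Judg A)) : Prop where
  sort_shape : ∀ X U, Judg.sort X U ∈ Ax → U.args = ctxVars X
  term_shape : ∀ X u U, Judg.term X u U ∈ Ax → ∃ t, u = Expr.app t (ctxVars X)
  term_unique : ∀ X t U X' U', introTerm X t U ∈ Ax → introTerm X' t U' ∈ Ax → X = X' ∧ U = U'

theorem IsPretheory.pre {Ax : Set (Judg A)} (h : IsPretheory Ax) : Pre Ax where
  sort_shape := h.sort_shape
  term_shape := h.term_shape
  term_unique X t U X' U' h1 h2 := by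
    have := (h.term_intro t).unique (y₁ := (X, U)) (y₂ := (X', U')) h1 h2
    simpa using this

theorem DerAt.succ {Ax : Set (Judg A)} {n : ℕ} {J : Judg A} (h : DerAt Ax n J) :
    DerAt Ax (n + 1) J := Or.inl h

theorem DerAt.mono {Ax : Set (Judg A)} {n m : ℕ} (hnm : n ≤ m) {J : Judg A} (h : DerAt Ax n J) :
    DerAt Ax m J := by
  induction hnm with
  | refl => exact h
  | step _ ih => exact ih.succ

theorem DerAt.der {Ax : Set (Judg A)} {n : ℕ} {J : Judg A} (h : DerAt Ax n J) :
    Derivable Ax J := ⟨n, h⟩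

theorem DerAt.step {Ax : Set (Judg A)} {n : ℕ} {J : Judg A} (h : Step Ax (DerAt Ax n) J) :
    DerAt Ax (n + 1) J := Or.inr h

/-- Induction on derivation stages. -/
theorem DerAt.ind {Ax : Set (Judg A)} {P : ℕ → Judg A → Prop}
    (hs : ∀ n J, P n J → P (n + 1) J)
    (h : ∀ n, (∀ J, DerAt Ax n J → P n J) → ∀ J, Step Ax (DerAt Ax n) J → P (n + 1) J) :
    ∀ n J, DerAt Ax n J → P n J := by
  intro n
  induction n with
  | zero => intro J hJ; exact hJ.elim
  | succ n ih =>
    intro J hJ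
    rcases hJ with hJ | hJ
    · exact hs n J (ih J hJ)
    · exact h n ih J hJ

/-- Finitely many premises, indexed by positions of a list, are derivable at a common stage. -/
theorem exists_stage {Ax : Set (Judg A)} (k : ℕ) (J : ∀ i, i < k → Judg A)
    (h : ∀ i hi, Derivable Ax (J i hi)) : ∃ n, ∀ i hi, DerAt Ax n (J i hi) := by
  choose N hN using h
  refine ⟨(Finset.univ : Finset (Fin k)).sup fun i => N i.1 i.2, fun i hi => (hN i hi).mono ?_⟩
  exact Finset.le_sup (f := fun i : Fin k => N i.1 i.2) (Finset.mem_univ ⟨i, hi⟩)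

/-- The derivable judgments are closed under the inference rules. -/
theorem Derivable.step {Ax : Set (Judg A)} {J : Judg A} (h : Step Ax (Derivable Ax) J) :
    Derivable Ax J := by
  have two : ∀ {J K : Judg A}, Derivable Ax J → Derivable Ax K →
      ∃ n, DerAt Ax n J ∧ DerAt Ax n K := by
    rintro J K ⟨n, hn⟩ ⟨m, hm⟩
    exact ⟨max n m, hn.mono (le_max_left _ _), hm.mono (le_max_right _ _)⟩
  have lift : ∀ {k : ℕ} {J : Judg A}, Step Ax (DerAt Ax k) J → Derivable Ax J :=
    fun h => ⟨_, .step h⟩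
  cases h with
  | ctx_nil => exact ⟨1, .step .ctx_nil⟩
  | ctx_cons a b c => obtain ⟨n, a⟩ := a; exact ⟨_, .step (.ctx_cons a b c)⟩
  | s1 a => obtain ⟨n, a⟩ := a; exact ⟨_, .step (.s1 a)⟩
  | s2 a => obtain ⟨n, a⟩ := a; exact ⟨_, .step (.s2 a)⟩
  | s3 a b => obtain ⟨n, a, b⟩ := two a b; exact ⟨_, .step (.s3 a b)⟩
  | t1 a => obtain ⟨n, a⟩ := a; exact ⟨_, .step (.t1 a)⟩
  | t2 a => obtain ⟨n, a⟩ := a; exact ⟨_, .step (.t2 a)⟩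
  | t3 a b => obtain ⟨n, a, b⟩ := two a b; exact ⟨_, .step (.t3 a b)⟩
  | seqt a b => obtain ⟨n, a, b⟩ := two a b; exact ⟨_, .step (.seqt a b)⟩
  | seqteq a b c d =>
    obtain ⟨n, a, b⟩ := two a b
    obtain ⟨m, c, d⟩ := two c d
    have h1 := le_max_left n m
    have h2 := le_max_right n m
    exact lift (.seqteq (a.mono h1) (b.mono h1) (c.mono h2) (d.mono h2))
  | var hi a => obtain ⟨n, a⟩ := a; exact ⟨_, .step (.var hi a)⟩
  | sA a b c =>
    obtain ⟨n, b⟩ := b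
    obtain ⟨m, c⟩ := exists_stage _ _ c
    exact lift (.sA a (b.mono (le_max_left n m)) fun i hi => (c i hi).mono (le_max_right n m))
  | tA a b c =>
    obtain ⟨n, b⟩ := b
    obtain ⟨m, c⟩ := exists_stage _ _ c
    exact lift (.tA a (b.mono (le_max_left n m)) fun i hi => (c i hi).mono (le_max_right n m))
  | seqA a b c => obtain ⟨n, b, c⟩ := two b c; exact ⟨_, .step (.seqA a b c)⟩
  | teqA a b c => obtain ⟨n, b, c⟩ := two b c; exact ⟨_, .step (.teqA a b c)⟩
  | sSub a b c d e f =>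
    obtain ⟨n, d, e⟩ := two d e
    obtain ⟨m, f⟩ := exists_stage _ _ fun i hi => f i hi (c.symm ▸ hi)
    exact lift (.sSub a b c (d.mono (le_max_left n m)) (e.mono (le_max_left n m))
      fun i hi _ => (f i hi).mono (le_max_right n m))
  | tSub a b c d e f =>
    obtain ⟨n, d, e⟩ := two d e
    obtain ⟨m, f⟩ := exists_stage _ _ fun i hi => f i hi (c.symm ▸ hi)
    exact lift (.tSub a b c (d.mono (le_max_left n m)) (e.mono (le_max_left n m))
      fun i hi _ => (f i hi).mono (le_max_right n m))
  | seqSub1 a b c d e f g =>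
    obtain ⟨n, d, e⟩ := two d e
    obtain ⟨k, f⟩ := f
    obtain ⟨m, g⟩ := exists_stage _ _ fun i hi => g i hi (c.symm ▸ hi)
    exact lift (k := n + k + m) (.seqSub1 a b c (d.mono (by omega)) (e.mono (by omega))
      (f.mono (by omega)) fun i hi _ => (g i hi).mono (by omega))
  | seqSub2 a b c d e f g k =>
    obtain ⟨n, e, f⟩ := two e f
    obtain ⟨l, g⟩ := g
    obtain ⟨m, k⟩ := exists_stage _ _ fun i hi => k i hi (c.symm ▸ hi) (d.symm ▸ hi)
    exact lift (k := n + l + m) (.seqSub2 a b c d (e.mono (by omega)) (f.mono (by omega))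
      (g.mono (by omega)) fun i hi _ _ => (k i hi).mono (by omega))
  | teqSub1 a b c d e f g =>
    obtain ⟨n, d, e⟩ := two d e
    obtain ⟨k, f⟩ := f
    obtain ⟨m, g⟩ := exists_stage _ _ fun i hi => g i hi (c.symm ▸ hi)
    exact lift (k := n + k + m) (.teqSub1 a b c (d.mono (by omega)) (e.mono (by omega))
      (f.mono (by omega)) fun i hi _ => (g i hi).mono (by omega))
  | teqSub2 a b c d e f g k =>
    obtain ⟨n, e, f⟩ := two e f
    obtain ⟨l, g⟩ := g
    obtain ⟨m, k⟩ := exists_stage _ _ fun i hi => k i hi (c.symm ▸ hi) (d.symm ▸ hi)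
    exact lift (k := n + l + m) (.teqSub2 a b c d (e.mono (by omega)) (f.mono (by omega))
      (g.mono (by omega)) fun i hi _ _ => (k i hi).mono (by omega))

end Metatheory

section Metatheory

variable {A : Alphabet}

/-- Occurrence of a variable in a judgment, outside of its context. -/
def Judg.Occ (v : A.Var) : Judg A → Prop
  | .ctx _ => False
  | .sort _ U => SOccurs v U
  | .term _ u U => Occurs v u ∨ SOccurs v U
  | .sortEq _ U V => SOccurs v U ∨ SOccurs v V
  | .termEq _ u u' U => Occurs v u ∨ Occurs v u' ∨ SOccurs v U

/-- A judgment is well-scoped. -/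
structure Judg.Ok (J : Judg A) : Prop where
  pre : IsPreCtx J.ctxOf
  nodup : (J.ctxOf.map Prod.fst).Nodup
  occ : ∀ v, J.Occ v → v ∈ J.ctxOf.map Prod.fst

theorem occurs_ctxVars {X : PreCtx A} {v : A.Var} :
    (∃ e ∈ ctxVars X, Occurs v e) ↔ v ∈ X.map Prod.fst := by
  simp only [ctxVars, List.mem_map]
  constructor
  · rintro ⟨_, ⟨p, hp, rfl⟩, h⟩
    exact ⟨p, hp, (occurs_var.1 h).symm⟩
  · rintro ⟨p, hp, rfl⟩
    exact ⟨_, ⟨p, hp, rfl⟩, .var⟩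

theorem occ_args {P : Expr A → Prop} {n : ℕ} {f : List (Expr A)} (hl : f.length = n)
    (h : ∀ i (hi : i < n) (hif : i < f.length), P (f[i]'hif)) : ∀ e ∈ f, P e := by
  intro e he
  obtain ⟨i, hi, rfl⟩ := List.getElem_of_mem he
  exact h i (hl ▸ hi) hi

theorem DerAt.ok {Ax : Set (Judg A)} (hP : Pre Ax) :
    ∀ n J, DerAt Ax n J → J.Ok := by
  refine DerAt.ind (P := fun _ J => J.Ok) (fun _ _ h => h) ?_
  intro n ih J hJ
  cases hJ with
  | ctx_nil => exact ⟨isPreCtx_nil, by simp [Judg.ctxOf], fun v h => h.elim⟩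
  | ctx_cons a b c =>
    refine ⟨c, ?_, fun v h => h.elim⟩
    have := (ih _ a).nodup
    simp only [Judg.ctxOf, List.map_append, List.map_cons, List.map_nil] at this ⊢
    refine List.Nodup.append this (by simp) ?_
    simp only [List.disjoint_singleton, List.mem_map, not_exists, not_and]
    exact b
  | s1 a =>
    have h := ih _ a
    exact ⟨h.pre, h.nodup, fun v hv => h.occ v (or_self_iff.1 hv)⟩
  | s2 a =>
    have h := ih _ a
    exact ⟨h.pre, h.nodup, fun v hv => h.occ v hv.symm⟩
  | s3 a b =>
    have h := ih _ a
    have h' := ih _ b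
    exact ⟨h.pre, h.nodup, fun v hv => hv.elim (fun hv => h.occ v (.inl hv))
      fun hv => h'.occ v (.inr hv)⟩
  | t1 a =>
    have h := ih _ a
    exact ⟨h.pre, h.nodup, fun v hv => h.occ v (by simpa [Judg.Occ] using hv)⟩
  | t2 a =>
    have h := ih _ a
    refine ⟨h.pre, h.nodup, fun v hv => h.occ v ?_⟩
    simp only [Judg.Occ] at hv ⊢
    tauto
  | t3 a b =>
    have h := ih _ a
    have h' := ih _ b
    refine ⟨h.pre, h.nodup, fun v hv => ?_⟩
    rcases hv with hv | hv | hv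
    · exact h.occ v (.inl hv)
    · exact h'.occ v (.inr (.inl hv))
    · exact h'.occ v (.inr (.inr hv))
  | seqt a b =>
    have h := ih _ a
    have h' := ih _ b
    exact ⟨h.pre, h.nodup, fun v hv => hv.elim (fun hv => h'.occ v (.inl hv))
      fun hv => h.occ v (.inr hv)⟩
  | seqteq a b c d =>
    have h := ih _ c
    have h' := ih _ d
    refine ⟨h.pre, h.nodup, fun v hv => ?_⟩
    rcases hv with hv | hv
    · exact h.occ v (.inl hv)
    · exact h'.occ v hv
  | var hi a =>
    have h := ih _ a
    refine ⟨h.pre, h.nodup, fun v hv => hv.elim (fun hv => ?_) (h.occ v)⟩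
    rw [occurs_var.1 hv]
    exact List.mem_map_of_mem (List.getElem_mem hi)
  | @sA X U a b c =>
    have h := ih _ b
    refine ⟨h.pre, h.nodup, fun v hv => ?_⟩
    obtain ⟨e, he, hv⟩ := hv
    rw [hP.sort_shape _ _ a] at he
    exact occurs_ctxVars.1 ⟨e, he, hv⟩
  | @tA X u U a b c =>
    have h := ih _ b
    refine ⟨h.pre, h.nodup, fun v hv => hv.elim (fun hv => ?_) (h.occ v)⟩
    obtain ⟨t, rfl⟩ := hP.term_shape _ _ _ a
    exact occurs_ctxVars.1 (occurs_app.1 hv)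
  | seqA a b c =>
    have h := ih _ b
    have h' := ih _ c
    exact ⟨h.pre, h.nodup, fun v hv => hv.elim (h.occ v) (h'.occ v)⟩
  | teqA a b c =>
    have h := ih _ b
    have h' := ih _ c
    exact ⟨h.pre, h.nodup, fun v hv => hv.elim (fun hv => h.occ v (.inl hv)) (h'.occ v)⟩
  | sSub a b c d e f =>
    have h := ih _ e
    refine ⟨h.pre, h.nodup, fun v hv => ?_⟩
    obtain ⟨x, hx, hv⟩ := hv
    exact occ_args c (P := fun x => Occurs v x → _)
      (fun i hi hif hv => (ih _ (f i hi hif)).occ v (.inl hv)) x hx hv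
  | tSub a b c d e f =>
    have h := ih _ e
    refine ⟨h.pre, h.nodup, fun v hv => hv.elim (fun hv => ?_) (h.occ v)⟩
    obtain ⟨x, hx, hv⟩ := occurs_app.1 hv
    exact occ_args c (P := fun x => Occurs v x → _)
      (fun i hi hif hv => (ih _ (f i hi hif)).occ v (.inl hv)) x hx hv
  | seqSub1 a b c d e f g =>
    have h := ih _ e
    have h' := ih _ f
    exact ⟨h.pre, h.nodup, fun v hv => hv.elim (h.occ v) (h'.occ v)⟩
  | seqSub2 a b c d e f g k =>
    have h := ih _ f
    have h' := ih _ g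
    exact ⟨h.pre, h.nodup, fun v hv => hv.elim (h.occ v) (h'.occ v)⟩
  | teqSub1 a b c d e f g =>
    have h := ih _ e
    have h' := ih _ f
    exact ⟨h.pre, h.nodup, fun v hv => hv.elim (fun hv => h.occ v (.inl hv)) (h'.occ v)⟩
  | teqSub2 a b c d e f g k =>
    have h := ih _ f
    have h' := ih _ g
    exact ⟨h.pre, h.nodup, fun v hv => hv.elim (fun hv => h.occ v (.inl hv)) (h'.occ v)⟩

theorem Derivable.ok {Ax : Set (Judg A)} (hP : Pre Ax) {J : Judg A} (h : Derivable Ax J) :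
    J.Ok := h.elim fun n hn => hn.ok hP

/-! Presuppositions, with control of the stages. -/

theorem DerAt.sort_ctx {Ax : Set (Judg A)} {n : ℕ} {X : PreCtx A} {U : SortE A}
    (h : DerAt Ax (n + 1) (.sort X U)) : DerAt Ax n (.ctx X) := by
  induction n with
  | zero =>
    rcases h with h | h
    · exact h.elim
    · cases h with
      | sA a b c => exact b
      | sSub a b c d e f => exact e
  | succ n ih =>
    rcases h with h | h
    · exact (ih h).succ
    · cases h with
      | sA a b c => exact b
      | sSub a b c d e f => exact e

theorem DerAt.seq_sorts {Ax : Set (Judg A)} {n : ℕ} {X : PreCtx A} {U V : SortE A}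
    (h : DerAt Ax (n + 1) (.sortEq X U V)) :
    DerAt Ax n (.sort X U) ∧ DerAt Ax n (.sort X V) := by
  induction n generalizing U V with
  | zero =>
    rcases h with h | h
    · exact h.elim
    · cases h with
      | s1 a => exact a.elim
      | s2 a => exact a.elim
      | s3 a b => exact a.elim
      | seqA a b c => exact b.elim
      | seqSub1 a b c d e f g => exact d.elim
      | seqSub2 a b c d e f g => exact e.elim
  | succ n ih =>
    rcases h with h | h
    · exact ⟨(ih h).1.succ, (ih h).2.succ⟩
    · cases h with
      | s1 a => exact ⟨a, a⟩
      | s2 a => exact ⟨(ih a).2.succ, (ih a).1.succ⟩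
      | s3 a b => exact ⟨(ih a).1.succ, (ih b).2.succ⟩
      | seqA a b c => exact ⟨b, c⟩
      | seqSub1 a b c d e f g => exact ⟨e, f⟩
      | seqSub2 a b c d e f g => exact ⟨f, g⟩

theorem DerAt.term_sort {Ax : Set (Judg A)} {n : ℕ} {X : PreCtx A} {u : Expr A} {U : SortE A}
    (h : DerAt Ax (n + 1) (.term X u U)) : DerAt Ax n (.sort X U) := by
  induction n generalizing U with
  | zero =>
    rcases h with h | h
    · exact h.elim
    · cases h with
      | seqt a b => exact a.elim
      | var hi a => exact a
      | tA a b c => exact b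
      | tSub a b c d e f => exact e
  | succ n ih =>
    rcases h with h | h
    · exact (ih h).succ
    · cases h with
      | seqt a b => exact a.seq_sorts.2.succ
      | var hi a => exact a
      | tA a b c => exact b
      | tSub a b c d e f => exact e

theorem DerAt.teq_terms {Ax : Set (Judg A)} {n : ℕ} {X : PreCtx A} {u v : Expr A} {U : SortE A}
    (h : DerAt Ax (n + 1) (.termEq X u v U)) :
    DerAt Ax n (.term X u U) ∧ DerAt Ax n (.term X v U) := by
  induction n generalizing u v with
  | zero =>
    rcases h with h | h
    · exact h.elim
    · cases h with
      | t1 a => exact a.elim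
      | t2 a => exact a.elim
      | t3 a b => exact a.elim
      | seqteq a b c d => exact a.elim
      | teqA a b c => exact b.elim
      | teqSub1 a b c d e f g => exact d.elim
      | teqSub2 a b c d e f g => exact e.elim
  | succ n ih =>
    rcases h with h | h
    · exact ⟨(ih h).1.succ, (ih h).2.succ⟩
    · cases h with
      | t1 a => exact ⟨a, a⟩
      | t2 a => exact ⟨(ih a).2.succ, (ih a).1.succ⟩
      | t3 a b => exact ⟨(ih a).1.succ, (ih b).2.succ⟩
      | seqteq a b c d => exact ⟨c, d⟩
      | teqA a b c => exact ⟨b, c⟩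
      | teqSub1 a b c d e f g => exact ⟨e, f⟩
      | teqSub2 a b c d e f g => exact ⟨f, g⟩

theorem DerAt.pos {Ax : Set (Judg A)} {n : ℕ} {J : Judg A} (h : DerAt Ax n J) :
    ∃ k, n = k + 1 := by
  cases n with
  | zero => exact h.elim
  | succ n => exact ⟨n, rfl⟩

theorem DerAt.ctx_snoc {Ax : Set (Judg A)} {n : ℕ} {X : PreCtx A} {x : A.Var} {U : SortE A}
    (h : DerAt Ax (n + 1) (.ctx (X ++ [(x, U)]))) : DerAt Ax n (.sort X U) := by
  have key : ∀ n J, DerAt Ax n J → J = .ctx (X ++ [(x, U)]) → ∃ k, n = k + 1 ∧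
      DerAt Ax k (.sort X U) := by
    refine DerAt.ind ?_ ?_
    · rintro n J ih hJ
      obtain ⟨k, rfl, hk⟩ := ih hJ
      exact ⟨_, rfl, hk.succ⟩
    · rintro n ih J hJ e
      cases hJ with
      | @ctx_cons X' U' x' a b c =>
        simp only [Judg.ctx.injEq] at e
        obtain ⟨rfl, e⟩ := List.append_inj' e rfl
        obtain ⟨rfl, rfl⟩ : x' = x ∧ U' = U := by simpa using e
        exact ⟨n, rfl, a⟩
      | ctx_nil => simp at e
      | _ => cases e
  obtain ⟨k, e, hk⟩ := key _ _ h rfl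
  obtain rfl : n = k := by omega
  exact hk

/-- The entries of a derivable context are derivable over the preceding entries. -/
theorem DerAt.ctx_entry {Ax : Set (Judg A)} {n : ℕ} {X : PreCtx A}
    (h : DerAt Ax (n + 1) (.ctx X)) {X0 : PreCtx A} {x : A.Var} {U : SortE A}
    (hp : X0 ++ [(x, U)] <+: X) : DerAt Ax n (.sort X0 U) := by
  induction X using List.reverseRecOn generalizing n with
  | nil => simp at hp
  | append_singleton X p ih =>
    rcases List.prefix_concat_iff.1 hp with e | hp
    · obtain ⟨rfl, e⟩ := List.append_inj' e rfl
      obtain rfl : (x, U) = p := by simpa using e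
      exact h.ctx_snoc
    · have h1 := h.ctx_snoc (x := p.1) (U := p.2)
      obtain ⟨k, rfl⟩ := h1.pos
      obtain ⟨l, rfl⟩ := h1.sort_ctx.pos
      exact (ih h1.sort_ctx hp).mono (by omega)

end Metatheory

section Metatheory

variable {A : Alphabet} {Ax : Set (Judg A)}

/-- The substitution `σ` is a well-typed morphism from the context `Y` to `X`. -/
def Typed (Ax : Set (Judg A)) (σ : A.Var → Expr A) (X Y : PreCtx A) : Prop :=
  ∀ p ∈ X, Derivable Ax (.term Y (σ p.1) (p.2.subst σ))

theorem Typed.pfx {σ : A.Var → Expr A} {X X0 Y : PreCtx A} (h : Typed Ax σ X Y)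
    (hp : X0 <+: X) : Typed Ax σ X0 Y := fun p hm => h p (hp.subset hm)

theorem Judg.Ok.args {J : Judg A} (hJ : J.Ok) (σ : A.Var → Expr A) {P : Expr A → SortE A → Prop}
    (h : ∀ p ∈ J.ctxOf, P (σ p.1) (p.2.subst σ)) :
    ∀ i (hi : i < J.ctxOf.length) (hif : i < (J.ctxOf.map fun p => σ p.1).length),
      P ((J.ctxOf.map fun p => σ p.1)[i]'hif)
        (subPre J.ctxOf (J.ctxOf.map fun p => σ p.1) i hi) := by
  rw [args_iff hJ.pre hJ.nodup (by simp)]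
  intro p hp
  rw [sb_map_apply _ (List.mem_map_of_mem hp), SortE.subst_congr fun v hv => sb_map_apply σ ?_]
  · exact h p hp
  · exact hJ.pre.mem hp hv

theorem Judg.Ok.args₂ {J : Judg A} (hJ : J.Ok) (σ τ : A.Var → Expr A)
    {P : Expr A → Expr A → SortE A → Prop}
    (h : ∀ p ∈ J.ctxOf, P (σ p.1) (τ p.1) (p.2.subst σ)) :
    ∀ i (hi : i < J.ctxOf.length) (hif : i < (J.ctxOf.map fun p => σ p.1).length)
      (hig : i < (J.ctxOf.map fun p => τ p.1).length),
      P ((J.ctxOf.map fun p => σ p.1)[i]'hif) ((J.ctxOf.map fun p => τ p.1)[i]'hig)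
        (subPre J.ctxOf (J.ctxOf.map fun p => σ p.1) i hi) := by
  rw [args_iff₂ hJ.pre hJ.nodup (by simp) (by simp)]
  intro p hp
  rw [sb_map_apply _ (List.mem_map_of_mem hp), sb_map_apply _ (List.mem_map_of_mem hp),
    SortE.subst_congr fun v hv => sb_map_apply σ ?_]
  · exact h p hp
  · exact hJ.pre.mem hp hv

theorem SortE.substL_map {X : PreCtx A} {U : SortE A} (hU : ∀ v, SOccurs v U → v ∈ X.map Prod.fst)
    (σ : A.Var → Expr A) : U.substL (mkSub X (X.map fun p => σ p.1)) = U.subst σ :=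
  SortE.subst_congr fun v hv => sb_map_apply σ (hU v hv)

theorem Expr.substL_map {X : PreCtx A} {u : Expr A} (hu : ∀ v, Occurs v u → v ∈ X.map Prod.fst)
    (σ : A.Var → Expr A) : u.substL (mkSub X (X.map fun p => σ p.1)) = u.subst σ :=
  Expr.subst_congr fun v hv => sb_map_apply σ (hu v hv)

theorem map_ctxVars (σ : A.Var → Expr A) (X : PreCtx A) :
    (ctxVars X).map (Expr.subst σ) = X.map fun p => σ p.1 := by
  simp [ctxVars]

theorem der_sSub (hP : Pre Ax) {X Y : PreCtx A} {S : A.SortSym} {σ : A.Var → Expr A}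
    (hax : introSort X S ∈ Ax) (hJ : Derivable Ax (introSort X S)) (hY : Derivable Ax (.ctx Y))
    (hσ : Typed Ax σ X Y) : Derivable Ax (.sort Y ⟨S, X.map fun p => σ p.1⟩) :=
  .step (.sSub hax (hY.ok hP).pre (by simp) hJ hY
    ((hJ.ok hP).args σ (P := fun u U => Derivable Ax (.term Y u U)) hσ))

theorem der_tSub (hP : Pre Ax) {X Y : PreCtx A} {t : A.TermSym} {U : SortE A}
    {σ : A.Var → Expr A} (hax : introTerm X t U ∈ Ax) (hJ : Derivable Ax (introTerm X t U))
    (hU : Derivable Ax (.sort Y (U.subst σ))) (hσ : Typed Ax σ X Y) :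
    Derivable Ax (.term Y (.app t (X.map fun p => σ p.1)) (U.subst σ)) := by
  have hs := SortE.substL_map (X := X) (U := U) (fun v hv => (hJ.ok hP).occ v (.inr hv)) σ
  rw [← hs] at hU ⊢
  exact .step (.tSub hax (hU.ok hP).pre (by simp) hJ hU
    ((hJ.ok hP).args σ (P := fun u U => Derivable Ax (.term Y u U)) hσ))

theorem der_seqSub1 (hP : Pre Ax) {X Y : PreCtx A} {U V : SortE A} {σ : A.Var → Expr A}
    (hax : Judg.sortEq X U V ∈ Ax) (hJ : Derivable Ax (.sortEq X U V))
    (hU : Derivable Ax (.sort Y (U.subst σ))) (hV : Derivable Ax (.sort Y (V.subst σ)))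
    (hσ : Typed Ax σ X Y) : Derivable Ax (.sortEq Y (U.subst σ) (V.subst σ)) := by
  have hs := SortE.substL_map (X := X) (U := U) (fun v hv => (hJ.ok hP).occ v (.inl hv)) σ
  have ht := SortE.substL_map (X := X) (U := V) (fun v hv => (hJ.ok hP).occ v (.inr hv)) σ
  rw [← hs] at hU ⊢
  rw [← ht] at hV ⊢
  exact .step (.seqSub1 hax (hU.ok hP).pre (by simp) hJ hU hV
    ((hJ.ok hP).args σ (P := fun u U => Derivable Ax (.term Y u U)) hσ))

theorem der_teqSub1 (hP : Pre Ax) {X Y : PreCtx A} {u v : Expr A} {U : SortE A}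
    {σ : A.Var → Expr A} (hax : Judg.termEq X u v U ∈ Ax)
    (hJ : Derivable Ax (.termEq X u v U))
    (hu : Derivable Ax (.term Y (u.subst σ) (U.subst σ)))
    (hv : Derivable Ax (.term Y (v.subst σ) (U.subst σ)))
    (hσ : Typed Ax σ X Y) : Derivable Ax (.termEq Y (u.subst σ) (v.subst σ) (U.subst σ)) := by
  have hs := Expr.substL_map (X := X) (u := u) (fun v hv => (hJ.ok hP).occ v (.inl hv)) σ
  have ht := Expr.substL_map (X := X) (u := v) (fun v hv => (hJ.ok hP).occ v (.inr (.inl hv))) σ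
  have hr := SortE.substL_map (X := X) (U := U) (fun v hv => (hJ.ok hP).occ v (.inr (.inr hv))) σ
  rw [← hs, ← hr] at hu
  rw [← ht, ← hr] at hv
  rw [← hs, ← ht, ← hr]
  exact .step (.teqSub1 hax (hu.ok hP).pre (by simp) hJ hu hv
    ((hJ.ok hP).args σ (P := fun u U => Derivable Ax (.term Y u U)) hσ))

theorem der_seqSub2 (hP : Pre Ax) {X Y : PreCtx A} {S : A.SortSym} {σ τ : A.Var → Expr A}
    (hax : introSort X S ∈ Ax) (hJ : Derivable Ax (introSort X S))
    (h1 : Derivable Ax (.sort Y ⟨S, X.map fun p => σ p.1⟩))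
    (h2 : Derivable Ax (.sort Y ⟨S, X.map fun p => τ p.1⟩))
    (h : ∀ p ∈ X, Derivable Ax (.termEq Y (σ p.1) (τ p.1) (p.2.subst σ))) :
    Derivable Ax (.sortEq Y ⟨S, X.map fun p => σ p.1⟩ ⟨S, X.map fun p => τ p.1⟩) :=
  .step (.seqSub2 hax (h1.ok hP).pre (by simp) (by simp) hJ h1 h2
    ((hJ.ok hP).args₂ σ τ (P := fun u v U => Derivable Ax (.termEq Y u v U)) h))

theorem der_teqSub2 (hP : Pre Ax) {X Y : PreCtx A} {t : A.TermSym} {U : SortE A}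
    {σ τ : A.Var → Expr A} (hax : introTerm X t U ∈ Ax) (hJ : Derivable Ax (introTerm X t U))
    (h1 : Derivable Ax (.term Y (.app t (X.map fun p => σ p.1)) (U.subst σ)))
    (h2 : Derivable Ax (.term Y (.app t (X.map fun p => τ p.1)) (U.subst σ)))
    (h : ∀ p ∈ X, Derivable Ax (.termEq Y (σ p.1) (τ p.1) (p.2.subst σ))) :
    Derivable Ax (.termEq Y (.app t (X.map fun p => σ p.1)) (.app t (X.map fun p => τ p.1))
      (U.subst σ)) := by
  have hs := SortE.substL_map (X := X) (U := U) (fun v hv => (hJ.ok hP).occ v (.inr hv)) σ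
  rw [← hs] at h1 h2 ⊢
  exact .step (.teqSub2 hax (h1.ok hP).pre (by simp) (by simp) hJ h1 h2
    ((hJ.ok hP).args₂ σ τ (P := fun u v U => Derivable Ax (.termEq Y u v U)) h))

/-- Substitution in a judgment. -/
def Judg.app (σ : A.Var → Expr A) (Y : PreCtx A) : Judg A → Judg A
  | .ctx _ => .ctx Y
  | .sort _ U => .sort Y (U.subst σ)
  | .term _ u U => .term Y (u.subst σ) (U.subst σ)
  | .sortEq _ U V => .sortEq Y (U.subst σ) (V.subst σ)
  | .termEq _ u v U => .termEq Y (u.subst σ) (v.subst σ) (U.subst σ)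

theorem subst_sb_map {X : PreCtx A} {U : SortE A} (σ : A.Var → Expr A) (f : List (Expr A)) :
    (U.substL (mkSub X f)).subst σ = U.subst fun y => (sb X f y).subst σ :=
  SortE.subst_subst _ _ _

theorem map_sb_subst {X : PreCtx A} {f : List (Expr A)} (hX : (X.map Prod.fst).Nodup)
    (hl : f.length = X.length) (σ : A.Var → Expr A) :
    f.map (Expr.subst σ) = X.map fun p => (sb X f p.1).subst σ := by
  conv_lhs => rw [← map_sb hX hl]
  simp

theorem Expr.subst_sb_map {X : PreCtx A} {u : Expr A} (σ : A.Var → Expr A) (f : List (Expr A)) :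
    (u.substL (mkSub X f)).subst σ = u.subst fun y => (sb X f y).subst σ :=
  Expr.subst_subst _ _ _

/-- Derivable judgments are closed under well-typed substitution. -/
theorem Derivable.subst (hP : Pre Ax) {J : Judg A} (hJ : Derivable Ax J) {Y : PreCtx A}
    {σ : A.Var → Expr A} (hY : Derivable Ax (.ctx Y)) (hσ : Typed Ax σ J.ctxOf Y) :
    Derivable Ax (J.app σ Y) := by
  obtain ⟨n, hn⟩ := hJ
  revert σ Y
  revert hn
  refine DerAt.ind (P := fun _ J => ∀ {Y : PreCtx A} {σ : A.Var → Expr A},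
    Derivable Ax (.ctx Y) → Typed Ax σ J.ctxOf Y → Derivable Ax (J.app σ Y))
    (fun _ _ h => h) ?_ n J
  intro n ih J hJ Y σ hY hσ
  have hD : Derivable Ax J := ⟨_, .step hJ⟩
  have hpre := (hD.ok hP)
  -- the arguments of a substitution rule after substitution
  have hargs : ∀ {X X' : PreCtx A} {K : Judg A}, K.Ok → K.ctxOf = X → ∀ {f : List (Expr A)},
      f.length = X.length → Typed Ax σ X' Y →
      (∀ i (hi : i < X.length) (hif : i < f.length),
        DerAt Ax n (.term X' (f[i]'hif) (subPre X f i hi))) →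
      Typed Ax (fun y => (sb X f y).subst σ) X Y := by
    intro X X' K hK hX f hl hσ h
    subst hX
    rw [args_iff hK.pre hK.nodup hl (P := fun u U => DerAt Ax n (.term X' u U))] at h
    intro p hp
    have := ih _ (h p hp) hY hσ
    rwa [Judg.app, SortE.subst_subst] at this
  have hargs₂ : ∀ {X X' : PreCtx A} {K : Judg A}, K.Ok → K.ctxOf = X → ∀ {f g : List (Expr A)},
      f.length = X.length → g.length = X.length → Typed Ax σ X' Y →
      (∀ i (hi : i < X.length) (hif : i < f.length) (hig : i < g.length),
        DerAt Ax n (.termEq X' (f[i]'hif) (g[i]'hig) (subPre X f i hi))) →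
      ∀ p ∈ X, Derivable Ax (.termEq Y ((sb X f p.1).subst σ) ((sb X g p.1).subst σ)
        (p.2.subst fun y => (sb X f y).subst σ)) := by
    intro X X' K hK hX f g hl hg hσ h
    subst hX
    rw [args_iff₂ hK.pre hK.nodup hl hg (P := fun u v U => DerAt Ax n (.termEq X' u v U))] at h
    intro p hp
    have := ih _ (h p hp) hY hσ
    rwa [Judg.app, SortE.subst_subst] at this
  cases hJ with
  | ctx_nil => exact hY
  | ctx_cons a b c => exact hY
  | s1 a => exact .step (.s1 (ih _ a hY hσ))
  | s2 a => exact .step (.s2 (ih _ a hY hσ))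
  | s3 a b => exact .step (.s3 (ih _ a hY hσ) (ih _ b hY hσ))
  | t1 a => exact .step (.t1 (ih _ a hY hσ))
  | t2 a => exact .step (.t2 (ih _ a hY hσ))
  | t3 a b => exact .step (.t3 (ih _ a hY hσ) (ih _ b hY hσ))
  | seqt a b => exact .step (.seqt (ih _ a hY hσ) (ih _ b hY hσ))
  | seqteq a b c d =>
    exact .step (.seqteq (ih _ a hY hσ) (ih _ b hY hσ) (ih _ c hY hσ) (ih _ d hY hσ))
  | var hi a =>
    rw [Judg.app, Expr.subst_var]
    exact hσ _ (List.getElem_mem hi)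
  | @sA X U a b c =>
    have hU := hP.sort_shape _ _ a
    obtain ⟨S, f⟩ := U
    obtain rfl : f = ctxVars X := hU
    rw [Judg.app, SortE.subst_mk, map_ctxVars]
    exact der_sSub hP a hD hY hσ
  | @tA X u U a b c =>
    obtain ⟨t, rfl⟩ := hP.term_shape _ _ _ a
    rw [Judg.app, Expr.subst_app, map_ctxVars]
    exact der_tSub hP a hD (ih _ b hY hσ) hσ
  | seqA a b c => exact der_seqSub1 hP a hD (ih _ b hY hσ) (ih _ c hY hσ) hσ
  | teqA a b c => exact der_teqSub1 hP a hD (ih _ b hY hσ) (ih _ c hY hσ) hσ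
  | @sSub X S a Y' b f c d e g =>
    have hK := d.ok hP
    have hn : (X.map Prod.fst).Nodup := hK.nodup
    have := der_sSub (X := X) hP a d.der hY (hargs (X := X) hK rfl c hσ g)
    rw [← map_sb_subst hn c] at this
    exact this
  | @tSub X t U a Y' b f c d e g =>
    have hK := d.ok hP
    have hn : (X.map Prod.fst).Nodup := hK.nodup
    have hU := ih _ e hY hσ
    simp only [Judg.app, subst_sb_map] at hU ⊢
    have := der_tSub hP a d.der hU (hargs (X := X) hK rfl c hσ g)
    rwa [← map_sb_subst hn c, ← Expr.subst_app] at this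
  | @seqSub1 X U V a Y' b f c d e e' g =>
    have hK := d.ok hP
    have hn : (X.map Prod.fst).Nodup := hK.nodup
    have hU := ih _ e hY hσ
    have hV := ih _ e' hY hσ
    simp only [Judg.app, subst_sb_map] at hU hV ⊢
    exact der_seqSub1 hP a d.der hU hV (hargs (X := X) hK rfl c hσ g)
  | @seqSub2 X S a Y' b f g c c' d e e' k =>
    have hK := d.ok hP
    have hn : (X.map Prod.fst).Nodup := hK.nodup
    have hU := ih _ e hY hσ
    have hV := ih _ e' hY hσ
    have h := hargs₂ (X := X) hK rfl c c' hσ k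
    simp only [Judg.app, SortE.subst_mk] at hU hV ⊢
    rw [map_sb_subst hn c] at hU ⊢
    rw [map_sb_subst hn c'] at hV ⊢
    exact der_seqSub2 (σ := fun y => (sb X f y).subst σ)
      (τ := fun y => (sb X g y).subst σ) hP a d.der hU hV h
  | @teqSub1 X u v U a Y' b f c d e e' g =>
    have hK := d.ok hP
    have hn : (X.map Prod.fst).Nodup := hK.nodup
    have hU := ih _ e hY hσ
    have hV := ih _ e' hY hσ
    simp only [Judg.app, subst_sb_map, Expr.subst_sb_map] at hU hV ⊢
    exact der_teqSub1 hP a d.der hU hV (hargs (X := X) hK rfl c hσ g)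
  | @teqSub2 X t U a Y' b f g c c' d e e' k =>
    have hK := d.ok hP
    have hn : (X.map Prod.fst).Nodup := hK.nodup
    have hU := ih _ e hY hσ
    have hV := ih _ e' hY hσ
    have h := hargs₂ (X := X) hK rfl c c' hσ k
    simp only [Judg.app, subst_sb_map, Expr.subst_app] at hU hV ⊢
    rw [map_sb_subst hn c] at hU ⊢
    rw [map_sb_subst hn c'] at hV ⊢
    exact der_teqSub2 (σ := fun y => (sb X f y).subst σ)
      (τ := fun y => (sb X g y).subst σ) hP a d.der hU hV h

end Metatheory

section Metatheory

variable {A : Alphabet} {Ax : Set (Judg A)}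

theorem Derivable.sort_ctx {X : PreCtx A} {U : SortE A} (h : Derivable Ax (.sort X U)) :
    Derivable Ax (.ctx X) := by
  obtain ⟨n, hn⟩ := h
  exact hn.succ.sort_ctx.der

theorem Derivable.term_sort {X : PreCtx A} {u : Expr A} {U : SortE A}
    (h : Derivable Ax (.term X u U)) : Derivable Ax (.sort X U) := by
  obtain ⟨n, hn⟩ := h
  exact hn.succ.term_sort.der

theorem Derivable.seq_left {X : PreCtx A} {U V : SortE A} (h : Derivable Ax (.sortEq X U V)) :
    Derivable Ax (.sort X U) := by
  obtain ⟨n, hn⟩ := h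
  exact hn.succ.seq_sorts.1.der

theorem Derivable.seq_right {X : PreCtx A} {U V : SortE A} (h : Derivable Ax (.sortEq X U V)) :
    Derivable Ax (.sort X V) := by
  obtain ⟨n, hn⟩ := h
  exact hn.succ.seq_sorts.2.der

theorem Derivable.teq_left {X : PreCtx A} {u v : Expr A} {U : SortE A}
    (h : Derivable Ax (.termEq X u v U)) : Derivable Ax (.term X u U) := by
  obtain ⟨n, hn⟩ := h
  exact hn.succ.teq_terms.1.der

theorem Derivable.teq_right {X : PreCtx A} {u v : Expr A} {U : SortE A}
    (h : Derivable Ax (.termEq X u v U)) : Derivable Ax (.term X v U) := by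
  obtain ⟨n, hn⟩ := h
  exact hn.succ.teq_terms.2.der

theorem Derivable.srefl {X : PreCtx A} {U : SortE A} (h : Derivable Ax (.sort X U)) :
    Derivable Ax (.sortEq X U U) := .step (.s1 h)

theorem Derivable.ssymm {X : PreCtx A} {U V : SortE A} (h : Derivable Ax (.sortEq X U V)) :
    Derivable Ax (.sortEq X V U) := .step (.s2 h)

theorem Derivable.strans {X : PreCtx A} {U V W : SortE A} (h : Derivable Ax (.sortEq X U V))
    (h' : Derivable Ax (.sortEq X V W)) : Derivable Ax (.sortEq X U W) := .step (.s3 h h')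

theorem Derivable.conv {X : PreCtx A} {u : Expr A} {U V : SortE A}
    (h : Derivable Ax (.term X u U)) (h' : Derivable Ax (.sortEq X U V)) :
    Derivable Ax (.term X u V) := .step (.seqt h' h)

theorem Derivable.teq_conv {X : PreCtx A} {u v : Expr A} {U V : SortE A}
    (h : Derivable Ax (.termEq X u v U)) (h' : Derivable Ax (.sortEq X U V)) :
    Derivable Ax (.termEq X u v V) :=
  .step (.seqteq h' h (h.teq_left.conv h') (h.teq_right.conv h'))

theorem der_ctx_nil : Derivable Ax (.ctx []) := .step .ctx_nil

theorem der_entry {X X0 : PreCtx A} {x : A.Var} {U : SortE A} (h : Derivable Ax (.ctx X))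
    (hp : X0 ++ [(x, U)] <+: X) : Derivable Ax (.sort X0 U) := by
  obtain ⟨n, hn⟩ := h
  exact (hn.succ.ctx_entry hp).der

theorem der_ctx_pfx {X X0 : PreCtx A} (h : Derivable Ax (.ctx X)) (hp : X0 <+: X) :
    Derivable Ax (.ctx X0) := by
  obtain ⟨Z, rfl⟩ := hp
  cases Z with
  | nil => simpa using h
  | cons p Z => exact (der_entry (x := p.1) (U := p.2) h ⟨Z, by simp⟩).sort_ctx

theorem der_ctx_snoc (hP : Pre Ax) {X : PreCtx A} {x : A.Var} {U : SortE A}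
    (h : Derivable Ax (.sort X U)) (hx : x ∉ X.map Prod.fst) :
    Derivable Ax (.ctx (X ++ [(x, U)])) :=
  .step (.ctx_cons h (fun p hp e => hx (e ▸ List.mem_map_of_mem hp))
    (isPreCtx_snoc.2 ⟨(h.ok hP).pre, (h.ok hP).occ⟩))

@[simp] theorem Judg.app_id_sort (X Y : PreCtx A) (U : SortE A) :
    (Judg.sort X U).app Expr.var Y = .sort Y U := by simp [Judg.app]

@[simp] theorem Judg.app_id_term (X Y : PreCtx A) (u : Expr A) (U : SortE A) :
    (Judg.term X u U).app Expr.var Y = .term Y u U := by simp [Judg.app]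

theorem typed_id_iff {X Y : PreCtx A} :
    Typed Ax Expr.var X Y ↔ ∀ p ∈ X, Derivable Ax (.term Y (.var p.1) p.2) := by
  simp [Typed]

theorem der_var {X : PreCtx A} {p : A.Var × SortE A} (hp : p ∈ X)
    (h : Derivable Ax (.sort X p.2)) : Derivable Ax (.term X (.var p.1) p.2) := by
  obtain ⟨i, hi, rfl⟩ := List.getElem_of_mem hp
  exact .step (.var hi h)

theorem typed_id (hP : Pre Ax) {X X0 : PreCtx A} (h : Derivable Ax (.ctx X)) (hp : X0 <+: X) :
    Typed Ax Expr.var X0 X := by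
  induction X0 using List.reverseRecOn with
  | nil => intro p hp; simp at hp
  | append_singleton X0 q ih =>
    have ih := ih ((List.prefix_append _ _).trans hp)
    intro p hm
    rcases List.mem_append.1 hm with hm | hm
    · exact ih p hm
    · obtain rfl : p = q := by simpa using hm
      have := (der_entry (x := p.1) (U := p.2) h hp).subst hP h ih
      rw [SortE.subst_id]
      exact der_var (hp.subset (by simp)) (by simpa using this)

theorem der_vars (hP : Pre Ax) {X : PreCtx A} (h : Derivable Ax (.ctx X))
    {p : A.Var × SortE A} (hp : p ∈ X) : Derivable Ax (.term X (.var p.1) p.2) := by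
  simpa using typed_id hP h (List.prefix_refl X) p hp

/-- Weakening along a prefix. -/
theorem Derivable.weaken (hP : Pre Ax) {J : Judg A} (hJ : Derivable Ax J) {X : PreCtx A}
    (h : Derivable Ax (.ctx X)) (hp : J.ctxOf <+: X) : Derivable Ax (J.app Expr.var X) :=
  hJ.subst hP h (typed_id hP h hp)

/-- The conclusion of the equality substitution principle. -/
def Judg.EqApp (Ax : Set (Judg A)) (σ τ : A.Var → Expr A) (Y : PreCtx A) : Judg A → Prop
  | .sort _ U => Derivable Ax (.sortEq Y (U.subst σ) (U.subst τ))
  | .term _ u U => Derivable Ax (.termEq Y (u.subst σ) (u.subst τ) (U.subst σ))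
  | _ => True

/-- Substituting equal morphisms yields equal results. -/
theorem Derivable.eqApp (hP : Pre Ax) {J : Judg A} (hJ : Derivable Ax J) {Y : PreCtx A}
    {σ τ : A.Var → Expr A} (hY : Derivable Ax (.ctx Y)) (hσ : Typed Ax σ J.ctxOf Y)
    (hτ : Typed Ax τ J.ctxOf Y)
    (h : ∀ p ∈ J.ctxOf, Derivable Ax (.termEq Y (σ p.1) (τ p.1) (p.2.subst σ))) :
    J.EqApp Ax σ τ Y := by
  obtain ⟨n, hn⟩ := hJ
  revert σ τ Y
  revert hn
  refine DerAt.ind (P := fun _ J => ∀ {Y : PreCtx A} {σ τ : A.Var → Expr A},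
    Derivable Ax (.ctx Y) → Typed Ax σ J.ctxOf Y → Typed Ax τ J.ctxOf Y →
    (∀ p ∈ J.ctxOf, Derivable Ax (.termEq Y (σ p.1) (τ p.1) (p.2.subst σ))) →
      J.EqApp Ax σ τ Y) (fun _ _ h => h) ?_ n J
  intro n ih J hJ Y σ τ hY hσ hτ h
  have hD : Derivable Ax J := ⟨_, .step hJ⟩
  have hsort := hD.subst hP hY hσ
  have hsort' := hD.subst hP hY hτ
  cases hJ with
  | ctx_nil => trivial
  | ctx_cons a b c => trivial
  | s1 a => trivial
  | s2 a => trivial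
  | s3 a b => trivial
  | t1 a => trivial
  | t2 a => trivial
  | t3 a b => trivial
  | seqt a b => exact (ih _ b hY hσ hτ h).teq_conv (a.der.subst hP hY hσ)
  | seqteq a b c d => trivial
  | var hi a =>
    simp only [Judg.EqApp, Expr.subst_var]
    exact h _ (List.getElem_mem hi)
  | @sA X U a b c =>
    have hU := hP.sort_shape _ _ a
    obtain ⟨S, f⟩ := U
    obtain rfl : f = ctxVars X := hU
    simp only [Judg.app, Judg.EqApp, SortE.subst_mk, map_ctxVars] at hsort hsort' ⊢
    exact der_seqSub2 hP a hD hsort hsort' h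
  | @tA X u U a b c =>
    obtain ⟨t, rfl⟩ := hP.term_shape _ _ _ a
    have hU := ih _ b hY hσ hτ h
    simp only [Judg.app, Judg.EqApp, Expr.subst_app, map_ctxVars] at hU hsort hsort' ⊢
    exact der_teqSub2 hP a hD hsort (hsort'.conv hU.ssymm) h
  | seqA a b c => trivial
  | teqA a b c => trivial
  | @sSub X S a Y' b f c d e g =>
    have hK := d.ok hP
    have hn : (X.map Prod.fst).Nodup := hK.nodup
    rw [args_iff (X := X) hK.pre hn c (P := fun u U => DerAt Ax n (.term Y' u U))] at g
    simp only [Judg.app, Judg.EqApp, SortE.subst_mk] at hsort hsort' ⊢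
    simp only [map_sb_subst hn c] at hsort hsort' ⊢
    exact der_seqSub2 (σ := fun y => (sb X f y).subst σ)
      (τ := fun y => (sb X f y).subst τ) hP a d.der hsort hsort' fun p hp => by
        have := ih _ (g p hp) hY hσ hτ h
        rwa [Judg.EqApp, SortE.subst_subst] at this
  | @tSub X t U a Y' b f c d e g =>
    have hK := d.ok hP
    have hn : (X.map Prod.fst).Nodup := hK.nodup
    rw [args_iff (X := X) hK.pre hn c (P := fun u U => DerAt Ax n (.term Y' u U))] at g
    have hargs : ∀ p ∈ X, Derivable Ax (.termEq Y ((sb X f p.1).subst σ)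
        ((sb X f p.1).subst τ) (p.2.subst fun y => (sb X f y).subst σ)) := fun p hp => by
      have := ih _ (g p hp) hY hσ hτ h
      rwa [Judg.EqApp, SortE.subst_subst] at this
    have hT : ∀ {ρ : A.Var → Expr A}, Typed Ax ρ Y' Y →
        Typed Ax (fun y => (sb X f y).subst ρ) X Y := fun hρ p hp => by
      have := (g p hp).der.subst hP hY hρ
      rwa [Judg.app, SortE.subst_subst] at this
    obtain ⟨k, rfl⟩ := d.pos
    have hU := ih _ d.term_sort.succ hY (hT hσ) (hT hτ) hargs
    simp only [Judg.app, Judg.EqApp, Expr.subst_app, subst_sb_map] at hU hsort hsort' ⊢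
    simp only [map_sb_subst hn c] at hsort hsort' ⊢
    exact der_teqSub2 (σ := fun y => (sb X f y).subst σ)
      (τ := fun y => (sb X f y).subst τ) hP a d.der hsort (hsort'.conv hU.ssymm) hargs
  | seqSub1 a b c d e f g => trivial
  | seqSub2 a b c d e f g k => trivial
  | teqSub1 a b c d e f g => trivial
  | teqSub2 a b c d e f g k => trivial

/-! Inversion principles. -/

theorem take_snoc_pfx {α : Type} (X : List α) {i : ℕ} (hi : i < X.length) :
    X.take i ++ [X[i]'hi] <+: X := by
  rw [List.take_concat_get' X i hi]
  exact List.take_prefix _ _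

theorem mem_split_pfx {α : Type} {X : List α} {a : α} (h : a ∈ X) :
    ∃ X0, X0 ++ [a] <+: X := by
  obtain ⟨i, hi, rfl⟩ := List.getElem_of_mem h
  exact ⟨_, take_snoc_pfx X hi⟩

theorem DerAt.var_inv {n : ℕ} {X : PreCtx A} {x : A.Var} {U : SortE A}
    (h : DerAt Ax (n + 1) (.term X (.var x) U)) (hP : Pre Ax) :
    ∃ V, (x, V) ∈ X ∧ DerAt Ax n (.sort X V) ∧ (V = U ∨ DerAt Ax (n + 1) (.sortEq X V U)) := by
  induction n generalizing U with
  | zero =>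
    rcases h with h | h
    · exact h.elim
    · generalize e : Expr.var x = u at h
      cases h with
      | seqt a b => exact a.elim
      | var hi a => exact a.elim
      | tA a b c => exact b.elim
      | tSub a b c d e f => exact d.elim
  | succ n ih =>
    rcases h with h | h
    · obtain ⟨V, h1, h2, h3⟩ := ih h
      exact ⟨V, h1, h2.succ, h3.imp id DerAt.succ⟩
    · generalize e : Expr.var x = u at h
      cases h with
      | seqt a b =>
        subst e
        obtain ⟨V, h1, h2, h3⟩ := ih b
        refine ⟨V, h1, h2.succ, .inr ?_⟩
        rcases h3 with rfl | h3
        · exact a.succ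
        · exact .step (.s3 h3 a)
      | var hi a =>
        rw [Expr.var.injEq] at e
        subst e
        exact ⟨_, List.getElem_mem hi, a, .inl rfl⟩
      | tA a b c =>
        obtain ⟨t, rfl⟩ := hP.term_shape _ _ _ a
        cases e
      | tSub a b c d e' f => cases e

theorem DerAt.app_inv {n : ℕ} {X : PreCtx A} {t : A.TermSym} {f : List (Expr A)} {U : SortE A}
    (h : DerAt Ax (n + 1) (.term X (.app t f) U)) (hP : Pre Ax) :
    ∃ Xa V, introTerm Xa t V ∈ Ax ∧ f.length = Xa.length ∧ DerAt Ax (n + 1) (introTerm Xa t V) ∧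
      DerAt Ax n (.sort X (V.subst (sb Xa f))) ∧
      (∀ p ∈ Xa, DerAt Ax n (.term X (sb Xa f p.1) (p.2.subst (sb Xa f)))) ∧
      DerAt Ax (n + 1) (.term X (.app t f) (V.subst (sb Xa f))) ∧
      (V.subst (sb Xa f) = U ∨ DerAt Ax (n + 1) (.sortEq X (V.subst (sb Xa f)) U)) := by
  induction n generalizing U with
  | zero =>
    rcases h with h | h
    · exact h.elim
    · generalize e : Expr.app t f = u at h
      cases h with
      | seqt a b => exact a.elim
      | var hi a => exact a.elim
      | tA a b c => exact b.elim
      | tSub a b c d e f => exact d.elim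
  | succ n ih =>
    rcases h with h | h
    · obtain ⟨Xa, V, h1, h2, h3, h4, h5, h6, h7⟩ := ih h
      exact ⟨Xa, V, h1, h2, h3.succ, h4.succ, fun p hp => (h5 p hp).succ, h6.succ,
        h7.imp id DerAt.succ⟩
    · have hD : DerAt Ax (n + 2) _ := .step h
      generalize e : Expr.app t f = u at h
      cases h with
      | seqt a b =>
        subst e
        obtain ⟨Xa, V, h1, h2, h3, h4, h5, h6, h7⟩ := ih b
        refine ⟨Xa, V, h1, h2, h3.succ, h4.succ, fun p hp => (h5 p hp).succ, h6.succ, .inr ?_⟩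
        rcases h7 with h7 | h7
        · exact h7 ▸ a.succ
        · exact .step (.s3 h7 a)
      | var hi a => cases e
      | tA a b c =>
        obtain ⟨t', rfl⟩ := hP.term_shape _ _ _ a
        rw [Expr.app.injEq] at e
        obtain ⟨rfl, rfl⟩ := e
        rw [show U = U.subst (sb X (ctxVars X)) by rw [sb_ctxVars, SortE.subst_id]] at b
        refine ⟨X, U, a, by simp [ctxVars], hD, b, ?_, ?_, ?_⟩
        · rw [sb_ctxVars]
          intro p hp
          obtain ⟨i, hi, rfl⟩ := List.getElem_of_mem hp
          simpa using c i hi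
        · simpa [sb_ctxVars] using hD
        · simp [sb_ctxVars]
      | @tSub Xa t' V a Y b f' c d e' g =>
        rw [Expr.app.injEq] at e
        obtain ⟨rfl, rfl⟩ := e
        have hK := d.ok hP
        rw [args_iff (X := Xa) hK.pre hK.nodup c (P := fun u U => DerAt Ax (n + 1) (.term X u U))] at g
        exact ⟨Xa, V, a, c, d.succ, e', g, hD, .inl rfl⟩

theorem DerAt.sort_inv {n : ℕ} {X : PreCtx A} {S : A.SortSym} {f : List (Expr A)}
    (h : DerAt Ax (n + 1) (.sort X ⟨S, f⟩)) (hP : Pre Ax) :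
    ∃ Xa, introSort Xa S ∈ Ax ∧ f.length = Xa.length ∧ DerAt Ax (n + 1) (introSort Xa S) ∧
      ∀ p ∈ Xa, DerAt Ax n (.term X (sb Xa f p.1) (p.2.subst (sb Xa f))) := by
  induction n with
  | zero =>
    rcases h with h | h
    · exact h.elim
    · cases h with
      | sA a b c => exact b.elim
      | sSub a b c d e f => exact e.elim
  | succ n ih =>
    rcases h with h | h
    · obtain ⟨Xa, h1, h2, h3, h4⟩ := ih h
      exact ⟨Xa, h1, h2, h3.succ, fun p hp => (h4 p hp).succ⟩
    · have hD : DerAt Ax (n + 2) _ := .step h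
      cases h with
      | sA a b c =>
        obtain rfl : f = ctxVars X := hP.sort_shape _ _ a
        refine ⟨X, a, by simp [ctxVars], hD, ?_⟩
        rw [sb_ctxVars]
        intro p hp
        obtain ⟨i, hi, rfl⟩ := List.getElem_of_mem hp
        simpa using c i hi
      | @sSub Xa _ a _ b _ c d e g =>
        have hK := d.ok hP
        rw [args_iff (X := Xa) hK.pre hK.nodup c (P := fun u U => DerAt Ax (n + 1) (.term X u U))] at g
        exact ⟨Xa, a, c, d.succ, g⟩

theorem Judg.Ok.entry_unique {J : Judg A} (h : J.Ok) {x : A.Var} {U V : SortE A}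
    (hU : (x, U) ∈ J.ctxOf) (hV : (x, V) ∈ J.ctxOf) : U = V := by
  have := List.inj_on_of_nodup_map h.nodup hU hV rfl
  simpa using this

theorem Derivable.app_inv (hP : Pre Ax) {X : PreCtx A} {t : A.TermSym} {f : List (Expr A)}
    {U : SortE A} (h : Derivable Ax (.term X (.app t f) U)) :
    ∃ Xa V, introTerm Xa t V ∈ Ax ∧ f.length = Xa.length ∧ Derivable Ax (introTerm Xa t V) ∧
      Typed Ax (sb Xa f) Xa X ∧ Derivable Ax (.sortEq X (V.subst (sb Xa f)) U) := by
  obtain ⟨n, hn⟩ := h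
  obtain ⟨Xa, V, h1, h2, h3, h4, h5, h6, h7⟩ := hn.succ.app_inv hP
  refine ⟨Xa, V, h1, h2, h3.der, fun p hp => (h5 p hp).der, ?_⟩
  rcases h7 with h7 | h7
  · rw [← h7]
    exact h4.der.srefl
  · exact h7.der

theorem Derivable.sort_inv (hP : Pre Ax) {X : PreCtx A} {S : A.SortSym} {f : List (Expr A)}
    (h : Derivable Ax (.sort X ⟨S, f⟩)) :
    ∃ Xa, introSort Xa S ∈ Ax ∧ f.length = Xa.length ∧ Derivable Ax (introSort Xa S) ∧
      Typed Ax (sb Xa f) Xa X := by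
  obtain ⟨n, hn⟩ := h
  obtain ⟨Xa, h1, h2, h3, h4⟩ := hn.succ.sort_inv hP
  exact ⟨Xa, h1, h2, h3.der, fun p hp => (h4 p hp).der⟩

/-- Sorts are unique up to derivable equality. -/
theorem Derivable.sort_unique (hP : Pre Ax) {X : PreCtx A} {u : Expr A} {U V : SortE A}
    (hU : Derivable Ax (.term X u U)) (hV : Derivable Ax (.term X u V)) :
    Derivable Ax (.sortEq X U V) := by
  cases u with
  | var x =>
    obtain ⟨n, hU⟩ := hU
    obtain ⟨m, hV⟩ := hV
    have hok := hU.ok hP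
    have key : ∀ {n U}, DerAt Ax n (.term X (.var x) U) →
        ∃ W, (x, W) ∈ X ∧ Derivable Ax (.sortEq X W U) := by
      intro n U h
      obtain ⟨W, h1, h2, h3⟩ := h.succ.var_inv hP
      refine ⟨W, h1, ?_⟩
      rcases h3 with rfl | h3
      · exact h2.der.srefl
      · exact h3.der
    obtain ⟨W, h1, h2⟩ := key hU
    obtain ⟨W', h1', h2'⟩ := key hV
    obtain rfl := hok.entry_unique h1 h1'
    exact h2.ssymm.strans h2'
  | app t f =>
    obtain ⟨Xa, W, h1, -, -, -, h2⟩ := hU.app_inv hP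
    obtain ⟨Xa', W', h1', -, -, -, hXV⟩ := hV.app_inv hP
    obtain ⟨rfl, rfl⟩ := hP.term_unique _ _ _ _ _ h1 h1'
    exact h2.ssymm.strans hXV

/-- The partial term equality judgment. -/
def TEq (Ax : Set (Judg A)) (X : PreCtx A) (u v : Expr A) : Prop :=
  ∃ U, Derivable Ax (.termEq X u v U)

theorem Derivable.teq_refl {X : PreCtx A} {u : Expr A} {U : SortE A}
    (h : Derivable Ax (.term X u U)) : TEq Ax X u u := ⟨U, .step (.t1 h)⟩

theorem TEq.symm {X : PreCtx A} {u v : Expr A} (h : TEq Ax X u v) : TEq Ax X v u := by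
  obtain ⟨U, h⟩ := h
  exact ⟨U, .step (.t2 h)⟩

theorem TEq.at_left (hP : Pre Ax) {X : PreCtx A} {u v : Expr A} {U : SortE A} (h : TEq Ax X u v)
    (hu : Derivable Ax (.term X u U)) : Derivable Ax (.termEq X u v U) := by
  obtain ⟨V, h⟩ := h
  exact h.teq_conv (h.teq_left.sort_unique hP hu)

theorem TEq.trans (hP : Pre Ax) {X : PreCtx A} {u v w : Expr A} (h : TEq Ax X u v)
    (h' : TEq Ax X v w) : TEq Ax X u w := by
  obtain ⟨U, h⟩ := h
  exact ⟨U, .step (.t3 h (h'.at_left hP h.teq_right))⟩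

theorem TEq.term_right (hP : Pre Ax) {X : PreCtx A} {u v : Expr A} {U : SortE A}
    (h : TEq Ax X u v) (hu : Derivable Ax (.term X u U)) : Derivable Ax (.term X v U) :=
  (h.at_left hP hu).teq_right

theorem TEq.subst (hP : Pre Ax) {X Y : PreCtx A} {u v : Expr A} {σ : A.Var → Expr A}
    (h : TEq Ax X u v) (hY : Derivable Ax (.ctx Y)) (hσ : Typed Ax σ X Y) :
    TEq Ax Y (u.subst σ) (v.subst σ) := by
  obtain ⟨U, h⟩ := h
  exact ⟨_, h.subst hP hY hσ⟩

/-- A morphism which is pointwise equal to a well-typed one is well-typed. -/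
theorem Typed.of_teq (hP : Pre Ax) {X Y : PreCtx A} {σ τ : A.Var → Expr A}
    (hσ : Typed Ax σ X Y) (hX : Derivable Ax (.ctx X)) (hY : Derivable Ax (.ctx Y))
    (h : ∀ p ∈ X, TEq Ax Y (σ p.1) (τ p.1)) : Typed Ax τ X Y := by
  induction X using List.reverseRecOn with
  | nil => intro p hp; simp at hp
  | append_singleton X q ih =>
    have ih := ih (hσ.pfx (List.prefix_append _ _)) (der_ctx_pfx hX (List.prefix_append _ _))
      fun p hp => h p (by simp [hp])
    intro p hp
    rcases List.mem_append.1 hp with hp' | hp'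
    · exact ih p hp'
    · obtain rfl : p = q := by simpa using hp'
      have h1 := der_entry (x := p.1) (U := p.2) hX (List.prefix_refl _)
      have := h1.eqApp hP hY (hσ.pfx (List.prefix_append _ _)) ih fun r hr =>
        (h r (by simp [(show r ∈ X from hr)])).at_left hP
          (hσ r (by simp [(show r ∈ X from hr)]))
      exact ((h p hp).term_right hP (hσ p hp)).conv this

theorem sort_msub (hP : Pre Ax) {X Y : PreCtx A} {σ τ : A.Var → Expr A} {U : SortE A}
    (hU : Derivable Ax (.sort X U))
    (hσ : Typed Ax σ X Y) (hY : Derivable Ax (.ctx Y))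
    (h : ∀ p ∈ X, TEq Ax Y (σ p.1) (τ p.1)) :
    Derivable Ax (.sortEq Y (U.subst σ) (U.subst τ)) :=
  hU.eqApp hP hY hσ (hσ.of_teq hP hU.sort_ctx hY h) fun p hp => (h p hp).at_left hP (hσ p hp)

theorem term_msub (hP : Pre Ax) {X Y : PreCtx A} {σ τ : A.Var → Expr A} {u : Expr A}
    {U : SortE A} (hu : Derivable Ax (.term X u U))
    (hσ : Typed Ax σ X Y) (hY : Derivable Ax (.ctx Y))
    (h : ∀ p ∈ X, TEq Ax Y (σ p.1) (τ p.1)) :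
    Derivable Ax (.termEq Y (u.subst σ) (u.subst τ) (U.subst σ)) :=
  hu.eqApp hP hY hσ (hσ.of_teq hP hu.term_sort.sort_ctx hY h)
    fun p hp => (h p hp).at_left hP (hσ p hp)

theorem forall₂_sb {R : Expr A → Expr A → Prop} {X : PreCtx A} {f g : List (Expr A)}
    (hl : f.length = X.length) (h : List.Forall₂ R f g) {p : A.Var × SortE A} (hp : p ∈ X) :
    R (sb X f p.1) (sb X g p.1) := by
  classical
  induction h generalizing X with
  | nil =>
    rw [List.length_nil, eq_comm, List.length_eq_zero_iff] at hl
    simp [hl] at hp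
  | @cons a b f g hab h ih =>
    cases X with
    | nil => simp at hp
    | cons q X =>
      rw [sb_cons, sb_cons]
      split_ifs with e
      · exact hab
      · refine ih (by simpa using hl) ((List.mem_cons.1 hp).resolve_left ?_)
        rintro rfl
        exact e rfl

theorem cong_app (hP : Pre Ax) {X : PreCtx A} {t : A.TermSym} {f g : List (Expr A)} {U : SortE A}
    (h : Derivable Ax (.term X (.app t f) U)) (hfg : List.Forall₂ (TEq Ax X) f g) :
    TEq Ax X (.app t f) (.app t g) := by
  obtain ⟨Xa, V, h1, h2, h3, h4, h5⟩ := h.app_inv hP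
  have hn : (Xa.map Prod.fst).Nodup := (h3.ok hP).nodup
  have := term_msub hP h3 h4 h.term_sort.sort_ctx fun p hp => forall₂_sb h2 hfg hp
  rw [Expr.subst_app, Expr.subst_app, map_ctxVars, map_ctxVars,
    map_sb hn h2, map_sb hn (hfg.length_eq ▸ h2)] at this
  exact ⟨_, this⟩

theorem cong_sort (hP : Pre Ax) {X : PreCtx A} {S : A.SortSym} {f g : List (Expr A)}
    (h : Derivable Ax (.sort X ⟨S, f⟩)) (hfg : List.Forall₂ (TEq Ax X) f g) :
    Derivable Ax (.sortEq X ⟨S, f⟩ ⟨S, g⟩) := by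
  obtain ⟨Xa, h1, h2, h3, h4⟩ := h.sort_inv hP
  have hn : (Xa.map Prod.fst).Nodup := (h3.ok hP).nodup
  have := sort_msub hP h3 h4 h.sort_ctx fun p hp => forall₂_sb h2 hfg hp
  rwa [SortE.subst_mk, SortE.subst_mk, map_ctxVars, map_ctxVars,
    map_sb hn h2, map_sb hn (hfg.length_eq ▸ h2)] at this

end Metatheory

section Levels

/-- A pretheory satisfying the structural conditions, with a choice of fresh variables. -/
structure Thy (A : Alphabet) where
  ax : Set (Judg A)
  ch : PreCtx A → A.Var
  dflt : SortE A
  pre : Pre ax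
  fresh : FreshCh ch

variable {A : Alphabet}

/-- `X ⊢ U` is a sort over a prefix of `X`, derivable at stage `n`. -/
def Thy.SAt (T : Thy A) (n : ℕ) (X : PreCtx A) (U : SortE A) : Prop :=
  ∃ X0, X0 <+: X ∧ DerAt T.ax n (.sort X0 U)

/-- `u : U` is a term over a prefix of `X` derivable at stage `n`, or an entry of `X` whose
sort is derivable at stage `n`. -/
def Thy.Arg (T : Thy A) (n : ℕ) (X : PreCtx A) (u : Expr A) (U : SortE A) : Prop :=
  (∃ x X0, u = .var x ∧ X0 ++ [(x, U)] <+: X ∧ DerAt T.ax n (.sort X0 U)) ∨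
    ∃ X0, X0 <+: X ∧ DerAt T.ax n (.term X0 u U)

def Thy.Good (T : Thy A) (X : PreCtx A) (u : Expr A) : Prop := ∃ n U, T.Arg n X u U

/-- The least stage at which `u` is an argument over `X`. -/
noncomputable def Thy.rk (T : Thy A) (X : PreCtx A) (u : Expr A) : ℕ :=
  sInf {n | ∃ U, T.Arg n X u U}

open Classical in
/-- The canonical sort of a term in a context. -/
noncomputable def Thy.cs (T : Thy A) (X : PreCtx A) : Expr A → SortE A
  | .var x => if h : ∃ U, (x, U) ∈ X then h.choose else T.dflt
  | .app t f => if h : ∃ p : PreCtx A × SortE A, introTerm p.1 t p.2 ∈ T.ax then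
      h.choose.2.subst (sb h.choose.1 f) else T.dflt

/-- A derivable context all of whose entries are derivable at stage `n`. -/
structure Thy.CtxAt (T : Thy A) (n : ℕ) (X : PreCtx A) : Prop where
  der : Derivable T.ax (.ctx X)
  entry : ∀ X0 x U, X0 ++ [(x, U)] <+: X → DerAt T.ax n (.sort X0 U)

variable {T : Thy A}

theorem Thy.SAt.pfx {n : ℕ} {X X' : PreCtx A} {U : SortE A} (h : T.SAt n X U) (hp : X <+: X') :
    T.SAt n X' U := h.imp fun _ h => ⟨h.1.trans hp, h.2⟩

theorem Thy.Arg.mono {n m : ℕ} {X : PreCtx A} {u : Expr A} {U : SortE A} (h : T.Arg n X u U)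
    (hnm : n ≤ m) : T.Arg m X u U := by
  rcases h with ⟨x, X0, h1, h2, h3⟩ | ⟨X0, h1, h2⟩
  · exact .inl ⟨x, X0, h1, h2, h3.mono hnm⟩
  · exact .inr ⟨X0, h1, h2.mono hnm⟩

theorem Thy.Arg.pfx {n : ℕ} {X X' : PreCtx A} {u : Expr A} {U : SortE A} (h : T.Arg n X u U)
    (hp : X <+: X') : T.Arg n X' u U := by
  rcases h with ⟨x, X0, h1, h2, h3⟩ | ⟨X0, h1, h2⟩
  · exact .inl ⟨x, X0, h1, h2.trans hp, h3⟩
  · exact .inr ⟨X0, h1.trans hp, h2⟩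

theorem Thy.Arg.good {n : ℕ} {X : PreCtx A} {u : Expr A} {U : SortE A} (h : T.Arg n X u U) :
    T.Good X u := ⟨n, U, h⟩

theorem Thy.Good.pfx {X X' : PreCtx A} {u : Expr A} (h : T.Good X u) (hp : X <+: X') :
    T.Good X' u := by
  obtain ⟨n, U, h⟩ := h
  exact ⟨n, U, h.pfx hp⟩

theorem Thy.SAt.pos {n : ℕ} {X : PreCtx A} {U : SortE A} (h : T.SAt n X U) : ∃ k, n = k + 1 := by
  obtain ⟨_, _, h⟩ := h
  exact h.pos

theorem Thy.Arg.sat {n : ℕ} {X : PreCtx A} {u : Expr A} {U : SortE A} (h : T.Arg n X u U) :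
    T.SAt n X U := by
  rcases h with ⟨x, X0, h1, h2, h3⟩ | ⟨X0, h1, h2⟩
  · exact ⟨X0, (List.prefix_append _ _).trans h2, h3⟩
  · obtain ⟨k, rfl⟩ := h2.pos
    exact ⟨X0, h1, h2.term_sort.succ⟩

theorem Thy.SAt.der {n : ℕ} {X : PreCtx A} {U : SortE A} (h : T.SAt n X U)
    (hX : Derivable T.ax (.ctx X)) : Derivable T.ax (.sort X U) := by
  obtain ⟨X0, h1, h2⟩ := h
  simpa [Judg.app_id_sort] using h2.der.weaken T.pre hX h1

theorem Thy.Arg.der {n : ℕ} {X : PreCtx A} {u : Expr A} {U : SortE A} (h : T.Arg n X u U)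
    (hX : Derivable T.ax (.ctx X)) : Derivable T.ax (.term X u U) := by
  rcases h with ⟨x, X0, rfl, h2, h3⟩ | ⟨X0, h1, h2⟩
  · exact der_vars T.pre hX (p := (x, U)) (h2.subset (by simp))
  · simpa using h2.der.weaken T.pre hX h1

theorem Thy.cs_var {X : PreCtx A} (hX : Derivable T.ax (.ctx X)) {x : A.Var} {U : SortE A}
    (h : (x, U) ∈ X) : T.cs X (.var x) = U := by
  have h' : ∃ U, (x, U) ∈ X := ⟨U, h⟩
  rw [Thy.cs, dif_pos h']
  exact (hX.ok T.pre).entry_unique h'.choose_spec h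

theorem Thy.cs_app {X Xa : PreCtx A} {t : A.TermSym} {V : SortE A} {f : List (Expr A)}
    (h : introTerm Xa t V ∈ T.ax) : T.cs X (.app t f) = V.subst (sb Xa f) := by
  have h' : ∃ p : PreCtx A × SortE A, introTerm p.1 t p.2 ∈ T.ax := ⟨(Xa, V), h⟩
  rw [Thy.cs, dif_pos h']
  obtain ⟨h1, h2⟩ := T.pre.term_unique _ _ _ _ _ h'.choose_spec h
  rw [h1, h2]

theorem Thy.SAt.inv {n : ℕ} {X : PreCtx A} {S : A.SortSym} {f : List (Expr A)}
    (h : T.SAt (n + 1) X ⟨S, f⟩) :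
    ∃ X0, introSort X0 S ∈ T.ax ∧ f.length = X0.length ∧ DerAt T.ax (n + 1) (introSort X0 S) ∧
      ∀ p ∈ X0, T.Arg n X (sb X0 f p.1) (p.2.subst (sb X0 f)) := by
  obtain ⟨X1, h1, h2⟩ := h
  obtain ⟨X0, h3, h4, h5, h6⟩ := h2.sort_inv T.pre
  exact ⟨X0, h3, h4, h5, fun p hp => .inr ⟨X1, h1, h6 p hp⟩⟩

theorem Thy.SAt.args {n : ℕ} {X : PreCtx A} {U : SortE A} (h : T.SAt (n + 1) X U) :
    ∀ a ∈ U.args, ∃ W, T.Arg n X a W := by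
  obtain ⟨S, f⟩ := U
  obtain ⟨X0, h3, h4, h5, h6⟩ := h.inv
  have hn : (X0.map Prod.fst).Nodup := (h5.ok T.pre).nodup
  intro a ha
  rw [← map_sb hn h4] at ha
  obtain ⟨p, hp, rfl⟩ := List.mem_map.1 ha
  exact ⟨_, h6 p hp⟩

/-- Inversion for terms built from a term symbol. -/
theorem Thy.Arg.inv {n : ℕ} {X : PreCtx A} {t : A.TermSym} {f : List (Expr A)} {U : SortE A}
    (h : T.Arg (n + 1) X (.app t f) U) :
    ∃ Xa V, introTerm Xa t V ∈ T.ax ∧ f.length = Xa.length ∧ DerAt T.ax (n + 1) (introTerm Xa t V) ∧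
      T.SAt n X (V.subst (sb Xa f)) ∧
      (∀ p ∈ Xa, T.Arg n X (sb Xa f p.1) (p.2.subst (sb Xa f))) ∧
      T.cs X (.app t f) = V.subst (sb Xa f) := by
  rcases h with ⟨x, X0, h1, h2, h3⟩ | ⟨X0, h1, h2⟩
  · simp at h1
  · obtain ⟨Xa, V, a1, a2, a3, a4, a5, a6, a7⟩ := h2.app_inv T.pre
    exact ⟨Xa, V, a1, a2, a3, ⟨X0, h1, a4⟩, fun p hp => .inr ⟨X0, h1, a5 p hp⟩, cs_app a1⟩

theorem Thy.Arg.args {n : ℕ} {X : PreCtx A} {t : A.TermSym} {f : List (Expr A)} {U : SortE A}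
    (h : T.Arg (n + 1) X (.app t f) U) : ∀ a ∈ f, ∃ W, T.Arg n X a W := by
  obtain ⟨Xa, V, h1, h4, h5, -, h6, -⟩ := h.inv
  have hn : (Xa.map Prod.fst).Nodup := (h5.ok T.pre).nodup
  intro a ha
  rw [← map_sb hn h4] at ha
  obtain ⟨p, hp, rfl⟩ := List.mem_map.1 ha
  exact ⟨_, h6 p hp⟩

theorem Thy.Arg.cs_eq {n : ℕ} {X : PreCtx A} (hX : Derivable T.ax (.ctx X)) {u : Expr A}
    {U : SortE A} (h : T.Arg n X u U) :
    T.cs X u = U ∨ ∃ X0, X0 <+: X ∧ DerAt T.ax n (.sortEq X0 (T.cs X u) U) ∧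
      DerAt T.ax n (.term X0 u (T.cs X u)) := by
  rcases h with ⟨x, X0, rfl, h2, h3⟩ | ⟨X0, h1, h2⟩
  · exact .inl (cs_var hX (h2.subset (by simp)))
  · obtain ⟨k, rfl⟩ := h2.pos
    cases u with
    | var x =>
      obtain ⟨V, hV, h4, h5⟩ := h2.var_inv T.pre
      rw [cs_var hX (h1.subset hV)]
      refine h5.imp id fun h5 => ⟨X0, h1, h5, ?_⟩
      obtain ⟨i, hi, e⟩ := List.getElem_of_mem hV
      have := Step.var (Ax := T.ax) (D := DerAt T.ax k) hi (by rw [e]; exact h4)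
      rw [e] at this
      exact .step this
    | app t f =>
      obtain ⟨Xa, V, a1, a2, a3, a4, a5, a6, a7⟩ := h2.app_inv T.pre
      rw [cs_app a1]
      exact a7.imp id fun a7 => ⟨X0, h1, a7, a6⟩

theorem Thy.Arg.cs_arg {n : ℕ} {X : PreCtx A} (hX : Derivable T.ax (.ctx X)) {u : Expr A}
    {U : SortE A} (h : T.Arg n X u U) : T.Arg n X u (T.cs X u) := by
  rcases h.cs_eq hX with e | ⟨X0, h1, h2, h3⟩
  · rwa [e]
  · exact .inr ⟨X0, h1, h3⟩

theorem Thy.Good.arg {X : PreCtx A} {u : Expr A} (h : T.Good X u) :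
    ∃ U, T.Arg (T.rk X u) X u U := Nat.sInf_mem (s := {n | ∃ U, T.Arg n X u U}) h

theorem Thy.Arg.rk_le {n : ℕ} {X : PreCtx A} {u : Expr A} {U : SortE A} (h : T.Arg n X u U) :
    T.rk X u ≤ n := Nat.sInf_le ⟨U, h⟩

theorem Thy.Good.cs_lt {X : PreCtx A} (hX : Derivable T.ax (.ctx X)) {u : Expr A}
    (h : T.Good X u) : ∀ a ∈ (T.cs X u).args, T.Good X a ∧ T.rk X a < T.rk X u := by
  obtain ⟨U, hU⟩ := h.arg
  intro a ha
  have hs := (hU.cs_arg hX).sat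
  obtain ⟨k, hk⟩ := hs.pos
  rw [hk] at hs ⊢
  obtain ⟨W, hW⟩ := hs.args a ha
  exact ⟨hW.good, Nat.lt_succ_of_le hW.rk_le⟩

theorem Thy.Good.arg_lt {X : PreCtx A} {t : A.TermSym} {f : List (Expr A)}
    (h : T.Good X (.app t f)) : ∀ a ∈ f, T.Good X a ∧ T.rk X a < T.rk X (.app t f) := by
  obtain ⟨U, hU⟩ := h.arg
  intro a ha
  obtain ⟨k, hk⟩ := hU.sat.pos
  rw [hk] at hU ⊢
  obtain ⟨W, hW⟩ := hU.args a ha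
  exact ⟨hW.good, Nat.lt_succ_of_le hW.rk_le⟩

theorem Thy.Good.cs_pfx {X X' : PreCtx A} (hX : Derivable T.ax (.ctx X')) (hp : X <+: X')
    {u : Expr A} (h : T.Good X u) : T.cs X' u = T.cs X u := by
  cases u with
  | app t f => rfl
  | var x =>
    have hX0 := der_ctx_pfx hX hp
    obtain ⟨n, U, h⟩ := h
    obtain ⟨U, hU⟩ : ∃ U, (x, U) ∈ X := by
      have := ((h.der hX0).ok T.pre).occ x (.inl .var)
      obtain ⟨p, hp, rfl⟩ := List.mem_map.1 this
      exact ⟨p.2, hp⟩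
    rw [cs_var hX (hp.subset hU), cs_var hX0 hU]

/-- Canonical sorts of composite terms are stable under substitution. -/
theorem Thy.Good.cs_subst {X X' : PreCtx A} {t : A.TermSym} {f : List (Expr A)}
    (h : T.Good X (.app t f)) (φ : A.Var → Expr A) :
    T.cs X' (.app t (f.map (Expr.subst φ))) = (T.cs X (.app t f)).subst φ := by
  obtain ⟨n, U, h⟩ := h
  obtain ⟨k, rfl⟩ := h.sat.pos
  obtain ⟨Xa, V, h1, h2, h3, -⟩ := h.inv
  rw [cs_app h1, cs_app h1, SortE.subst_subst]
  exact SortE.subst_congr fun v hv => sb_map h2 φ ((h3.ok T.pre).occ v (.inr hv))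

theorem Thy.Good.occ {X : PreCtx A} (hX : Derivable T.ax (.ctx X)) {u : Expr A} (h : T.Good X u)
    {v : A.Var} (hv : Occurs v u) : v ∈ X.map Prod.fst := by
  obtain ⟨n, U, h⟩ := h
  exact ((h.der hX).ok T.pre).occ v (.inl hv)

theorem Thy.Good.of_der {X : PreCtx A} {u : Expr A} {U : SortE A}
    (h : Derivable T.ax (.term X u U)) : T.Good X u := by
  obtain ⟨n, h⟩ := h
  exact ⟨n, U, .inr ⟨X, List.prefix_rfl, h⟩⟩

theorem Thy.CtxAt.of_ctx {n : ℕ} {X : PreCtx A} (h : DerAt T.ax (n + 1) (.ctx X)) :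
    T.CtxAt n X := ⟨h.der, fun _ _ _ hp => h.ctx_entry hp⟩

theorem Thy.CtxAt.mono {n m : ℕ} {X : PreCtx A} (h : T.CtxAt n X) (hnm : n ≤ m) : T.CtxAt m X :=
  ⟨h.der, fun _ _ _ hp => (h.entry _ _ _ hp).mono hnm⟩

theorem Thy.CtxAt.of_sort {n : ℕ} {X : PreCtx A} {U : SortE A}
    (h : DerAt T.ax (n + 1) (.sort X U)) : T.CtxAt n X := by
  have := h.sort_ctx
  obtain ⟨k, rfl⟩ := this.pos
  exact (Thy.CtxAt.of_ctx this).mono (Nat.le_succ _)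

theorem Thy.CtxAt.pfx {n : ℕ} {X X0 : PreCtx A} (h : T.CtxAt n X) (hp : X0 <+: X) :
    T.CtxAt n X0 := ⟨der_ctx_pfx h.der hp, fun _ _ _ hq => h.entry _ _ _ (hq.trans hp)⟩

theorem Thy.CtxAt.snoc {n : ℕ} {X : PreCtx A} {x : A.Var} {U : SortE A} (h : T.CtxAt n X)
    (hU : DerAt T.ax n (.sort X U)) (hx : x ∉ X.map Prod.fst) : T.CtxAt n (X ++ [(x, U)]) := by
  refine ⟨der_ctx_snoc T.pre hU.der hx, fun X0 y V hp => ?_⟩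
  rcases List.prefix_concat_iff.1 hp with e | hp
  · obtain ⟨rfl, h2⟩ := List.append_inj' e rfl
    obtain ⟨rfl, rfl⟩ : y = x ∧ V = U := by simpa using h2
    exact hU
  · exact h.entry _ _ _ hp

theorem Thy.CtxAt.arg {n : ℕ} {X : PreCtx A} (h : T.CtxAt n X) {p : A.Var × SortE A}
    (hp : p ∈ X) : T.Arg n X (.var p.1) p.2 := by
  obtain ⟨X0, hX0⟩ := mem_split_pfx hp
  exact .inl ⟨p.1, X0, rfl, hX0, h.entry _ _ _ hX0⟩

theorem Thy.exists_ctxAt {X : PreCtx A} (h : Derivable T.ax (.ctx X)) : ∃ n, T.CtxAt n X := by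
  obtain ⟨n, h⟩ := h
  obtain ⟨k, rfl⟩ := h.pos
  exact ⟨k, .of_ctx h⟩

end Levels

section Grids

variable {α β γ δ α' β' γ' : Type}

/-- The list of values of `F` on `as × bs`, in row-major or column-major order. -/
def gr : Bool → List α → List β → (α → β → γ) → List γ
  | true, as, bs, F => as.flatMap fun a => bs.map (F a)
  | false, as, bs, F => bs.flatMap fun b => as.map fun a => F a b

/-- The grid on `(as ++ [a]) × (bs ++ [b])` with its last entry removed. -/
def grD : Bool → List α → α → List β → β → (α → β → γ) → List γ
  | true, as, a, bs, b, F => gr true as (bs ++ [b]) F ++ bs.map (F a)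
  | false, as, a, bs, b, F => gr false (as ++ [a]) bs F ++ as.map fun a => F a b

theorem gr_snoc (o : Bool) (as : List α) (a : α) (bs : List β) (b : β) (F : α → β → γ) :
    gr o (as ++ [a]) (bs ++ [b]) F = grD o as a bs b F ++ [F a b] := by
  cases o <;> simp [gr, grD]

theorem gr_swap (o : Bool) (as : List α) (bs : List β) (F : α → β → γ) :
    gr (!o) bs as (fun b a => F a b) = gr o as bs F := by
  cases o <;> rfl

theorem grD_swap (o : Bool) (as : List α) (a : α) (bs : List β) (b : β) (F : α → β → γ) :
    grD (!o) bs b as a (fun b a => F a b) = grD o as a bs b F := by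
  cases o <;> rfl

theorem map_gr (o : Bool) (as : List α) (bs : List β) (F : α → β → γ) (g : γ → δ) :
    (gr o as bs F).map g = gr o as bs fun a b => g (F a b) := by
  cases o <;> simp [gr, List.map_flatMap, Function.comp_def]

theorem map_grD (o : Bool) (as : List α) (a : α) (bs : List β) (b : β) (F : α → β → γ)
    (g : γ → δ) : (grD o as a bs b F).map g = grD o as a bs b fun a b => g (F a b) := by
  cases o <;> simp [grD, map_gr]

theorem gr_map (o : Bool) (as : List α') (bs : List β') (φ : α' → α) (ψ : β' → β)
    (F : α → β → γ) :
    gr o (as.map φ) (bs.map ψ) F = gr o as bs fun a b => F (φ a) (ψ b) := by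
  cases o <;> simp [gr, List.flatMap_map, Function.comp_def]

theorem grD_map (o : Bool) (as : List α') (a : α') (bs : List β') (b : β') (φ : α' → α)
    (ψ : β' → β) (F : α → β → γ) :
    grD o (as.map φ) (φ a) (bs.map ψ) (ψ b) F = grD o as a bs b fun a b => F (φ a) (ψ b) := by
  have h1 : bs.map ψ ++ [ψ b] = (bs ++ [b]).map ψ := by simp
  have h2 : as.map φ ++ [φ a] = (as ++ [a]).map φ := by simp
  cases o
  · rw [grD, h2, gr_map]
    simp [grD, Function.comp_def]
  · rw [grD, h1, gr_map]
    simp [grD, Function.comp_def]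

theorem mem_gr {o : Bool} {as : List α} {bs : List β} {F : α → β → γ} {c : γ} :
    c ∈ gr o as bs F ↔ ∃ a ∈ as, ∃ b ∈ bs, F a b = c := by
  cases o
  · simp only [gr, List.mem_flatMap, List.mem_map]
    grind
  · simp only [gr, List.mem_flatMap, List.mem_map]

theorem mem_grD {o : Bool} {as : List α} {a : α} {bs : List β} {b : β} {F : α → β → γ} {c : γ} :
    c ∈ grD o as a bs b F ↔ (∃ a' ∈ as ++ [a], ∃ b' ∈ bs, F a' b' = c) ∨
      ∃ a' ∈ as, ∃ b' ∈ bs ++ [b], F a' b' = c := by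
  cases o
  · simp only [grD, List.mem_append, mem_gr, List.mem_map, List.mem_singleton]
    grind
  · simp only [grD, List.mem_append, mem_gr, List.mem_map, List.mem_singleton]
    grind

theorem forall₂_flatMap {RA : α → α' → Prop} {R : γ → γ' → Prop} {as : List α} {as' : List α'}
    {F : α → List γ} {G : α' → List γ'} (ha : List.Forall₂ RA as as')
    (h : ∀ a a', RA a a' → List.Forall₂ R (F a) (G a')) :
    List.Forall₂ R (as.flatMap F) (as'.flatMap G) := by
  induction ha with
  | nil => exact .nil
  | cons h1 h2 ih =>
    simp only [List.flatMap_cons]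
    exact List.rel_append (h _ _ h1) ih

theorem forall₂_gr {RA : α → α' → Prop} {RB : β → β' → Prop} {R : γ → γ' → Prop}
    {as : List α} {as' : List α'} {bs : List β} {bs' : List β'} {F : α → β → γ}
    {G : α' → β' → γ'} (o : Bool) (ha : List.Forall₂ RA as as') (hb : List.Forall₂ RB bs bs')
    (h : ∀ a a' b b', RA a a' → RB b b' → R (F a b) (G a' b')) :
    List.Forall₂ R (gr o as bs F) (gr o as' bs' G) := by
  cases o
  · refine forall₂_flatMap hb fun b b' hbb => ?_
    rw [List.forall₂_map_left_iff, List.forall₂_map_right_iff]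
    exact ha.imp fun a a' haa => h _ _ _ _ haa hbb
  · refine forall₂_flatMap ha fun a a' haa => ?_
    rw [List.forall₂_map_left_iff, List.forall₂_map_right_iff]
    exact hb.imp fun b b' hbb => h _ _ _ _ haa hbb

theorem forall₂_mem {as : List α} : List.Forall₂ (fun a a' => a = a' ∧ a ∈ as) as as := by
  rw [List.forall₂_same]
  exact fun a ha => ⟨rfl, ha⟩

theorem forall₂_gr_same {R : γ → γ' → Prop} {as : List α} {bs : List β} {F : α → β → γ}
    {G : α → β → γ'} (o : Bool) (h : ∀ a ∈ as, ∀ b ∈ bs, R (F a b) (G a b)) :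
    List.Forall₂ R (gr o as bs F) (gr o as bs G) := by
  refine forall₂_gr o (forall₂_mem (as := as)) (forall₂_mem (as := bs)) ?_
  rintro a _ b _ ⟨rfl, ha⟩ ⟨rfl, hb⟩
  exact h a ha b hb

theorem forall₂_grD_same {R : γ → γ' → Prop} {as : List α} {a : α} {bs : List β} {b : β}
    {F : α → β → γ} {G : α → β → γ'} (o : Bool)
    (h1 : ∀ a' ∈ as ++ [a], ∀ b' ∈ bs, R (F a' b') (G a' b'))
    (h2 : ∀ a' ∈ as, ∀ b' ∈ bs ++ [b], R (F a' b') (G a' b')) :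
    List.Forall₂ R (grD o as a bs b F) (grD o as a bs b G) := by
  cases o
  · refine List.rel_append (forall₂_gr_same false h1) ?_
    rw [List.forall₂_map_left_iff, List.forall₂_map_right_iff, List.forall₂_same]
    exact fun a' ha' => h2 a' ha' b (by simp)
  · refine List.rel_append (forall₂_gr_same true h2) ?_
    rw [List.forall₂_map_left_iff, List.forall₂_map_right_iff, List.forall₂_same]
    exact fun b' hb' => h1 a (by simp) b' hb'

theorem gr_congr {o : Bool} {as : List α} {bs : List β} {F G : α → β → γ}
    (h : ∀ a ∈ as, ∀ b ∈ bs, F a b = G a b) : gr o as bs F = gr o as bs G := by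
  have := forall₂_gr_same (R := Eq) o h
  rwa [List.forall₂_eq_eq_eq] at this

theorem grD_congr {o : Bool} {as : List α} {a : α} {bs : List β} {b : β} {F G : α → β → γ}
    (h1 : ∀ a' ∈ as ++ [a], ∀ b' ∈ bs, F a' b' = G a' b')
    (h2 : ∀ a' ∈ as, ∀ b' ∈ bs ++ [b], F a' b' = G a' b') :
    grD o as a bs b F = grD o as a bs b G := by
  have := forall₂_grD_same (R := Eq) o h1 h2
  rwa [List.forall₂_eq_eq_eq] at this

end Grids

section Tensor

variable {A B C : Alphabet}

/-- The data defining the canonical tensor operations, symmetric in the two theories. -/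
structure Sys (A B C : Alphabet) where
  a : Thy A
  b : Thy B
  ax : Set (Judg C)
  v : A.Var → B.Var → C.Var
  v_inj : ∀ {x x' y y'}, v x y = v x' y' → x = x' ∧ y = y'
  sS : A.SortSym → B.SortSym → C.SortSym
  tL : A.SortSym → B.TermSym → C.TermSym
  tR : A.TermSym → B.SortSym → C.TermSym
  ord : Bool
  pref : Bool

namespace Sys

/-- Interchange of the two factors. -/
def swap (s : Sys A B C) : Sys B A C where
  a := s.b
  b := s.a
  ax := s.ax
  v y x := s.v x y
  v_inj h := (s.v_inj h).symm
  sS T S := s.sS S T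
  tL T t := s.tR t T
  tR t S := s.tL S t
  ord := !s.ord
  pref := !s.pref

theorem swap_swap (s : Sys A B C) : s.swap.swap = s := by
  cases s
  simp [swap]

variable (s : Sys A B C)

def L (F : Expr A → Expr B → Expr C) (U : SortE A) (u : Expr A) (t : B.TermSym)
    (g : List (Expr B)) : Expr C := .app (s.tL U.head t) (gr s.ord (U.args ++ [u]) g F)

def R (F : Expr A → Expr B → Expr C) (t : A.TermSym) (f : List (Expr A)) (V : SortE B)
    (v : Expr B) : Expr C := .app (s.tR t V.head) (gr s.ord f (V.args ++ [v]) F)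

def TT (F : Expr A → Expr B → Expr C) (U : SortE A) (u : Expr A) (V : SortE B) (v : Expr B) :
    SortE C := ⟨s.sS U.head V.head, grD s.ord U.args u V.args v F⟩

theorem R_eq (F : Expr A → Expr B → Expr C) (t : A.TermSym) (f : List (Expr A)) (V : SortE B)
    (v : Expr B) : s.R F t f V v = s.swap.L (fun b a => F a b) V v t f := by
  simp only [R, L, swap, gr_swap]

theorem L_eq (F : Expr A → Expr B → Expr C) (U : SortE A) (u : Expr A) (t : B.TermSym)
    (g : List (Expr B)) : s.L F U u t g = s.swap.R (fun b a => F a b) t g U u := by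
  simp only [R, L, swap, gr_swap]

theorem TT_swap (F : Expr A → Expr B → Expr C) (U : SortE A) (u : Expr A) (V : SortE B)
    (v : Expr B) : s.swap.TT (fun b a => F a b) V v U u = s.TT F U u V v := by
  simp only [TT, swap, grD_swap]

/-- The canonical tensor product of terms over the contexts `X` and `Y`. -/
noncomputable def ten (X : PreCtx A) (Y : PreCtx B) (u : Expr A) (v : Expr B) : Expr C :=
  let F : Expr A → Expr B → Expr C := fun a b =>
    if h : s.a.rk X a + s.b.rk Y b < s.a.rk X u + s.b.rk Y v then ten X Y a b
    else .var (s.v (s.a.ch []) (s.b.ch []))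
  match u, v with
  | .var x, .var y => .var (s.v x y)
  | .var x, .app t g => s.L F (s.a.cs X (.var x)) (.var x) t g
  | .app t f, .var y => s.R F t f (s.b.cs Y (.var y)) (.var y)
  | .app t f, .app t' g => if s.pref then s.L F (s.a.cs X (.app t f)) (.app t f) t' g
      else s.R F t f (s.b.cs Y (.app t' g)) (.app t' g)
termination_by s.a.rk X u + s.b.rk Y v

theorem ten_var_var (X : PreCtx A) (Y : PreCtx B) (x : A.Var) (y : B.Var) :
    s.ten X Y (.var x) (.var y) = .var (s.v x y) := by
  rw [ten]

variable {s} {X : PreCtx A} {Y : PreCtx B}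

theorem L_congr {F G : Expr A → Expr B → Expr C} {U : SortE A} {u : Expr A} {t : B.TermSym}
    {g : List (Expr B)} (h : ∀ a ∈ U.args ++ [u], ∀ b ∈ g, F a b = G a b) :
    s.L F U u t g = s.L G U u t g := by
  rw [L, L, gr_congr h]

theorem R_congr {F G : Expr A → Expr B → Expr C} {V : SortE B} {v : Expr B} {t : A.TermSym}
    {f : List (Expr A)} (h : ∀ a ∈ f, ∀ b ∈ V.args ++ [v], F a b = G a b) :
    s.R F t f V v = s.R G t f V v := by
  rw [R, R, gr_congr h]

theorem lt_left (hX : Derivable s.a.ax (.ctx X)) {u : Expr A} {t : B.TermSym} {g : List (Expr B)}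
    (hu : s.a.Good X u) (hv : s.b.Good Y (.app t g)) :
    ∀ a ∈ (s.a.cs X u).args ++ [u], ∀ b ∈ g, s.a.Good X a ∧ s.b.Good Y b ∧
      s.a.rk X a + s.b.rk Y b < s.a.rk X u + s.b.rk Y (.app t g) := by
  intro a ha b hb
  obtain ⟨h1, h2⟩ := hv.arg_lt b hb
  rcases List.mem_append.1 ha with ha | ha
  · obtain ⟨h3, h4⟩ := hu.cs_lt hX a ha
    exact ⟨h3, h1, by omega⟩
  · obtain rfl := List.mem_singleton.1 ha
    exact ⟨hu, h1, by omega⟩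

theorem lt_right (hY : Derivable s.b.ax (.ctx Y)) {v : Expr B} {t : A.TermSym} {f : List (Expr A)}
    (hu : s.a.Good X (.app t f)) (hv : s.b.Good Y v) :
    ∀ a ∈ f, ∀ b ∈ (s.b.cs Y v).args ++ [v], s.a.Good X a ∧ s.b.Good Y b ∧
      s.a.rk X a + s.b.rk Y b < s.a.rk X (.app t f) + s.b.rk Y v := by
  intro a ha b hb
  obtain ⟨h1, h2, h3⟩ := lt_left (s := s.swap) hY hv hu b hb a ha
  exact ⟨h2, h1, by simp only [swap] at h3; omega⟩

theorem ten_left (hX : Derivable s.a.ax (.ctx X)) {u : Expr A} {t : B.TermSym}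
    {g : List (Expr B)} (hu : s.a.Good X u) (hv : s.b.Good Y (.app t g))
    (h : (∃ x, u = .var x) ∨ s.pref = true) :
    s.ten X Y u (.app t g) = s.L (s.ten X Y) (s.a.cs X u) u t g := by
  have key := lt_left (s := s) hX hu hv
  cases u with
  | var x =>
    rw [ten]
    exact L_congr fun a ha b hb => dif_pos (key a ha b hb).2.2
  | app t' f =>
    have hp : s.pref = true := h.resolve_left (by simp)
    rw [ten]
    simp only [hp, if_true]
    exact L_congr fun a ha b hb => dif_pos (key a ha b hb).2.2

theorem ten_right (hY : Derivable s.b.ax (.ctx Y)) {v : Expr B} {t : A.TermSym}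
    {f : List (Expr A)} (hu : s.a.Good X (.app t f)) (hv : s.b.Good Y v)
    (h : (∃ y, v = .var y) ∨ s.pref = false) :
    s.ten X Y (.app t f) v = s.R (s.ten X Y) t f (s.b.cs Y v) v := by
  have key := lt_right (s := s) hY hu hv
  cases v with
  | var x =>
    rw [ten]
    exact R_congr fun a ha b hb => dif_pos (key a ha b hb).2.2
  | app t' g =>
    have hp : s.pref = false := h.resolve_left (by simp)
    rw [ten]
    simp only [hp, if_false, Bool.false_eq_true]
    exact R_congr fun a ha b hb => dif_pos (key a ha b hb).2.2

theorem ten_swap (X : PreCtx A) (Y : PreCtx B) (u : Expr A) (v : Expr B) :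
    s.swap.ten Y X v u = s.ten X Y u v := by
  induction hN : s.a.rk X u + s.b.rk Y v using Nat.strong_induction_on generalizing u v with
  | _ N ih =>
    subst hN
    have key : (fun (b : Expr B) (a : Expr A) =>
        if h : s.swap.a.rk Y b + s.swap.b.rk X a < s.swap.a.rk Y v + s.swap.b.rk X u then
          s.swap.ten Y X b a else .var (s.swap.v (s.swap.a.ch []) (s.swap.b.ch []))) =
        fun b a => (fun a b => if h : s.a.rk X a + s.b.rk Y b < s.a.rk X u + s.b.rk Y v then
          s.ten X Y a b else .var (s.v (s.a.ch []) (s.b.ch []))) a b := by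
      funext b a
      by_cases h : s.a.rk X a + s.b.rk Y b < s.a.rk X u + s.b.rk Y v
      · beta_reduce
        rw [dif_pos (show s.swap.a.rk Y b + s.swap.b.rk X a < s.swap.a.rk Y v + s.swap.b.rk X u by
          simp only [swap]; omega), dif_pos h, ih _ h _ _ rfl]
      · beta_reduce
        rw [dif_neg (show ¬ s.swap.a.rk Y b + s.swap.b.rk X a < s.swap.a.rk Y v + s.swap.b.rk X u by
          simp only [swap]; omega), dif_neg h]
        rfl
    rw [ten.eq_def, ten.eq_def, key]
    cases u with
    | var x =>
      cases v with
      | var y => rfl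
      | app t g => simp only [L_eq]; rfl
    | app t f =>
      cases v with
      | var y => simp only [R_eq]; rfl
      | app t' g =>
        rcases hp : s.pref with _ | _
        · have : s.swap.pref = true := by simp [swap, hp]
          simp only [this, if_true, R_eq, Bool.false_eq_true, if_false]
          rfl
        · have : s.swap.pref = false := by simp [swap, hp]
          simp only [this, if_true, L_eq, Bool.false_eq_true, if_false]
          rfl

theorem ten_swap' (X : PreCtx A) (Y : PreCtx B) :
    s.swap.ten Y X = fun v u => s.ten X Y u v := by
  funext v u
  exact ten_swap X Y u v

/-- The sort of a pair of context entries. -/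
noncomputable def E (s : Sys A B C) (X : PreCtx A) (Y : PreCtx B) (p : A.Var × SortE A)
    (q : B.Var × SortE B) : SortE C := s.TT (s.ten X Y) p.2 (.var p.1) q.2 (.var q.1)

/-- The canonical tensor product of contexts. -/
noncomputable def tctx (s : Sys A B C) (X : PreCtx A) (Y : PreCtx B) : PreCtx C :=
  gr s.ord X Y fun p q => (s.v p.1 q.1, s.E X Y p q)

/-- The tensor product of two extended contexts, without the last entry. -/
noncomputable def tctxD (s : Sys A B C) (X : PreCtx A) (p : A.Var × SortE A) (Y : PreCtx B)
    (q : B.Var × SortE B) : PreCtx C :=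
  grD s.ord X p Y q fun p' q' => (s.v p'.1 q'.1, s.E (X ++ [p]) (Y ++ [q]) p' q')

theorem E_swap (X : PreCtx A) (Y : PreCtx B) (p : A.Var × SortE A) (q : B.Var × SortE B) :
    s.swap.E Y X q p = s.E X Y p q := by
  rw [E, E, ten_swap', TT_swap]

theorem tctx_swap (X : PreCtx A) (Y : PreCtx B) : s.swap.tctx Y X = s.tctx X Y := by
  unfold tctx
  simp only [E_swap]
  exact gr_swap s.ord X Y fun p q => (s.v p.1 q.1, s.E X Y p q)

theorem tctxD_swap (X : PreCtx A) (p : A.Var × SortE A) (Y : PreCtx B) (q : B.Var × SortE B) :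
    s.swap.tctxD Y q X p = s.tctxD X p Y q := by
  unfold tctxD
  simp only [E_swap]
  exact grD_swap s.ord X p Y q fun p' q' => (s.v p'.1 q'.1, s.E (X ++ [p]) (Y ++ [q]) p' q')

theorem TT_congr {F G : Expr A → Expr B → Expr C} {U : SortE A} {u : Expr A} {V : SortE B}
    {v : Expr B} (h1 : ∀ a ∈ U.args ++ [u], ∀ b ∈ V.args, F a b = G a b)
    (h2 : ∀ a ∈ U.args, ∀ b ∈ V.args ++ [v], F a b = G a b) :
    s.TT F U u V v = s.TT G U u V v := by
  rw [TT, TT, grD_congr h1 h2]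

/-- The tensor product of terms does not depend on the ambient context. -/
theorem ten_pfx {X' : PreCtx A} {Y' : PreCtx B} (hX : Derivable s.a.ax (.ctx X'))
    (hY : Derivable s.b.ax (.ctx Y')) (hpX : X <+: X') (hpY : Y <+: Y') {u : Expr A} {v : Expr B}
    (hu : s.a.Good X u) (hv : s.b.Good Y v) : s.ten X' Y' u v = s.ten X Y u v := by
  have hX0 := der_ctx_pfx hX hpX
  have hY0 := der_ctx_pfx hY hpY
  induction hN : s.a.rk X u + s.b.rk Y v using Nat.strong_induction_on generalizing u v with
  | _ N ih =>
    subst hN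
    have left : ∀ {t g}, v = .app t g → ((∃ x, u = .var x) ∨ s.pref = true) →
        s.ten X' Y' u v = s.ten X Y u v := by
      rintro t g rfl h
      rw [ten_left hX (hu.pfx hpX) (hv.pfx hpY) h, ten_left hX0 hu hv h,
        hu.cs_pfx hX hpX]
      refine L_congr fun a ha b hb => ?_
      obtain ⟨h1, h2, h3⟩ := lt_left hX0 hu hv a ha b hb
      exact ih _ h3 h1 h2 rfl
    have right : ∀ {t f}, u = .app t f → ((∃ y, v = .var y) ∨ s.pref = false) →
        s.ten X' Y' u v = s.ten X Y u v := by
      rintro t f rfl h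
      rw [ten_right hY (hu.pfx hpX) (hv.pfx hpY) h, ten_right hY0 hu hv h,
        hv.cs_pfx hY hpY]
      refine R_congr fun a ha b hb => ?_
      obtain ⟨h1, h2, h3⟩ := lt_right hY0 hu hv a ha b hb
      exact ih _ h3 h1 h2 rfl
    cases u with
    | var x =>
      cases v with
      | var y => rw [ten_var_var, ten_var_var]
      | app t g => exact left rfl (.inl ⟨x, rfl⟩)
    | app t f =>
      cases v with
      | var y => exact right rfl (.inl ⟨y, rfl⟩)
      | app t g =>
        rcases hp : s.pref with _ | _
        · exact right rfl (.inr hp)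
        · exact left rfl (.inr hp)

theorem TT_pfx {X' : PreCtx A} {Y' : PreCtx B} (hX : Derivable s.a.ax (.ctx X'))
    (hY : Derivable s.b.ax (.ctx Y')) (hpX : X <+: X') (hpY : Y <+: Y') {U : SortE A} {u : Expr A}
    {V : SortE B} {v : Expr B} (hU : ∀ a ∈ U.args ++ [u], s.a.Good X a)
    (hV : ∀ b ∈ V.args ++ [v], s.b.Good Y b) :
    s.TT (s.ten X' Y') U u V v = s.TT (s.ten X Y) U u V v :=
  TT_congr (fun a ha b hb => ten_pfx hX hY hpX hpY (hU a ha) (hV b (List.mem_append_left _ hb)))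
    fun a ha b hb => ten_pfx hX hY hpX hpY (hU a (List.mem_append_left _ ha)) (hV b hb)

end Sys

theorem Thy.Arg.all_good {T : Thy A} {n : ℕ} {X : PreCtx A} {u : Expr A} {U : SortE A}
    (h : T.Arg n X u U) : ∀ a ∈ U.args ++ [u], T.Good X a := by
  intro a ha
  rcases List.mem_append.1 ha with ha | ha
  · obtain ⟨k, rfl⟩ := h.sat.pos
    obtain ⟨W, hW⟩ := h.sat.args a ha
    exact hW.good
  · obtain rfl := List.mem_singleton.1 ha
    exact h.good

/-- Arguments and the arguments of their sorts. -/
theorem Thy.Arg.all_arg {T : Thy A} {n : ℕ} {X : PreCtx A} {u : Expr A} {U : SortE A}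
    (h : T.Arg n X u U) : ∀ a ∈ U.args ++ [u], ∃ W, T.Arg n X a W := by
  intro a ha
  rcases List.mem_append.1 ha with ha | ha
  · obtain ⟨k, rfl⟩ := h.sat.pos
    obtain ⟨W, hW⟩ := h.sat.args a ha
    exact ⟨W, hW.mono (Nat.le_succ _)⟩
  · obtain rfl := List.mem_singleton.1 ha
    exact ⟨U, h⟩

theorem Thy.var_arg {T : Thy A} {X : PreCtx A} (h : Derivable T.ax (.ctx X))
    {p : A.Var × SortE A} (hp : p ∈ X) : ∃ n, T.Arg n X (.var p.1) p.2 := by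
  obtain ⟨n, hn⟩ := T.exists_ctxAt h
  exact ⟨n, hn.arg hp⟩

namespace Sys

variable {s : Sys A B C} {X : PreCtx A} {Y : PreCtx B}

theorem E_pfx {X' : PreCtx A} {Y' : PreCtx B} (hX : Derivable s.a.ax (.ctx X'))
    (hY : Derivable s.b.ax (.ctx Y')) (hpX : X <+: X') (hpY : Y <+: Y') {p : A.Var × SortE A}
    {q : B.Var × SortE B} (hp : p ∈ X) (hq : q ∈ Y) : s.E X' Y' p q = s.E X Y p q := by
  obtain ⟨n, h1⟩ := Thy.var_arg (der_ctx_pfx hX hpX) hp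
  obtain ⟨m, h2⟩ := Thy.var_arg (der_ctx_pfx hY hpY) hq
  exact TT_pfx hX hY hpX hpY h1.all_good h2.all_good

end Sys

end Tensor

section Ambient

variable {A B C : Alphabet}

namespace Sys

variable {s : Sys A B C} {X X' : PreCtx A} {Y Y' : PreCtx B} {Δ : PreCtx C} {n m : ℕ}

/-- The tensor products of arguments at levels `n`, `m` over `X`, `Y` are derivable over `Δ`. -/
structure Amb (s : Sys A B C) (n m : ℕ) (X : PreCtx A) (Y : PreCtx B) (Δ : PreCtx C) : Prop where
  ctxa : Derivable s.a.ax (.ctx X)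
  ctxb : Derivable s.b.ax (.ctx Y)
  ctx : Derivable s.ax (.ctx Δ)
  typ : ∀ {u U v V}, s.a.Arg n X u U → s.b.Arg m Y v V →
    Derivable s.ax (.term Δ (s.ten X Y u v) (s.TT (s.ten X Y) U u V v))
  left : ∀ {u U t g V}, s.a.Arg n X u U → s.b.Arg m Y (.app t g) V →
    TEq s.ax Δ (s.ten X Y u (.app t g)) (s.L (s.ten X Y) U u t g)
  right : ∀ {t f U v V}, s.a.Arg n X (.app t f) U → s.b.Arg m Y v V →
    TEq s.ax Δ (s.ten X Y (.app t f) v) (s.R (s.ten X Y) t f V v)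

theorem Amb.swap (h : s.Amb n m X Y Δ) : s.swap.Amb m n Y X Δ where
  ctxa := h.ctxb
  ctxb := h.ctxa
  ctx := h.ctx
  typ h1 h2 := by
    rw [ten_swap', TT_swap]
    exact h.typ h2 h1
  left {u U t g V} h1 h2 := by
    rw [ten_swap', ← R_eq]
    exact h.right h2 h1
  right {t f U v V} h1 h2 := by
    rw [ten_swap', ← L_eq]
    exact h.left h2 h1

theorem subst_L (F : Expr A → Expr B → Expr C) (U : SortE A) (u : Expr A) (t : B.TermSym)
    (g : List (Expr B)) (σ : C.Var → Expr C) :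
    (s.L F U u t g).subst σ = s.L (fun a b => (F a b).subst σ) U u t g := by
  rw [L, L, Expr.subst_app, map_gr]

theorem subst_R (F : Expr A → Expr B → Expr C) (t : A.TermSym) (f : List (Expr A)) (V : SortE B)
    (v : Expr B) (σ : C.Var → Expr C) :
    (s.R F t f V v).subst σ = s.R (fun a b => (F a b).subst σ) t f V v := by
  rw [R, R, Expr.subst_app, map_gr]

theorem subst_TT (F : Expr A → Expr B → Expr C) (U : SortE A) (u : Expr A) (V : SortE B)
    (v : Expr B) (σ : C.Var → Expr C) :
    (s.TT F U u V v).subst σ = s.TT (fun a b => (F a b).subst σ) U u V v := by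
  rw [TT, TT, SortE.subst_mk, map_grD]

theorem L_map (F : Expr A → Expr B → Expr C) (U : SortE A) (u : Expr A) (t : B.TermSym)
    (g : List (Expr B)) (φ : A.Var → Expr A) (ψ : B.Var → Expr B) :
    s.L F (U.subst φ) (u.subst φ) t (g.map (Expr.subst ψ)) =
      s.L (fun a b => F (a.subst φ) (b.subst ψ)) U u t g := by
  rw [L, L, ← gr_map s.ord (U.args ++ [u]) g (Expr.subst φ) (Expr.subst ψ) F]
  simp [SortE.subst]

theorem TT_map (F : Expr A → Expr B → Expr C) (U : SortE A) (u : Expr A) (V : SortE B)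
    (v : Expr B) (φ : A.Var → Expr A) (ψ : B.Var → Expr B) :
    s.TT F (U.subst φ) (u.subst φ) (V.subst ψ) (v.subst ψ) =
      s.TT (fun a b => F (a.subst φ) (b.subst ψ)) U u V v := by
  rw [TT, TT, ← grD_map s.ord U.args u V.args v (Expr.subst φ) (Expr.subst ψ) F]
  simp [SortE.subst]

theorem L_teq (hP : Pre s.ax) {F G : Expr A → Expr B → Expr C} {U : SortE A} {u : Expr A}
    {t : B.TermSym} {g : List (Expr B)} {W : SortE C}
    (hd : Derivable s.ax (.term Δ (s.L G U u t g) W))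
    (h : ∀ a ∈ U.args ++ [u], ∀ b ∈ g, TEq s.ax Δ (F a b) (G a b)) :
    TEq s.ax Δ (s.L F U u t g) (s.L G U u t g) :=
  (cong_app hP hd (forall₂_gr_same _ fun a ha b hb => (h a ha b hb).symm)).symm

theorem TT_seq (hP : Pre s.ax) {F G : Expr A → Expr B → Expr C} {U : SortE A} {u : Expr A}
    {V : SortE B} {v : Expr B} (hd : Derivable s.ax (.sort Δ (s.TT G U u V v)))
    (h1 : ∀ a ∈ U.args ++ [u], ∀ b ∈ V.args, TEq s.ax Δ (F a b) (G a b))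
    (h2 : ∀ a ∈ U.args, ∀ b ∈ V.args ++ [v], TEq s.ax Δ (F a b) (G a b)) :
    Derivable s.ax (.sortEq Δ (s.TT F U u V v) (s.TT G U u V v)) :=
  (cong_sort hP hd (forall₂_grD_same _ (fun a ha b hb => (h1 a ha b hb).symm)
    fun a ha b hb => (h2 a ha b hb).symm)).ssymm

theorem Amb.sub_left (hP : Pre s.ax) (h : s.Amb n m X' Y' Δ) {F : Expr A → Expr B → Expr C}
    {W : SortE A} {u : Expr A} {t : B.TermSym} {g : List (Expr B)} {V : SortE B}
    {φ : A.Var → Expr A} {ψ : B.Var → Expr B} {τ : C.Var → Expr C}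
    (hu : s.a.Arg n X' (u.subst φ) (W.subst φ)) (hv : s.b.Arg m Y' ((Expr.app t g).subst ψ) V)
    (hF : ∀ a ∈ W.args ++ [u], ∀ b ∈ g,
      TEq s.ax Δ ((F a b).subst τ) (s.ten X' Y' (a.subst φ) (b.subst ψ))) :
    TEq s.ax Δ ((s.L F W u t g).subst τ) (s.ten X' Y' (u.subst φ) ((Expr.app t g).subst ψ)) := by
  rw [Expr.subst_app] at hv ⊢
  have h1 := h.left hu hv
  obtain ⟨Q, hQ⟩ := id h1
  have h2 := hQ.teq_right
  rw [L_map] at h2 h1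
  rw [subst_L]
  exact (L_teq hP h2 hF).trans hP h1.symm

theorem TT_sub (hP : Pre s.ax) {F G : Expr A → Expr B → Expr C} {U : SortE A} {u : Expr A}
    {V : SortE B} {v : Expr B} {φ : A.Var → Expr A} {ψ : B.Var → Expr B} {τ : C.Var → Expr C}
    (hd : Derivable s.ax (.sort Δ (s.TT G (U.subst φ) (u.subst φ) (V.subst ψ) (v.subst ψ))))
    (h1 : ∀ a ∈ U.args ++ [u], ∀ b ∈ V.args,
      TEq s.ax Δ ((F a b).subst τ) (G (a.subst φ) (b.subst ψ)))
    (h2 : ∀ a ∈ U.args, ∀ b ∈ V.args ++ [v],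
      TEq s.ax Δ ((F a b).subst τ) (G (a.subst φ) (b.subst ψ))) :
    Derivable s.ax (.sortEq Δ ((s.TT F U u V v).subst τ)
      (s.TT G (U.subst φ) (u.subst φ) (V.subst ψ) (v.subst ψ))) := by
  rw [TT_map] at hd ⊢
  rw [subst_TT]
  exact TT_seq hP hd h1 h2

theorem dsl_left (hP : Pre s.ax) (h : s.Amb n m X' Y' Δ) (hX : Derivable s.a.ax (.ctx X))
    {φ : A.Var → Expr A} {ψ : B.Var → Expr B} {τ : C.Var → Expr C}
    (hφ : ∀ p ∈ X, s.a.Arg n X' (φ p.1) (p.2.subst φ)) {u : Expr A} {t : B.TermSym}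
    {g : List (Expr B)} (hu : s.a.Good X u) (hv : s.b.Good Y (.app t g))
    (hu' : ∃ U, s.a.Arg n X' (u.subst φ) U) (hv' : ∃ V, s.b.Arg m Y' ((Expr.app t g).subst ψ) V)
    (hc : (∃ x, u = .var x) ∨ s.pref = true)
    (ih : ∀ a b, s.a.Good X a → s.b.Good Y b → (∃ U, s.a.Arg n X' (a.subst φ) U) →
      (∃ V, s.b.Arg m Y' (b.subst ψ) V) →
      s.a.rk X a + s.b.rk Y b < s.a.rk X u + s.b.rk Y (.app t g) →
      TEq s.ax Δ ((s.ten X Y a b).subst τ) (s.ten X' Y' (a.subst φ) (b.subst ψ))) :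
    TEq s.ax Δ ((s.ten X Y u (.app t g)).subst τ)
      (s.ten X' Y' (u.subst φ) ((Expr.app t g).subst ψ)) := by
  have hW : s.a.Arg n X' (u.subst φ) ((s.a.cs X u).subst φ) := by
    cases u with
    | var x =>
      obtain ⟨p, hp, rfl⟩ := List.mem_map.1 (hu.occ hX (v := x) .var)
      rw [Thy.cs_var hX hp]
      simpa using hφ p hp
    | app t f =>
      obtain ⟨U, hU⟩ := hu'
      rw [← hu.cs_subst (X' := X') φ, ← Expr.subst_app]
      exact hU.cs_arg h.ctxa
  rw [ten_left hX hu hv hc]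
  obtain ⟨V, hV⟩ := hv'
  refine h.sub_left hP hW hV fun a ha b hb => ?_
  obtain ⟨h1, h2, h3⟩ := lt_left hX hu hv a ha b hb
  refine ih a b h1 h2 ?_ ?_ h3
  · apply hW.all_arg
    rcases List.mem_append.1 ha with ha | ha
    · exact List.mem_append_left _ (List.mem_map_of_mem ha)
    · simp [List.mem_singleton.1 ha]
  · rw [Expr.subst_app] at hV
    obtain ⟨k, rfl⟩ := hV.sat.pos
    obtain ⟨W, hW⟩ := hV.args (b.subst ψ) (List.mem_map_of_mem hb)
    exact ⟨W, hW.mono (Nat.le_succ _)⟩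

/-- Compatibility of the tensor product with substitution. -/
theorem dsl (hP : Pre s.ax) (h : s.Amb n m X' Y' Δ) (hX : Derivable s.a.ax (.ctx X))
    (hY : Derivable s.b.ax (.ctx Y)) {φ : A.Var → Expr A} {ψ : B.Var → Expr B}
    {τ : C.Var → Expr C} (hφ : ∀ p ∈ X, s.a.Arg n X' (φ p.1) (p.2.subst φ))
    (hψ : ∀ q ∈ Y, s.b.Arg m Y' (ψ q.1) (q.2.subst ψ))
    (hτ : ∀ p ∈ X, ∀ q ∈ Y, τ (s.v p.1 q.1) = s.ten X' Y' (φ p.1) (ψ q.1)) {u : Expr A}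
    {v : Expr B} (hu : s.a.Good X u) (hv : s.b.Good Y v) (hu' : ∃ U, s.a.Arg n X' (u.subst φ) U)
    (hv' : ∃ V, s.b.Arg m Y' (v.subst ψ) V) :
    TEq s.ax Δ ((s.ten X Y u v).subst τ) (s.ten X' Y' (u.subst φ) (v.subst ψ)) := by
  induction hN : s.a.rk X u + s.b.rk Y v using Nat.strong_induction_on generalizing u v with
  | _ N ih =>
    subst hN
    have left : ∀ {t g}, v = .app t g → ((∃ x, u = .var x) ∨ s.pref = true) →
        TEq s.ax Δ ((s.ten X Y u v).subst τ) (s.ten X' Y' (u.subst φ) (v.subst ψ)) := by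
      rintro t g rfl hc
      exact dsl_left hP h hX hφ hu hv hu' hv' hc fun a b h1 h2 h3 h4 h5 => ih _ h5 h1 h2 h3 h4 rfl
    have right : ∀ {t f}, u = .app t f → ((∃ y, v = .var y) ∨ s.pref = false) →
        TEq s.ax Δ ((s.ten X Y u v).subst τ) (s.ten X' Y' (u.subst φ) (v.subst ψ)) := by
      rintro t f rfl hc
      have := dsl_left (s := s.swap) (X := Y) (Y := X) (τ := τ) hP h.swap hY hψ hv hu hv' hu'
        (hc.imp id fun e => by simp [swap, e]) fun a b h1 h2 h3 h4 h5 => by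
          rw [ten_swap, ten_swap]
          exact ih _ (by simp only [swap] at h5; omega) h2 h1 h4 h3 rfl
      rwa [ten_swap, ten_swap] at this
    cases u with
    | var x =>
      cases v with
      | var y =>
        obtain ⟨p, hp, rfl⟩ := List.mem_map.1 (hu.occ hX (v := x) .var)
        obtain ⟨q, hq, rfl⟩ := List.mem_map.1 (hv.occ hY (v := y) .var)
        rw [ten_var_var, Expr.subst_var, Expr.subst_var, Expr.subst_var, hτ p hp q hq]
        exact (h.typ (hφ p hp) (hψ q hq)).teq_refl
      | app t g => exact left rfl (.inl ⟨x, rfl⟩)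
    | app t f =>
      cases v with
      | var y => exact right rfl (.inl ⟨y, rfl⟩)
      | app t g =>
        rcases hp : s.pref with _ | _
        · exact right rfl (.inr hp)
        · exact left rfl (.inr hp)

theorem mem_tctx {r : C.Var × SortE C} :
    r ∈ s.tctx X Y ↔ ∃ p ∈ X, ∃ q ∈ Y, (s.v p.1 q.1, s.E X Y p q) = r := mem_gr

theorem all_arg_subst {T : Thy A} {U : SortE A} {u : Expr A} {φ : A.Var → Expr A}
    (h : T.Arg n X' (u.subst φ) (U.subst φ)) :
    ∀ a ∈ U.args ++ [u], ∃ W, T.Arg n X' (a.subst φ) W := by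
  intro a ha
  apply h.all_arg
  rcases List.mem_append.1 ha with ha | ha
  · exact List.mem_append_left _ (List.mem_map_of_mem ha)
  · simp [List.mem_singleton.1 ha]

/-- Tensor products of tuples of terms are well-typed. -/
theorem tuple (hP : Pre s.ax) (h : s.Amb n m X' Y' Δ) (hX : Derivable s.a.ax (.ctx X))
    (hY : Derivable s.b.ax (.ctx Y)) {φ : A.Var → Expr A} {ψ : B.Var → Expr B}
    {τ : C.Var → Expr C} (hφ : ∀ p ∈ X, s.a.Arg n X' (φ p.1) (p.2.subst φ))
    (hψ : ∀ q ∈ Y, s.b.Arg m Y' (ψ q.1) (q.2.subst ψ))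
    (hτ : ∀ p ∈ X, ∀ q ∈ Y, τ (s.v p.1 q.1) = s.ten X' Y' (φ p.1) (ψ q.1)) :
    Typed s.ax τ (s.tctx X Y) Δ := by
  intro r hr
  obtain ⟨p, hp, q, hq, rfl⟩ := mem_tctx.1 hr
  have h1 := h.typ (hφ p hp) (hψ q hq)
  rw [hτ p hp q hq]
  refine h1.conv (Derivable.ssymm ?_)
  obtain ⟨k, hk⟩ := Thy.var_arg hX hp
  obtain ⟨l, hl⟩ := Thy.var_arg hY hq
  have key : ∀ a ∈ p.2.args ++ [.var p.1], ∀ b ∈ q.2.args ++ [.var q.1],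
      TEq s.ax Δ ((s.ten X Y a b).subst τ) (s.ten X' Y' (a.subst φ) (b.subst ψ)) :=
    fun a ha b hb => dsl hP h hX hY hφ hψ hτ (hk.all_good a ha) (hl.all_good b hb)
      (all_arg_subst (by simpa using hφ p hp) a ha) (all_arg_subst (by simpa using hψ q hq) b hb)
  have := TT_sub (s := s) (τ := τ) (φ := φ) (ψ := ψ) (F := s.ten X Y) (U := p.2) (u := .var p.1)
    (V := q.2) (v := .var q.1) hP (by simpa using h1.term_sort)
    (fun a ha b hb => key a ha b (List.mem_append_left _ hb))
    fun a ha b hb => key a (List.mem_append_left _ ha) b hb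
  simp only [Expr.subst_var] at this
  exact this

theorem mem_tctxD {p : A.Var × SortE A} {q : B.Var × SortE B}
    (hX : Derivable s.a.ax (.ctx (X ++ [p]))) (hY : Derivable s.b.ax (.ctx (Y ++ [q])))
    {r : C.Var × SortE C} :
    r ∈ s.tctxD X p Y q ↔ r ∈ s.tctx (X ++ [p]) Y ∨ r ∈ s.tctx X (Y ++ [q]) := by
  rw [tctxD, mem_grD, mem_tctx, mem_tctx]
  constructor
  · rintro (⟨a, ha, b, hb, rfl⟩ | ⟨a, ha, b, hb, rfl⟩)
    · exact .inl ⟨a, ha, b, hb, by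
        rw [E_pfx hX hY List.prefix_rfl (List.prefix_append _ _) ha hb]⟩
    · exact .inr ⟨a, ha, b, hb, by
        rw [E_pfx hX hY (List.prefix_append _ _) List.prefix_rfl ha hb]⟩
  · rintro (⟨a, ha, b, hb, rfl⟩ | ⟨a, ha, b, hb, rfl⟩)
    · exact .inl ⟨a, ha, b, hb, by
        rw [E_pfx hX hY List.prefix_rfl (List.prefix_append _ _) ha hb]⟩
    · exact .inr ⟨a, ha, b, hb, by
        rw [E_pfx hX hY (List.prefix_append _ _) List.prefix_rfl ha hb]⟩

theorem typed_tctxD {τ : C.Var → Expr C} {p : A.Var × SortE A} {q : B.Var × SortE B}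
    (hX : Derivable s.a.ax (.ctx (X ++ [p]))) (hY : Derivable s.b.ax (.ctx (Y ++ [q]))) :
    Typed s.ax τ (s.tctxD X p Y q) Δ ↔
      Typed s.ax τ (s.tctx (X ++ [p]) Y) Δ ∧ Typed s.ax τ (s.tctx X (Y ++ [q])) Δ := by
  constructor
  · exact fun h => ⟨fun r hr => h r ((mem_tctxD hX hY).2 (.inl hr)),
      fun r hr => h r ((mem_tctxD hX hY).2 (.inr hr))⟩
  · exact fun h r hr => ((mem_tctxD hX hY).1 hr).elim (h.1 r) (h.2 r)

/-- The variables of `X ⊗ Y` have the expected sorts over `Δ`. -/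
def Has (s : Sys A B C) (X : PreCtx A) (Y : PreCtx B) (Δ : PreCtx C) : Prop :=
  ∀ p ∈ X, ∀ q ∈ Y, Derivable s.ax (.term Δ (.var (s.v p.1 q.1)) (s.E X Y p q))

theorem has_iff : s.Has X Y Δ ↔ Typed s.ax Expr.var (s.tctx X Y) Δ := by
  rw [typed_id_iff]
  constructor
  · intro h r hr
    obtain ⟨p, hp, q, hq, rfl⟩ := mem_tctx.1 hr
    exact h p hp q hq
  · exact fun h p hp q hq => h _ (mem_tctx.2 ⟨p, hp, q, hq, rfl⟩)

theorem has_swap : s.swap.Has Y X Δ ↔ s.Has X Y Δ := by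
  constructor
  · intro h p hp q hq
    have := h q hq p hp
    rwa [E_swap] at this
  · intro h q hq p hp
    rw [E_swap]
    exact h p hp q hq

theorem Has.pfx (h : s.Has X' Y' Δ) (hX : Derivable s.a.ax (.ctx X'))
    (hY : Derivable s.b.ax (.ctx Y')) (hpX : X <+: X') (hpY : Y <+: Y') : s.Has X Y Δ := by
  intro p hp q hq
  rw [← E_pfx hX hY hpX hpY hp hq]
  exact h p (hpX.subset hp) q (hpY.subset hq)

theorem has_tctx (hP : Pre s.ax) (h : Derivable s.ax (.ctx (s.tctx X Y))) :
    s.Has X Y (s.tctx X Y) :=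
  fun p hp q hq => der_vars hP h (mem_tctx.2 ⟨p, hp, q, hq, rfl⟩)

theorem has_tctxD (hP : Pre s.ax) {p : A.Var × SortE A} {q : B.Var × SortE B}
    (hX : Derivable s.a.ax (.ctx (X ++ [p]))) (hY : Derivable s.b.ax (.ctx (Y ++ [q])))
    (h : Derivable s.ax (.ctx (s.tctxD X p Y q))) :
    s.Has (X ++ [p]) Y (s.tctxD X p Y q) ∧ s.Has X (Y ++ [q]) (s.tctxD X p Y q) := by
  rw [has_iff, has_iff, ← typed_tctxD hX hY]
  exact typed_id hP h List.prefix_rfl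

end Sys
end Ambient

section Update

variable {A : Alphabet} {T : Thy A}

open Classical in
/-- Modify a substitution at one variable. -/
noncomputable def upd (φ : A.Var → Expr A) (x : A.Var) (u : Expr A) : A.Var → Expr A :=
  fun a => if a = x then u else φ a

theorem upd_self (φ : A.Var → Expr A) (x : A.Var) (u : Expr A) : upd φ x u x = u := if_pos rfl

theorem upd_mem {X : PreCtx A} {x : A.Var} (hx : x ∉ X.map Prod.fst) (φ : A.Var → Expr A)
    (u : Expr A) {p : A.Var × SortE A} (hp : p ∈ X) : upd φ x u p.1 = φ p.1 :=
  if_neg (c := p.1 = x) fun e => hx (e ▸ List.mem_map_of_mem hp)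

theorem upd_sort {X : PreCtx A} {U : SortE A} {x : A.Var} (hP : Pre T.ax)
    (h : Derivable T.ax (.sort X U)) (hx : x ∉ X.map Prod.fst) (φ : A.Var → Expr A) (u : Expr A) :
    U.subst (upd φ x u) = U.subst φ :=
  SortE.subst_congr fun v hv => if_neg (c := v = x) fun e => hx (e ▸ (h.ok hP).occ v hv)

theorem upd_term {X : PreCtx A} {u' : Expr A} {U : SortE A} {x : A.Var} (hP : Pre T.ax)
    (h : Derivable T.ax (.term X u' U)) (hx : x ∉ X.map Prod.fst) (φ : A.Var → Expr A)
    (u : Expr A) : u'.subst (upd φ x u) = u'.subst φ :=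
  Expr.subst_congr fun v hv => if_neg (c := v = x) fun e => hx (e ▸ (h.ok hP).occ v (.inl hv))

/-- `φ` sends the variables of `X` to arguments over `X'` at level `n`. -/
def Thy.Mor (T : Thy A) (n : ℕ) (φ : A.Var → Expr A) (X X' : PreCtx A) : Prop :=
  ∀ p ∈ X, T.Arg n X' (φ p.1) (p.2.subst φ)

theorem Thy.Mor.mono {n m : ℕ} {φ : A.Var → Expr A} {X X' : PreCtx A} (h : T.Mor n φ X X')
    (hnm : n ≤ m) : T.Mor m φ X X' := fun p hp => (h p hp).mono hnm

theorem Thy.Mor.pfx {n : ℕ} {φ : A.Var → Expr A} {X X' X'' : PreCtx A} (h : T.Mor n φ X X')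
    (hp : X' <+: X'') : T.Mor n φ X X'' := fun p hm => (h p hm).pfx hp

theorem nodup_snoc {X : PreCtx A} {x : A.Var} {U : SortE A}
    (h : Derivable T.ax (.ctx (X ++ [(x, U)]))) : x ∉ X.map Prod.fst := by
  have := (h.ok T.pre).nodup
  simp only [Judg.ctxOf, List.map_append, List.map_cons, List.map_nil] at this
  intro hx
  exact (List.disjoint_of_nodup_append this) hx (by simp)

theorem Thy.Mor.upd {n k : ℕ} {φ : A.Var → Expr A} {X X' X1 : PreCtx A} (h : T.Mor k φ X X1)
    (hk : k ≤ n) (hp : X1 <+: X') {x : A.Var} {U : SortE A} {u : Expr A}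
    (hX : Derivable T.ax (.ctx (X ++ [(x, U)]))) (hu : T.Arg n X' u (U.subst φ)) :
    T.Mor n (upd φ x u) (X ++ [(x, U)]) X' := by
  have hx := nodup_snoc hX
  intro p hm
  rcases List.mem_append.1 hm with hm | hm
  · obtain ⟨X0, hX0⟩ := mem_split_pfx hm
    have h1 : Derivable T.ax (.sort X0 p.2) :=
      der_entry (x := p.1) hX (hX0.trans (List.prefix_append _ _))
    have h2 : x ∉ X0.map Prod.fst := fun h => hx
      (((List.prefix_append _ _).trans hX0).map Prod.fst |>.subset h)
    rw [upd_mem hx _ _ hm, upd_sort T.pre h1 h2]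
    exact ((h p hm).mono hk).pfx hp
  · obtain rfl := List.mem_singleton.1 hm
    rw [upd_self, upd_sort T.pre (der_entry hX List.prefix_rfl) hx]
    exact hu

theorem Thy.CtxAt.mor {n : ℕ} {X : PreCtx A} (h : T.CtxAt n X) : T.Mor n .var X X := by
  intro p hp
  rw [SortE.subst_id]
  exact h.arg hp

theorem Thy.CtxAt.snoc_ch {n : ℕ} {X : PreCtx A} {U : SortE A}
    (hU : DerAt T.ax (n + 1) (.sort X U)) :
    T.ch X ∉ X.map Prod.fst ∧ T.CtxAt n X ∧ T.CtxAt (n + 1) (X ++ [(T.ch X, U)]) := by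
  have hx : T.ch X ∉ X.map Prod.fst := by
    intro h
    obtain ⟨p, hp, e⟩ := List.mem_map.1 h
    exact T.fresh X p hp e
  exact ⟨hx, .of_sort hU, ((Thy.CtxAt.of_sort hU).mono (Nat.le_succ _)).snoc hU hx⟩

/-- Inversion of sorts in terms of the generic context of their head symbol. -/
theorem Thy.SAt.inv' {n : ℕ} {X : PreCtx A} {U : SortE A} (h : T.SAt (n + 1) X U) :
    ∃ X0 φ, introSort X0 U.head ∈ T.ax ∧ DerAt T.ax (n + 1) (introSort X0 U.head) ∧
      T.Mor n φ X0 X ∧ (⟨U.head, ctxVars X0⟩ : SortE A).subst φ = U := by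
  obtain ⟨S, f⟩ := U
  obtain ⟨X0, h3, h4, h5, h6⟩ := h.inv
  have hn : (X0.map Prod.fst).Nodup := (h5.ok T.pre).nodup
  refine ⟨X0, sb X0 f, h3, h5, h6, ?_⟩
  rw [SortE.subst_mk, map_ctxVars, map_sb hn h4]

/-- Inversion of terms in terms of the generic context of their head symbol. -/
theorem Thy.Arg.inv' {n : ℕ} {X : PreCtx A} {t : A.TermSym} {f : List (Expr A)} {U : SortE A}
    (h : T.Arg (n + 1) X (.app t f) U) :
    ∃ Xa V φ, introTerm Xa t V ∈ T.ax ∧ DerAt T.ax (n + 1) (introTerm Xa t V) ∧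
      T.Mor n φ Xa X ∧ (ctxVars Xa).map (Expr.subst φ) = f ∧ T.SAt n X (V.subst φ) ∧
      T.cs X (.app t f) = V.subst φ := by
  obtain ⟨Xa, V, h1, h2, h3, h4, h5, h6⟩ := h.inv
  have hn : (Xa.map Prod.fst).Nodup := (h3.ok T.pre).nodup
  refine ⟨Xa, V, sb Xa f, h1, h3, h5, ?_, h4, h6⟩
  rw [map_ctxVars, map_sb hn h2]

end Update

section Claims

variable {A B C : Alphabet}

namespace Sys

/-- The function on variables of `C` with prescribed values on pairs. -/
noncomputable def tau (s : Sys A B C) (F : A.Var → B.Var → Expr C) (z : C.Var) : Expr C :=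
  open Classical in
  if h : ∃ x y, s.v x y = z then F h.choose h.choose_spec.choose else .var z

theorem tau_v (s : Sys A B C) (F : A.Var → B.Var → Expr C) (x : A.Var) (y : B.Var) :
    s.tau F (s.v x y) = F x y := by
  have h : ∃ x' y', s.v x' y' = s.v x y := ⟨x, y, rfl⟩
  rw [tau, dif_pos h]
  obtain ⟨h1, h2⟩ := s.v_inj h.choose_spec.choose_spec
  congr 1

variable {s : Sys A B C} {X X' X1 : PreCtx A} {Y Y' Y1 : PreCtx B} {Δ : PreCtx C} {n m : ℕ}

/-- Derivable contexts `X`, `Y`, `Δ` such that `Δ` contains `X ⊗ Y`. -/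
structure In (s : Sys A B C) (X : PreCtx A) (Y : PreCtx B) (Δ : PreCtx C) : Prop where
  ctxa : Derivable s.a.ax (.ctx X)
  ctxb : Derivable s.b.ax (.ctx Y)
  ctx : Derivable s.ax (.ctx Δ)
  has : s.Has X Y Δ

theorem In.swap (h : s.In X Y Δ) : s.swap.In Y X Δ := ⟨h.ctxb, h.ctxa, h.ctx, has_swap.2 h.has⟩

theorem In.of_swap (h : s.swap.In Y X Δ) : s.In X Y Δ := ⟨h.ctxb, h.ctxa, h.ctx, has_swap.1 h.has⟩

theorem In.pfx (h : s.In X' Y' Δ) (hpX : X <+: X') (hpY : Y <+: Y') : s.In X Y Δ :=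
  ⟨der_ctx_pfx h.ctxa hpX, der_ctx_pfx h.ctxb hpY, h.ctx, h.has.pfx h.ctxa h.ctxb hpX hpY⟩

/-- Tensor products of sorts are derivable. -/
def Srt (s : Sys A B C) (n m : ℕ) : Prop :=
  ∀ {X X1 : PreCtx A} {Y Y1 : PreCtx B} {Δ : PreCtx C} {u : Expr A} {U : SortE A} {v : Expr B}
    {V : SortE B}, s.In X Y1 Δ → s.In X1 Y Δ → X1 <+: X → Y1 <+: Y → s.a.SAt n X1 U →
    s.b.SAt m Y1 V → s.a.Arg n X u U → s.b.Arg m Y v V →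
    Derivable s.ax (.sort Δ (s.TT (s.ten X Y) U u V v))

theorem Srt.swap (h : s.Srt n m) : s.swap.Srt m n := by
  intro Y Y1 X X1 Δ v V u U h1 h2 h3 h4 h5 h6 h7 h8
  rw [ten_swap', TT_swap]
  exact h h2.of_swap h1.of_swap h4 h3 h6 h5 h8 h7

theorem tctx_snoc_true (ho : s.ord = true) {p : A.Var × SortE A}
    (hX : Derivable s.a.ax (.ctx (X ++ [p]))) (hY : Derivable s.b.ax (.ctx Y)) :
    s.tctx (X ++ [p]) Y = s.tctx X Y ++ Y.map fun q => (s.v p.1 q.1, s.E (X ++ [p]) Y p q) := by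
  have h : s.tctx X Y = gr s.ord X Y fun p' q => (s.v p'.1 q.1, s.E (X ++ [p]) Y p' q) :=
    gr_congr fun a ha b hb => by
      rw [E_pfx hX hY (List.prefix_append _ _) List.prefix_rfl ha hb]
  rw [h, tctx, ho]
  simp [gr]

theorem tctxD_true (ho : s.ord = true) {p : A.Var × SortE A} {q : B.Var × SortE B}
    (hX : Derivable s.a.ax (.ctx (X ++ [p]))) (hY : Derivable s.b.ax (.ctx (Y ++ [q]))) :
    s.tctxD X p Y q = s.tctx X (Y ++ [q]) ++
      Y.map fun q' => (s.v p.1 q'.1, s.E (X ++ [p]) (Y ++ [q]) p q') := by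
  have h : s.tctx X (Y ++ [q]) =
      gr s.ord X (Y ++ [q]) fun p' q' => (s.v p'.1 q'.1, s.E (X ++ [p]) (Y ++ [q]) p' q') :=
    gr_congr fun a ha b hb => by
      rw [E_pfx hX hY (List.prefix_append _ _) List.prefix_rfl ha hb]
  rw [h, tctxD, ho]
  rfl

theorem ctx_row (hP : Pre s.ax) {p : A.Var × SortE A}
    (hX : Derivable s.a.ax (.ctx (X ++ [p]))) (hY' : Derivable s.b.ax (.ctx Y'))
    (hs : ∀ Y0 q Δ, Y0 ++ [q] <+: Y → s.In (X ++ [p]) Y0 Δ → s.In X (Y0 ++ [q]) Δ →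
      Derivable s.ax (.sort Δ (s.E (X ++ [p]) (Y0 ++ [q]) p q)))
    (hpY : Y <+: Y') (hc : Derivable s.ax (.ctx (s.tctx X Y'))) :
    Derivable s.ax (.ctx (s.tctx X Y' ++
      Y.map fun q => (s.v p.1 q.1, s.E (X ++ [p]) Y' p q))) := by
  have hXp := der_ctx_pfx hX (List.prefix_append _ _)
  have main : ∀ Y0, Y0 <+: Y → Derivable s.ax (.ctx (s.tctx X Y' ++
      Y0.map fun q => (s.v p.1 q.1, s.E (X ++ [p]) Y' p q))) := by
    intro Y0
    induction Y0 using List.reverseRecOn with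
    | nil => intro; simpa using hc
    | append_singleton Y0 q ih =>
      intro hq
      have hD := ih ((List.prefix_append _ _).trans hq)
      have hqY := hq.trans hpY
      set D := s.tctx X Y' ++ Y0.map fun q => (s.v p.1 q.1, s.E (X ++ [p]) Y' p q) with hDdef
      have h1 : s.In X Y' D := ⟨hXp, hY', hD, fun p' hp' q' hq' =>
        der_vars hP hD (List.mem_append_left _ (mem_tctx.2 ⟨p', hp', q', hq', rfl⟩))⟩
      have hY0 : Y0 <+: Y' := (List.prefix_append _ _).trans hqY
      have h2 : s.In (X ++ [p]) Y0 D := by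
        refine ⟨hX, der_ctx_pfx hY' hY0, hD, fun p' hp' q' hq' => ?_⟩
        rcases List.mem_append.1 hp' with hp' | hp'
        · rw [← E_pfx hX hY' List.prefix_rfl hY0 (List.mem_append_left _ hp') hq',
            E_pfx hX hY' (List.prefix_append _ _) List.prefix_rfl hp' (hY0.subset hq')]
          exact h1.has p' hp' q' (hY0.subset hq')
        · obtain rfl := List.mem_singleton.1 hp'
          rw [← E_pfx hX hY' List.prefix_rfl hY0 (by simp) hq']
          exact der_vars hP hD (List.mem_append_right _ (List.mem_map.2 ⟨q', hq', rfl⟩))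
      have h3 := hs Y0 q D hq h2 (h1.pfx List.prefix_rfl hqY)
      rw [← E_pfx hX hY' List.prefix_rfl hqY (by simp) (by simp)] at h3
      rw [List.map_append, ← List.append_assoc]
      refine der_ctx_snoc hP h3 ?_
      intro hm
      obtain ⟨r, hr, e⟩ := List.mem_map.1 hm
      rcases List.mem_append.1 hr with hr | hr
      · obtain ⟨p', hp', q', hq', rfl⟩ := mem_tctx.1 hr
        obtain ⟨e1, -⟩ := s.v_inj e
        exact nodup_snoc (U := p.2) hX (e1 ▸ List.mem_map_of_mem hp')
      · obtain ⟨q', hq', rfl⟩ := List.mem_map.1 hr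
        obtain ⟨-, e1⟩ := s.v_inj e
        have : Derivable s.b.ax (.ctx (Y0 ++ [(q.1, q.2)])) := der_ctx_pfx hY' hqY
        exact nodup_snoc this (e1 ▸ List.mem_map_of_mem hq')
  exact main Y List.prefix_rfl

theorem Srt.entry (h : s.Srt n m) {p : A.Var × SortE A} {q : B.Var × SortE B}
    (hX : s.a.CtxAt n (X ++ [p])) (hY : s.b.CtxAt m (Y ++ [q])) (h1 : s.In (X ++ [p]) Y Δ)
    (h2 : s.In X (Y ++ [q]) Δ) : Derivable s.ax (.sort Δ (s.E (X ++ [p]) (Y ++ [q]) p q)) :=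
  h h1 h2 (List.prefix_append _ _) (List.prefix_append _ _)
    ⟨X, List.prefix_rfl, hX.entry X p.1 p.2 List.prefix_rfl⟩
    ⟨Y, List.prefix_rfl, hY.entry Y q.1 q.2 List.prefix_rfl⟩ (hX.arg (by simp)) (hY.arg (by simp))

theorem tctx_nil_left (Y : PreCtx B) : s.tctx [] Y = [] := by
  cases h : s.ord <;> simp [tctx, gr, h]

theorem ctx_true (hP : Pre s.ax) (ho : s.ord = true) (h : s.Srt n m) (hX : s.a.CtxAt n X)
    (hY : s.b.CtxAt m Y) : Derivable s.ax (.ctx (s.tctx X Y)) := by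
  induction X using List.reverseRecOn with
  | nil => rw [tctx_nil_left]; exact der_ctx_nil
  | append_singleton X p ih =>
    rw [tctx_snoc_true ho hX.der hY.der]
    exact ctx_row hP hX.der hY.der (fun Y0 q Δ hq h1 h2 => h.entry hX (hY.pfx hq) h1 h2)
      List.prefix_rfl (ih (hX.pfx (List.prefix_append _ _)))

theorem ctxD_true (hP : Pre s.ax) (ho : s.ord = true) {p : A.Var × SortE A}
    {q : B.Var × SortE B} (h1 : s.Srt (n + 1) m) (h2 : s.Srt n (m + 1)) (hX : s.a.CtxAt n X)
    (hX' : s.a.CtxAt (n + 1) (X ++ [p])) (hY : s.b.CtxAt m Y)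
    (hY' : s.b.CtxAt (m + 1) (Y ++ [q])) : Derivable s.ax (.ctx (s.tctxD X p Y q)) := by
  rw [tctxD_true ho hX'.der hY'.der]
  exact ctx_row hP hX'.der hY'.der (fun Y0 q Δ hq e1 e2 => h1.entry hX' (hY.pfx hq) e1 e2)
    (List.prefix_append _ _) (ctx_true hP ho h2 hX hY')

theorem in_tctx (hP : Pre s.ax) (h : s.Srt n m) (hX : s.a.CtxAt n X)
    (hY : s.b.CtxAt m Y) : s.In X Y (s.tctx X Y) := by
  have : Derivable s.ax (.ctx (s.tctx X Y)) := by
    rcases ho : s.ord with _ | _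
    · rw [← tctx_swap]
      exact ctx_true (s := s.swap) hP (by simp [Sys.swap, ho]) h.swap hY hX
    · exact ctx_true hP ho h hX hY
  exact ⟨hX.der, hY.der, this, has_tctx hP this⟩

theorem in_tctxD (hP : Pre s.ax) {p : A.Var × SortE A}
    {q : B.Var × SortE B} (h1 : s.Srt (n + 1) m) (h2 : s.Srt n (m + 1)) (hX : s.a.CtxAt n X)
    (hX' : s.a.CtxAt (n + 1) (X ++ [p])) (hY : s.b.CtxAt m Y)
    (hY' : s.b.CtxAt (m + 1) (Y ++ [q])) :
    s.In (X ++ [p]) Y (s.tctxD X p Y q) ∧ s.In X (Y ++ [q]) (s.tctxD X p Y q) := by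
  have : Derivable s.ax (.ctx (s.tctxD X p Y q)) := by
    rcases ho : s.ord with _ | _
    · rw [← tctxD_swap]
      exact ctxD_true (s := s.swap) hP (by simp [Sys.swap, ho]) h2.swap h1.swap hY hY' hX hX'
    · exact ctxD_true hP ho h1 h2 hX hX' hY hY'
  obtain ⟨e1, e2⟩ := has_tctxD hP hX'.der hY'.der this
  exact ⟨⟨hX'.der, hY.der, this, e1⟩, ⟨hX.der, hY'.der, this, e2⟩⟩

end Sys
end Claims

section SortStep

variable {A B C : Alphabet}

namespace Sys

/-- The extension of a context by the chosen fresh variable. -/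
abbrev _root_.GATPaper.Thy.ext (T : Thy A) (X : PreCtx A) (U : SortE A) : PreCtx A :=
  X ++ [(T.ch X, U)]

/-- Closure of the axioms of `C` under the tensor products of axioms that are not symmetric in the
two factors. -/
structure Half (s : Sys A B C) : Prop where
  st : ∀ {X U Y v V}, Judg.sort X U ∈ s.a.ax → Judg.term Y v V ∈ s.b.ax →
    Derivable s.ax (.sort (s.tctx (s.a.ext X U) Y)
      (s.TT (s.ten (s.a.ext X U) Y) U (.var (s.a.ch X)) V v)) →
    Derivable s.ax (.term (s.tctx (s.a.ext X U) Y) (s.ten (s.a.ext X U) Y (.var (s.a.ch X)) v)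
      (s.TT (s.ten (s.a.ext X U) Y) U (.var (s.a.ch X)) V v))
  seqs : ∀ {X U U' Y V}, Judg.sortEq X U U' ∈ s.a.ax → Judg.sort Y V ∈ s.b.ax →
    Derivable s.ax (.sort (s.tctxD X (s.a.ch X, U) Y (s.b.ch Y, V))
      (s.TT (s.ten (s.a.ext X U) (s.b.ext Y V)) U (.var (s.a.ch X)) V (.var (s.b.ch Y)))) →
    Derivable s.ax (.sort (s.tctxD X (s.a.ch X, U) Y (s.b.ch Y, V))
      (s.TT (s.ten (s.a.ext X U') (s.b.ext Y V)) U' (.var (s.a.ch X)) V (.var (s.b.ch Y)))) →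
    Derivable s.ax (.sortEq (s.tctxD X (s.a.ch X, U) Y (s.b.ch Y, V))
      (s.TT (s.ten (s.a.ext X U) (s.b.ext Y V)) U (.var (s.a.ch X)) V (.var (s.b.ch Y)))
      (s.TT (s.ten (s.a.ext X U') (s.b.ext Y V)) U' (.var (s.a.ch X)) V (.var (s.b.ch Y))))
  seqt : ∀ {X U U' Y v V}, Judg.sortEq X U U' ∈ s.a.ax → Judg.term Y v V ∈ s.b.ax →
    ∃ τ : C.Var → Expr C, (∀ p ∈ X, ∀ q ∈ Y, τ (s.v p.1 q.1) = .var (s.v p.1 q.1)) ∧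
      (∀ q ∈ Y, τ (s.v (s.a.ch X) q.1) = .var (s.v (s.a.ch X) q.1)) ∧
      (∀ p ∈ X, τ (s.v p.1 (s.b.ch Y)) = s.ten (s.a.ext X U) Y (.var p.1) v) ∧
      (Derivable s.ax (.term (s.tctx (s.a.ext X U) Y) (s.ten (s.a.ext X U) Y (.var (s.a.ch X)) v)
        ((s.TT (s.ten (s.a.ext X U) (s.b.ext Y V)) U (.var (s.a.ch X)) V
          (.var (s.b.ch Y))).subst τ)) →
      Derivable s.ax (.term (s.tctx (s.a.ext X U) Y) (s.ten (s.a.ext X U') Y (.var (s.a.ch X)) v)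
        ((s.TT (s.ten (s.a.ext X U) (s.b.ext Y V)) U (.var (s.a.ch X)) V
          (.var (s.b.ch Y))).subst τ)) →
      TEq s.ax (s.tctx (s.a.ext X U) Y) (s.ten (s.a.ext X U) Y (.var (s.a.ch X)) v)
        (s.ten (s.a.ext X U') Y (.var (s.a.ch X)) v))
  teqs : ∀ {X u u' U Y V}, Judg.termEq X u u' U ∈ s.a.ax → Judg.sort Y V ∈ s.b.ax →
    Derivable s.ax (.term (s.tctx X (s.b.ext Y V)) (s.ten X (s.b.ext Y V) u (.var (s.b.ch Y)))
      (s.TT (s.ten X (s.b.ext Y V)) U u V (.var (s.b.ch Y)))) →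
    Derivable s.ax (.term (s.tctx X (s.b.ext Y V)) (s.ten X (s.b.ext Y V) u' (.var (s.b.ch Y)))
      (s.TT (s.ten X (s.b.ext Y V)) U u V (.var (s.b.ch Y)))) →
    Derivable s.ax (.termEq (s.tctx X (s.b.ext Y V)) (s.ten X (s.b.ext Y V) u (.var (s.b.ch Y)))
      (s.ten X (s.b.ext Y V) u' (.var (s.b.ch Y)))
      (s.TT (s.ten X (s.b.ext Y V)) U u V (.var (s.b.ch Y))))

/-- Closure of the axioms of `C` under the tensor products of axioms. -/
structure Full (s : Sys A B C) : Prop where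
  pre : Pre s.ax
  half : s.Half
  half' : s.swap.Half
  ss : ∀ {X U Y V}, Judg.sort X U ∈ s.a.ax → Judg.sort Y V ∈ s.b.ax →
    Derivable s.ax (.ctx (s.tctxD X (s.a.ch X, U) Y (s.b.ch Y, V))) →
    Derivable s.ax (.sort (s.tctxD X (s.a.ch X, U) Y (s.b.ch Y, V))
      (s.TT (s.ten (s.a.ext X U) (s.b.ext Y V)) U (.var (s.a.ch X)) V (.var (s.b.ch Y))))
  tt : ∀ {X t U Y r V}, introTerm X t U ∈ s.a.ax → introTerm Y r V ∈ s.b.ax →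
    ∃ τ : C.Var → Expr C, (∀ p ∈ X, ∀ q ∈ Y, τ (s.v p.1 q.1) = .var (s.v p.1 q.1)) ∧
      (∀ q ∈ Y, τ (s.v (s.a.ch X) q.1) = s.ten X Y (.app t (ctxVars X)) (.var q.1)) ∧
      (∀ p ∈ X, τ (s.v p.1 (s.b.ch Y)) = s.ten X Y (.var p.1) (.app r (ctxVars Y))) ∧
      (Derivable s.ax (.term (s.tctx X Y)
          (s.L (s.ten X Y) U (.app t (ctxVars X)) r (ctxVars Y))
          ((s.TT (s.ten (s.a.ext X U) (s.b.ext Y V)) U (.var (s.a.ch X)) V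
            (.var (s.b.ch Y))).subst τ)) →
        Derivable s.ax (.term (s.tctx X Y)
          (s.R (s.ten X Y) t (ctxVars X) V (.app r (ctxVars Y)))
          ((s.TT (s.ten (s.a.ext X U) (s.b.ext Y V)) U (.var (s.a.ch X)) V
            (.var (s.b.ch Y))).subst τ)) →
        TEq s.ax (s.tctx X Y) (s.L (s.ten X Y) U (.app t (ctxVars X)) r (ctxVars Y))
          (s.R (s.ten X Y) t (ctxVars X) V (.app r (ctxVars Y))))

variable {s : Sys A B C} {X X' X1 X0 : PreCtx A} {Y Y' Y1 Y0 : PreCtx B} {Δ : PreCtx C} {n m : ℕ}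

theorem Full.swap (h : s.Full) : s.swap.Full where
  pre := h.pre
  half := h.half'
  half' := by rw [swap_swap]; exact h.half
  ss := by
    intro X U Y V h1 h2 h3
    have e := s.tctxD_swap Y (s.a.ch Y, V) X (s.b.ch X, U)
    rw [ten_swap', TT_swap]
    change Derivable s.ax (.sort (s.swap.tctxD X (s.b.ch X, U) Y (s.a.ch Y, V)) _)
    change Derivable s.ax (.ctx (s.swap.tctxD X (s.b.ch X, U) Y (s.a.ch Y, V))) at h3
    rw [e] at h3 ⊢
    exact h.ss h2 h1 h3
  tt := by
    intro X t U Y r V h1 h2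
    obtain ⟨τ, e1, e2, e3, e4⟩ := h.tt h2 h1
    refine ⟨τ, fun p hp q hq => e1 q hq p hp, fun q hq => ?_, fun p hp => ?_, ?_⟩
    · rw [ten_swap]; exact e3 q hq
    · rw [ten_swap]; exact e2 p hp
    · rw [ten_swap', ten_swap', TT_swap, tctx_swap, ← R_eq, ← L_eq]
      exact fun e5 e6 => (e4 e6 e5).symm

theorem typed_sub (hP : Pre s.ax) (h : s.Amb n m X' Y' Δ) (hX : Derivable s.a.ax (.ctx X))
    (hY : Derivable s.b.ax (.ctx Y)) {φ : A.Var → Expr A} {ψ : B.Var → Expr B}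
    {Φ : A.Var → Expr A} {Ψ : B.Var → Expr B}
    (hφ : s.a.Mor n φ X X') (hψ : s.b.Mor m ψ Y Y')
    (eφ : ∀ p ∈ X, Φ p.1 = φ p.1) (eψ : ∀ q ∈ Y, Ψ q.1 = ψ q.1)
    {X'' : PreCtx A} {Y'' : PreCtx B} (hX'' : Derivable s.a.ax (.ctx X''))
    (hY'' : Derivable s.b.ax (.ctx Y'')) (hpX : X' <+: X'') (hpY : Y' <+: Y'') :
    Typed s.ax (s.tau fun a b => s.ten X'' Y'' (Φ a) (Ψ b)) (s.tctx X Y) Δ :=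
  tuple hP h hX hY hφ hψ fun p hp q hq => by
    rw [tau_v, eφ p hp, eψ q hq, ten_pfx hX'' hY'' hpX hpY (hφ p hp).good (hψ q hq).good]

theorem dsl_of_eq (hP : Pre s.ax) (h : s.Amb n m X' Y' Δ) (hX : Derivable s.a.ax (.ctx X))
    (hY : Derivable s.b.ax (.ctx Y)) {φ : A.Var → Expr A} {ψ : B.Var → Expr B}
    {Φ : A.Var → Expr A} {Ψ : B.Var → Expr B} {τ : C.Var → Expr C}
    (hφ : s.a.Mor n φ X X') (hψ : s.b.Mor m ψ Y Y')
    (eφ : ∀ p ∈ X, Φ p.1 = φ p.1) (eψ : ∀ q ∈ Y, Ψ q.1 = ψ q.1)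
    (hτ : ∀ p ∈ X, ∀ q ∈ Y, τ (s.v p.1 q.1) = s.ten X' Y' (φ p.1) (ψ q.1))
    {X₀ : PreCtx A} {Y₀ : PreCtx B} (hX₀ : Derivable s.a.ax (.ctx X₀))
    (hY₀ : Derivable s.b.ax (.ctx Y₀)) (hqX : X <+: X₀) (hqY : Y <+: Y₀)
    {u : Expr A} {v : Expr B} (hu : s.a.Good X u) (hv : s.b.Good Y v)
    (hu' : ∃ U, s.a.Arg n X' (u.subst Φ) U) (hv' : ∃ V, s.b.Arg m Y' (v.subst Ψ) V) :
    TEq s.ax Δ ((s.ten X₀ Y₀ u v).subst τ) (s.ten X' Y' (u.subst Φ) (v.subst Ψ)) := by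
  have e1 : ∀ x ∈ X.map Prod.fst, Φ x = φ x := by
    intro x hx
    obtain ⟨p, hp, rfl⟩ := List.mem_map.1 hx
    exact eφ p hp
  have e2 : ∀ x ∈ Y.map Prod.fst, Ψ x = ψ x := by
    intro x hx
    obtain ⟨p, hp, rfl⟩ := List.mem_map.1 hx
    exact eψ p hp
  have e3 : u.subst Φ = u.subst φ := Expr.subst_congr fun x hx => e1 x (hu.occ hX hx)
  have e4 : v.subst Ψ = v.subst ψ := Expr.subst_congr fun x hx => e2 x (hv.occ hY hx)
  rw [ten_pfx hX₀ hY₀ hqX hqY hu hv]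
  rw [e3] at hu' ⊢
  rw [e4] at hv' ⊢
  exact dsl hP h hX hY hφ hψ hτ hu hv hu' hv'

theorem dsl_sub (hP : Pre s.ax) (h : s.Amb n m X' Y' Δ) (hX : Derivable s.a.ax (.ctx X))
    (hY : Derivable s.b.ax (.ctx Y)) {φ : A.Var → Expr A} {ψ : B.Var → Expr B}
    {Φ : A.Var → Expr A} {Ψ : B.Var → Expr B}
    (hφ : s.a.Mor n φ X X') (hψ : s.b.Mor m ψ Y Y')
    (eφ : ∀ p ∈ X, Φ p.1 = φ p.1) (eψ : ∀ q ∈ Y, Ψ q.1 = ψ q.1)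
    {X'' : PreCtx A} {Y'' : PreCtx B} (hX'' : Derivable s.a.ax (.ctx X''))
    (hY'' : Derivable s.b.ax (.ctx Y'')) (hpX : X' <+: X'') (hpY : Y' <+: Y'')
    {X₀ : PreCtx A} {Y₀ : PreCtx B} (hX₀ : Derivable s.a.ax (.ctx X₀))
    (hY₀ : Derivable s.b.ax (.ctx Y₀)) (hqX : X <+: X₀) (hqY : Y <+: Y₀)
    {u : Expr A} {v : Expr B} (hu : s.a.Good X u) (hv : s.b.Good Y v)
    (hu' : ∃ U, s.a.Arg n X' (u.subst Φ) U) (hv' : ∃ V, s.b.Arg m Y' (v.subst Ψ) V) :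
    TEq s.ax Δ ((s.ten X₀ Y₀ u v).subst (s.tau fun a b => s.ten X'' Y'' (Φ a) (Ψ b)))
      (s.ten X'' Y'' (u.subst Φ) (v.subst Ψ)) := by
  have g1 : s.a.Good X' (u.subst Φ) := by obtain ⟨U, hU⟩ := hu'; exact hU.good
  have g2 : s.b.Good Y' (v.subst Ψ) := by obtain ⟨V, hV⟩ := hv'; exact hV.good
  rw [ten_pfx hX'' hY'' hpX hpY g1 g2]
  refine dsl_of_eq hP h hX hY hφ hψ eφ eψ (fun p hp q hq => ?_) hX₀ hY₀ hqX hqY hu hv hu' hv'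
  rw [tau_v, eφ p hp, eψ q hq, ten_pfx hX'' hY'' hpX hpY (hφ p hp).good (hψ q hq).good]

theorem _root_.GATPaper.Thy.Mor.cons {T : Thy A} {φ : A.Var → Expr A} {x : A.Var} {u : Expr A}
    {U : SortE A} (h : T.Mor n φ X X') (hX : Derivable T.ax (.ctx (X ++ [(x, U)]))) :
    T.Mor n (upd φ x u) X X' := by
  have hx := nodup_snoc hX
  intro p hm
  obtain ⟨X0, hX0⟩ := mem_split_pfx hm
  have h1 : Derivable T.ax (.sort X0 p.2) :=
    der_entry (x := p.1) hX (hX0.trans (List.prefix_append _ _))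
  have h2 : x ∉ X0.map Prod.fst := fun h => hx
    (((List.prefix_append _ _).trans hX0).map Prod.fst |>.subset h)
  rw [upd_mem hx _ _ hm, upd_sort T.pre h1 h2]
  exact h p hm

/-- Equality of sorts whose terms are sent to one another by a substitution, for generic sorts. -/
theorem ten_vars {F G : Expr A → Expr B → Expr C} {a : Expr A} {b : Expr B} {Z : PreCtx A}
    {Z' : PreCtx B} {Φ : A.Var → Expr A} {Ψ : B.Var → Expr B} {τ : C.Var → Expr C}
    (ha : a ∈ ctxVars Z) (hb : b ∈ ctxVars Z')
    (hF : ∀ x y, F (.var x) (.var y) = .var (s.v x y)) (hτ : ∀ x y, τ (s.v x y) = G (Φ x) (Ψ y)) :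
    (F a b).subst τ = G (a.subst Φ) (b.subst Ψ) := by
  obtain ⟨p, -, rfl⟩ := List.mem_map.1 ha
  obtain ⟨q, -, rfl⟩ := List.mem_map.1 hb
  simp [hF, hτ]

theorem mem_ctxVars_snoc {p : A.Var × SortE A} : ctxVars (X ++ [p]) = ctxVars X ++ [.var p.1] := by
  simp [ctxVars]

theorem TT_map_of (F : Expr A → Expr B → Expr C) {U U0 : SortE A} {u u0 : Expr A} {V V0 : SortE B}
    {v v0 : Expr B} {φ : A.Var → Expr A} {ψ : B.Var → Expr B} (e1 : U = U0.subst φ)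
    (e2 : u = u0.subst φ) (e3 : V = V0.subst ψ) (e4 : v = v0.subst ψ) :
    s.TT F U u V v = s.TT (fun a b => F (a.subst φ) (b.subst ψ)) U0 u0 V0 v0 := by
  rw [e1, e2, e3, e4, TT_map]

theorem L_map_of (F : Expr A → Expr B → Expr C) {U U0 : SortE A} {u u0 : Expr A} {t : B.TermSym}
    {g g0 : List (Expr B)} {φ : A.Var → Expr A} {ψ : B.Var → Expr B} (e1 : U = U0.subst φ)
    (e2 : u = u0.subst φ) (e3 : g = g0.map (Expr.subst ψ)) :
    s.L F U u t g = s.L (fun a b => F (a.subst φ) (b.subst ψ)) U0 u0 t g0 := by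
  rw [e1, e2, e3, L_map]

theorem _root_.GATPaper.Thy.CtxAt.last {T : Thy A} {x : A.Var} {U : SortE A}
    (h : T.CtxAt n (X ++ [(x, U)])) : T.Arg n (X ++ [(x, U)]) (.var x) U :=
  h.arg (p := (x, U)) (by simp)

theorem srt_step (hF : s.Full) (h1 : s.Srt (n + 1) m) (h2 : s.Srt n (m + 1))
    (a1 : ∀ {X Y Δ}, s.In X Y Δ → s.Amb (n + 1) m X Y Δ)
    (a2 : ∀ {X Y Δ}, s.In X Y Δ → s.Amb n (m + 1) X Y Δ) : s.Srt (n + 1) (m + 1) := by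
  intro X X1 Y Y1 Δ u U v V i1 i2 pX pY hU hV hu hv
  obtain ⟨X0, φ, ax1, d1, mφ, eφ⟩ := hU.inv'
  obtain ⟨Y0, ψ, ax2, d2, mψ, eψ⟩ := hV.inv'
  obtain ⟨fx, cX0, cX⟩ := Thy.CtxAt.snoc_ch d1
  obtain ⟨fy, cY0, cY⟩ := Thy.CtxAt.snoc_ch d2
  obtain ⟨j1, j2⟩ := in_tctxD hF.pre h1 h2 cX0 cX cY0 cY
  have K := hF.ss ax1 ax2 j1.ctx
  have mΦ := mφ.upd (Nat.le_succ n) pX (u := u) cX.der (by rw [eφ]; exact hu)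
  have mΨ := mψ.upd (Nat.le_succ m) pY (u := v) cY.der (by rw [eψ]; exact hv)
  have hT : Typed s.ax (s.tau fun a b => s.ten X Y (upd φ (s.a.ch X0) u a)
      (upd ψ (s.b.ch Y0) v b)) (s.tctxD X0 (s.a.ch X0, ⟨U.head, ctxVars X0⟩) Y0
        (s.b.ch Y0, ⟨V.head, ctxVars Y0⟩)) Δ :=
    (typed_tctxD cX.der cY.der).2
      ⟨typed_sub hF.pre (a1 i1) cX.der cY0.der mΦ (mψ.cons cY.der) (fun _ _ => rfl)
        (fun _ _ => rfl) i1.ctxa i2.ctxb List.prefix_rfl pY,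
       typed_sub hF.pre (a2 i2) cX0.der cY.der (mφ.cons cX.der) mΨ (fun _ _ => rfl)
        (fun _ _ => rfl) i1.ctxa i2.ctxb pX List.prefix_rfl⟩
  have R := K.subst hF.pre i1.ctx hT
  rw [Judg.app, subst_TT] at R
  have e1 : U = (⟨U.head, ctxVars X0⟩ : SortE A).subst (upd φ (s.a.ch X0) u) := by
    rw [upd_sort s.a.pre d1.der fx, eφ]
  have e2 : V = (⟨V.head, ctxVars Y0⟩ : SortE B).subst (upd ψ (s.b.ch Y0) v) := by
    rw [upd_sort s.b.pre d2.der fy, eψ]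
  have e3 : u = (Expr.var (s.a.ch X0)).subst (upd φ (s.a.ch X0) u) := by
    rw [Expr.subst_var, upd_self]
  have e4 : v = (Expr.var (s.b.ch Y0)).subst (upd ψ (s.b.ch Y0) v) := by
    rw [Expr.subst_var, upd_self]
  rw [TT_map_of _ e1 e3 e2 e4]
  convert R using 2
  have key : ∀ a ∈ ctxVars (X0 ++ [(s.a.ch X0, (⟨U.head, ctxVars X0⟩ : SortE A))]),
      ∀ b ∈ ctxVars (Y0 ++ [(s.b.ch Y0, (⟨V.head, ctxVars Y0⟩ : SortE B))]), 
      s.ten X Y (a.subst (upd φ (s.a.ch X0) u)) (b.subst (upd ψ (s.b.ch Y0) v)) =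
      (s.ten (s.a.ext X0 ⟨U.head, ctxVars X0⟩) (s.b.ext Y0 ⟨V.head, ctxVars Y0⟩) a b).subst
        (s.tau fun a b => s.ten X Y (upd φ (s.a.ch X0) u a) (upd ψ (s.b.ch Y0) v b)) :=
    fun a ha b hb => (ten_vars (s := s) ha hb (fun x y => ten_var_var _ _ _ _ _)
      fun x y => tau_v _ _ _ _).symm
  rw [mem_ctxVars_snoc, mem_ctxVars_snoc] at key
  exact TT_congr (fun a ha b hb => key a ha b (List.mem_append_left _ hb))
    fun a ha b hb => key a (List.mem_append_left _ ha) b hb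

/-- Compatibility of sorts with substitution, one variable being sent to a term of higher level. -/
theorem sub_sort (hP : Pre s.ax) (a1 : s.Amb (n + 1) m X Y Δ) (a2 : s.Amb n (m + 1) X Y Δ)
    {x0 : A.Var} {U0 : SortE A} {φ : A.Var → Expr A} {ψ : B.Var → Expr B} {u : Expr A}
    {V0 : SortE B} {v0 : Expr B}
    (hX : Derivable s.a.ax (.ctx (X0 ++ [(x0, U0)]))) (hY : Derivable s.b.ax (.ctx Y0))
    (hφ : s.a.Mor n φ X0 X) (hu : s.a.Arg (n + 1) X u (U0.subst φ)) (hψ : s.b.Mor m ψ Y0 Y)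
    (hv0 : ∀ b ∈ V0.args ++ [v0], s.b.Good Y0 b)
    (hv : s.b.Arg (m + 1) Y (v0.subst ψ) (V0.subst ψ))
    (hd : Derivable s.ax (.sort Δ (s.TT (s.ten X Y) (U0.subst φ) u (V0.subst ψ) (v0.subst ψ)))) :
    Derivable s.ax (.sortEq Δ ((s.TT (s.ten (X0 ++ [(x0, U0)]) Y0) U0 (.var x0) V0 v0).subst
      (s.tau fun a b => s.ten X Y (upd φ x0 u a) (ψ b)))
      (s.TT (s.ten X Y) (U0.subst φ) u (V0.subst ψ) (v0.subst ψ))) := by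
  have hx := nodup_snoc hX
  have dU : Derivable s.a.ax (.sort X0 U0) := der_entry hX List.prefix_rfl
  have dX := dU.sort_ctx
  have eU := upd_sort s.a.pre dU hx φ u
  have eu : (Expr.var x0).subst (upd φ x0 u) = u := by rw [Expr.subst_var, upd_self]
  have mΦ := hφ.upd (Nat.le_succ n) List.prefix_rfl hX hu
  have gU : ∀ a ∈ U0.args, s.a.Good X0 a := by
    obtain ⟨k, hk⟩ := dU
    obtain ⟨k, rfl⟩ := hk.pos
    intro a ha
    obtain ⟨W, hW⟩ := Thy.SAt.args (T := s.a) ⟨X0, List.prefix_rfl, hk⟩ a ha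
    exact hW.good
  have aU : ∀ a ∈ U0.args, ∃ W, s.a.Arg n X (a.subst (upd φ x0 u)) W := by
    rw [← eU] at hu
    exact fun a ha => hu.sat.args _ (List.mem_map_of_mem ha)
  have aV : ∀ b ∈ V0.args, ∃ W, s.b.Arg m Y (b.subst ψ) W :=
    fun b hb => hv.sat.args _ (List.mem_map_of_mem hb)
  have key := TT_sub (s := s) (φ := upd φ x0 u) (ψ := ψ) (F := s.ten (X0 ++ [(x0, U0)]) Y0)
    (τ := s.tau fun a b => s.ten X Y (upd φ x0 u a) (ψ b))
    (U := U0) (u := .var x0) (V := V0) (v := v0) (G := s.ten X Y) (Δ := Δ) hP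
    (by rw [eU, eu]; exact hd)
    (fun a ha b hb => dsl_sub hP a1 hX hY mΦ hψ (fun _ _ => rfl) (fun _ _ => rfl) a1.ctxa a1.ctxb
      List.prefix_rfl List.prefix_rfl hX hY List.prefix_rfl List.prefix_rfl
      (by
        rcases List.mem_append.1 ha with ha | ha
        · exact (gU a ha).pfx (List.prefix_append _ _)
        · obtain rfl := List.mem_singleton.1 ha
          obtain ⟨k, hk⟩ := Thy.var_arg hX (p := (x0, U0)) (by simp)
          exact hk.good)
      (hv0 b (List.mem_append_left _ hb))
      (by
        rcases List.mem_append.1 ha with ha | ha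
        · obtain ⟨W, hW⟩ := aU a ha
          exact ⟨W, hW.mono (Nat.le_succ n)⟩
        · obtain rfl := List.mem_singleton.1 ha
          rw [eu]
          exact ⟨_, hu⟩) (aV b hb))
    (fun a ha b hb => dsl_sub hP a2 dX hY (hφ.cons hX) (hψ.mono (Nat.le_succ m))
      (fun _ _ => rfl) (fun _ _ => rfl) a1.ctxa a1.ctxb List.prefix_rfl List.prefix_rfl hX hY
      (List.prefix_append _ _) List.prefix_rfl (gU a ha) (hv0 b hb) (aU a ha)
      (by
        rcases List.mem_append.1 hb with hb | hb
        · obtain ⟨W, hW⟩ := aV b hb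
          exact ⟨W, hW.mono (Nat.le_succ m)⟩
        · obtain rfl := List.mem_singleton.1 hb
          exact ⟨_, hv⟩))
  rwa [eU, eu] at key

theorem _root_.GATPaper.Thy.CtxAt.of_term {T : Thy A} {u : Expr A} {U : SortE A}
    (h : DerAt T.ax (n + 1) (.term X u U)) : T.CtxAt n X := by
  have h' := h.term_sort
  obtain ⟨k, rfl⟩ := h'.pos
  exact (Thy.CtxAt.of_sort h').mono (Nat.le_succ _)

theorem left_typ (hF : s.Full) (h1 : s.Srt (n + 1) m) (h3 : s.Srt (n + 1) (m + 1))
    (a1 : ∀ {X Y Δ}, s.In X Y Δ → s.Amb (n + 1) m X Y Δ)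
    (a2 : ∀ {X Y Δ}, s.In X Y Δ → s.Amb n (m + 1) X Y Δ) {u : Expr A} {U : SortE A}
    {t : B.TermSym} {g : List (Expr B)} {V : SortE B} (i : s.In X Y Δ)
    (hu : s.a.Arg (n + 1) X u U) (hv : s.b.Arg (m + 1) Y (.app t g) V) :
    Derivable s.ax (.term Δ (s.L (s.ten X Y) U u t g)
      (s.TT (s.ten X Y) U u (s.b.cs Y (.app t g)) (.app t g))) := by
  obtain ⟨X0, φ, ax1, d1, mφ, eφ⟩ := hu.sat.inv'
  obtain ⟨Yt, V0, ψ, ax2, d2, mψ, eψ, sV, cV⟩ := hv.inv'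
  obtain ⟨fx, cX0, cX⟩ := Thy.CtxAt.snoc_ch d1
  have cY := Thy.CtxAt.of_term d2
  have hv' : s.b.Arg (m + 1) Y (.app t g) (V0.subst ψ) := cV ▸ hv.cs_arg i.ctxb
  have j := in_tctx hF.pre h1 cX cY
  have hd := h3 j (j.pfx (List.prefix_append _ _) List.prefix_rfl) (List.prefix_append _ _)
    List.prefix_rfl ⟨X0, List.prefix_rfl, d1⟩ (.pfx ⟨Yt, List.prefix_rfl, d2.term_sort.succ⟩
      List.prefix_rfl) cX.last (.inr ⟨Yt, List.prefix_rfl, d2⟩)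
  have K := hF.half.st ax1 ax2 hd
  have mΦ := mφ.upd (Nat.le_succ n) List.prefix_rfl (u := u) cX.der (by rw [eφ]; exact hu)
  have hT := typed_sub hF.pre (a1 i) cX.der cY.der mΦ mψ (fun _ _ => rfl) (fun _ _ => rfl)
    i.ctxa i.ctxb List.prefix_rfl List.prefix_rfl
  have K' := K.subst hF.pre i.ctx hT
  have et : (Expr.app t (ctxVars Yt)).subst ψ = .app t g := by rw [Expr.subst_app, eψ]
  have S := sub_sort hF.pre (a1 i) (a2 i) (V0 := V0) (v0 := .app t (ctxVars Yt)) cX.der cY.der mφ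
    (by rw [eφ]; exact hu) mψ
    (Thy.Arg.all_good (T := s.b) (.inr ⟨Yt, List.prefix_rfl, d2⟩)) (by rw [et]; exact hv')
    (by rw [eφ, et]; exact h3 i i List.prefix_rfl List.prefix_rfl hu.sat hv'.sat hu hv')
  rw [eφ, et] at S
  have K2 := K'.conv S
  rw [cV]
  convert K2 using 2
  have gx : s.a.Good (s.a.ext X0 ⟨U.head, ctxVars X0⟩) (.var (s.a.ch X0)) :=
    cX.last.good
  have gt : s.b.Good Yt (.app t (ctxVars Yt)) := ⟨_, _, .inr ⟨Yt, List.prefix_rfl, d2⟩⟩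
  rw [ten_left cX.der gx gt (.inl ⟨_, rfl⟩), subst_L]
  have ec : s.a.cs (s.a.ext X0 ⟨U.head, ctxVars X0⟩) (.var (s.a.ch X0)) = ⟨U.head, ctxVars X0⟩ :=
    Thy.cs_var cX.der (by simp)
  rw [ec]
  have e1 : U = (⟨U.head, ctxVars X0⟩ : SortE A).subst (upd φ (s.a.ch X0) u) := by
    rw [upd_sort s.a.pre d1.der fx, eφ]
  have e3 : u = (Expr.var (s.a.ch X0)).subst (upd φ (s.a.ch X0) u) := by
    rw [Expr.subst_var, upd_self]
  rw [L_map_of _ e1 e3 eψ.symm]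
  refine L_congr fun a ha b hb => ?_
  have ha' : a ∈ ctxVars (X0 ++ [(s.a.ch X0, (⟨U.head, ctxVars X0⟩ : SortE A))]) := by
    rw [mem_ctxVars_snoc]; exact ha
  exact (ten_vars (s := s) ha' hb (fun x y => ten_var_var _ _ _ _ _)
      fun x y => tau_v _ _ _ _).symm

end Sys
end SortStep

section Grid
variable {α α' β β' γ γ' : Type}

theorem forall₂_grD {RA : α → α' → Prop} {RB : β → β' → Prop} {R : γ → γ' → Prop}
    {as : List α} {as' : List α'} {a : α} {a' : α'} {bs : List β} {bs' : List β'} {b : β} {b' : β'}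
    {F : α → β → γ} {G : α' → β' → γ'} (o : Bool)
    (ha : List.Forall₂ RA as as') (hb : List.Forall₂ RB bs bs')
    (h : ∀ a a' b b', RA a a' → RB b b' → R (F a b) (G a' b'))
    (h1 : ∀ b b', RB b b' → R (F a b) (G a' b')) (h2 : ∀ a a', RA a a' → R (F a b) (G a' b')) :
    List.Forall₂ R (grD o as a bs b F) (grD o as' a' bs' b' G) := by
  have key : ∀ {α α' β β' : Type} {RA : α → α' → Prop} {RB : β → β' → Prop} {as : List α}
      {as' : List α'} {a : α} {a' : α'} {bs : List β} {bs' : List β'} {b : β} {b' : β'}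
      {F : α → β → γ} {G : α' → β' → γ'} (ha : List.Forall₂ RA as as')
      (hb : List.Forall₂ RB bs bs')
      (h : ∀ a a' b b', RA a a' → RB b b' → R (F a b) (G a' b'))
      (h1 : ∀ b b', RB b b' → R (F a b) (G a' b')) (h2 : ∀ a a', RA a a' → R (F a b) (G a' b')),
      List.Forall₂ R (grD true as a bs b F) (grD true as' a' bs' b' G) := by
    intro α α' β β' RA RB as as' a a' bs bs' b b' F G ha hb h h1 h2
    refine List.rel_append ?_ ?_
    · refine forall₂_gr (RB := fun x y => RB x y ∨ (x = b ∧ y = b')) true ha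
        (List.rel_append (hb.imp fun _ _ => .inl) (.cons (.inr ⟨rfl, rfl⟩) .nil)) ?_
      rintro x x' y y' hx (hy | ⟨rfl, rfl⟩)
      · exact h _ _ _ _ hx hy
      · exact h2 _ _ hx
    · exact List.forall₂_map_left_iff.2 (List.forall₂_map_right_iff.2 (hb.imp fun _ _ => h1 _ _))
  cases o with
  | true => exact key ha hb h h1 h2
  | false =>
    rw [← grD_swap false, ← grD_swap false]
    exact key hb ha (fun b b' a a' hb ha => h a a' b b' ha hb) h2 h1

end Grid

section Cases
variable {A : Alphabet} {T : Thy A}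

theorem Thy.mor_sb {n : ℕ} {X Y : PreCtx A} {f : List (Expr A)} (hX : IsPreCtx X)
    (hn : (X.map Prod.fst).Nodup) (hl : f.length = X.length)
    (h : ∀ i (hi : i < X.length) (hif : i < f.length),
      DerAt T.ax n (.term Y (f[i]'hif) (subPre X f i hi))) : T.Mor n (sb X f) X Y :=
  fun p hp => .inr ⟨Y, List.prefix_rfl,
    (args_iff hX hn hl (P := fun u U => DerAt T.ax n (.term Y u U))).1 h p hp⟩

theorem forall₂_of_args {n : ℕ} {X Y : PreCtx A} {f g : List (Expr A)}
    (hl : f.length = X.length) (hg : g.length = X.length)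
    (h : ∀ i (hi : i < X.length) (hif : i < f.length) (hig : i < g.length),
      DerAt T.ax n (.termEq Y (f[i]'hif) (g[i]'hig) (subPre X f i hi))) :
    List.Forall₂ (fun a b => ∃ W, DerAt T.ax n (.termEq Y a b W)) f g :=
  List.forall₂_iff_get.2 ⟨hl.trans hg.symm, fun i hi hi' => ⟨_, h i (hl ▸ hi) hi hi'⟩⟩

/-- The last step of the derivation of an equality of sorts. -/
theorem Thy.seq_cases {n : ℕ} {X : PreCtx A} {U U' : SortE A}
    (h : DerAt T.ax (n + 1) (.sortEq X U U')) :
    U = U' ∨ DerAt T.ax n (.sortEq X U U') ∨ DerAt T.ax n (.sortEq X U' U) ∨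
    (∃ W, DerAt T.ax n (.sortEq X U W) ∧ DerAt T.ax n (.sortEq X W U')) ∨
    (∃ X0 V V' φ, Judg.sortEq X0 V V' ∈ T.ax ∧ DerAt T.ax (n + 1) (.sortEq X0 V V') ∧
      T.Mor n φ X0 X ∧ V.subst φ = U ∧ V'.subst φ = U') ∨
    (U.head = U'.head ∧
      List.Forall₂ (fun a b => ∃ W, DerAt T.ax n (.termEq X a b W)) U.args U'.args) := by
  rcases h with h | h
  · exact .inr (.inl h)
  · cases h with
    | s1 h => exact .inl rfl
    | s2 h => exact .inr (.inr (.inl h))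
    | s3 h1 h2 => exact .inr (.inr (.inr (.inl ⟨_, h1, h2⟩)))
    | seqA hax h1 h2 =>
      refine .inr (.inr (.inr (.inr (.inl ⟨X, U, U', .var, hax, .step (.seqA hax h1 h2), ?_,
        SortE.subst_id _, SortE.subst_id _⟩))))
      obtain ⟨k, rfl⟩ := h1.pos
      exact ((Thy.CtxAt.of_sort h1).mono (Nat.le_succ k)).mor
    | seqSub1 hax hY hl hJ h1 h2 hargs =>
      have ok := hJ.ok T.pre
      exact .inr (.inr (.inr (.inr (.inl ⟨_, _, _, _, hax, hJ.succ,
        Thy.mor_sb ok.pre ok.nodup hl hargs, rfl, rfl⟩))))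
    | seqSub2 hax hY hl hg hJ h1 h2 hargs =>
      exact .inr (.inr (.inr (.inr (.inr ⟨rfl, forall₂_of_args hl hg hargs⟩))))

/-- The last step of the derivation of an equality of terms. -/
theorem Thy.teq_cases {n : ℕ} {X : PreCtx A} {u u' : Expr A} {U : SortE A}
    (h : DerAt T.ax (n + 1) (.termEq X u u' U)) :
    u = u' ∨ (∃ W, DerAt T.ax n (.termEq X u u' W)) ∨ DerAt T.ax n (.termEq X u' u U) ∨
    (∃ w, DerAt T.ax n (.termEq X u w U) ∧ DerAt T.ax n (.termEq X w u' U)) ∨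
    (∃ X0 w w' W φ, Judg.termEq X0 w w' W ∈ T.ax ∧ DerAt T.ax (n + 1) (.termEq X0 w w' W) ∧
      T.Mor n φ X0 X ∧ w.subst φ = u ∧ w'.subst φ = u') ∨
    (∃ t f g, u = .app t f ∧ u' = .app t g ∧
      List.Forall₂ (fun a b => ∃ W, DerAt T.ax n (.termEq X a b W)) f g) := by
  rcases h with h | h
  · exact .inr (.inl ⟨_, h⟩)
  · cases h with
    | t1 h => exact .inl rfl
    | t2 h => exact .inr (.inr (.inl h))
    | t3 h1 h2 => exact .inr (.inr (.inr (.inl ⟨_, h1, h2⟩)))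
    | seqteq h1 h2 => exact .inr (.inl ⟨_, h2⟩)
    | teqA hax h1 h2 =>
      refine .inr (.inr (.inr (.inr (.inl ⟨X, u, u', U, .var, hax, .step (.teqA hax h1 h2), ?_,
        Expr.subst_id _, Expr.subst_id _⟩))))
      obtain ⟨k, rfl⟩ := h1.pos
      exact (Thy.CtxAt.of_term h1).mono (Nat.le_succ k) |>.mor
    | teqSub1 hax hY hl hJ h1 h2 hargs =>
      have ok := hJ.ok T.pre
      exact .inr (.inr (.inr (.inr (.inl ⟨_, _, _, _, _, hax, hJ.succ,
        Thy.mor_sb ok.pre ok.nodup hl hargs, rfl, rfl⟩))))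
    | teqSub2 hax hY hl hg hJ h1 h2 hargs =>
      exact .inr (.inr (.inr (.inr (.inr ⟨_, _, _, rfl, rfl, forall₂_of_args hl hg hargs⟩))))

end Cases

section FinalSort

variable {A B C : Alphabet}

theorem Thy.SAt.args' {T : Thy A} {n : ℕ} {X : PreCtx A} {U : SortE A} (h : T.SAt n X U) :
    ∀ a ∈ U.args, ∃ W, T.Arg n X a W := by
  obtain ⟨k, rfl⟩ := h.pos
  intro a ha
  obtain ⟨W, hW⟩ := h.args a ha
  exact ⟨W, hW.mono (Nat.le_succ k)⟩

theorem upd_arg {T : Thy A} {X X' : PreCtx A} {x : A.Var} {n : ℕ} {a u : Expr A} {W : SortE A}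
    (hX : Derivable T.ax (.ctx X)) (hx : x ∉ X.map Prod.fst) (h : T.Arg n X a W)
    (hp : X <+: X') : T.Arg n X' (a.subst (upd .var x u)) W := by
  rw [upd_term T.pre (h.der hX) hx, Expr.subst_id]
  exact h.pfx hp

namespace Sys

variable {s : Sys A B C} {n m : ℕ} {X X' : PreCtx A} {Y Y' : PreCtx B} {Δ : PreCtx C}

/-- Substituting terms for the last variables in a tensor product of sorts. -/
theorem final_sort (hP : Pre s.ax) (h : s.Amb n m X' Y' Δ) {x : A.Var} {y : B.Var} {U : SortE A}
    {V : SortE B} {u : Expr A} {v : Expr B} {τ : C.Var → Expr C} (cX : s.a.CtxAt n X)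
    (cY : s.b.CtxAt m Y) (hX : Derivable s.a.ax (.ctx (X ++ [(x, U)])))
    (hY : Derivable s.b.ax (.ctx (Y ++ [(y, V)]))) (pX : X <+: X') (pY : Y <+: Y')
    (hu : s.a.Arg n X' u U) (hv : s.b.Arg m Y' v V)
    (hd : Derivable s.ax (.sort Δ (s.TT (s.ten X' Y') U u V v)))
    (hU : ∀ a ∈ U.args, ∃ W, s.a.Arg n X a W) (hV : ∀ b ∈ V.args, ∃ W, s.b.Arg m Y b W)
    (hτ : ∀ p ∈ X, ∀ q ∈ Y, τ (s.v p.1 q.1) = .var (s.v p.1 q.1))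
    (hτx : ∀ q ∈ Y, τ (s.v x q.1) = s.ten X' Y' u (.var q.1))
    (hτy : ∀ p ∈ X, τ (s.v p.1 y) = s.ten X' Y' (.var p.1) v) :
    Derivable s.ax (.sortEq Δ ((s.TT (s.ten (X ++ [(x, U)]) (Y ++ [(y, V)])) U (.var x) V
      (.var y)).subst τ) (s.TT (s.ten X' Y') U u V v)) := by
  have fx := nodup_snoc hX
  have fy := nodup_snoc hY
  have dU : Derivable s.a.ax (.sort X U) := der_entry (x := x) hX List.prefix_rfl
  have dV : Derivable s.b.ax (.sort Y V) := der_entry (x := y) hY List.prefix_rfl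
  have eU : U.subst (upd .var x u) = U := by
    rw [upd_sort s.a.pre dU fx, SortE.subst_id]
  have eV : V.subst (upd .var y v) = V := by
    rw [upd_sort s.b.pre dV fy, SortE.subst_id]
  have eu : (Expr.var x).subst (upd .var x u) = u := by rw [Expr.subst_var, upd_self]
  have ev : (Expr.var y).subst (upd .var y v) = v := by rw [Expr.subst_var, upd_self]
  have mX := cX.mor.upd le_rfl pX hX (u := u) (by rw [SortE.subst_id]; exact hu)
  have mY := cY.mor.upd le_rfl pY hY (u := v) (by rw [SortE.subst_id]; exact hv)
  have gU : ∀ a ∈ U.args, s.a.Good X a := fun a ha => by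
    obtain ⟨W, hW⟩ := hU a ha; exact hW.good
  have gV : ∀ b ∈ V.args, s.b.Good Y b := fun b hb => by
    obtain ⟨W, hW⟩ := hV b hb; exact hW.good
  have aU : ∀ a ∈ U.args, ∃ W, s.a.Arg n X' (a.subst (upd .var x u)) W := fun a ha => by
    obtain ⟨W, hW⟩ := hU a ha; exact ⟨W, upd_arg cX.der fx hW pX⟩
  have aV : ∀ b ∈ V.args, ∃ W, s.b.Arg m Y' (b.subst (upd .var y v)) W := fun b hb => by
    obtain ⟨W, hW⟩ := hV b hb; exact ⟨W, upd_arg cY.der fy hW pY⟩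
  have key := TT_sub hP (F := s.ten (X ++ [(x, U)]) (Y ++ [(y, V)])) (G := s.ten X' Y') (U := U)
    (u := .var x) (V := V) (v := .var y) (φ := upd .var x u) (ψ := upd .var y v) (τ := τ)
    (Δ := Δ) (by rw [eU, eV, eu, ev]; exact hd) ?_ ?_
  · rwa [eU, eV, eu, ev] at key
  · intro a ha b hb
    refine dsl_of_eq hP h hX cY.der mX (fun q hq => mY q (List.mem_append_left _ hq)) (fun _ _ => rfl)
      (fun _ _ => rfl) (fun p hp q hq => ?_) hX hY List.prefix_rfl (List.prefix_append _ _) ?_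
      (gV b hb) ?_ (aV b hb)
    · rw [upd_mem fy _ _ hq]
      rcases List.mem_append.1 hp with hp | hp
      · rw [upd_mem fx _ _ hp, ten_var_var]
        exact hτ p hp q hq
      · obtain rfl := List.mem_singleton.1 hp
        rw [upd_self]
        exact hτx q hq
    · rcases List.mem_append.1 ha with ha | ha
      · exact (gU a ha).pfx (List.prefix_append _ _)
      · obtain rfl := List.mem_singleton.1 ha
        obtain ⟨k, hk⟩ := s.a.var_arg hX (p := (x, U)) (by simp)
        exact hk.good
    · rcases List.mem_append.1 ha with ha | ha
      · exact aU a ha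
      · obtain rfl := List.mem_singleton.1 ha
        exact ⟨U, eu.symm ▸ hu⟩
  · intro a ha b hb
    refine dsl_of_eq hP h cX.der hY (fun p hp => mX p (List.mem_append_left _ hp)) mY (fun _ _ => rfl)
      (fun _ _ => rfl) (fun p hp q hq => ?_) hX hY (List.prefix_append _ _) List.prefix_rfl
      (gU a ha) ?_ (aU a ha) ?_
    · rw [upd_mem fx _ _ hp]
      rcases List.mem_append.1 hq with hq | hq
      · rw [upd_mem fy _ _ hq, ten_var_var]
        exact hτ p hp q hq
      · obtain rfl := List.mem_singleton.1 hq
        rw [upd_self]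
        exact hτy p hp
    · rcases List.mem_append.1 hb with hb | hb
      · exact (gV b hb).pfx (List.prefix_append _ _)
      · obtain rfl := List.mem_singleton.1 hb
        obtain ⟨k, hk⟩ := s.b.var_arg hY (p := (y, V)) (by simp)
        exact hk.good
    · rcases List.mem_append.1 hb with hb | hb
      · exact aV b hb
      · obtain rfl := List.mem_singleton.1 hb
        exact ⟨V, ev.symm ▸ hv⟩

end Sys
end FinalSort

section EqStep

variable {A B C : Alphabet}

namespace Sys

/-- Equal sorts of `A` have equal tensor products with the sorts of `B`. -/
def SeqS (s : Sys A B C) (n m : ℕ) : Prop :=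
  ∀ {X : PreCtx A} {U U' : SortE A} {x : A.Var} {Y Y1 : PreCtx B} {v : Expr B} {V : SortE B}
    {Δ : PreCtx C}, DerAt s.a.ax n (.sortEq X U U') → s.b.SAt m Y1 V → Y1 <+: Y →
    s.b.Arg m Y v V → s.In (X ++ [(x, U)]) Y1 Δ → s.In X Y Δ →
    Derivable s.ax (.sortEq Δ (s.TT (s.ten (X ++ [(x, U)]) Y) U (.var x) V v)
      (s.TT (s.ten (X ++ [(x, U')]) Y) U' (.var x) V v))

/-- Equal sorts of `A` have equal tensor products with the terms of `B`. -/
def SeqT (s : Sys A B C) (n m : ℕ) : Prop :=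
  ∀ {X : PreCtx A} {U U' : SortE A} {x : A.Var} {Y : PreCtx B} {v : Expr B} {V : SortE B}
    {Δ : PreCtx C}, DerAt s.a.ax n (.sortEq X U U') → s.b.Arg m Y v V →
    s.In (X ++ [(x, U)]) Y Δ →
    TEq s.ax Δ (s.ten (X ++ [(x, U)]) Y (.var x) v) (s.ten (X ++ [(x, U')]) Y (.var x) v)

/-- Equal terms of `A` have equal tensor products with the terms of `B`. -/
def TeqT (s : Sys A B C) (n m : ℕ) : Prop :=
  ∀ {X : PreCtx A} {u u' : Expr A} {U : SortE A} {Y : PreCtx B} {v : Expr B} {V : SortE B}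
    {Δ : PreCtx C}, DerAt s.a.ax n (.termEq X u u' U) → s.b.Arg m Y v V → s.In X Y Δ →
    TEq s.ax Δ (s.ten X Y u v) (s.ten X Y u' v)

variable {s : Sys A B C} {n m : ℕ}

theorem _root_.GATPaper.Thy.CtxAt.replace {T : Thy A} {X : PreCtx A} {x : A.Var} {U U' : SortE A}
    (hX : Derivable T.ax (.ctx (X ++ [(x, U)]))) (h : Derivable T.ax (.sort X U')) :
    Derivable T.ax (.ctx (X ++ [(x, U')])) := der_ctx_snoc T.pre h (nodup_snoc hX)

theorem In.conv (hS : s.SeqS n m) {X : PreCtx A} {U U' : SortE A} {x : A.Var} {Y : PreCtx B}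
    {Δ : PreCtx C} (hU : DerAt s.a.ax n (.sortEq X U U')) (hY : s.b.CtxAt m Y)
    (i : s.In (X ++ [(x, U)]) Y Δ) : s.In (X ++ [(x, U')]) Y Δ := by
  have hX' := Thy.CtxAt.replace i.ctxa hU.der.seq_right
  refine ⟨hX', i.ctxb, i.ctx, fun p hp q hq => ?_⟩
  rcases List.mem_append.1 hp with hp | hp
  · have h := i.has p (List.mem_append_left _ hp) q hq
    rw [E_pfx i.ctxa i.ctxb (List.prefix_append _ _) List.prefix_rfl hp hq] at h
    rwa [E_pfx hX' i.ctxb (List.prefix_append _ _) List.prefix_rfl hp hq]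
  · obtain rfl := List.mem_singleton.1 hp
    obtain ⟨Y1, hY1⟩ := mem_split_pfx hq
    refine (i.has (x, U) (by simp) q hq).conv (hS hU ⟨Y1, List.prefix_rfl, hY.entry _ _ _ hY1⟩
      ((List.prefix_append _ _).trans hY1) (hY.arg hq)
      (i.pfx List.prefix_rfl ((List.prefix_append _ _).trans hY1))
      (i.pfx (List.prefix_append _ _) List.prefix_rfl))

theorem _root_.GATPaper.Thy.last_arg {T : Thy A} {X : PreCtx A} {x : A.Var} {U : SortE A}
    (h : DerAt T.ax n (.sort X U)) : T.Arg n (X ++ [(x, U)]) (.var x) U :=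
  .inl ⟨x, X, rfl, List.prefix_rfl, h⟩

theorem _root_.GATPaper.Thy.SAt.shrink {T : Thy A} {X : PreCtx A} {U : SortE A}
    (h : T.SAt (n + 1) X U) : ∃ X0, X0 <+: X ∧ T.CtxAt n X0 ∧ T.SAt (n + 1) X0 U := by
  obtain ⟨X0, h1, h2⟩ := h
  exact ⟨X0, h1, .of_sort h2, X0, List.prefix_rfl, h2⟩

theorem _root_.GATPaper.Thy.Arg.shrink_app {T : Thy A} {X : PreCtx A} {t : A.TermSym}
    {f : List (Expr A)} {U : SortE A} (h : T.Arg (n + 1) X (.app t f) U) :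
    ∃ X0, X0 <+: X ∧ T.CtxAt n X0 ∧ T.Arg (n + 1) X0 (.app t f) U := by
  rcases h with ⟨x, X0, h1, h2, h3⟩ | ⟨X0, h1, h2⟩
  · exact absurd h1 (by simp)
  · exact ⟨X0, h1, .of_term h2, .inr ⟨X0, List.prefix_rfl, h2⟩⟩

theorem seqS_step (hF : s.Full) (h1 : s.Srt (n + 1) m) (h2 : s.Srt n (m + 1))
    (a2 : ∀ {X Y Δ}, s.In X Y Δ → s.Amb n (m + 1) X Y Δ) (hS1 : s.SeqS (n + 1) m)
    (hS2 : s.SeqS n (m + 1)) (hT1 : s.SeqT (n + 1) m) (hE2 : s.TeqT n (m + 1)) :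
    s.SeqS (n + 1) (m + 1) := by
  intro X U U' x Y Y1 v V Δ hU sV pY hv i1 i
  obtain ⟨Y2, pY2, cY2, sV⟩ := sV.shrink
  replace pY := pY2.trans pY
  replace i1 := i1.pfx List.prefix_rfl pY2
  obtain ⟨dU, dU'⟩ := hU.seq_sorts
  have hd : ∀ {W}, DerAt s.a.ax n (.sort X W) → s.In (X ++ [(x, W)]) Y2 Δ →
      Derivable s.ax (.sort Δ (s.TT (s.ten (X ++ [(x, W)]) Y) W (.var x) V v)) := fun hW j =>
    h2 j i (List.prefix_append _ _) pY ⟨X, List.prefix_rfl, hW⟩ sV (Thy.last_arg hW) hv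
  have i1' := i1.conv hS1 hU cY2
  have hx : ∀ b, (∃ W, s.b.Arg m Y2 b W) →
      TEq s.ax Δ (s.ten (X ++ [(x, U)]) Y (.var x) b) (s.ten (X ++ [(x, U')]) Y (.var x) b) := by
    rintro b ⟨W, hb⟩
    rw [ten_pfx i1.ctxa i.ctxb List.prefix_rfl pY (Thy.last_arg dU).good hb.good,
      ten_pfx i1'.ctxa i.ctxb List.prefix_rfl pY (Thy.last_arg dU').good hb.good]
    exact hT1 hU hb i1
  rcases Thy.seq_cases hU with rfl | hU | hU | ⟨W, hU1, hU2⟩ |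
    ⟨X0, U0, U0', φ, ax1, d1, mφ, rfl, rfl⟩ | ⟨hh, hf⟩
  · exact (hd dU i1).srefl
  · exact hS2 hU sV pY hv i1 i
  · exact (hS2 hU sV pY hv i1' i).ssymm
  · exact (hS2 hU1 sV pY hv i1 i).strans (hS2 hU2 sV pY hv (i1.conv hS1 hU1.succ cY2) i)
  · obtain ⟨Y0, ψ, ax2, d2, mψ, eψ⟩ := sV.inv'
    obtain ⟨dU0, dU0'⟩ := d1.seq_sorts
    obtain ⟨fx, cX0, cX⟩ := Thy.CtxAt.snoc_ch dU0.succ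
    obtain ⟨fy, cY0, cY⟩ := Thy.CtxAt.snoc_ch d2
    obtain ⟨j1, j2⟩ := in_tctxD hF.pre h1 h2 cX0 cX cY0 cY
    have j1' := j1.conv hS1 d1 cY0
    have K := hF.half.seqs ax1 ax2
      (h2 j1 j2 (List.prefix_append _ _) (List.prefix_append _ _) ⟨X0, List.prefix_rfl, dU0⟩
        ⟨Y0, List.prefix_rfl, d2⟩ (Thy.last_arg dU0) (Thy.last_arg d2))
      (h2 j1' j2 (List.prefix_append _ _) (List.prefix_append _ _) ⟨X0, List.prefix_rfl, dU0'⟩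
        ⟨Y0, List.prefix_rfl, d2⟩ (Thy.last_arg dU0') (Thy.last_arg d2))
    have mΦ := mφ.upd le_rfl (List.prefix_append X [(x, U0.subst φ)]) cX.der (Thy.last_arg dU)
    have mΨ := mψ.upd (Nat.le_succ m) pY (u := v) cY.der (by rw [eψ]; exact hv)
    have hT : Typed s.ax (s.tau fun a b => s.ten (X ++ [(x, U0.subst φ)]) Y
        (upd φ (s.a.ch X0) (.var x) a) (upd ψ (s.b.ch Y0) v b))
        (s.tctxD X0 (s.a.ch X0, U0) Y0 (s.b.ch Y0, ⟨V.head, ctxVars Y0⟩)) Δ :=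
      (typed_tctxD cX.der cY.der).2
        ⟨typed_sub hF.pre (a2 i1) cX.der cY0.der mΦ ((mψ.cons cY.der).mono (Nat.le_succ m))
          (fun _ _ => rfl) (fun _ _ => rfl) i1.ctxa i.ctxb List.prefix_rfl pY,
        typed_sub hF.pre (a2 i) cX0.der cY.der (mφ.cons cX.der) mΨ (fun _ _ => rfl)
          (fun _ _ => rfl) i1.ctxa i.ctxb (List.prefix_append _ _) List.prefix_rfl⟩
    have R := K.subst hF.pre i.ctx hT
    have fin : ∀ {W}, DerAt s.a.ax n (.sort X0 W) → DerAt s.a.ax n (.sort X (W.subst φ)) →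
        s.In (X ++ [(x, W.subst φ)]) Y2 Δ →
        (∀ b, (∃ V', s.b.Arg m Y2 b V') → TEq s.ax Δ (s.ten (X ++ [(x, U0.subst φ)]) Y (.var x) b)
          (s.ten (X ++ [(x, W.subst φ)]) Y (.var x) b)) →
        Derivable s.ax (.sortEq Δ ((s.TT (s.ten (s.a.ext X0 W) (s.b.ext Y0 ⟨V.head, ctxVars Y0⟩)) W
          (.var (s.a.ch X0)) ⟨V.head, ctxVars Y0⟩ (.var (s.b.ch Y0))).subst
            (s.tau fun a b => s.ten (X ++ [(x, U0.subst φ)]) Y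
              (upd φ (s.a.ch X0) (.var x) a) (upd ψ (s.b.ch Y0) v b)))
          (s.TT (s.ten (X ++ [(x, W.subst φ)]) Y) (W.subst φ) (.var x) V v)) := by
      intro W dW dW' iW hxW
      have eW := upd_sort s.a.pre dW.der fx φ (.var x)
      have ex : (Expr.var (s.a.ch X0)).subst (upd φ (s.a.ch X0) (.var x)) = .var x := by
        rw [Expr.subst_var, upd_self]
      have eV : (⟨V.head, ctxVars Y0⟩ : SortE B).subst (upd ψ (s.b.ch Y0) v) = V := by
        rw [upd_sort s.b.pre d2.der fy, eψ]
      have ev : (Expr.var (s.b.ch Y0)).subst (upd ψ (s.b.ch Y0) v) = v := by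
        rw [Expr.subst_var, upd_self]
      have cXW := Thy.CtxAt.replace cX.der dW.der
      have argW : ∀ a ∈ W.args, s.a.Good X0 a ∧
          ∃ W', s.a.Arg n X (a.subst (upd φ (s.a.ch X0) (.var x))) W' := by
        intro a ha
        obtain ⟨k, rfl⟩ := dW.pos
        refine ⟨?_, ?_⟩
        · obtain ⟨W', h⟩ := Thy.SAt.args (T := s.a) ⟨X0, List.prefix_rfl, dW⟩ a ha
          exact h.good
        · rw [← eW] at dW'
          obtain ⟨W', h⟩ := Thy.SAt.args (T := s.a) ⟨X, List.prefix_rfl, dW'⟩ _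
            (List.mem_map_of_mem ha)
          exact ⟨W', h.mono (Nat.le_succ k)⟩
      have argV : ∀ b ∈ ctxVars Y0 ++ [.var (s.b.ch Y0)],
          s.b.Good (Y0 ++ [(s.b.ch Y0, ⟨V.head, ctxVars Y0⟩)]) b ∧
          ∃ W', s.b.Arg (m + 1) Y (b.subst (upd ψ (s.b.ch Y0) v)) W' := by
        intro b hb
        have hb' : b ∈ ctxVars (Y0 ++ [(s.b.ch Y0, (⟨V.head, ctxVars Y0⟩ : SortE B))]) := by
          rw [mem_ctxVars_snoc]; exact hb
        obtain ⟨q, hq, rfl⟩ := List.mem_map.1 hb'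
        exact ⟨(cY.arg hq).good, _, by rw [Expr.subst_var]; exact mΨ q hq⟩
      have main : ∀ a ∈ W.args, ∀ b ∈ ctxVars Y0 ++ [.var (s.b.ch Y0)],
          TEq s.ax Δ ((s.ten (s.a.ext X0 W) (s.b.ext Y0 ⟨V.head, ctxVars Y0⟩) a b).subst
            (s.tau fun a b => s.ten (X ++ [(x, U0.subst φ)]) Y
              (upd φ (s.a.ch X0) (.var x) a) (upd ψ (s.b.ch Y0) v b)))
            (s.ten (X ++ [(x, W.subst φ)]) Y (a.subst (upd φ (s.a.ch X0) (.var x)))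
              (b.subst (upd ψ (s.b.ch Y0) v))) := by
        intro a ha b hb
        obtain ⟨ga, Wa, ha'⟩ := argW a ha
        obtain ⟨gb, Wb, hb'⟩ := argV b hb
        rw [ten_pfx iW.ctxa i.ctxb (List.prefix_append _ _) List.prefix_rfl ha'.good hb'.good,
          ← ten_pfx i1.ctxa i.ctxb (List.prefix_append X [(x, U0.subst φ)]) List.prefix_rfl
            ha'.good hb'.good]
        exact dsl_sub hF.pre (a2 i) cX0.der cY.der (mφ.cons cX.der) mΨ (fun _ _ => rfl)
          (fun _ _ => rfl) i1.ctxa i.ctxb (List.prefix_append _ _) List.prefix_rfl cXW cY.der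
          (List.prefix_append _ _) List.prefix_rfl ga gb ⟨Wa, ha'⟩ ⟨Wb, hb'⟩
      have key := TT_sub (s := s) (φ := upd φ (s.a.ch X0) (.var x)) (ψ := upd ψ (s.b.ch Y0) v)
        (F := s.ten (s.a.ext X0 W) (s.b.ext Y0 ⟨V.head, ctxVars Y0⟩))
        (τ := s.tau fun a b => s.ten (X ++ [(x, U0.subst φ)]) Y
              (upd φ (s.a.ch X0) (.var x) a) (upd ψ (s.b.ch Y0) v b))
        (U := W) (u := .var (s.a.ch X0)) (V := ⟨V.head, ctxVars Y0⟩) (v := .var (s.b.ch Y0))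
        (G := s.ten (X ++ [(x, W.subst φ)]) Y) (Δ := Δ) hF.pre
        (by rw [eW, ex, eV, ev]; exact hd dW' iW)
        (by
          intro a ha b hb
          rcases List.mem_append.1 ha with ha | ha
          · exact main a ha b (List.mem_append_left _ hb)
          · obtain rfl := List.mem_singleton.1 ha
            obtain ⟨q, hq, rfl⟩ := List.mem_map.1 hb
            rw [ex, ten_var_var, Expr.subst_var, tau_v, Expr.subst_var, upd_self, upd_mem fy _ _ hq]
            exact hxW _ ⟨_, mψ q hq⟩)
        main
      rwa [eW, ex, eV, ev] at key
    have g1 := fin dU0 dU i1 fun b hb => by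
      obtain ⟨W, hb⟩ := hb
      rw [ten_pfx i1.ctxa i.ctxb List.prefix_rfl pY (Thy.last_arg dU).good hb.good]
      exact ((a2 i1).typ (Thy.last_arg dU) (hb.mono (Nat.le_succ m))).teq_refl
    exact g1.ssymm.strans (R.strans (fin dU0' dU' i1' hx))
  · obtain ⟨S, f⟩ := U
    obtain ⟨S', g⟩ := U'
    obtain rfl : S = S' := hh
    refine cong_sort hF.pre (hd dU i1) (forall₂_grD _ hf forall₂_mem ?_ ?_ ?_)
    · rintro a a' b _ ⟨W, ha⟩ ⟨rfl, hb⟩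
      obtain ⟨W', hb⟩ := hv.sat.args b hb
      obtain ⟨d, d'⟩ := ha.succ.teq_terms
      rw [ten_pfx i1.ctxa i.ctxb (List.prefix_append _ _) List.prefix_rfl
        (.of_der d.der) hb.good, ten_pfx i1'.ctxa i.ctxb (List.prefix_append _ _)
        List.prefix_rfl (.of_der d'.der) hb.good]
      exact hE2 ha (hb.mono (Nat.le_succ m)) i
    · rintro b _ ⟨rfl, hb⟩
      exact hx b (sV.args b hb)
    · rintro a a' ⟨W, ha⟩
      obtain ⟨d, d'⟩ := ha.succ.teq_terms
      rw [ten_pfx i1.ctxa i.ctxb (List.prefix_append _ _) List.prefix_rfl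
        (.of_der d.der) hv.good, ten_pfx i1'.ctxa i.ctxb (List.prefix_append _ _)
        List.prefix_rfl (.of_der d'.der) hv.good]
      exact hE2 ha hv i

end Sys
end EqStep

section EqStepTerm

variable {A B C : Alphabet}

namespace Sys

variable {s : Sys A B C} {n m : ℕ}

theorem seqT_step (hF : s.Full) (h1 : s.Srt (n + 1) m)
    (a2 : ∀ {X Y Δ}, s.In X Y Δ → s.Amb n (m + 1) X Y Δ) (hS1 : s.SeqS (n + 1) m)
    (hS3 : s.SeqS (n + 1) (m + 1)) (hT1 : s.SeqT (n + 1) m) (hT2 : s.SeqT n (m + 1))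
    (hE2 : s.TeqT n (m + 1)) : s.SeqT (n + 1) (m + 1) := by
  intro X U U' x Y v V Δ hU hv i
  obtain ⟨dU, dU'⟩ := hU.seq_sorts
  cases v with
  | var y =>
    rw [ten_var_var, ten_var_var]
    have hy : y ∈ Y.map Prod.fst := hv.good.occ i.ctxb .var
    obtain ⟨q, hq, rfl⟩ := List.mem_map.1 hy
    exact (i.has (x, U) (by simp) q hq).teq_refl
  | app t g =>
  obtain ⟨Y2, pY, cY2, hv2⟩ := hv.shrink_app
  clear hv
  rename' hv2 => hv
  rw [ten_pfx i.ctxa i.ctxb List.prefix_rfl pY (Thy.last_arg dU).good hv.good,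
    ten_pfx (Thy.CtxAt.replace i.ctxa hU.der.seq_right) i.ctxb List.prefix_rfl pY
      (Thy.last_arg dU').good hv.good]
  replace i := i.pfx List.prefix_rfl pY
  clear pY
  clear Y
  rename' Y2 => Y, cY2 => cY
  have i' := i.conv hS1 hU cY
  rcases Thy.seq_cases hU with rfl | hU | hU | ⟨W, hU1, hU2⟩ |
    ⟨X0, U0, U0', φ, ax1, d1, mφ, rfl, rfl⟩ | ⟨hh, hf⟩
  · exact ((a2 i).typ (Thy.last_arg dU) hv).teq_refl
  · exact hT2 hU hv i
  · exact (hT2 hU hv i').symm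
  · exact (hT2 hU1 hv i).trans hF.pre (hT2 hU2 hv (i.conv hS1 hU1.succ cY))
  · obtain ⟨Yt, V0, ψ, ax2, d2, mψ, eψ, sV, cV⟩ := hv.inv'
    obtain ⟨dU0, dU0'⟩ := d1.seq_sorts
    obtain ⟨fx, cX0, cX⟩ := Thy.CtxAt.snoc_ch dU0.succ
    have cYt := Thy.CtxAt.of_term d2
    have at' : s.b.Arg (m + 1) Yt (.app t (ctxVars Yt)) V0 := .inr ⟨Yt, List.prefix_rfl, d2⟩
    have j := in_tctx hF.pre h1 cX cYt
    have j' := j.conv hS1 d1 cYt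
    have e := (a2 j).typ (Thy.last_arg dU0) at'
    have e' := ((a2 j').typ (Thy.last_arg dU0') at').conv
      (hS3 d1 ⟨Yt, List.prefix_rfl, d2.term_sort.succ⟩ List.prefix_rfl at' j
        (j.pfx (List.prefix_append _ _) List.prefix_rfl)).ssymm
    have fy : s.b.ch Yt ∉ Yt.map Prod.fst :=
      (Thy.CtxAt.snoc_ch d2.term_sort.succ).1
    have cY' : Derivable s.b.ax (.ctx (Yt ++ [(s.b.ch Yt, V0)])) :=
      der_ctx_snoc s.b.pre d2.term_sort.der fy
    obtain ⟨τ, hτ, hτx, hτy, hK⟩ := hF.half.seqt ax1 ax2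
    have S := final_sort hF.pre (a2 j) (X := X0) (U := U0) (x := s.a.ch X0) (Y := Yt) (V := V0)
      (y := s.b.ch Yt) (τ := τ) (cX0.mono (Nat.le_refl n)) (cYt.mono (Nat.le_succ m)) cX.der cY'
      (List.prefix_append _ _) List.prefix_rfl (Thy.last_arg dU0) at' e.term_sort
      (Thy.SAt.args' ⟨_, List.prefix_rfl, dU0⟩)
      (Thy.SAt.args' ⟨_, List.prefix_rfl, d2.term_sort.succ⟩) hτ
      (fun q hq => (hτx q hq).trans (ten_var_var _ _ _ _ _).symm) hτy
    obtain ⟨_, K⟩ := hK (e.conv S.ssymm) (e'.conv S.ssymm)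
    have mΦ := mφ.upd le_rfl (List.prefix_append X [(x, U0.subst φ)]) cX.der (Thy.last_arg dU)
    have mΦ' := mφ.upd le_rfl (List.prefix_append X [(x, U0'.subst φ)])
      (Thy.CtxAt.replace cX.der dU0'.der) (Thy.last_arg dU')
    have mψ' := mψ.mono (Nat.le_succ m)
    have hT := typed_sub hF.pre (a2 i) cX.der cYt.der mΦ mψ' (fun _ _ => rfl) (fun _ _ => rfl)
      i.ctxa i.ctxb List.prefix_rfl List.prefix_rfl
    have R : TEq _ _ _ _ := ⟨_, K.subst hF.pre i.ctx hT⟩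
    have ex : (Expr.var (s.a.ch X0)).subst (upd φ (s.a.ch X0) (.var x)) = .var x := by
      rw [Expr.subst_var, upd_self]
    have et : (Expr.app t (ctxVars Yt)).subst ψ = .app t g := by rw [Expr.subst_app, eψ]
    have D1 := dsl_sub hF.pre (a2 i) cX.der cYt.der mΦ mψ' (fun _ _ => rfl) (fun _ _ => rfl)
      i.ctxa i.ctxb List.prefix_rfl List.prefix_rfl cX.der cYt.der List.prefix_rfl List.prefix_rfl
      (Thy.last_arg dU0).good at'.good ⟨_, by rw [ex]; exact Thy.last_arg dU⟩
      ⟨_, by rw [et]; exact hv⟩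
    have D2 := dsl_sub hF.pre (a2 i') (Thy.CtxAt.replace cX.der dU0'.der) cYt.der mΦ' mψ'
      (fun _ _ => rfl) (fun _ _ => rfl)
      i'.ctxa i.ctxb List.prefix_rfl List.prefix_rfl (Thy.CtxAt.replace cX.der dU0'.der) cYt.der
      List.prefix_rfl List.prefix_rfl
      (Thy.last_arg dU0').good at'.good ⟨_, by rw [ex]; exact Thy.last_arg dU'⟩
      ⟨_, by rw [et]; exact hv⟩
    rw [ex, et] at D1 D2
    refine D1.symm.trans hF.pre (R.trans hF.pre (TEq.trans hF.pre ⟨_, term_msub hF.pre e' hT i.ctx ?_⟩ D2))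
    intro r hr
    obtain ⟨p, hp, q, hq, rfl⟩ := mem_tctx.1 hr
    rw [tau_v, tau_v]
    rcases List.mem_append.1 hp with hp | hp
    · rw [upd_mem fx _ _ hp]
      have hp' := mφ p hp
      have hq' := mψ q hq
      rw [ten_pfx i'.ctxa i.ctxb (List.prefix_append _ _) List.prefix_rfl hp'.good hq'.good,
        ten_pfx i.ctxa i.ctxb (List.prefix_append _ _) List.prefix_rfl hp'.good hq'.good]
      exact ((a2 (i.pfx (List.prefix_append _ _) List.prefix_rfl)).typ hp'
        (mψ' q hq)).teq_refl
    · obtain rfl := List.mem_singleton.1 hp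
      rw [upd_self]
      exact hT1 hU (mψ q hq) i
  · obtain ⟨S, f⟩ := U
    obtain ⟨S', f'⟩ := U'
    obtain rfl : S = S' := hh
    have hd := (a2 i).typ (Thy.last_arg dU) hv
    rw [ten_left i.ctxa (Thy.last_arg dU).good hv.good (.inl ⟨_, rfl⟩),
      Thy.cs_var i.ctxa (U := ⟨S, f⟩) (by simp)] at hd ⊢
    rw [ten_left i'.ctxa (Thy.last_arg dU').good hv.good (.inl ⟨_, rfl⟩),
      Thy.cs_var i'.ctxa (U := ⟨S, f'⟩) (by simp)]
    have hR : List.Forall₂ (fun a a' => (∃ W, DerAt s.a.ax n (.termEq X a a' W)) ∨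
        (a = .var x ∧ a' = .var x)) (f ++ [.var x]) (f' ++ [.var x]) :=
      List.rel_append (List.Forall₂.imp (fun _ _ h => .inl h) hf) (.cons (.inr ⟨rfl, rfl⟩) .nil)
    refine cong_app hF.pre hd (forall₂_gr _ hR forall₂_mem ?_)
    · rintro a a' b _ ha ⟨rfl, hb⟩
      obtain ⟨W', hb⟩ := hv.args b hb
      rcases ha with ⟨W, ha⟩ | ⟨rfl, rfl⟩
      · obtain ⟨d, d'⟩ := ha.succ.teq_terms
        rw [ten_pfx i.ctxa i.ctxb (List.prefix_append _ _) List.prefix_rfl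
          (.of_der d.der) hb.good, ten_pfx i'.ctxa i.ctxb (List.prefix_append _ _)
          List.prefix_rfl (.of_der d'.der) hb.good]
        exact hE2 ha (hb.mono (Nat.le_succ m)) (i.pfx (List.prefix_append _ _) List.prefix_rfl)
      · exact hT1 hU hb i

theorem teqT_step (hF : s.Full) (h2 : s.Srt n (m + 1))
    (a2 : ∀ {X Y Δ}, s.In X Y Δ → s.Amb n (m + 1) X Y Δ) (hE1 : s.TeqT (n + 1) m)
    (hE2 : s.TeqT n (m + 1)) : s.TeqT (n + 1) (m + 1) := by
  intro X u u' U Y v V Δ hu hv i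
  obtain ⟨du, du'⟩ := hu.teq_terms
  have au : s.a.Arg n X u U := .inr ⟨X, List.prefix_rfl, du⟩
  have au' : s.a.Arg n X u' U := .inr ⟨X, List.prefix_rfl, du'⟩
  rcases Thy.teq_cases hu with rfl | ⟨W, hu⟩ | hu | ⟨w, hu1, hu2⟩ |
    ⟨X0, w, w', W, φ, ax1, d1, mφ, rfl, rfl⟩ | ⟨t, f, g, rfl, rfl, hf⟩
  · exact ((a2 i).typ au hv).teq_refl
  · exact hE2 hu hv i
  · exact (hE2 hu hv i).symm
  · exact (hE2 hu1 hv i).trans hF.pre (hE2 hu2 hv i)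
  · obtain ⟨Y0, ψ, ax2, d2, mψ, eψ⟩ := hv.sat.inv'
    obtain ⟨dw, dw'⟩ := d1.teq_terms
    have aw : s.a.Arg n X0 w W := .inr ⟨X0, List.prefix_rfl, dw⟩
    have aw' : s.a.Arg n X0 w' W := .inr ⟨X0, List.prefix_rfl, dw'⟩
    obtain ⟨k, rfl⟩ := dw.pos
    have cX0 := (Thy.CtxAt.of_term dw).mono (Nat.le_succ k)
    obtain ⟨fy, cY0, cY⟩ := Thy.CtxAt.snoc_ch d2
    have j := in_tctx hF.pre h2 cX0 cY
    have e := (a2 j).typ aw cY.last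
    have hd := e.term_sort
    have e' := ((a2 j).typ aw' cY.last).conv (cong_sort hF.pre hd (forall₂_grD (a := w)
      (a' := w') s.ord forall₂_mem forall₂_mem ?_ ?_ ?_)).ssymm
    · have K := hF.half.teqs ax1 ax2 e e'
      have mΨ := mψ.upd (Nat.le_succ m) List.prefix_rfl (u := v) cY.der (by rw [eψ]; exact hv)
      have hT := typed_sub hF.pre (a2 i) cX0.der cY.der mφ mΨ (fun _ _ => rfl) (fun _ _ => rfl)
        i.ctxa i.ctxb List.prefix_rfl List.prefix_rfl
      have R : TEq _ _ _ _ := ⟨_, K.subst hF.pre i.ctx hT⟩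
      have ev : (Expr.var (s.b.ch Y0)).subst (upd ψ (s.b.ch Y0) v) = v := by
        rw [Expr.subst_var, upd_self]
      have D : ∀ {z Z}, s.a.Arg (k + 1) X0 z W → s.a.Arg (k + 1) X (z.subst φ) Z → TEq s.ax Δ
          ((s.ten X0 (s.b.ext Y0 ⟨V.head, ctxVars Y0⟩) z (.var (s.b.ch Y0))).subst
            (s.tau fun a b => s.ten X Y (φ a) (upd ψ (s.b.ch Y0) v b)))
          (s.ten X Y (z.subst φ) v) := by
        intro z Z az az'
        have := dsl_sub hF.pre (a2 i) cX0.der cY.der mφ mΨ (fun _ _ => rfl) (fun _ _ => rfl)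
          i.ctxa i.ctxb List.prefix_rfl List.prefix_rfl cX0.der cY.der List.prefix_rfl
          List.prefix_rfl az.good cY.last.good ⟨_, az'⟩ ⟨_, by rw [ev]; exact hv⟩
        rwa [ev] at this
      exact (D aw au).symm.trans hF.pre (R.trans hF.pre (D aw' au'))
    · rintro a _ b _ ⟨rfl, ha⟩ ⟨rfl, hb⟩
      obtain ⟨_, ha⟩ := aw.all_arg a (List.mem_append_left _ ha)
      obtain ⟨_, hb⟩ := cY.last.all_arg b (List.mem_append_left _ hb)
      exact ((a2 j).typ ha hb).teq_refl
    · rintro b _ ⟨rfl, hb⟩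
      obtain ⟨q, hq, rfl⟩ := List.mem_map.1 hb
      exact hE1 d1 ((cY0.arg hq).pfx (List.prefix_append _ _)) j
    · rintro a _ ⟨rfl, ha⟩
      obtain ⟨_, ha⟩ := aw.all_arg a (List.mem_append_left _ ha)
      exact ((a2 j).typ ha cY.last).teq_refl
  · have h3 := (a2 i).right au hv
    refine h3.trans hF.pre (TEq.trans hF.pre ?_ ((a2 i).right au' hv).symm)
    obtain ⟨W, h3⟩ := h3
    refine cong_app hF.pre h3.teq_right (forall₂_gr _ hf forall₂_mem ?_)
    rintro a a' b _ ⟨W, ha⟩ ⟨rfl, hb⟩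
    obtain ⟨_, hb⟩ := hv.all_arg b hb
    exact hE2 ha hb i

end Sys
end EqStepTerm

section AmbStep

variable {A B C : Alphabet}

theorem Thy.Arg.shrink {T : Thy A} {n : ℕ} {X : PreCtx A} (hX : Derivable T.ax (.ctx X))
    {u : Expr A} {U : SortE A} (h : T.Arg n X u U) :
    ∃ X0, X0 <+: X ∧ T.CtxAt n X0 ∧ T.Arg n X0 u U := by
  rcases h with ⟨x, X0, h1, h2, h3⟩ | ⟨X0, h1, h2⟩
  · obtain ⟨k, rfl⟩ := h3.pos
    exact ⟨_, h2, ((Thy.CtxAt.of_sort h3).mono (Nat.le_succ k)).snoc h3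
      (nodup_snoc (der_ctx_pfx hX h2)), .inl ⟨x, X0, h1, List.prefix_rfl, h3⟩⟩
  · obtain ⟨k, rfl⟩ := h2.pos
    exact ⟨X0, h1, (Thy.CtxAt.of_term h2).mono (Nat.le_succ k), .inr ⟨X0, List.prefix_rfl, h2⟩⟩

namespace Sys

/-- What is known when passing to the stage `(n + 1, m + 1)`. -/
structure Stage (s : Sys A B C) (n m : ℕ) : Prop where
  full : s.Full
  srt1 : s.Srt (n + 1) m
  srt2 : s.Srt n (m + 1)
  srt : s.Srt (n + 1) (m + 1)
  amb1 : ∀ {X Y Δ}, s.In X Y Δ → s.Amb (n + 1) m X Y Δ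
  amb2 : ∀ {X Y Δ}, s.In X Y Δ → s.Amb n (m + 1) X Y Δ
  seqS : s.SeqS (n + 1) (m + 1)
  seqT : s.SeqT (n + 1) (m + 1)
  seqS' : s.swap.SeqS (m + 1) (n + 1)
  seqT' : s.swap.SeqT (m + 1) (n + 1)

variable {s : Sys A B C} {n m : ℕ} {X X0 : PreCtx A} {Y Y0 : PreCtx B} {Δ : PreCtx C}

theorem Stage.swap (h : s.Stage n m) : s.swap.Stage m n where
  full := h.full.swap
  srt1 := Srt.swap h.srt2
  srt2 := Srt.swap h.srt1
  srt := Srt.swap h.srt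
  amb1 i := (h.amb2 i.of_swap).swap
  amb2 i := (h.amb1 i.of_swap).swap
  seqS := h.seqS'
  seqT := h.seqT'
  seqS' := by rw [swap_swap]; exact h.seqS
  seqT' := by rw [swap_swap]; exact h.seqT

theorem Stage.left_typ (h : s.Stage n m) {u : Expr A} {U : SortE A}
    {t : B.TermSym} {g : List (Expr B)} {V : SortE B} (i : s.In X Y Δ)
    (hu : s.a.Arg (n + 1) X u U) (hv : s.b.Arg (m + 1) Y (.app t g) V) :
    Derivable s.ax (.term Δ (s.L (s.ten X Y) U u t g)
      (s.TT (s.ten X Y) U u (s.b.cs Y (.app t g)) (.app t g))) :=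
  Sys.left_typ h.full h.srt1 h.srt h.amb1 h.amb2 i hu hv

theorem Stage.right_typ (h : s.Stage n m) {v : Expr B} {V : SortE B}
    {t : A.TermSym} {f : List (Expr A)} {U : SortE A} (i : s.In X Y Δ)
    (hu : s.a.Arg (n + 1) X (.app t f) U) (hv : s.b.Arg (m + 1) Y v V) :
    Derivable s.ax (.term Δ (s.R (s.ten X Y) t f V v)
      (s.TT (s.ten X Y) (s.a.cs X (.app t f)) (.app t f) V v)) := by
  have := h.swap.left_typ i.swap hv hu
  rw [ten_swap'] at this
  rw [R_eq, ← TT_swap]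
  exact this

theorem Stage.canon_half (h : s.Stage n m) {u : Expr A} {U : SortE A}
    {t : B.TermSym} {g : List (Expr B)} {V : SortE B} (i : s.In X Y Δ)
    (hu : s.a.Arg (n + 1) X u U) (hv : s.b.Arg (m + 1) Y (.app t g) V)
    (hc : (∃ x, u = .var x) ∨ s.pref = true) :
    Derivable s.ax (.term Δ (s.ten X Y u (.app t g))
      (s.TT (s.ten X Y) (s.a.cs X u) u (s.b.cs Y (.app t g)) (.app t g))) := by
  rw [ten_left i.ctxa hu.good hv.good hc]
  exact h.left_typ i (hu.cs_arg i.ctxa) hv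

theorem Stage.canon (h : s.Stage n m) {u : Expr A} {U : SortE A} {v : Expr B} {V : SortE B}
    (i : s.In X Y Δ) (hu : s.a.Arg (n + 1) X u U) (hv : s.b.Arg (m + 1) Y v V) :
    Derivable s.ax (.term Δ (s.ten X Y u v)
      (s.TT (s.ten X Y) (s.a.cs X u) u (s.b.cs Y v) v)) := by
  have right : ∀ {t f}, u = .app t f → ((∃ x, v = .var x) ∨ s.pref = false) →
      Derivable s.ax (.term Δ (s.ten X Y u v)
        (s.TT (s.ten X Y) (s.a.cs X u) u (s.b.cs Y v) v)) := by
    rintro t f rfl hc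
    have := h.swap.canon_half i.swap hv hu (hc.imp_right fun h => by simp [Sys.swap, h])
    rw [ten_swap'] at this
    rw [← TT_swap]
    exact this
  cases u with
  | var x =>
    cases v with
    | var y =>
      have hx : x ∈ X.map Prod.fst := hu.good.occ i.ctxa .var
      have hy : y ∈ Y.map Prod.fst := hv.good.occ i.ctxb .var
      obtain ⟨p, hp, rfl⟩ := List.mem_map.1 hx
      obtain ⟨q, hq, rfl⟩ := List.mem_map.1 hy
      rw [ten_var_var, Thy.cs_var i.ctxa (U := p.2) hp, Thy.cs_var i.ctxb (U := q.2) hq]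
      exact i.has p hp q hq
    | app t g => exact h.canon_half i hu hv (.inl ⟨x, rfl⟩)
  | app t f =>
    cases v with
    | var y => exact right rfl (.inl ⟨y, rfl⟩)
    | app t' g =>
      rcases hp : s.pref with _ | _
      · exact right rfl (.inr hp)
      · exact h.canon_half i hu hv (.inr hp)

/-- The substitution of `u` for the last variable of a context. -/
noncomputable def last (s : Sys A B C) (X X0 : PreCtx A) (Y : PreCtx B) (u : Expr A) :
    C.Var → Expr C :=
  s.tau fun a b => s.ten X Y (upd .var (s.a.ch X0) u a) (.var b)

theorem Stage.last_ten (h : s.Stage n m) {u : Expr A} {W : SortE A}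
    (i : s.In X Y Δ) (hW : DerAt s.a.ax n (.sort X0 W)) (pX : X0 <+: X) (pY : Y0 <+: Y)
    (hu : s.a.Arg (n + 1) X u W) (cY : s.b.CtxAt (m + 1) Y0) :
    (∀ a ∈ W.args ++ [.var (s.a.ch X0)], ∀ b, (∃ V, s.b.Arg m Y0 b V) → (∃ Y1, Y1 <+: Y0 ∧
      s.b.CtxAt m Y1 ∧ s.b.Good Y1 b) → TEq s.ax Δ
        ((s.ten (s.a.ext X0 W) Y0 a b).subst (s.last X X0 Y u))
        (s.ten X Y (a.subst (upd .var (s.a.ch X0) u)) (b.subst .var))) ∧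
    (∀ a ∈ W.args, ∀ b, (∃ V, s.b.Arg (m + 1) Y0 b V) → TEq s.ax Δ
        ((s.ten (s.a.ext X0 W) Y0 a b).subst (s.last X X0 Y u))
        (s.ten X Y (a.subst (upd .var (s.a.ch X0) u)) (b.subst .var))) := by
  obtain ⟨k, rfl⟩ := hW.pos
  obtain ⟨fx, cX0, cX⟩ := Thy.CtxAt.snoc_ch hW
  have eW : W.subst (upd .var (s.a.ch X0) u) = W := by
    rw [upd_sort s.a.pre hW.der fx, SortE.subst_id]
  have ex : (Expr.var (s.a.ch X0)).subst (upd .var (s.a.ch X0) u) = u := by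
    rw [Expr.subst_var, upd_self]
  have mX : s.a.Mor (k + 1) .var X0 X := (cX0.mor.pfx pX).mono (Nat.le_succ k)
  have mΦ : s.a.Mor (k + 1 + 1) (upd .var (s.a.ch X0) u) (s.a.ext X0 W) X :=
    mX.upd (Nat.le_succ _) List.prefix_rfl cX.der (by rw [SortE.subst_id]; exact hu)
  constructor
  · rintro a ha b ⟨V, hb⟩ ⟨Y1, pY1, cY1, gb⟩
    refine dsl_sub h.full.pre (h.amb1 i) cX.der cY1.der mΦ (cY1.mor.pfx (pY1.trans pY))
      (fun _ _ => rfl) (fun _ _ => rfl) i.ctxa i.ctxb List.prefix_rfl List.prefix_rfl cX.der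
      cY.der List.prefix_rfl pY1 (cX.last.all_good a ha) gb
      (all_arg_subst (by rw [eW, ex]; exact hu) a ha) ⟨V, ?_⟩
    rw [Expr.subst_id]
    exact hb.pfx pY
  · rintro a ha b ⟨V, hb⟩
    have sW : s.a.SAt (k + 1) X0 W := ⟨X0, List.prefix_rfl, hW⟩
    obtain ⟨W1, ha1⟩ := sW.args a ha
    have ha2 : a.subst (upd .var (s.a.ch X0) u) ∈ W.args := by
      have h := List.mem_map_of_mem (f := Expr.subst (upd .var (s.a.ch X0) u)) ha
      change _ ∈ (W.subst _).args at h
      rwa [eW] at h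
    obtain ⟨W2, ha2⟩ := sW.args _ ha2
    refine dsl_sub h.full.pre (h.amb2 i) cX0.der cY.der mX (cY.mor.pfx pY)
      (fun p hp => upd_mem fx _ _ hp) (fun _ _ => rfl) i.ctxa i.ctxb List.prefix_rfl
      List.prefix_rfl cX.der cY.der (List.prefix_append _ _) List.prefix_rfl ha1.good hb.good
      ⟨W2, (ha2.pfx pX).mono (Nat.le_succ k)⟩ ⟨V, ?_⟩
    rw [Expr.subst_id]
    exact hb.pfx pY

theorem Stage.last_sort (h : s.Stage n m) {u : Expr A} {W : SortE A} {v : Expr B} {V : SortE B}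
    (i : s.In X Y Δ) (hW : DerAt s.a.ax n (.sort X0 W)) (pX : X0 <+: X) (pY : Y0 <+: Y)
    (hu : s.a.Arg (n + 1) X u W) (cY : s.b.CtxAt (m + 1) Y0) (hv : s.b.Arg (m + 1) Y0 v V) :
    Derivable s.ax (.sortEq Δ
      ((s.TT (s.ten (s.a.ext X0 W) Y0) W (.var (s.a.ch X0)) V v).subst (s.last X X0 Y u))
      (s.TT (s.ten X Y) W u V v)) := by
  obtain ⟨h1, h2⟩ := h.last_ten i hW pX pY hu cY
  obtain ⟨fx, cX0, cX⟩ := Thy.CtxAt.snoc_ch hW.succ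
  have eW : W.subst (upd .var (s.a.ch X0) u) = W := by
    rw [upd_sort s.a.pre hW.der fx, SortE.subst_id]
  have ex : (Expr.var (s.a.ch X0)).subst (upd .var (s.a.ch X0) u) = u := by
    rw [Expr.subst_var, upd_self]
  have hd := h.srt i i List.prefix_rfl List.prefix_rfl hu.sat (hv.pfx pY).sat hu (hv.pfx pY)
  obtain ⟨Y1, pY1, cY1, sV⟩ := hv.sat.shrink
  have key := TT_sub (s := s) (F := s.ten (s.a.ext X0 W) Y0) (G := s.ten X Y) (U := W)
    (u := .var (s.a.ch X0)) (V := V) (v := v) (φ := upd .var (s.a.ch X0) u) (ψ := .var)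
    (τ := s.last X X0 Y u) (Δ := Δ) h.full.pre
    (by rw [eW, ex, SortE.subst_id, Expr.subst_id]; exact hd)
    (fun a ha b hb => by
      obtain ⟨Vb, hb⟩ := sV.args b hb
      exact h1 a ha b ⟨Vb, hb.pfx pY1⟩ ⟨Y1, pY1, cY1, hb.good⟩)
    fun a ha b hb => h2 a ha b (hv.all_arg b hb)
  rwa [eW, ex, SortE.subst_id, Expr.subst_id] at key

theorem Stage.last_left (h : s.Stage n m) {u : Expr A} {W : SortE A} {t : B.TermSym}
    {g : List (Expr B)} {V : SortE B}
    (i : s.In X Y Δ) (hW : DerAt s.a.ax n (.sort X0 W)) (pX : X0 <+: X) (pY : Y0 <+: Y)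
    (hu : s.a.Arg (n + 1) X u W) (cY : s.b.CtxAt m Y0) (hv : s.b.Arg (m + 1) Y0 (.app t g) V) :
    TEq s.ax Δ
      ((s.ten (s.a.ext X0 W) Y0 (.var (s.a.ch X0)) (.app t g)).subst (s.last X X0 Y u))
      (s.L (s.ten X Y) W u t g) := by
  obtain ⟨h1, h2⟩ := h.last_ten i hW pX pY hu (cY.mono (Nat.le_succ m))
  obtain ⟨fx, cX0, cX⟩ := Thy.CtxAt.snoc_ch hW.succ
  have eW : W = W.subst (upd .var (s.a.ch X0) u) := by
    rw [upd_sort s.a.pre hW.der fx, SortE.subst_id]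
  have ex : u = (Expr.var (s.a.ch X0)).subst (upd .var (s.a.ch X0) u) := by
    rw [Expr.subst_var, upd_self]
  have eg : g = g.map (Expr.subst .var) :=
    ((List.map_congr_left fun e _ => Expr.subst_id e).trans (List.map_id _)).symm
  have hd := h.left_typ i hu (hv.pfx pY)
  rw [ten_left cX.der cX.last.good hv.good (.inl ⟨_, rfl⟩), Thy.cs_var cX.der (U := W) (by simp),
    subst_L]
  have el := L_map_of (s := s) (t := t) (s.ten X Y) eW ex eg
  rw [el] at hd ⊢
  refine L_teq h.full.pre hd fun a ha b hb => ?_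
  obtain ⟨Vb, hb⟩ := hv.args b hb
  exact h1 a ha b ⟨Vb, hb⟩ ⟨Y0, List.prefix_rfl, cY, hb.good⟩

theorem Stage.last_typed (h : s.Stage n m) {u : Expr A} {W : SortE A}
    (i : s.In X Y Δ) (hW : DerAt s.a.ax n (.sort X0 W)) (pX : X0 <+: X) (pY : Y0 <+: Y)
    (hu : s.a.Arg (n + 1) X u W) (hc : s.a.cs X u = W) (cY : s.b.CtxAt (m + 1) Y0) :
    Typed s.ax (s.last X X0 Y u) (s.tctx (s.a.ext X0 W) Y0) Δ := by
  obtain ⟨fx, cX0, cX⟩ := Thy.CtxAt.snoc_ch hW.succ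
  intro r hr
  obtain ⟨p, hp, q, hq, rfl⟩ := mem_tctx.1 hr
  rcases List.mem_append.1 hp with hp | hp
  · have j := in_tctx h.full.pre h.srt (cX0.mono (Nat.le_succ n)) cY
    have e1 : s.last X X0 Y u (s.v p.1 q.1) = .var (s.v p.1 q.1) := by
      rw [last, tau_v, upd_mem fx _ _ hp, ten_var_var]
    have hE := (j.has p hp q hq).term_sort
    have e2 : (s.E X0 Y0 p q).subst (s.last X X0 Y u) = s.E X0 Y0 p q := by
      conv_rhs => rw [← SortE.subst_id (s.E X0 Y0 p q)]
      refine SortE.subst_congr fun z hz => ?_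
      have := (hE.ok h.full.pre).occ z hz
      obtain ⟨r, hr, rfl⟩ := List.mem_map.1 this
      obtain ⟨p', hp', q', hq', rfl⟩ := mem_tctx.1 hr
      rw [last, tau_v, upd_mem fx _ _ hp', ten_var_var]
    rw [E_pfx cX.der cY.der (List.prefix_append _ _) List.prefix_rfl hp hq, e1, e2,
      ← E_pfx i.ctxa i.ctxb pX pY hp hq]
    exact i.has p (pX.subset hp) q (pY.subset hq)
  · obtain rfl := List.mem_singleton.1 hp
    have hq' := cY.arg hq
    have key := h.canon i hu (hq'.pfx pY)
    rw [hc, Thy.cs_var i.ctxb (U := q.2) (pY.subset hq)] at key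
    have := key.conv (h.last_sort i hW pX pY hu cY hq').ssymm
    rw [last, tau_v, upd_self]
    exact this

theorem Stage.conv_sort (h : s.Stage n m) {u : Expr A} {U : SortE A} {v : Expr B} {V : SortE B}
    (i : s.In X Y Δ) (hu : s.a.Arg (n + 1) X u U) (hv : s.b.Arg (m + 1) Y v V) :
    Derivable s.ax (.sortEq Δ (s.TT (s.ten X Y) (s.a.cs X u) u V v)
      (s.TT (s.ten X Y) U u V v)) := by
  have hu' := hu.cs_arg i.ctxa
  have hd := h.srt i i List.prefix_rfl List.prefix_rfl hu'.sat hv.sat hu' hv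
  rcases hu.cs_eq i.ctxa with e | ⟨X0, pX, hW, hut⟩
  · rw [e] at hd ⊢
    exact hd.srefl
  · obtain ⟨dW, dU⟩ := hW.seq_sorts
    obtain ⟨Y0, pY, cY, hv0⟩ := hv.shrink i.ctxb
    have cX := (Thy.CtxAt.snoc_ch dW.succ).2.2
    have j := in_tctx h.full.pre h.srt cX cY
    have S := h.seqS hW hv0.sat List.prefix_rfl hv0 j (j.pfx (List.prefix_append _ _) List.prefix_rfl)
    have T := h.last_typed i dW pX pY hu' rfl cY
    exact ((h.last_sort i dW pX pY hu' cY hv0).ssymm.strans (S.subst h.full.pre i.ctx T)).strans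
      (h.last_sort i dU pX pY hu cY hv0)

theorem Stage.conv_left (h : s.Stage n m) {u : Expr A} {U : SortE A} {t : B.TermSym}
    {g : List (Expr B)} {V : SortE B}
    (i : s.In X Y Δ) (hu : s.a.Arg (n + 1) X u U) (hv : s.b.Arg (m + 1) Y (.app t g) V) :
    TEq s.ax Δ (s.L (s.ten X Y) (s.a.cs X u) u t g) (s.L (s.ten X Y) U u t g) := by
  have hu' := hu.cs_arg i.ctxa
  rcases hu.cs_eq i.ctxa with e | ⟨X0, pX, hW, hut⟩
  · rw [e]
    exact (h.left_typ i hu hv).teq_refl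
  · obtain ⟨dW, dU⟩ := hW.seq_sorts
    obtain ⟨Y0, pY, cY, hv0⟩ := hv.shrink_app
    have cX := (Thy.CtxAt.snoc_ch dW.succ).2.2
    have j := in_tctx h.full.pre h.srt cX (cY.mono (Nat.le_succ m))
    have T := h.last_typed i dW pX pY hu' rfl (cY.mono (Nat.le_succ m))
    have S := (h.seqT hW hv0 j).subst h.full.pre i.ctx T
    exact ((h.last_left i dW pX pY hu' cY hv0).symm.trans h.full.pre S).trans h.full.pre
      (h.last_left i dU pX pY hu cY hv0)

theorem Stage.typ (h : s.Stage n m) {u : Expr A} {U : SortE A} {v : Expr B} {V : SortE B}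
    (i : s.In X Y Δ) (hu : s.a.Arg (n + 1) X u U) (hv : s.b.Arg (m + 1) Y v V) :
    Derivable s.ax (.term Δ (s.ten X Y u v) (s.TT (s.ten X Y) U u V v)) := by
  have h1 := h.conv_sort i hu (hv.cs_arg i.ctxb)
  have h2 := h.swap.conv_sort i.swap hv hu
  rw [ten_swap', TT_swap, TT_swap] at h2
  exact ((h.canon i hu hv).conv h1).conv h2

end Sys
end AmbStep

section Interchange

variable {A B C : Alphabet}

namespace Sys

variable {s : Sys A B C} {n m : ℕ} {X Xs : PreCtx A} {Y Yt : PreCtx B} {Δ : PreCtx C}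

theorem Stage.interchange_sort (h : s.Stage n m) {t : A.TermSym} {U : SortE A} {V : SortE B}
    {v : Expr B}
    (hu : DerAt s.a.ax (n + 1) (introTerm Xs t U)) (hV : DerAt s.b.ax m (.sort Yt V))
    (i : s.In Xs Yt Δ) {τ : C.Var → Expr C}
    (e1 : ∀ p ∈ Xs, ∀ q ∈ Yt, τ (s.v p.1 q.1) = .var (s.v p.1 q.1))
    (e2 : ∀ q ∈ Yt, τ (s.v (s.a.ch Xs) q.1) = s.ten Xs Yt (.app t (ctxVars Xs)) (.var q.1)) :
    ∀ a ∈ U.args ++ [.var (s.a.ch Xs)], ∀ b ∈ V.args, TEq s.ax Δ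
      ((s.ten (s.a.ext Xs U) (s.b.ext Yt V) a b).subst τ)
      (s.ten Xs Yt (a.subst (upd .var (s.a.ch Xs) (.app t (ctxVars Xs))))
        (b.subst (upd .var (s.b.ch Yt) v))) := by
  intro a ha b hb
  have hU := hu.term_sort
  have au : s.a.Arg (n + 1) Xs (.app t (ctxVars Xs)) U := .inr ⟨Xs, List.prefix_rfl, hu⟩
  obtain ⟨fx, cX0, cX⟩ := Thy.CtxAt.snoc_ch hU.succ
  obtain ⟨fy, cY0, cY⟩ := Thy.CtxAt.snoc_ch hV.succ
  obtain ⟨k, rfl⟩ := hV.pos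
  have sV : s.b.SAt (k + 1) Yt V := ⟨Yt, List.prefix_rfl, hV⟩
  obtain ⟨Vb, hb'⟩ := sV.args b hb
  have eW : U.subst (upd .var (s.a.ch Xs) (.app t (ctxVars Xs))) = U := by
    rw [upd_sort s.a.pre hU.der fx, SortE.subst_id]
  have ex : (Expr.var (s.a.ch Xs)).subst (upd .var (s.a.ch Xs) (.app t (ctxVars Xs))) =
      .app t (ctxVars Xs) := by
    rw [Expr.subst_var, upd_self]
  have mΦ : s.a.Mor (n + 1) (upd .var (s.a.ch Xs) (.app t (ctxVars Xs))) (s.a.ext Xs U) Xs :=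
    cX0.mor.upd (Nat.le_succ _) List.prefix_rfl cX.der (by rw [SortE.subst_id]; exact au)
  have eb : b.subst (upd .var (s.b.ch Yt) v) = b := by
    have h1 : b.subst (upd .var (s.b.ch Yt) v) = b.subst .var := by
      refine Expr.subst_congr fun z hz => ?_
      obtain ⟨q, hq, rfl⟩ := List.mem_map.1 (hb'.good.occ i.ctxb hz)
      exact upd_mem fy _ _ hq
    rw [h1, Expr.subst_id]
  refine dsl_of_eq h.full.pre (h.amb1 i) cX.der cY0.der mΦ
    (Ψ := upd .var (s.b.ch Yt) v) cY0.mor (fun _ _ => rfl) (fun q hq => upd_mem fy _ _ hq) ?_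
    cX.der cY.der List.prefix_rfl (List.prefix_append _ _) (cX.last.all_good a ha) hb'.good
    (all_arg_subst (by rw [eW, ex]; exact au) a ha) ⟨Vb, by rw [eb]; exact hb'.mono (Nat.le_succ k)⟩
  intro p hp q hq
  rcases List.mem_append.1 hp with hp | hp
  · rw [upd_mem fx _ _ hp, e1 p hp q hq, ten_var_var]
  · obtain rfl := List.mem_singleton.1 hp
    rw [upd_self, e2 q hq]

theorem Stage.interchange_left (h : s.Stage n m) {t : A.TermSym} {r : B.TermSym} {U U' : SortE A}
    {V : SortE B} {f : List (Expr A)} {g : List (Expr B)} {φ : A.Var → Expr A}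
    {ψ : B.Var → Expr B} (hu0 : DerAt s.a.ax (n + 1) (introTerm Xs t U))
    (hY : s.b.CtxAt m Yt) (mφ : s.a.Mor n φ Xs X) (mψ : s.b.Mor m ψ Yt Y)
    (i : s.In X Y Δ) (hu : s.a.Arg (n + 1) X (.app t f) U')
    (hv : s.b.Arg (m + 1) Y (.app r g) V) (ef : (ctxVars Xs).map (Expr.subst φ) = f)
    (eg : (ctxVars Yt).map (Expr.subst ψ) = g) (ec : s.a.cs X (.app t f) = U.subst φ)
    {τ : C.Var → Expr C}
    (hτ : ∀ p ∈ Xs, ∀ q ∈ Yt, τ (s.v p.1 q.1) = s.ten X Y (φ p.1) (ψ q.1)) :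
    TEq s.ax Δ ((s.L (s.ten Xs Yt) U (.app t (ctxVars Xs)) r (ctxVars Yt)).subst τ)
      (s.L (s.ten X Y) (s.a.cs X (.app t f)) (.app t f) r g) := by
  have hu' := hu.cs_arg i.ctxa
  have hd := h.left_typ i hu' hv
  have et : Expr.app t f = (Expr.app t (ctxVars Xs)).subst φ := by rw [Expr.subst_app, ef]
  rw [subst_L]
  have el := L_map_of (s := s) (t := r) (s.ten X Y) ec et eg.symm
  rw [el] at hd ⊢
  have au : s.a.Arg (n + 1) Xs (.app t (ctxVars Xs)) U := .inr ⟨Xs, List.prefix_rfl, hu0⟩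
  refine L_teq h.full.pre hd fun a ha b hb => ?_
  obtain ⟨q, hq, rfl⟩ := List.mem_map.1 hb
  refine dsl h.full.pre (h.amb1 i) hu0.der.term_sort.sort_ctx hY.der (mφ.mono (Nat.le_succ n)) mψ hτ
    (Thy.Arg.all_good au a ha) (hY.arg hq).good
    (all_arg_subst (by rw [← et, ← ec]; exact hu') a ha) ⟨_, by
      rw [Expr.subst_var]; exact mψ q hq⟩

theorem Stage.interchange (h : s.Stage n m) {t : A.TermSym} {r : B.TermSym} {U : SortE A}
    {V : SortE B} {f : List (Expr A)} {g : List (Expr B)}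
    (i : s.In X Y Δ) (hu : s.a.Arg (n + 1) X (.app t f) U)
    (hv : s.b.Arg (m + 1) Y (.app r g) V) :
    TEq s.ax Δ (s.L (s.ten X Y) (s.a.cs X (.app t f)) (.app t f) r g)
      (s.R (s.ten X Y) t f (s.b.cs Y (.app r g)) (.app r g)) := by
  obtain ⟨Xs, Us, φ, ax1, d1, mφ, ef, _, ecu⟩ := hu.inv'
  obtain ⟨Yt, Vt, ψ, ax2, d2, mψ, eg, _, ecv⟩ := hv.inv'
  have hP := h.full.pre
  have cX := Thy.CtxAt.of_term d1
  have cY := Thy.CtxAt.of_term d2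
  have j := in_tctx hP h.srt1 (cX.mono (Nat.le_succ n)) cY
  have au : s.a.Arg (n + 1) Xs (.app t (ctxVars Xs)) Us := .inr ⟨Xs, List.prefix_rfl, d1⟩
  have av : s.b.Arg (m + 1) Yt (.app r (ctxVars Yt)) Vt := .inr ⟨Yt, List.prefix_rfl, d2⟩
  have cu : s.a.cs Xs (.app t (ctxVars Xs)) = Us := by
    rw [Thy.cs_app ax1, sb_ctxVars, SortE.subst_id]
  have cv : s.b.cs Yt (.app r (ctxVars Yt)) = Vt := by
    rw [Thy.cs_app ax2, sb_ctxVars, SortE.subst_id]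
  obtain ⟨τ, e1, e2, e3, e4⟩ := h.full.tt ax1 ax2
  obtain ⟨fx, _, cX'⟩ := Thy.CtxAt.snoc_ch d1.term_sort.succ
  obtain ⟨fy, _, cY'⟩ := Thy.CtxAt.snoc_ch d2.term_sort.succ
  have L0 := h.left_typ j au av
  have R0 := h.right_typ j au av
  rw [cv] at L0
  rw [cu] at R0
  have k1 := h.interchange_sort (v := .app r (ctxVars Yt)) d1 d2.term_sort j e1 e2
  have k2 := h.swap.interchange_sort (v := .app t (ctxVars Xs)) d2 d1.term_sort j.swap
    (fun q hq p hp => e1 p hp q hq) (fun p hp => by rw [ten_swap]; exact e3 p hp)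
  rw [ten_swap', ten_swap'] at k2
  have eU : Us = Us.subst (upd .var (s.a.ch Xs) (.app t (ctxVars Xs))) := by
    rw [upd_sort s.a.pre d1.der.term_sort fx, SortE.subst_id]
  have eV : Vt = Vt.subst (upd .var (s.b.ch Yt) (.app r (ctxVars Yt))) := by
    rw [upd_sort s.b.pre d2.der.term_sort fy, SortE.subst_id]
  have eu : Expr.app t (ctxVars Xs) =
      (Expr.var (s.a.ch Xs)).subst (upd .var (s.a.ch Xs) (.app t (ctxVars Xs))) := by
    rw [Expr.subst_var, upd_self]
  have ev : Expr.app r (ctxVars Yt) =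
      (Expr.var (s.b.ch Yt)).subst (upd .var (s.b.ch Yt) (.app r (ctxVars Yt))) := by
    rw [Expr.subst_var, upd_self]
  have hS := TT_sub (s := s) (U := Us) (u := .var (s.a.ch Xs)) (V := Vt) (v := .var (s.b.ch Yt))
    (F := s.ten (s.a.ext Xs Us) (s.b.ext Yt Vt)) (G := s.ten Xs Yt) (τ := τ) hP
    (by rw [← eU, ← eV, ← eu, ← ev]; exact L0.term_sort) k1 fun a ha b hb => k2 b hb a ha
  rw [← eU, ← eV, ← eu, ← ev] at hS
  have key := e4 (L0.conv hS.ssymm) (R0.conv hS.ssymm)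
  have hT := typed_sub hP (h.amb1 i) cX.der cY.der (mφ.mono (Nat.le_succ n)) mψ (fun _ _ => rfl)
    (fun _ _ => rfl) i.ctxa i.ctxb List.prefix_rfl List.prefix_rfl
  have key' := key.subst hP i.ctx hT
  have K1 := h.interchange_left (U := Us) d1 cY mφ mψ i hu hv ef eg ecu
    (τ := s.tau fun a b => s.ten X Y (φ a) (ψ b)) fun p hp q hq => tau_v _ _ _ _
  have K2 := h.swap.interchange_left (U := Vt) d2 cX mψ mφ i.swap hv hu eg ef ecv
    (τ := s.tau fun a b => s.ten X Y (φ a) (ψ b))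
    fun q hq p hp => by rw [ten_swap]; exact tau_v _ _ _ _
  rw [ten_swap', ten_swap', ← R_eq, ← R_eq] at K2
  exact (K1.symm.trans hP key').trans hP K2

theorem Stage.left (h : s.Stage n m) {u : Expr A} {U : SortE A} {t : B.TermSym}
    {g : List (Expr B)} {V : SortE B}
    (i : s.In X Y Δ) (hu : s.a.Arg (n + 1) X u U) (hv : s.b.Arg (m + 1) Y (.app t g) V) :
    TEq s.ax Δ (s.ten X Y u (.app t g)) (s.L (s.ten X Y) U u t g) := by
  have main : TEq s.ax Δ (s.ten X Y u (.app t g)) (s.L (s.ten X Y) (s.a.cs X u) u t g) := by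
    by_cases hc : (∃ x, u = .var x) ∨ s.pref = true
    · have := h.left_typ i (hu.cs_arg i.ctxa) hv
      rw [ten_left i.ctxa hu.good hv.good hc]
      exact this.teq_refl
    · cases u with
      | var x => exact absurd (.inl ⟨x, rfl⟩) hc
      | app t' f =>
        rw [ten_right i.ctxb hu.good hv.good (.inr (by simpa using hc))]
        exact (h.interchange i hu hv).symm
  exact main.trans h.full.pre (h.conv_left i hu hv)

theorem Stage.amb (h : s.Stage n m) (i : s.In X Y Δ) : s.Amb (n + 1) (m + 1) X Y Δ where
  ctxa := i.ctxa
  ctxb := i.ctxb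
  ctx := i.ctx
  typ := h.typ i
  left := h.left i
  right hu hv := by
    have := h.swap.left i.swap hv hu
    rw [ten_swap, ten_swap', ← R_eq] at this
    exact this

/-- Everything that is proved at stage `(n, m)`. -/
structure Cl (s : Sys A B C) (n m : ℕ) : Prop where
  srt : s.Srt n m
  amb : ∀ {X Y Δ}, s.In X Y Δ → s.Amb n m X Y Δ
  seqS : s.SeqS n m
  seqT : s.SeqT n m
  teqT : s.TeqT n m
  seqS' : s.swap.SeqS m n
  seqT' : s.swap.SeqT m n
  teqT' : s.swap.TeqT m n

theorem Cl.swap (h : s.Cl n m) : s.swap.Cl m n where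
  srt := Srt.swap h.srt
  amb i := (h.amb i.of_swap).swap
  seqS := h.seqS'
  seqT := h.seqT'
  teqT := h.teqT'
  seqS' := by rw [swap_swap]; exact h.seqS
  seqT' := by rw [swap_swap]; exact h.seqT
  teqT' := by rw [swap_swap]; exact h.teqT

theorem Cl.step (hF : s.Full) (h1 : s.Cl (n + 1) m) (h2 : s.Cl n (m + 1)) :
    s.Cl (n + 1) (m + 1) := by
  have half : ∀ {A B : Alphabet} {s : Sys A B C} {n m : ℕ}, s.Full → s.Cl (n + 1) m →
      s.Cl n (m + 1) → s.SeqS (n + 1) (m + 1) ∧ s.SeqT (n + 1) (m + 1) ∧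
        s.TeqT (n + 1) (m + 1) := fun {A B s n m} hF h1 h2 => by
    have hS : s.SeqS (n + 1) (m + 1) :=
      seqS_step hF h1.srt h2.srt h2.amb h1.seqS h2.seqS h1.seqT h2.teqT
    exact ⟨hS, seqT_step hF h1.srt h2.amb h1.seqS hS h1.seqT h2.seqT h2.teqT,
      teqT_step hF h2.srt h2.amb h1.teqT h2.teqT⟩
  obtain ⟨a1, a2, a3⟩ := half hF h1 h2
  obtain ⟨b1, b2, b3⟩ := half hF.swap h2.swap h1.swap
  have hs : s.Srt (n + 1) (m + 1) := srt_step hF h1.srt h2.srt h1.amb h2.amb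
  have st : s.Stage n m := ⟨hF, h1.srt, h2.srt, hs, h1.amb, h2.amb, a1, a2, b1, b2⟩
  exact ⟨hs, st.amb, a1, a2, a3, b1, b2, b3⟩

theorem cl_zero (m : ℕ) : s.Cl 0 m := by
  have hs : ∀ {X U}, ¬ s.a.SAt 0 X U := fun h => by
    obtain ⟨k, hk⟩ := h.pos
    omega
  have ha : ∀ {X u U}, ¬ s.a.Arg 0 X u U := fun h => hs h.sat
  have hd : ∀ {J}, ¬ DerAt s.a.ax 0 J := fun h => by
    obtain ⟨k, hk⟩ := h.pos
    omega
  exact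
  { srt := fun _ _ _ _ h => (hs h).elim
    amb := fun i => ⟨i.ctxa, i.ctxb, i.ctx, fun h => (ha h).elim, fun h => (ha h).elim,
      fun h => (ha h).elim⟩
    seqS := fun h => (hd h).elim
    seqT := fun h => (hd h).elim
    teqT := fun h => (hd h).elim
    seqS' := fun _ h => (hs h).elim
    seqT' := fun _ h => (ha h).elim
    teqT' := fun _ h => (ha h).elim }

theorem Full.cl (hF : s.Full) (n m : ℕ) : s.Cl n m := by
  induction n generalizing m with
  | zero => exact cl_zero m
  | succ n ih =>
    induction m with
    | zero => simpa only [swap_swap] using (cl_zero (s := s.swap) (n + 1)).swap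
    | succ m ihm => exact Cl.step hF ihm (ih (m + 1))

end Sys
end Interchange

section
variable {A B C : Alphabet} {α β γ : Type}

theorem IsGrid.ext {m n : ℕ} {M M' : ℕ → ℕ → γ} {L L' : List γ} (h : IsGrid m n M L)
    (h' : IsGrid m n M' L') (hM : ∀ i < m, ∀ j < n, M i j = M' i j) : L = L' := by
  refine List.ext_getElem (h.1.trans h'.1.symm) fun k hk hk' => ?_
  have hk2 : k < m * n := h.1 ▸ hk
  have hn : 0 < n := Nat.pos_of_ne_zero fun h0 => by simp [h0] at hk2
  have hi : k / n < m := Nat.div_lt_of_lt_mul (by rwa [mul_comm])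
  have hj : k % n < n := Nat.mod_lt _ hn
  have e : k / n * n + k % n = k := Nat.div_add_mod' k n
  have h1 := h.2 _ _ hi hj (by rwa [e])
  have h2 := h'.2 _ _ hi hj (by rwa [e])
  simp only [e] at h1 h2
  rw [h1, h2, hM _ hi _ hj]

theorem IsGrid.dropLast_ext {m n : ℕ} {M M' : ℕ → ℕ → γ} {L L' : List γ}
    (h : IsGrid (m + 1) (n + 1) M L) (h' : IsGrid (m + 1) (n + 1) M' L')
    (hM : ∀ i < m + 1, ∀ j < n + 1, i < m ∨ j < n → M i j = M' i j) :
    L.dropLast = L'.dropLast := by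
  refine List.ext_getElem (by simp [h.1, h'.1]) fun k hk hk' => ?_
  simp only [List.length_dropLast, h.1] at hk
  have hi : k / (n + 1) < m + 1 := Nat.div_lt_of_lt_mul (by rw [mul_comm]; omega)
  have hj : k % (n + 1) < n + 1 := Nat.mod_lt _ (by omega)
  have e : k / (n + 1) * (n + 1) + k % (n + 1) = k := Nat.div_add_mod' k _
  have h1 := h.2 _ _ hi hj (by rw [e, h.1]; omega)
  have h2 := h'.2 _ _ hi hj (by rw [e, h'.1]; omega)
  simp only [e] at h1 h2
  rw [List.getElem_dropLast, List.getElem_dropLast, h1, h2]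
  refine hM _ hi _ hj ?_
  by_contra hc
  have a1 : k / (n + 1) = m := by omega
  have a2 : k % (n + 1) = n := by omega
  rw [a1, a2] at e
  have : (m + 1) * (n + 1) = m * (n + 1) + n + 1 := by ring
  omega

theorem gr_isGrid (as : List α) (bs : List β) (F : α → β → γ) (M : ℕ → ℕ → γ)
    (hM : ∀ i (hi : i < as.length) j (hj : j < bs.length), M i j = F as[i] bs[j]) :
    IsGrid as.length bs.length M (gr true as bs F) := by
  induction as generalizing M with
  | nil => exact ⟨by simp [gr], fun i j hi => absurd hi (by simp)⟩
  | cons a as ih =>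
    have ih := ih (fun i j => M (i + 1) j) fun i hi j hj => by
      exact hM (i + 1) (by simpa using hi) j hj
    have e : gr true (a :: as) bs F = bs.map (F a) ++ gr true as bs F := by simp [gr]
    refine ⟨by rw [e, List.length_append, ih.1, List.length_map, List.length_cons]; ring, ?_⟩
    intro i j hi hj h
    simp only [e]
    cases i with
    | zero =>
      rw [hM 0 hi j hj, List.getElem_append_left (by simpa using hj)]
      simp
    | succ i =>
      have e2 : (i + 1) * bs.length + j = bs.length + (i * bs.length + j) := by ring
      simp only [e2]
      rw [List.getElem_append_right (by simp)]
      simp only [e2, e, List.length_append, List.length_map] at h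
      have := ih.2 i j (by simpa using hi) hj (by omega)
      simpa using this

theorem IsGrid.eq_gr {as : List α} {bs : List β} {F : α → β → γ} {M : ℕ → ℕ → γ} {L : List γ}
    (h : IsGrid as.length bs.length M L)
    (hM : ∀ i (hi : i < as.length) j (hj : j < bs.length), M i j = F as[i] bs[j]) :
    L = gr true as bs F :=
  h.ext (gr_isGrid as bs F M hM) fun _ _ _ _ => rfl

theorem lookupV_eq {ps : List (A.Var × Expr A)} {z : A.Var} {e : Expr A}
    (h : ∀ p ∈ ps, p.1 = z → p.2 = e) (hz : ∃ p ∈ ps, p.1 = z) : lookupV ps z = e := by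
  induction ps with
  | nil => simp at hz
  | cons p ps ih =>
    rw [lookupV]
    split_ifs with hp
    · exact h p (by simp) hp
    · refine ih (fun q hq => h q (by simp [hq])) ?_
      obtain ⟨q, hq, e⟩ := hz
      rcases List.mem_cons.1 hq with rfl | hq
      · exact absurd e hp
      · exact ⟨q, hq, e⟩

theorem lookupV_not {ps : List (A.Var × Expr A)} {z : A.Var} (h : ∀ p ∈ ps, p.1 ≠ z) :
    lookupV ps z = .var z := by
  induction ps with
  | nil => rfl
  | cons p ps ih =>
    rw [lookupV, if_neg (h p (by simp))]
    exact ih fun q hq => h q (by simp [hq])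

theorem mem_pairsR {x : A.Var} {Y : PreCtx B} {g : ℕ → Expr (A.tensor B)}
    {p : (A.tensor B).Var × Expr (A.tensor B)} :
    p ∈ pairsR x Y g ↔ ∃ j, ∃ hj : j < Y.length, ((x, Y[j].1), g j) = p := by
  simp [pairsR, List.mem_map, Fin.exists_iff]

theorem mem_pairsL {X : PreCtx A} {y : B.Var} {g : ℕ → Expr (A.tensor B)}
    {p : (A.tensor B).Var × Expr (A.tensor B)} :
    p ∈ pairsL X y g ↔ ∃ i, ∃ hi : i < X.length, ((X[i].1, y), g i) = p := by
  simp [pairsL, List.mem_map, Fin.exists_iff]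

section
variable {X : PreCtx A} {Y : PreCtx B} {x : A.Var} {y : B.Var} {gx gy : ℕ → Expr (A.tensor B)}

theorem lookup_pairsR {G : B.Var → Expr (A.tensor B)}
    (hg : ∀ j (hj : j < Y.length), gy j = G Y[j].1) {q : B.Var × SortE B} (hq : q ∈ Y) :
    lookupV (pairsR x Y gy) (x, q.1) = G q.1 := by
  refine lookupV_eq ?_ ?_
  · intro p hp e
    obtain ⟨j, hj, rfl⟩ := mem_pairsR.1 hp
    obtain ⟨-, e⟩ := Prod.mk.inj e
    rw [← e]
    exact hg j hj
  · obtain ⟨j, hj, rfl⟩ := List.mem_iff_getElem.1 hq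
    exact ⟨_, mem_pairsR.2 ⟨j, hj, rfl⟩, rfl⟩

theorem lookup_pairsR_not {z : A.Var × B.Var} (h : z.1 ≠ x) :
    lookupV (pairsR x Y gy) z = .var z := by
  refine lookupV_not fun p hp e => ?_
  obtain ⟨j, hj, rfl⟩ := mem_pairsR.1 hp
  exact h (congrArg Prod.fst e).symm

theorem lookup_pairsL {G : A.Var → Expr (A.tensor B)}
    (hg : ∀ i (hi : i < X.length), gx i = G X[i].1) {p : A.Var × SortE A} (hp : p ∈ X) :
    lookupV (pairsL X y gx) (p.1, y) = G p.1 := by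
  refine lookupV_eq ?_ ?_
  · intro r hr e
    obtain ⟨i, hi, rfl⟩ := mem_pairsL.1 hr
    obtain ⟨e, -⟩ := Prod.mk.inj e
    rw [← e]
    exact hg i hi
  · obtain ⟨i, hi, rfl⟩ := List.mem_iff_getElem.1 hp
    exact ⟨_, mem_pairsL.2 ⟨i, hi, rfl⟩, rfl⟩

theorem lookup_pairsL_not {z : A.Var × B.Var} (h : z.2 ≠ y) :
    lookupV (pairsL X y gx) z = .var z := by
  refine lookupV_not fun p hp e => ?_
  obtain ⟨i, hi, rfl⟩ := mem_pairsL.1 hp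
  exact h (congrArg Prod.snd e).symm

theorem lookupV_append {ps qs : List (A.Var × Expr A)} {z : A.Var} (h : ∀ p ∈ ps, p.1 ≠ z) :
    lookupV (ps ++ qs) z = lookupV qs z := by
  induction ps with
  | nil => rfl
  | cons p ps ih =>
    rw [List.cons_append, lookupV, if_neg (h p (by simp))]
    exact ih fun q hq => h q (by simp [hq])

theorem lookupV_append_left {ps qs : List (A.Var × Expr A)} {z : A.Var} (h : ∃ p ∈ ps, p.1 = z) :
    lookupV (ps ++ qs) z = lookupV ps z := by
  induction ps with
  | nil => simp at h
  | cons p ps ih =>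
    rw [List.cons_append, lookupV, lookupV]
    split_ifs with hp
    · rfl
    · obtain ⟨q, hq, e⟩ := h
      rcases List.mem_cons.1 hq with rfl | hq
      · exact absurd e hp
      · exact ih ⟨q, hq, e⟩

theorem lookup_pairs_append (hx : ∀ p ∈ X, p.1 ≠ x) (hy : ∀ q ∈ Y, q.1 ≠ y)
    {G : A.Var → Expr (A.tensor B)} {H : B.Var → Expr (A.tensor B)}
    (hgx : ∀ i (hi : i < X.length), gx i = G X[i].1)
    (hgy : ∀ j (hj : j < Y.length), gy j = H Y[j].1) :
    (∀ p ∈ X, ∀ q ∈ Y, lookupV (pairsL X y gx ++ pairsR x Y gy) (p.1, q.1) = .var (p.1, q.1)) ∧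
    (∀ q ∈ Y, lookupV (pairsL X y gx ++ pairsR x Y gy) (x, q.1) = H q.1) ∧
    (∀ p ∈ X, lookupV (pairsL X y gx ++ pairsR x Y gy) (p.1, y) = G p.1) := by
  refine ⟨fun p hp q hq => ?_, fun q hq => ?_, fun p hp => ?_⟩
  · rw [lookupV_append, lookup_pairsR_not (hx p hp)]
    intro r hr e
    obtain ⟨i, hi, rfl⟩ := mem_pairsL.1 hr
    exact hy q hq (congrArg Prod.snd e).symm
  · rw [lookupV_append, lookup_pairsR hgy hq]
    intro r hr e
    obtain ⟨i, hi, rfl⟩ := mem_pairsL.1 hr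
    exact hy q hq (congrArg Prod.snd e).symm
  · rw [lookupV_append_left, lookup_pairsL hgx hp]
    obtain ⟨i, hi, rfl⟩ := List.mem_iff_getElem.1 hp
    exact ⟨_, mem_pairsL.2 ⟨i, hi, rfl⟩, rfl⟩

end

namespace Sys
variable {s : Sys A B C} {X X' : PreCtx A} {Y : PreCtx B}

/-- Substitution into the left-hand variables commutes strictly with the tensor product of
terms, as long as canonical sorts are preserved. -/
theorem ten_subst (hp : s.pref = true) (hX : Derivable s.a.ax (.ctx X))
    (hX' : Derivable s.a.ax (.ctx X')) (hY : Derivable s.b.ax (.ctx Y)) {φ : A.Var → Expr A}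
    {τ : C.Var → Expr C} (hφ : ∀ p ∈ X, s.a.cs X' (φ p.1) = p.2.subst φ)
    (hτ : ∀ p ∈ X, ∀ q ∈ Y, τ (s.v p.1 q.1) = s.ten X' Y (φ p.1) (.var q.1)) {u : Expr A}
    {v : Expr B} (hu : s.a.Good X u) (hv : s.b.Good Y v) (hu' : s.a.Good X' (u.subst φ)) :
    (s.ten X Y u v).subst τ = s.ten X' Y (u.subst φ) v := by
  have mem : ∀ {x : A.Var}, s.a.Good X (.var x) → ∃ U, (x, U) ∈ X := fun h => by
    simpa using h.occ hX .var
  have memb : ∀ {y : B.Var}, s.b.Good Y (.var y) → ∃ V, (y, V) ∈ Y := fun h => by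
    simpa using h.occ hY .var
  have hcs : ∀ {u : Expr A}, s.a.Good X u → s.a.cs X' (u.subst φ) = (s.a.cs X u).subst φ := by
    intro u hu
    cases u with
    | var x =>
      obtain ⟨U, hU⟩ := mem hu
      rw [Thy.cs_var hX hU, Expr.subst_var]
      exact hφ _ hU
    | app t f => rw [Expr.subst_app]; exact hu.cs_subst φ
  induction hN : s.a.rk X u + s.b.rk Y v using Nat.strong_induction_on generalizing u v with
  | _ N ih =>
    subst hN
    cases v with
    | var y =>
      cases u with
      | var x =>
        obtain ⟨U, hU⟩ := mem hu
        obtain ⟨V, hV⟩ := memb hv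
        rw [ten_var_var, Expr.subst_var, Expr.subst_var]
        exact hτ _ hU _ hV
      | app t f =>
        rw [Expr.subst_app] at hu'
        rw [Expr.subst_app, ten_right hY hu hv (.inl ⟨y, rfl⟩), ten_right hY hu' hv (.inl ⟨y, rfl⟩),
          subst_R, R, R]
        congr 1
        have e := gr_map s.ord f ((s.b.cs Y (.var y)).args ++ [.var y]) (Expr.subst φ) id
          (s.ten X' Y)
        rw [List.map_id] at e
        rw [e]
        refine gr_congr fun a ha b hb => ?_
        obtain ⟨ga, gb, hlt⟩ := lt_right hY hu hv a ha b hb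
        exact ih _ hlt ga gb (hu'.arg_lt _ (List.mem_map_of_mem ha)).1 rfl
    | app t g =>
      have hlt' := lt_left hX' hu' hv
      rw [ten_left hX hu hv (.inr hp), ten_left hX' hu' hv (.inr hp), subst_L, hcs hu]
      rw [hcs hu] at hlt'
      have e : g = g.map (Expr.subst Expr.var) :=
        ((List.map_congr_left fun e _ => Expr.subst_id e).trans (List.map_id _)).symm
      rw [L_map_of (s.ten X' Y) (φ := φ) (ψ := Expr.var) rfl rfl e]
      refine L_congr fun a ha b hb => ?_
      obtain ⟨ga, gb, hlt⟩ := lt_left hX hu hv a ha b hb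
      rw [Expr.subst_id]
      refine ih _ hlt ga gb (hlt' (a.subst φ) ?_ b hb).1 rfl
      rcases List.mem_append.1 ha with h | h
      · exact List.mem_append_left _ (List.mem_map_of_mem h)
      · simp only [List.mem_singleton] at h
        simp [h]

end Sys
end

section
variable {A B C : Alphabet}

theorem Thy.Good.canon {T : Thy A} {X : PreCtx A} (hX : Derivable T.ax (.ctx X)) {u : Expr A}
    (h : T.Good X u) : CanonSort T.ax X u (T.cs X u) := by
  cases u with
  | var x =>
    obtain ⟨U, hU⟩ : ∃ U, (x, U) ∈ X := by simpa using h.occ hX .var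
    rw [Thy.cs_var hX hU]
    obtain ⟨i, hi, e⟩ := List.mem_iff_getElem.1 hU
    have := CanonSort.var (Ax := T.ax) (X := X) hi
    rwa [e] at this
  | app t f =>
    obtain ⟨n, U, hn⟩ := h
    obtain ⟨k, rfl⟩ := hn.sat.pos
    obtain ⟨Xa, V, hax, -, -, -, -, e⟩ := hn.inv
    rw [e]
    exact .app hax

theorem CanonSort.cs_eq {T : Thy A} {X : PreCtx A} (hX : Derivable T.ax (.ctx X)) {u : Expr A}
    {U : SortE A} (h : CanonSort T.ax X u U) : T.cs X u = U := by
  cases h with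
  | var hi => exact Thy.cs_var hX (List.getElem_mem hi)
  | app hax => exact Thy.cs_app hax

theorem CanonSort.mem {T : Thy A} {X : PreCtx A} {x : A.Var} {U : SortE A}
    (h : CanonSort T.ax X (.var x) U) : (x, U) ∈ X := by
  cases h with
  | var hi => exact List.getElem_mem hi

theorem Thy.entry_good {T : Thy A} {X : PreCtx A} (hX : Derivable T.ax (.ctx X)) {i : ℕ}
    (hi : i < X.length) : ∀ e ∈ X[i].2.args, T.Good (X.take i) e := by
  obtain ⟨n, hn⟩ := T.exists_ctxAt hX
  have h := hn.entry (X.take i) X[i].1 X[i].2 (by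
    simpa using List.take_prefix (i + 1) X)
  obtain ⟨k, rfl⟩ := h.pos
  intro e he
  obtain ⟨W, hW⟩ := Thy.SAt.args ⟨_, List.prefix_rfl, h⟩ e he
  exact hW.good

theorem Thy.sort_good {T : Thy A} {X : PreCtx A} {U : SortE A}
    (h : Derivable T.ax (.sort X U)) : ∀ e ∈ U.args, T.Good X e := by
  obtain ⟨n, h⟩ := h
  obtain ⟨k, rfl⟩ := h.pos
  intro e he
  obtain ⟨W, hW⟩ := Thy.SAt.args ⟨_, List.prefix_rfl, h⟩ e he
  exact hW.good

theorem Thy.Good.cs_der {T : Thy A} {X : PreCtx A} (hX : Derivable T.ax (.ctx X)) {u : Expr A}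
    (h : T.Good X u) : Derivable T.ax (.sort X (T.cs X u)) := by
  obtain ⟨n, U, hn⟩ := h
  exact (hn.cs_arg hX).sat.der hX

/-- The data of the tensor product of two theories. -/
def tsys (a : Thy A) (b : Thy B) : Sys A B (A.tensor B) where
  a := a
  b := b
  ax := tensorAx a.ax b.ax a.ch b.ch
  v := Prod.mk
  v_inj h := Prod.mk.inj h
  sS := Prod.mk
  tL S t := .inl (S, t)
  tR t T := .inr (t, T)
  ord := true
  pref := true

variable {a : Thy A} {b : Thy B}

/-- Inputs on which the graph of the tensor product of terms computes the canonical tensor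
product over the contexts `X'` and `Y'`. -/
structure Adm (a : Thy A) (b : Thy B) (p : TArg A) (X' : PreCtx A) (q : TArg B) (Y' : PreCtx B) :
    Prop where
  ctxa : Derivable a.ax (.ctx X')
  ctxb : Derivable b.ax (.ctx Y')
  prea : p.ctx <+: X'
  preb : q.ctx <+: Y'
  srta : ∀ e ∈ p.srt.args, a.Good p.ctx e
  srtb : ∀ e ∈ q.srt.args, b.Good q.ctx e
  appa : ∀ t f, p.tm = .app t f → a.Good p.ctx p.tm
  appb : ∀ t f, q.tm = .app t f → b.Good q.ctx q.tm
  vara : ∀ x t f, p.tm = .var x → q.tm = .app t f → (x, p.srt) ∈ X'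
  varb : ∀ y t f, p.tm = .app t f → q.tm = .var y → (y, q.srt) ∈ Y'
  cs : ∀ t f t' f', p.tm = .app t f → q.tm = .app t' f' → a.cs p.ctx p.tm = p.srt

theorem Adm.canon {X X' : PreCtx A} {Y Y' : PreCtx B} (hX : Derivable a.ax (.ctx X'))
    (hY : Derivable b.ax (.ctx Y')) (pX : X <+: X') (pY : Y <+: Y') {u : Expr A} {U : SortE A}
    {v : Expr B} {V : SortE B} (hu : a.Good X u) (hU : CanonSort a.ax X u U) (hv : b.Good Y v)
    (hV : CanonSort b.ax Y v V) : Adm a b ⟨X, u, U⟩ X' ⟨Y, v, V⟩ Y' := by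
  have hX0 := der_ctx_pfx hX pX
  have hY0 := der_ctx_pfx hY pY
  refine ⟨hX, hY, pX, pY, ?_, ?_, fun _ _ _ => hu, fun _ _ _ => hv, ?_, ?_, ?_⟩
  · rw [← hU.cs_eq hX0]
    exact fun e he => (hu.cs_lt hX0 e he).1
  · rw [← hV.cs_eq hY0]
    exact fun e he => (hv.cs_lt hY0 e he).1
  · rintro x t f ⟨⟩ -
    exact pX.subset hU.mem
  · rintro y t f - ⟨⟩
    exact pY.subset hV.mem
  · exact fun _ _ _ _ _ _ => hU.cs_eq hX0

/-- A variable taken at its sort in the left-hand context. -/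
theorem Adm.left {X X' : PreCtx A} {Y Y' : PreCtx B} (hX : Derivable a.ax (.ctx X'))
    (hY : Derivable b.ax (.ctx Y')) (pX : X <+: X') (pY : Y <+: Y') {x : A.Var} {U : SortE A}
    {v : Expr B} {V : SortE B} (hU : ∀ e ∈ U.args, a.Good X e) (hx : (x, U) ∈ X')
    (hV : ∀ e ∈ V.args, b.Good Y e) (hv : b.Good Y v) :
    Adm a b ⟨X, .var x, U⟩ X' ⟨Y, v, V⟩ Y' := by
  refine ⟨hX, hY, pX, pY, hU, hV, ?_, fun _ _ _ => hv, ?_, ?_, ?_⟩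
  · rintro t f ⟨⟩
  · rintro _ t f ⟨⟩ -
    exact hx
  · rintro y t f ⟨⟩
  · rintro t f t' f' ⟨⟩

/-- A variable taken at its sort in the right-hand context. -/
theorem Adm.right {X X' : PreCtx A} {Y Y' : PreCtx B} (hX : Derivable a.ax (.ctx X'))
    (hY : Derivable b.ax (.ctx Y')) (pX : X <+: X') (pY : Y <+: Y') {y : B.Var} {U : SortE A}
    {u : Expr A} {V : SortE B} (hV : ∀ e ∈ V.args, b.Good Y e) (hy : (y, V) ∈ Y')
    (hU : ∀ e ∈ U.args, a.Good X e) (hu : a.Good X u) :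
    Adm a b ⟨X, u, U⟩ X' ⟨Y, .var y, V⟩ Y' := by
  refine ⟨hX, hY, pX, pY, hU, hV, fun _ _ _ => hu, ?_, ?_, ?_, ?_⟩
  · rintro t f ⟨⟩
  · rintro x t f - ⟨⟩
  · rintro _ t f - ⟨⟩
    exact hy
  · rintro t f t' f' - ⟨⟩

theorem Thy.fresh_ctx {X : PreCtx A} {U : SortE A} {x : A.Var} (hU : Derivable a.ax (.sort X U))
    (hx : ∀ p ∈ X, p.1 ≠ x) : Derivable a.ax (.ctx (X ++ [(x, U)])) :=
  der_ctx_snoc a.pre hU (by simpa [List.mem_map] using fun W h => hx (x, W) h rfl)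

theorem ten_appapp {X : PreCtx A} {Y : PreCtx B} (hX : Derivable a.ax (.ctx X))
    (hY : Derivable b.ax (.ctx Y)) {u : Expr A} {v : Expr B} (hu : a.Good X u) (hv : b.Good Y v)
    {x : A.Var} (hx : ∀ p ∈ X, p.1 ≠ x) {g : ℕ → Expr (A.tensor B)}
    (hg : ∀ j (hj : j < Y.length), g j = (tsys a b).ten X Y u (.var Y[j].1)) :
    ((tsys a b).ten (X ++ [(x, a.cs X u)]) Y (.var x) v).substL (pairsR x Y g) =
      (tsys a b).ten X Y u v := by
  have hU := hu.cs_der hX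
  have hX' := Thy.fresh_ctx hU hx
  have hx' := nodup_snoc hX'
  have := Sys.ten_subst (s := tsys a b) (X := X ++ [(x, a.cs X u)]) (X' := X) (Y := Y)
    (u := .var x) (v := v) (φ := upd .var x u) (τ := lookupV (pairsR x Y g)) rfl hX' hX hY ?_ ?_
    ?_ hv ?_
  · rw [Expr.subst_var, upd_self] at this
    exact this
  · intro p hp
    rcases List.mem_append.1 hp with h | h
    · rw [upd_mem hx' _ _ h]
      obtain ⟨n, hn⟩ := a.exists_ctxAt hX
      show a.cs X _ = _
      rw [Thy.cs_var hX h, upd_sort a.pre ((hn.arg h).sat.der hX) hx', SortE.subst_id]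
    · simp only [List.mem_singleton] at h
      subst h
      simp only [upd_self]
      rw [upd_sort a.pre hU hx', SortE.subst_id]
      rfl
  · intro p hp q hq
    rcases List.mem_append.1 hp with h | h
    · rw [upd_mem hx' _ _ h, Sys.ten_var_var]
      exact lookup_pairsR_not (hx _ h)
    · simp only [List.mem_singleton] at h
      subst h
      simp only [upd_self]
      exact lookup_pairsR (G := fun y => (tsys a b).ten X Y u (.var y)) hg hq
  · obtain ⟨n, hn⟩ := a.var_arg hX' (p := (x, a.cs X u)) (by simp)
    exact hn.good
  · rwa [Expr.subst_var, upd_self]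

end

section
variable {α β γ : Type} {as : List α} {bs : List β} {F : α → β → γ} {M : ℕ → ℕ → γ} {L : List γ}

theorem IsGrid.eq_gr_left {a : α} (h : IsGrid (as.length + 1) bs.length M L)
    (hM : ∀ i (hi : i < as.length) j (hj : j < bs.length), M i j = F as[i] bs[j])
    (ha : ∀ j (hj : j < bs.length), M as.length j = F a bs[j]) :
    L = gr true (as ++ [a]) bs F := by
  refine IsGrid.eq_gr (M := M) (by simpa using h) fun i hi j hj => ?_
  rw [List.getElem_append]
  split
  · exact hM i ‹_› j hj
  · obtain rfl : i = as.length := by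
      simp at hi
      omega
    simpa using ha j hj

theorem IsGrid.eq_gr_right {b : β} (h : IsGrid as.length (bs.length + 1) M L)
    (hM : ∀ i (hi : i < as.length) j (hj : j < bs.length), M i j = F as[i] bs[j])
    (hb : ∀ i (hi : i < as.length), M i bs.length = F as[i] b) :
    L = gr true as (bs ++ [b]) F := by
  refine IsGrid.eq_gr (M := M) (by simpa using h) fun i hi j hj => ?_
  rw [List.getElem_append]
  split
  · exact hM i hi j ‹_›
  · obtain rfl : j = bs.length := by
      simp at hj
      omega
    simpa using hb i hi

end

section
variable {A B : Alphabet} {a : Thy A} {b : Thy B}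

theorem Thy.mem_good {X : PreCtx A} (hX : Derivable a.ax (.ctx X)) {x : A.Var} {U : SortE A}
    (h : (x, U) ∈ X) : a.Good X (.var x) := by
  obtain ⟨n, hn⟩ := a.var_arg hX h
  exact hn.good

theorem Thy.entry_mem {X : PreCtx A} {i : ℕ} (hi : i < X.length) :
    (X[i].1, X[i].2) ∈ X := List.getElem_mem hi

/-- The graph of the tensor product of terms computes the canonical tensor product. -/
theorem TTg.eq_ten {p : TArg A} {q : TArg B} {e : Expr (A.tensor B)}
    (h : TTg a.ax b.ax false p q e) : ∀ {X' : PreCtx A} {Y' : PreCtx B}, Adm a b p X' q Y' →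
      e = (tsys a b).ten X' Y' p.tm q.tm := by
  generalize hfl : false = fl at h
  induction h with
  | varvar => intro X' Y' H; exact ((tsys a b).ten_var_var X' Y' _ _).symm
  | @varapp fl X x S ss Y t ts V SS TSf hSS hTS M out hM hMx hout ihM ihx =>
    intro X' Y' H
    have hv := H.appb _ _ rfl
    have hx := H.vara _ _ _ rfl rfl
    have hX0 := der_ctx_pfx H.ctxa H.prea
    have hY0 := der_ctx_pfx H.ctxb H.preb
    have hs := fun i (hi : i < ss.length) => H.srta _ (List.getElem_mem hi)
    have ht := fun j (hj : j < ts.length) => (hv.arg_lt _ (List.getElem_mem hj)).1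
    rw [(tsys a b).ten_left H.ctxa (Thy.mem_good H.ctxa hx) (hv.pfx H.preb) (.inl ⟨_, rfl⟩)]
    rw [show (tsys a b).a.cs X' (.var x) = _ from Thy.cs_var H.ctxa hx]
    refine congrArg _ (IsGrid.eq_gr_left hout (fun i hi j hj => ?_) fun j hj => ?_)
    · exact ihM i hi j hj hfl (.canon H.ctxa H.ctxb H.prea H.preb (hs i hi) (hSS i hi) (ht j hj)
        (hTS j hj))
    · refine ihx j hj hfl (.left H.ctxa H.ctxb H.prea H.preb H.srta hx ?_ (ht j hj))
      rw [← (hTS j hj).cs_eq hY0]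
      exact fun e he => ((ht j hj).cs_lt hY0 e he).1
  | @appvar fl X s ss U Y y T ts SS TSf hSS hTS M out hM hMy hout ihM ihy =>
    intro X' Y' H
    have hu := H.appa _ _ rfl
    have hy := H.varb _ _ _ rfl rfl
    have hX0 := der_ctx_pfx H.ctxa H.prea
    have hs := fun i (hi : i < ss.length) => (hu.arg_lt _ (List.getElem_mem hi)).1
    have ht := fun j (hj : j < ts.length) => H.srtb _ (List.getElem_mem hj)
    rw [(tsys a b).ten_right H.ctxb (hu.pfx H.prea) (Thy.mem_good H.ctxb hy) (.inl ⟨_, rfl⟩)]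
    rw [show (tsys a b).b.cs Y' (.var y) = _ from Thy.cs_var H.ctxb hy]
    refine congrArg _ (IsGrid.eq_gr_right hout (fun i hi j hj => ?_) fun i hi => ?_)
    · exact ihM i hi j hj hfl (.canon H.ctxa H.ctxb H.prea H.preb (hs i hi) (hSS i hi) (ht j hj)
        (hTS j hj))
    · refine ihy i hi hfl (.right H.ctxa H.ctxb H.prea H.preb H.srtb hy ?_ (hs i hi))
      rw [← (hSS i hi).cs_eq hX0]
      exact fun e he => ((hs i hi).cs_lt hX0 e he).1
  | @appapp_base X s ss U Y t ts V x hx e0 h0 g hg ih0 ihg =>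
    intro X' Y' H
    have hu := H.appa _ _ rfl
    have hv := H.appb _ _ rfl
    have hX0 := der_ctx_pfx H.ctxa H.prea
    have hY0 := der_ctx_pfx H.ctxb H.preb
    have hU : a.cs X (.app s ss) = U := H.cs _ _ _ _ rfl rfl
    have hU' := hu.cs_der hX0
    have hX1 := Thy.fresh_ctx hU' hx
    rw [hU] at hX1
    rw [ih0 rfl (.left hX1 hY0 (List.prefix_append _ _) List.prefix_rfl H.srta (by simp) H.srtb hv),
      (tsys a b).ten_pfx H.ctxa H.ctxb H.prea H.preb hu hv]
    rw [← hU]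
    refine ten_appapp hX0 hY0 hu hv hx fun j hj => ?_
    exact ihg j hj rfl (.right hX0 hY0 List.prefix_rfl (List.take_prefix _ _)
      (Thy.entry_good hY0 hj) (Thy.entry_mem hj) H.srta hu)
  | appapp_star => cases hfl

end

section
variable {α β γ : Type} {as : List α} {bs : List β} {F : α → β → γ} {M : ℕ → ℕ → γ} {L : List γ}

theorem IsGrid.forall₂ {m n : ℕ} {M M' : ℕ → ℕ → γ} {L L' : List γ} {R : γ → γ → Prop}
    (h : IsGrid m n M L) (h' : IsGrid m n M' L') (hM : ∀ i < m, ∀ j < n, R (M i j) (M' i j)) :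
    List.Forall₂ R L L' := by
  refine List.forall₂_iff_get.2 ⟨h.1.trans h'.1.symm, fun k hk hk' => ?_⟩
  have hk2 : k < m * n := h.1 ▸ hk
  have hn : 0 < n := Nat.pos_of_ne_zero fun h0 => by simp [h0] at hk2
  have hi : k / n < m := Nat.div_lt_of_lt_mul (by rwa [mul_comm])
  have hj : k % n < n := Nat.mod_lt _ hn
  have e : k / n * n + k % n = k := Nat.div_add_mod' k n
  have h1 := h.2 _ _ hi hj (by rwa [e])
  have h2 := h'.2 _ _ hi hj (by rwa [e])
  simp only [e] at h1 h2
  simp only [List.get_eq_getElem]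
  rw [h1, h2]
  exact hM _ hi _ hj

open Classical in
theorem gr_grid (as : List α) (bs : List β) (F : α → β → γ) (M : ℕ → ℕ → γ) :
    ∃ M' : ℕ → ℕ → γ, IsGrid as.length bs.length M' (gr true as bs F) ∧
      ∀ i (hi : i < as.length) j (hj : j < bs.length), M' i j = F as[i] bs[j] := by
  refine ⟨fun i j => if h : i < as.length ∧ j < bs.length then F (as[i]'h.1) (bs[j]'h.2) else M i j,
    gr_isGrid as bs F _ ?_, ?_⟩ <;> exact fun i hi j hj => dif_pos ⟨hi, hj⟩

theorem IsGrid.forall₂_gr {R : γ → γ → Prop} (h : IsGrid as.length bs.length M L)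
    (hM : ∀ i (hi : i < as.length) j (hj : j < bs.length), R (M i j) (F as[i] bs[j])) :
    List.Forall₂ R L (gr true as bs F) := by
  obtain ⟨M', h', e⟩ := gr_grid as bs F M
  refine h.forall₂ h' fun i hi j hj => ?_
  rw [e i hi j hj]
  exact hM i hi j hj

theorem IsGrid.forall₂_gr_left {R : γ → γ → Prop} {a : α}
    (h : IsGrid (as.length + 1) bs.length M L)
    (hM : ∀ i (hi : i < as.length) j (hj : j < bs.length), R (M i j) (F as[i] bs[j]))
    (ha : ∀ j (hj : j < bs.length), R (M as.length j) (F a bs[j])) :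
    List.Forall₂ R L (gr true (as ++ [a]) bs F) := by
  refine IsGrid.forall₂_gr (M := M) (by simpa using h) fun i hi j hj => ?_
  rw [List.getElem_append]
  split
  · exact hM i ‹_› j hj
  · obtain rfl : i = as.length := by
      simp at hi
      omega
    simpa using ha j hj

theorem IsGrid.forall₂_gr_right {R : γ → γ → Prop} {b : β}
    (h : IsGrid as.length (bs.length + 1) M L)
    (hM : ∀ i (hi : i < as.length) j (hj : j < bs.length), R (M i j) (F as[i] bs[j]))
    (hb : ∀ i (hi : i < as.length), R (M i bs.length) (F as[i] b)) :
    List.Forall₂ R L (gr true as (bs ++ [b]) F) := by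
  refine IsGrid.forall₂_gr (M := M) (by simpa using h) fun i hi j hj => ?_
  rw [List.getElem_append]
  split
  · exact hM i hi j ‹_›
  · obtain rfl : j = bs.length := by
      simp at hj
      omega
    simpa using hb i hi

end

section
variable {A B : Alphabet} {a : Thy A} {b : Thy B} {n m : ℕ} {X' : PreCtx A} {Y' : PreCtx B}
  {Δ : PreCtx (A.tensor B)}

theorem Thy.Arg.args' {T : Thy A} {n : ℕ} {X : PreCtx A} {t : A.TermSym} {f : List (Expr A)}
    {U : SortE A} (h : T.Arg n X (.app t f) U) : ∀ a ∈ f, ∃ W, T.Arg n X a W := by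
  obtain ⟨k, rfl⟩ := h.sat.pos
  intro a ha
  obtain ⟨W, hW⟩ := h.args a ha
  exact ⟨W, hW.mono (Nat.le_succ k)⟩

theorem CanonSort.arg {T : Thy A} {X : PreCtx A} (hX : Derivable T.ax (.ctx X)) {u : Expr A}
    {U : SortE A} (h : CanonSort T.ax X u U) (hu : ∃ W, T.Arg n X u W) : T.Arg n X u U := by
  obtain ⟨W, hW⟩ := hu
  rw [← h.cs_eq hX]
  exact hW.cs_arg hX

/-- Two canonical arguments have a strictly computed tensor product. -/
theorem TTg.teq_canon (hA : (tsys a b).Amb n m X' Y' Δ) {X : PreCtx A} {Y : PreCtx B}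
    (pX : X <+: X') (pY : Y <+: Y') {u : Expr A} {v : Expr B} {U : SortE A} {V : SortE B}
    {e : Expr (A.tensor B)} (h : TTg a.ax b.ax false ⟨X, u, U⟩ ⟨Y, v, V⟩ e)
    (hU : CanonSort a.ax X u U) (hV : CanonSort b.ax Y v V) (hu : a.Arg n X u U)
    (hv : b.Arg m Y v V) :
    TEq (tsys a b).ax Δ e ((tsys a b).ten X' Y' u v) := by
  rw [h.eq_ten (.canon hA.ctxa hA.ctxb pX pY hu.good hU hv.good hV)]
  exact (hA.typ (hu.pfx pX) (hv.pfx pY)).teq_refl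

theorem TTg.teq_left (hP : Pre (tsys a b).ax) (hA : (tsys a b).Amb n m X' Y' Δ) {p : TArg A}
    {q : TArg B} {e : Expr (A.tensor B)} (h : TTg a.ax b.ax false p q e) :
    (∃ x, p.tm = .var x) → p.ctx <+: X' → q.ctx <+: Y' →
      a.Arg n p.ctx p.tm p.srt → b.Arg m q.ctx q.tm q.srt →
      TEq (tsys a b).ax Δ e ((tsys a b).ten X' Y' p.tm q.tm) := by
  generalize hfl : false = fl at h
  induction h with
  | varvar =>
    intro _ pX pY hu hv
    have := (hA.typ (hu.pfx pX) (hv.pfx pY)).teq_refl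
    rwa [Sys.ten_var_var] at this ⊢
  | @varapp fl X x S ss Y t ts V SS TSf hSS hTS M out hM hMx hout ihM ihx =>
    intro _ pX pY hu hv
    subst hfl
    have hX0 := der_ctx_pfx hA.ctxa pX
    have hY0 := der_ctx_pfx hA.ctxb pY
    have hl := hA.left (hu.pfx pX) (hv.pfx pY)
    refine (hl.trans hP (cong_app hP (hl.term_right hP (hA.typ (hu.pfx pX) (hv.pfx pY)))
      ?_)).symm
    refine List.Forall₂.flip (IsGrid.forall₂_gr_left hout (fun i hi j hj => ?_) fun j hj => ?_)
    · exact ((hM i hi j hj).teq_canon hA pX pY (hSS i hi) (hTS j hj)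
        ((hSS i hi).arg hX0 (hu.sat.args' _ (List.getElem_mem hi)))
        ((hTS j hj).arg hY0 (hv.args' _ (List.getElem_mem hj)))).symm
    · exact (ihx j hj rfl ⟨x, rfl⟩ pX pY hu ((hTS j hj).arg hY0
        (hv.args' _ (List.getElem_mem hj)))).symm
  | appvar => rintro ⟨_, ⟨⟩⟩
  | appapp_base => rintro ⟨_, ⟨⟩⟩
  | appapp_star => rintro ⟨_, ⟨⟩⟩

theorem TTg.teq_right (hP : Pre (tsys a b).ax) (hA : (tsys a b).Amb n m X' Y' Δ) {p : TArg A}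
    {q : TArg B} {e : Expr (A.tensor B)} (h : TTg a.ax b.ax false p q e) :
    (∃ y, q.tm = .var y) → p.ctx <+: X' → q.ctx <+: Y' →
      a.Arg n p.ctx p.tm p.srt → b.Arg m q.ctx q.tm q.srt →
      TEq (tsys a b).ax Δ e ((tsys a b).ten X' Y' p.tm q.tm) := by
  generalize hfl : false = fl at h
  induction h with
  | varvar =>
    intro _ pX pY hu hv
    have := (hA.typ (hu.pfx pX) (hv.pfx pY)).teq_refl
    rwa [Sys.ten_var_var] at this ⊢
  | @appvar fl X s ss U Y y T ts SS TSf hSS hTS M out hM hMy hout ihM ihy =>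
    intro _ pX pY hu hv
    subst hfl
    have hX0 := der_ctx_pfx hA.ctxa pX
    have hY0 := der_ctx_pfx hA.ctxb pY
    have hl := hA.right (hu.pfx pX) (hv.pfx pY)
    refine (hl.trans hP (cong_app hP (hl.term_right hP (hA.typ (hu.pfx pX) (hv.pfx pY)))
      ?_)).symm
    refine List.Forall₂.flip (IsGrid.forall₂_gr_right hout (fun i hi j hj => ?_) fun i hi => ?_)
    · exact ((hM i hi j hj).teq_canon hA pX pY (hSS i hi) (hTS j hj)
        ((hSS i hi).arg hX0 (hu.args' _ (List.getElem_mem hi)))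
        ((hTS j hj).arg hY0 (hv.sat.args' _ (List.getElem_mem hj)))).symm
    · exact (ihy i hi rfl ⟨y, rfl⟩ pX pY ((hSS i hi).arg hX0
        (hu.args' _ (List.getElem_mem hi))) hv).symm
  | varapp => rintro ⟨_, ⟨⟩⟩
  | appapp_base => rintro ⟨_, ⟨⟩⟩
  | appapp_star => rintro ⟨_, ⟨⟩⟩

theorem Thy.ctxAt_fresh {X : PreCtx A} {U : SortE A} {u : Expr A} (cX : a.CtxAt n X)
    (hu : a.Arg n X u U) {x : A.Var} (hx : ∀ p ∈ X, p.1 ≠ x) :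
    Derivable a.ax (.ctx (X ++ [(x, U)])) ∧ a.Mor n (upd .var x u) (X ++ [(x, U)]) X := by
  have hX := Thy.fresh_ctx (hu.sat.der cX.der) hx
  exact ⟨hX, cX.mor.upd le_rfl List.prefix_rfl hX (by rwa [SortE.subst_id])⟩

theorem Thy.Arg.sort_good {X : PreCtx A} {u : Expr A} {U : SortE A} (h : a.Arg n X u U) :
    ∀ e ∈ U.args, a.Good X e := fun e he => by
  obtain ⟨W, hW⟩ := h.sat.args' e he
  exact hW.good

/-- The entries of the first substitution in the definition of the tensor product. -/
theorem TTg.entry_right {X : PreCtx A} {Y : PreCtx B} (hX : Derivable a.ax (.ctx X))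
    (hY : Derivable b.ax (.ctx Y)) {u : Expr A} {U : SortE A} (hU : ∀ e ∈ U.args, a.Good X e)
    (hu : a.Good X u) {j : ℕ} (hj : j < Y.length) {e : Expr (A.tensor B)}
    (h : TTg a.ax b.ax false ⟨X, u, U⟩ ⟨Y.take j, .var Y[j].1, Y[j].2⟩ e) :
    e = (tsys a b).ten X Y u (.var Y[j].1) :=
  h.eq_ten (.right hX hY List.prefix_rfl (List.take_prefix _ _) (Thy.entry_good hY hj)
    (Thy.entry_mem hj) hU hu)

theorem TTg.entry_left {X : PreCtx A} {Y : PreCtx B} (hX : Derivable a.ax (.ctx X))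
    (hY : Derivable b.ax (.ctx Y)) {v : Expr B} {V : SortE B} (hV : ∀ e ∈ V.args, b.Good Y e)
    (hv : b.Good Y v) {i : ℕ} (hi : i < X.length) {e : Expr (A.tensor B)}
    (h : TTg a.ax b.ax false ⟨X.take i, .var X[i].1, X[i].2⟩ ⟨Y, v, V⟩ e) :
    e = (tsys a b).ten X Y (.var X[i].1) v :=
  h.eq_ten (.left hX hY (List.take_prefix _ _) List.prefix_rfl (Thy.entry_good hX hi)
    (Thy.entry_mem hi) hV hv)

theorem TTg.teq (hP : Pre (tsys a b).ax) {X : PreCtx A} {Y : PreCtx B}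
    (hA : (tsys a b).Amb n m X Y Δ) (cX : a.CtxAt n X) (cY : b.CtxAt m Y) {u : Expr A}
    {U : SortE A} {v : Expr B} {V : SortE B} {e : Expr (A.tensor B)}
    (h : TTg a.ax b.ax false ⟨X, u, U⟩ ⟨Y, v, V⟩ e) (hu : a.Arg n X u U) (hv : b.Arg m Y v V) :
    TEq (tsys a b).ax Δ e ((tsys a b).ten X Y u v) := by
  cases u with
  | var x => exact h.teq_left hP hA ⟨x, rfl⟩ List.prefix_rfl List.prefix_rfl hu hv
  | app t f =>
    cases v with
    | var y => exact h.teq_right hP hA ⟨y, rfl⟩ List.prefix_rfl List.prefix_rfl hu hv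
    | app r k =>
      cases h with
      | @appapp_base _ _ _ _ _ _ _ _ x hx e0 h0 g hg =>
        obtain ⟨hX1, hm⟩ := Thy.ctxAt_fresh cX hu hx
        rw [h0.eq_ten (.left hX1 cY.der (List.prefix_append _ _) List.prefix_rfl hu.sort_good
          (by simp) hv.sort_good hv.good)]
        have fx := nodup_snoc hX1
        have key := Sys.dsl_of_eq (s := tsys a b) hP hA hX1 cY.der (Φ := upd .var x (.app t f))
          (Ψ := .var) (τ := lookupV (pairsR x Y g)) hm cY.mor (fun _ _ => rfl) (fun _ _ => rfl) ?_
          hX1 cY.der List.prefix_rfl List.prefix_rfl (u := .var x) (v := .app r k)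
          (Thy.mem_good hX1 (U := U) (by simp)) hv.good ?_ ?_
        · rwa [Expr.subst_var, upd_self, Expr.subst_id] at key
        · intro p hp q hq
          rcases List.mem_append.1 hp with hp | hp
          · rw [upd_mem fx _ _ hp, Sys.ten_var_var]
            exact lookup_pairsR_not (hx _ hp)
          · obtain rfl := List.mem_singleton.1 hp
            rw [upd_self]
            exact lookup_pairsR (G := fun y => (tsys a b).ten X Y (.app t f) (.var y))
              (fun j hj => (hg j hj).entry_right cX.der cY.der hu.sort_good hu.good) hq
        · rw [Expr.subst_var, upd_self]
          exact ⟨U, hu⟩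
        · rw [Expr.subst_id]
          exact ⟨V, hv⟩

theorem TTd.teq (hP : Pre (tsys a b).ax) {X : PreCtx A} {Y : PreCtx B}
    (hA : (tsys a b).Amb n m X Y Δ) (cX : a.CtxAt n X) (cY : b.CtxAt m Y) {u : Expr A}
    {U : SortE A} {v : Expr B} {V : SortE B} {e : Expr (A.tensor B)}
    (h : TTd a.ax b.ax false ⟨X, u, U⟩ ⟨Y, v, V⟩ e) (hu : a.Arg n X u U) (hv : b.Arg m Y v V) :
    TEq (tsys a b).ax Δ e ((tsys a b).ten X Y u v) := by
  cases h with
  | varL h => exact h.teq hP hA cX cY hu hv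
  | varR h => exact h.teq hP hA cX cY hu hv
  | @appapp_base _ t f _ _ r k _ y hy e0 h0 g hg =>
    obtain ⟨hY1, hm⟩ := Thy.ctxAt_fresh cY hv hy
    rw [h0.eq_ten (.right cX.der hY1 List.prefix_rfl (List.prefix_append _ _) hv.sort_good
      (by simp) hu.sort_good hu.good)]
    have fy := nodup_snoc hY1
    have key := Sys.dsl_of_eq (s := tsys a b) hP hA cX.der hY1 (Φ := .var)
      (Ψ := upd .var y (.app r k)) (τ := lookupV (pairsL X y g)) cX.mor hm (fun _ _ => rfl)
      (fun _ _ => rfl) ?_ cX.der hY1 List.prefix_rfl List.prefix_rfl (u := .app t f) (v := .var y)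
      hu.good (Thy.mem_good hY1 (U := V) (by simp)) ?_ ?_
    · rwa [Expr.subst_var, upd_self, Expr.subst_id] at key
    · intro p hp q hq
      rcases List.mem_append.1 hq with hq | hq
      · rw [upd_mem fy _ _ hq, Sys.ten_var_var]
        exact lookup_pairsL_not (hy _ hq)
      · obtain rfl := List.mem_singleton.1 hq
        rw [upd_self]
        exact lookup_pairsL (G := fun x => (tsys a b).ten X Y (.var x) (.app r k))
          (fun i hi => (hg i hi).entry_left cX.der cY.der hv.sort_good hv.good) hp
    · rw [Expr.subst_id]
      exact ⟨U, hu⟩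
    · rw [Expr.subst_var, upd_self]
      exact ⟨V, hv⟩

end

section
variable {γ : Type}

theorem exists_entries [Inhabited γ] {m n : ℕ} {P : ∀ i, i < m → ∀ j, j < n → γ → Prop}
    {Q : ∀ j, j < n → γ → Prop} {R : ∀ i, i < m → γ → Prop} (hP : ∀ i hi j hj, ∃ e, P i hi j hj e)
    (hQ : ∀ j hj, ∃ e, Q j hj e) (hR : ∀ i hi, ∃ e, R i hi e) :
    ∃ M : ℕ → ℕ → γ, (∀ i hi j hj, P i hi j hj (M i j)) ∧ (∀ j hj, Q j hj (M m j)) ∧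
      ∀ i hi, R i hi (M i n) := by
  have : ∀ i j, ∃ e, (∀ hi hj, P i hi j hj e) ∧ (i = m → ∀ hj, Q j hj e) ∧
      (j = n → ∀ hi, R i hi e) := by
    intro i j
    by_cases hi : i < m
    · by_cases hj : j < n
      · obtain ⟨e, he⟩ := hP i hi j hj
        exact ⟨e, fun _ _ => he, fun h => by omega, fun h => by omega⟩
      · obtain ⟨e, he⟩ := hR i hi
        exact ⟨e, fun _ h => absurd h hj, fun h => by omega, fun _ _ => he⟩
    · by_cases hj : j < n
      · obtain ⟨e, he⟩ := hQ j hj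
        exact ⟨e, fun h => absurd h hi, fun _ _ => he, fun h => by omega⟩
      · exact ⟨default, fun h => absurd h hi, fun _ h => absurd h hj, fun _ h => absurd h hi⟩
  choose M hM using this
  exact ⟨M, fun i hi j hj => (hM i j).1 hi hj, fun j hj => (hM m j).2.1 rfl hj,
    fun i hi => (hM i n).2.2 rfl hi⟩

theorem exists_isGrid (m n : ℕ) (M : ℕ → ℕ → γ) : ∃ L, IsGrid m n M L := by
  have := gr_isGrid (List.range m) (List.range n) M M (by simp)
  exact ⟨_, by simpa using this⟩

end

section
variable {A B : Alphabet} {a : Thy A} {b : Thy B} {X' : PreCtx A} {Y' : PreCtx B}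

noncomputable instance : Inhabited (Expr A) :=
  haveI := A.var_infinite
  ⟨.var (Classical.arbitrary A.Var)⟩

/-- The canonical sorts of the entries of a list. -/
noncomputable def Thy.css (T : Thy A) (X : PreCtx A) (f : List (Expr A)) (i : ℕ) : SortE A :=
  T.cs X (f.getD i default)

theorem Thy.css_eq (T : Thy A) (X : PreCtx A) (f : List (Expr A)) {i : ℕ} (hi : i < f.length) :
    T.css X f i = T.cs X f[i] := by
  rw [Thy.css, List.getD_eq_getElem _ _ hi]

theorem Thy.css_canon {T : Thy A} {X : PreCtx A} (hX : Derivable T.ax (.ctx X))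
    {f : List (Expr A)} {i : ℕ} (hi : i < f.length) (h : T.Good X f[i]) :
    CanonSort T.ax X f[i] (T.css X f i) := by
  rw [Thy.css_eq _ _ _ hi]
  exact h.canon hX

theorem Thy.Good.cs_good {T : Thy A} {X : PreCtx A} (hX : Derivable T.ax (.ctx X)) {u : Expr A}
    (h : T.Good X u) : ∀ e ∈ (T.cs X u).args, T.Good X e := fun e he => (h.cs_lt hX e he).1

theorem exists_ttg_aux (k : ℕ) : ∀ (p : TArg A) (q : TArg B) (X' : PreCtx A) (Y' : PreCtx B),
    (∀ x, p.tm = .var x → ∀ e ∈ p.srt.args, a.rk p.ctx e < k) →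
    (∀ t f, p.tm = .app t f → a.rk p.ctx p.tm ≤ k) → Adm a b p X' q Y' →
    ∃ e, TTg a.ax b.ax false p q e := by
  induction k using Nat.strong_induction_on with
  | _ k ih =>
  have sub : ∀ {X : PreCtx A} {u : Expr A} (q : TArg B) {X' : PreCtx A} {Y' : PreCtx B},
      Derivable a.ax (.ctx X) → a.Good X u → a.rk X u < k → Adm a b ⟨X, u, a.cs X u⟩ X' q Y' →
      ∃ e, TTg a.ax b.ax false ⟨X, u, a.cs X u⟩ q e := by
    intro X u q X' Y' hX hu hk hA
    refine ih _ hk _ q X' Y' ?_ ?_ hA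
    · rintro x - e he
      exact (hu.cs_lt hX e he).2
    · exact fun _ _ _ => le_rfl
  have hV : ∀ {X X' : PreCtx A} {Y Y' : PreCtx B} (x : A.Var) (U : SortE A) (v : Expr B)
      (V : SortE B), (∀ e ∈ U.args, a.rk X e < k) → Adm a b ⟨X, .var x, U⟩ X' ⟨Y, v, V⟩ Y' →
      ∃ e, TTg a.ax b.ax false ⟨X, .var x, U⟩ ⟨Y, v, V⟩ e := by
    intro X X' Y Y' x U v
    induction v using Expr.induct with
    | hv y => exact fun V _ _ => ⟨_, .varvar⟩
    | ha t ts ihv =>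
      intro V hk H
      obtain ⟨S, ss⟩ := U
      have hX0 := der_ctx_pfx H.ctxa H.prea
      have hY0 := der_ctx_pfx H.ctxb H.preb
      have hx := H.vara _ _ _ rfl rfl
      have hs := fun i (hi : i < ss.length) => H.srta _ (List.getElem_mem hi)
      have ht := fun j (hj : j < ts.length) =>
        ((H.appb _ _ rfl).arg_lt _ (List.getElem_mem hj)).1
      obtain ⟨M, hM, hMx, -⟩ := exists_entries (γ := Expr (A.tensor B)) (m := ss.length)
        (n := ts.length)
        (P := fun i hi j hj e => TTg a.ax b.ax false ⟨X, ss[i], a.css X ss i⟩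
          ⟨Y, ts[j], b.css Y ts j⟩ e)
        (Q := fun j hj e => TTg a.ax b.ax false ⟨X, .var x, ⟨S, ss⟩⟩ ⟨Y, ts[j], b.css Y ts j⟩ e)
        (R := fun _ _ _ => True) (fun i hi j hj => by
              rw [Thy.css_eq _ _ _ hi, Thy.css_eq _ _ _ hj]
              exact sub _ hX0 (hs i hi) (hk _ (List.getElem_mem hi)) (.canon H.ctxa H.ctxb H.prea H.preb
                (hs i hi) ((hs i hi).canon hX0) (ht j hj) ((ht j hj).canon hY0))) (fun j hj => by
              rw [Thy.css_eq _ _ _ hj]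
              exact ihv _ (List.getElem_mem hj) _ hk (.left H.ctxa H.ctxb H.prea H.preb H.srta hx
                ((ht j hj).cs_good hY0) (ht j hj))) (fun _ _ => ⟨default, trivial⟩)
      obtain ⟨out, hout⟩ := exists_isGrid (ss.length + 1) ts.length M
      exact ⟨_, .varapp (a.css X ss) (b.css Y ts) (fun i hi => Thy.css_canon hX0 hi (hs i hi))
        (fun j hj => Thy.css_canon hY0 hj (ht j hj)) M out hM hMx hout⟩
  rintro ⟨X, u, U⟩ ⟨Y, v, V⟩ X' Y' h1 h2 H
  cases u with
  | var x => exact hV x U v V (h1 x rfl) H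
  | app s ss =>
    have hk := h2 _ _ rfl
    have hX0 := der_ctx_pfx H.ctxa H.prea
    have hu := H.appa _ _ rfl
    have hs := fun i (hi : i < ss.length) => (hu.arg_lt _ (List.getElem_mem hi)).1
    have hl := fun i (hi : i < ss.length) =>
      ((hu.arg_lt _ (List.getElem_mem hi)).2).trans_le hk
    have hvar : ∀ {X' : PreCtx A} {Y Y' : PreCtx B} (y : B.Var) (V : SortE B),
        Adm a b ⟨X, .app s ss, U⟩ X' ⟨Y, .var y, V⟩ Y' →
        ∃ e, TTg a.ax b.ax false ⟨X, .app s ss, U⟩ ⟨Y, .var y, V⟩ e := by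
      rintro X' Y Y' y ⟨T, ts⟩ H
      have hy := H.varb _ _ _ rfl rfl
      have hY0 := der_ctx_pfx H.ctxb H.preb
      have ht := fun j (hj : j < ts.length) => H.srtb _ (List.getElem_mem hj)
      obtain ⟨M, hM, -, hMy⟩ := exists_entries (γ := Expr (A.tensor B)) (m := ss.length)
        (n := ts.length)
        (P := fun i hi j hj e => TTg a.ax b.ax false ⟨X, ss[i], a.css X ss i⟩
          ⟨Y, ts[j], b.css Y ts j⟩ e)
        (Q := fun _ _ _ => True)
        (R := fun i hi e => TTg a.ax b.ax false ⟨X, ss[i], a.css X ss i⟩ ⟨Y, .var y, ⟨T, ts⟩⟩ e)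
        (fun i hi j hj => by
              rw [Thy.css_eq _ _ _ hi, Thy.css_eq _ _ _ hj]
              exact sub _ hX0 (hs i hi) (hl i hi) (.canon H.ctxa H.ctxb H.prea H.preb
                (hs i hi) ((hs i hi).canon hX0) (ht j hj) ((ht j hj).canon hY0))) (fun _ _ => ⟨default, trivial⟩) (fun i hi => by
              rw [Thy.css_eq _ _ _ hi]
              exact sub _ hX0 (hs i hi) (hl i hi) (.right H.ctxa H.ctxb H.prea H.preb H.srtb hy
                ((hs i hi).cs_good hX0) (hs i hi)))
      obtain ⟨out, hout⟩ := exists_isGrid ss.length (ts.length + 1) M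
      exact ⟨_, .appvar (a.css X ss) (b.css Y ts) (fun i hi => Thy.css_canon hX0 hi (hs i hi))
        (fun j hj => Thy.css_canon hY0 hj (ht j hj)) M out hM hMy hout⟩
    cases v with
    | var y => exact hvar y V H
    | app t ts =>
      have hv := H.appb _ _ rfl
      have hY0 := der_ctx_pfx H.ctxb H.preb
      have hU : a.cs X (.app s ss) = U := H.cs _ _ _ _ rfl rfl
      have hX1 := Thy.fresh_ctx (hu.cs_der hX0) (a.fresh X)
      rw [hU] at hX1
      obtain ⟨e0, h0⟩ := hV (a.ch X) U (.app t ts) V (X := X) (fun e he => by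
          rw [← hU] at he
          exact ((hu.cs_lt hX0 e he).2).trans_le hk)
        (.left hX1 hY0 (List.prefix_append _ _) List.prefix_rfl H.srta (by simp) H.srtb hv)
      obtain ⟨M, hM, -, -⟩ := exists_entries (γ := Expr (A.tensor B)) (m := 1)
        (n := Y.length)
        (P := fun i hi j hj e => TTg a.ax b.ax false ⟨X, .app s ss, U⟩
          ⟨Y.take j, .var Y[j].1, Y[j].2⟩ e)
        (Q := fun _ _ _ => True) (R := fun _ _ _ => True)
        (fun i hi j hj => hvar _ _ (.right hX0 hY0 List.prefix_rfl (List.take_prefix _ _)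
          (Thy.entry_good hY0 hj) (Thy.entry_mem hj) H.srta hu))
        (fun _ _ => ⟨default, trivial⟩) (fun _ _ => ⟨default, trivial⟩)
      exact ⟨_, .appapp_base (a.fresh X) e0 h0 (M 0) (hM 0 one_pos)⟩

theorem Adm.exists_ttg {p : TArg A} {q : TArg B} (h : Adm a b p X' q Y') :
    ∃ e, TTg a.ax b.ax false p q e := by
  refine exists_ttg_aux (a.rk p.ctx p.tm + (p.srt.args.map fun e => a.rk p.ctx e + 1).sum) p q X' Y' ?_
    (fun _ _ _ => Nat.le_add_right _ _) h
  intro x _ e he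
  have := List.single_le_sum (l := p.srt.args.map fun e => a.rk p.ctx e + 1) (by simp) _
    (List.mem_map_of_mem he)
  omega

theorem Adm.ttg {p : TArg A} {q : TArg B} (h : Adm a b p X' q Y') :
    TTg a.ax b.ax false p q ((tsys a b).ten X' Y' p.tm q.tm) := by
  obtain ⟨e, he⟩ := h.exists_ttg
  rwa [he.eq_ten h] at he

/-- The graph of the tensor product of sorts computes the canonical tensor product. -/
theorem TSo.eq_TT {X : PreCtx A} {x : A.Var} {U : SortE A} {Y : PreCtx B} {y : B.Var} {V : SortE B}
    {W : SortE (A.tensor B)} (h : TSo a.ax b.ax false X x U Y y V W)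
    (hX : Derivable a.ax (.ctx X')) (hY : Derivable b.ax (.ctx Y')) (pX : X <+: X')
    (pY : Y <+: Y') (hx : (x, U) ∈ X') (hy : (y, V) ∈ Y') (hU : ∀ e ∈ U.args, a.Good X e)
    (hV : ∀ e ∈ V.args, b.Good Y e) :
    W = (tsys a b).TT ((tsys a b).ten X' Y') U (.var x) V (.var y) := by
  obtain ⟨S, ss⟩ := U
  obtain ⟨T, ts⟩ := V
  cases h with
  | mk fx fy SS TSf hSS hTS M out hM hMx hMy hout =>
    have hX0 := der_ctx_pfx hX pX
    have hY0 := der_ctx_pfx hY pY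
    have hs := fun i (hi : i < ss.length) => hU _ (List.getElem_mem hi)
    have ht := fun j (hj : j < ts.length) => hV _ (List.getElem_mem hj)
    obtain ⟨M', h', e'⟩ := gr_grid (ss ++ [.var x]) (ts ++ [.var y]) ((tsys a b).ten X' Y') M
    simp only [List.length_append, List.length_singleton] at h'
    have key := hout.dropLast_ext h' fun i hi j hj hc => ?_
    · rw [key, gr_snoc, List.dropLast_concat]
      rfl
    · rw [e' i (by simpa using hi) j (by simpa using hj), List.getElem_append, List.getElem_append]
      split
      · split
        · exact (hM i ‹_› j ‹_›).eq_ten (.canon hX hY pX pY (hs i ‹_›) (hSS i ‹_›) (ht j ‹_›)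
            (hTS j ‹_›))
        · obtain rfl : j = ts.length := by omega
          have := (hMy i ‹_›).eq_ten (.right hX hY pX pY hV hy (by
            rw [← (hSS i ‹_›).cs_eq hX0]
            exact (hs i ‹_›).cs_good hX0) (hs i ‹_›))
          simpa using this
      · obtain rfl : i = ss.length := by omega
        have hj' : j < ts.length := by omega
        rw [dif_pos hj']
        have := (hMx j hj').eq_ten (.left hX hY pX pY hU hx (by
          rw [← (hTS j hj').cs_eq hY0]
          exact (ht j hj').cs_good hY0) (ht j hj'))
        simpa using this

theorem exists_tso {X : PreCtx A} {x : A.Var} {U : SortE A} {Y : PreCtx B} {y : B.Var} {V : SortE B}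
    (fx : ∀ p ∈ X, p.1 ≠ x) (fy : ∀ q ∈ Y, q.1 ≠ y)
    (hX : Derivable a.ax (.ctx X')) (hY : Derivable b.ax (.ctx Y')) (pX : X <+: X')
    (pY : Y <+: Y') (hx : (x, U) ∈ X') (hy : (y, V) ∈ Y') (hU : ∀ e ∈ U.args, a.Good X e)
    (hV : ∀ e ∈ V.args, b.Good Y e) :
    TSo a.ax b.ax false X x U Y y V
      ((tsys a b).TT ((tsys a b).ten X' Y') U (.var x) V (.var y)) := by
  obtain ⟨S, ss⟩ := U
  obtain ⟨T, ts⟩ := V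
  have hX0 := der_ctx_pfx hX pX
  have hY0 := der_ctx_pfx hY pY
  have hs := fun i (hi : i < ss.length) => hU _ (List.getElem_mem hi)
  have ht := fun j (hj : j < ts.length) => hV _ (List.getElem_mem hj)
  obtain ⟨M, hM, hMx, hMy⟩ := exists_entries (γ := Expr (A.tensor B)) (m := ss.length)
    (n := ts.length)
    (P := fun i hi j hj e => TTg a.ax b.ax false ⟨X, ss[i], a.css X ss i⟩
      ⟨Y, ts[j], b.css Y ts j⟩ e)
    (Q := fun j hj e => TTg a.ax b.ax false ⟨X, .var x, ⟨S, ss⟩⟩ ⟨Y, ts[j], b.css Y ts j⟩ e)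
    (R := fun i hi e => TTg a.ax b.ax false ⟨X, ss[i], a.css X ss i⟩ ⟨Y, .var y, ⟨T, ts⟩⟩ e)
    (fun i hi j hj => by
          rw [Thy.css_eq _ _ _ hi, Thy.css_eq _ _ _ hj]
          exact ⟨_, (Adm.canon hX hY pX pY (hs i hi) ((hs i hi).canon hX0) (ht j hj)
            ((ht j hj).canon hY0)).ttg⟩) (fun j hj => by
          rw [Thy.css_eq _ _ _ hj]
          exact ⟨_, (Adm.left hX hY pX pY hU hx ((ht j hj).cs_good hY0) (ht j hj)).ttg⟩) (fun i hi => by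
          rw [Thy.css_eq _ _ _ hi]
          exact ⟨_, (Adm.right hX hY pX pY hV hy ((hs i hi).cs_good hX0) (hs i hi)).ttg⟩)
  obtain ⟨out, hout⟩ := exists_isGrid (ss.length + 1) (ts.length + 1) M
  have := TSo.mk (b := false) fx fy (a.css X ss) (b.css Y ts)
    (fun i hi => Thy.css_canon hX0 hi (hs i hi)) (fun j hj => Thy.css_canon hY0 hj (ht j hj)) M out
    hM hMx hMy hout
  rwa [← this.eq_TT hX hY pX pY hx hy hU hV]

theorem tctx_isGrid (X : PreCtx A) (Y : PreCtx B) (s : Sys A B (A.tensor B)) (hs : s.ord = true) :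
    (s.tctx X Y).length = X.length * Y.length ∧
    ∀ i j (hi : i < X.length) (hj : j < Y.length) (h : i * Y.length + j < (s.tctx X Y).length),
      (s.tctx X Y)[i * Y.length + j]'h = (s.v X[i].1 Y[j].1, s.E X Y X[i] Y[j]) := by
  cases X with
  | nil => simp [Sys.tctx, hs, gr]
  | cons p X =>
  cases Y with
  | nil => simp [Sys.tctx, hs, gr]
  | cons q Y =>
  unfold Sys.tctx
  rw [hs]
  obtain ⟨M, h, e⟩ := gr_grid (p :: X) (q :: Y) (fun p' q' => (s.v p'.1 q'.1, s.E (p :: X) (q :: Y) p' q'))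
    fun _ _ => (s.v p.1 q.1, s.E X Y p q)
  exact ⟨h.1, fun i j hi hj hl => (h.2 i j hi hj hl).trans (e i hi j hj)⟩

end

section
variable {A B : Alphabet} {a : Thy A} {b : Thy B} {X : PreCtx A} {Y : PreCtx B}
  {U U' : SortE A} {V V' : SortE B} {u : Expr A} {v : Expr B}

theorem take_fresh {X : PreCtx A} (hX : Derivable a.ax (.ctx X)) {i : ℕ} (hi : i < X.length) :
    ∀ p ∈ X.take i, p.1 ≠ X[i].1 := by
  have h : X.take i ++ [(X[i].1, X[i].2)] <+: X := by simpa using List.take_prefix (i + 1) X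
  have := nodup_snoc (der_ctx_pfx hX h)
  intro p hp e
  exact this (List.mem_map.2 ⟨p, hp, e⟩)

/-- The graph of the tensor product of contexts computes the canonical tensor product. -/
theorem TCtx.eq_tctx {Z : PreCtx (A.tensor B)} (h : TCtx a.ax b.ax false X Y Z)
    (hX : Derivable a.ax (.ctx X)) (hY : Derivable b.ax (.ctx Y)) : Z = (tsys a b).tctx X Y := by
  obtain ⟨hl, he⟩ := h
  obtain ⟨hl', he'⟩ := tctx_isGrid X Y (tsys a b) rfl
  refine List.ext_getElem (by rw [hl, hl']) fun k hk hk' => ?_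
  have hY0 : 0 < Y.length := by
    rcases Nat.eq_zero_or_pos Y.length with h0 | h0
    · rw [hl, h0] at hk
      omega
    · exact h0
  have hi : k / Y.length < X.length := Nat.div_lt_of_lt_mul (by rw [hl, mul_comm] at hk; exact hk)
  have hj : k % Y.length < Y.length := Nat.mod_lt _ hY0
  have hk0 : k / Y.length * Y.length + k % Y.length = k := Nat.div_add_mod' k _
  have h1 := he _ _ hi hj (by rwa [hk0])
  have h2 := he' _ _ hi hj (by rwa [hk0])
  simp only [hk0] at h1 h2
  rw [h2, Prod.ext_iff]
  refine ⟨h1.1, ?_⟩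
  exact h1.2.eq_TT hX hY (List.take_prefix _ _) (List.take_prefix _ _) (Thy.entry_mem hi)
    (Thy.entry_mem hj) (Thy.entry_good hX hi) (Thy.entry_good hY hj)

theorem tctx_graph (hX : Derivable a.ax (.ctx X)) (hY : Derivable b.ax (.ctx Y)) :
    TCtx a.ax b.ax false X Y ((tsys a b).tctx X Y) := by
  obtain ⟨hl', he'⟩ := tctx_isGrid X Y (tsys a b) rfl
  refine ⟨hl', fun i j hi hj h => ?_⟩
  rw [he' i j hi hj h]
  exact ⟨rfl, exists_tso (take_fresh hX hi) (take_fresh hY hj) hX hY (List.take_prefix _ _)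
    (List.take_prefix _ _) (Thy.entry_mem hi) (Thy.entry_mem hj) (Thy.entry_good hX hi)
    (Thy.entry_good hY hj)⟩

theorem tctx_dropLast {C : Alphabet} (s : Sys A B C) (p : A.Var × SortE A) (q : B.Var × SortE B) :
    (s.tctx (X ++ [p]) (Y ++ [q])).dropLast = s.tctxD X p Y q := by
  rw [Sys.tctx, gr_snoc, List.dropLast_concat]
  rfl

theorem Thy.ext_ctx (h : Derivable a.ax (.sort X U)) : Derivable a.ax (.ctx (a.ext X U)) :=
  Thy.fresh_ctx h (a.fresh X)

/-- The tensor product of two sorts in extended contexts. -/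
noncomputable def extTT (a : Thy A) (b : Thy B) (X : PreCtx A) (U : SortE A) (Y : PreCtx B)
    (V : SortE B) : SortE (A.tensor B) :=
  (tsys a b).TT ((tsys a b).ten (a.ext X U) (b.ext Y V)) U (.var (a.ch X)) V (.var (b.ch Y))

theorem TSo.eq_ext {W : SortE (A.tensor B)} (h : TSo a.ax b.ax false X (a.ch X) U Y (b.ch Y) V W)
    (hU : Derivable a.ax (.sort X U)) (hV : Derivable b.ax (.sort Y V)) :
    W = extTT a b X U Y V :=
  h.eq_TT (Thy.ext_ctx hU) (Thy.ext_ctx hV) (List.prefix_append _ _) (List.prefix_append _ _)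
    (by simp) (by simp) (Thy.sort_good hU) (Thy.sort_good hV)

theorem tso_ext (hU : Derivable a.ax (.sort X U)) (hV : Derivable b.ax (.sort Y V)) :
    TSo a.ax b.ax false X (a.ch X) U Y (b.ch Y) V (extTT a b X U Y V) :=
  exists_tso (a.fresh X) (b.fresh Y) (Thy.ext_ctx hU) (Thy.ext_ctx hV) (List.prefix_append _ _)
    (List.prefix_append _ _) (by simp) (by simp) (Thy.sort_good hU) (Thy.sort_good hV)

theorem adm_extL (hU : Derivable a.ax (.sort X U)) (hv : Derivable b.ax (.term Y v V)) :
    Adm a b ⟨X, .var (a.ch X), U⟩ (a.ext X U) ⟨Y, v, V⟩ Y :=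
  have hV := hv.term_sort
  .left (Thy.ext_ctx hU) (hV.sort_ctx) (List.prefix_append _ _) List.prefix_rfl
    (Thy.sort_good hU) (by simp) (Thy.sort_good hV) (.of_der hv)

theorem adm_extR (hu : Derivable a.ax (.term X u U)) (hV : Derivable b.ax (.sort Y V)) :
    Adm a b ⟨X, u, U⟩ X ⟨Y, .var (b.ch Y), V⟩ (b.ext Y V) :=
  have hU := hu.term_sort
  .right (hU.sort_ctx) (Thy.ext_ctx hV) List.prefix_rfl (List.prefix_append _ _)
    (Thy.sort_good hV) (by simp) (Thy.sort_good hU) (.of_der hu)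

theorem adm_entryL (hX : Derivable a.ax (.ctx X)) (hv : Derivable b.ax (.term Y v V)) {i : ℕ}
    (hi : i < X.length) : Adm a b ⟨X.take i, .var X[i].1, X[i].2⟩ X ⟨Y, v, V⟩ Y :=
  have hV := hv.term_sort
  .left hX (hV.sort_ctx) (List.take_prefix _ _) List.prefix_rfl (Thy.entry_good hX hi)
    (Thy.entry_mem hi) (Thy.sort_good hV) (.of_der hv)

theorem adm_entryR (hY : Derivable b.ax (.ctx Y)) (hu : Derivable a.ax (.term X u U)) {j : ℕ}
    (hj : j < Y.length) : Adm a b ⟨X, u, U⟩ X ⟨Y.take j, .var Y[j].1, Y[j].2⟩ Y :=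
  have hU := hu.term_sort
  .right (hU.sort_ctx) hY List.prefix_rfl (List.take_prefix _ _) (Thy.entry_good hY hj)
    (Thy.entry_mem hj) (Thy.sort_good hU) (.of_der hu)

/-- The canonical terms substituted for the variables paired with a fresh variable of `B`. -/
noncomputable def subL (a : Thy A) (b : Thy B) (X : PreCtx A) (Y : PreCtx B) (v : Expr B) (i : ℕ) :
    Expr (A.tensor B) :=
  if h : i < X.length then (tsys a b).ten X Y (.var X[i].1) v else default

/-- The canonical terms substituted for the variables paired with a fresh variable of `A`. -/
noncomputable def subR (a : Thy A) (b : Thy B) (X : PreCtx A) (Y : PreCtx B) (u : Expr A) (j : ℕ) :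
    Expr (A.tensor B) :=
  if h : j < Y.length then (tsys a b).ten X Y u (.var Y[j].1) else default

theorem subL_eq {i : ℕ} (hi : i < X.length) :
    subL a b X Y v i = (tsys a b).ten X Y (.var X[i].1) v := dif_pos hi

theorem subR_eq {j : ℕ} (hj : j < Y.length) :
    subR a b X Y u j = (tsys a b).ten X Y u (.var Y[j].1) := dif_pos hj

theorem graph_subL (hX : Derivable a.ax (.ctx X)) (hv : Derivable b.ax (.term Y v V)) (i : ℕ)
    (hi : i < X.length) :
    TTg a.ax b.ax false ⟨X.take i, .var X[i].1, X[i].2⟩ ⟨Y, v, V⟩ (subL a b X Y v i) := by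
  rw [subL_eq hi]
  exact (adm_entryL hX hv hi).ttg

theorem graph_subR (hY : Derivable b.ax (.ctx Y)) (hu : Derivable a.ax (.term X u U)) (j : ℕ)
    (hj : j < Y.length) :
    TTg a.ax b.ax false ⟨X, u, U⟩ ⟨Y.take j, .var Y[j].1, Y[j].2⟩ (subR a b X Y u j) := by
  rw [subR_eq hj]
  exact (adm_entryR hY hu hj).ttg

theorem pairsL_eq (hX : Derivable a.ax (.ctx X)) (hv : Derivable b.ax (.term Y v V)) {y : B.Var}
    {g : ℕ → Expr (A.tensor B)} (hg : ∀ i (hi : i < X.length),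
      TTg a.ax b.ax false ⟨X.take i, .var X[i].1, X[i].2⟩ ⟨Y, v, V⟩ (g i)) :
    pairsL X y g = pairsL X y (subL a b X Y v) :=
  List.map_congr_left fun i _ => by
    rw [subL_eq i.2, (hg i i.2).eq_ten (adm_entryL hX hv i.2)]

theorem pairsR_eq (hY : Derivable b.ax (.ctx Y)) (hu : Derivable a.ax (.term X u U)) {x : A.Var}
    {g : ℕ → Expr (A.tensor B)} (hg : ∀ j (hj : j < Y.length),
      TTg a.ax b.ax false ⟨X, u, U⟩ ⟨Y.take j, .var Y[j].1, Y[j].2⟩ (g j)) :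
    pairsR x Y g = pairsR x Y (subR a b X Y u) :=
  List.map_congr_left fun j _ => by
    rw [subR_eq j.2, (hg j j.2).eq_ten (adm_entryR hY hu j.2)]

end

section
variable {α β α' β' γ : Type}

theorem grD_last {as : List α} {bs : List β} {x x' : α} {y y' : β} {F G : α → β → γ}
    (h : ∀ a ∈ as, ∀ b ∈ bs, F a b = G a b) (hx : ∀ b ∈ bs, F x b = G x' b)
    (hy : ∀ a ∈ as, F a y = G a y') : grD true as x bs y F = grD true as x' bs y' G := by
  rw [grD, grD, List.map_congr_left hx]
  congr 1
  refine List.flatMap_congr fun a ha => ?_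
  simp only [List.map_append, List.map_cons, List.map_nil]
  rw [List.map_congr_left (h a ha), hy a ha]

end

section
variable {A B : Alphabet} {a : Thy A} {b : Thy B} {X : PreCtx A} {Y : PreCtx B}
  {U : SortE A} {V : SortE B} {u : Expr A} {v : Expr B}
  {τ : (A.tensor B).Var → Expr (A.tensor B)}

theorem ten_fixed (hX : Derivable a.ax (.ctx X)) (hY : Derivable b.ax (.ctx Y))
    (hτ : ∀ p ∈ X, ∀ q ∈ Y, τ (p.1, q.1) = .var (p.1, q.1)) (hu : a.Good X u) (hv : b.Good Y v) :
    ((tsys a b).ten X Y u v).subst τ = (tsys a b).ten X Y u v := by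
  have := Sys.ten_subst (s := tsys a b) (φ := .var) (τ := τ) rfl hX hX hY (fun p hp => by
    rw [SortE.subst_id]
    exact Thy.cs_var hX hp) (fun p hp q hq => by
    rw [Sys.ten_var_var]
    exact hτ p hp q hq) hu hv (by rwa [Expr.subst_id])
  rwa [Expr.subst_id] at this

theorem mem_ctxVars {e : Expr A} : e ∈ ctxVars X ↔ ∃ p ∈ X, .var p.1 = e := by
  simp [ctxVars]

theorem Thy.var_good {T : Thy A} (hX : Derivable T.ax (.ctx X)) {p : A.Var × SortE A} (hp : p ∈ X) :
    T.Good X (.var p.1) :=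
  let ⟨_, h⟩ := T.var_arg hX hp
  h.good

theorem Thy.ch_good {T : Thy A} (hU : Derivable T.ax (.sort X U)) :
    T.Good (T.ext X U) (.var (T.ch X)) :=
  Thy.var_good (p := (T.ch X, U)) (Thy.ext_ctx hU) (by simp)

theorem forall_ext {P : A.Var → Prop} (h1 : ∀ p ∈ X, P p.1) (h2 : P (a.ch X)) :
    ∀ p ∈ a.ext X U, P p.1 := by
  intro p hp
  rcases List.mem_append.1 hp with h | h
  · exact h1 p h
  · simp only [List.mem_singleton] at h
    subst h
    exact h2

theorem tsys_TT_subst {F F' : Expr A → Expr B → Expr (A.tensor B)} {u' : Expr A} {v' : Expr B}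
    (h : ∀ e ∈ U.args, ∀ f ∈ V.args, (F e f).subst τ = F' e f)
    (hu : ∀ f ∈ V.args, (F u f).subst τ = F' u' f)
    (hv : ∀ e ∈ U.args, (F e v).subst τ = F' e v') :
    ((tsys a b).TT F U u V v).subst τ = (tsys a b).TT F' U u' V v' := by
  rw [Sys.subst_TT, Sys.TT, Sys.TT]
  congr 1
  exact grD_last h hu hv

theorem extTT_left (hU : Derivable a.ax (.sort X U)) (hUa : U.args = ctxVars X)
    (hv : Derivable b.ax (.term Y v V))
    (h1 : ∀ p ∈ X, ∀ q ∈ Y, τ (p.1, q.1) = .var (p.1, q.1))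
    (h2 : ∀ q ∈ Y, τ (a.ch X, q.1) = .var (a.ch X, q.1))
    (h3 : ∀ p ∈ X, τ (p.1, b.ch Y) = (tsys a b).ten X Y (.var p.1) v) :
    (extTT a b X U Y V).subst τ =
      (tsys a b).TT ((tsys a b).ten (a.ext X U) Y) U (.var (a.ch X)) V v := by
  have hV := hv.term_sort
  have cX := Thy.ext_ctx hU
  have cY := Thy.ext_ctx hV
  have cX0 := hU.sort_ctx
  have cY0 := hV.sort_ctx
  have hfix : ∀ e, a.Good (a.ext X U) e → ∀ w ∈ V.args,
      ((tsys a b).ten (a.ext X U) (b.ext Y V) e w).subst τ = (tsys a b).ten (a.ext X U) Y e w := by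
    intro e ge w hw
    have gw := Thy.sort_good hV w hw
    rw [Sys.ten_pfx (s := tsys a b) cX cY List.prefix_rfl (List.prefix_append _ _) ge gw]
    exact ten_fixed cX cY0 (forall_ext (a := a) (P := fun x => ∀ q ∈ Y, τ (x, q.1) = .var (x, q.1))
      h1 h2) ge gw
  refine tsys_TT_subst ?_ (hfix _ (Thy.ch_good hU)) ?_
  · exact fun e he => hfix e ((Thy.sort_good hU e he).pfx (List.prefix_append _ _))
  · intro e he
    have ge := Thy.sort_good hU e he
    rw [Sys.ten_pfx (s := tsys a b) cX cY0 (List.prefix_append _ _) List.prefix_rfl ge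
      (.of_der hv)]
    rw [hUa] at he
    obtain ⟨p, hp, rfl⟩ := mem_ctxVars.1 he
    rw [Sys.ten_var_var, Expr.subst_var]
    exact h3 p hp

theorem extTT_right (hu : Derivable a.ax (.term X u U)) (hV : Derivable b.ax (.sort Y V))
    (hVa : V.args = ctxVars Y)
    (h1 : ∀ p ∈ X, ∀ q ∈ Y, τ (p.1, q.1) = .var (p.1, q.1))
    (h2 : ∀ q ∈ Y, τ (a.ch X, q.1) = (tsys a b).ten X Y u (.var q.1))
    (h3 : ∀ p ∈ X, τ (p.1, b.ch Y) = .var (p.1, b.ch Y)) :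
    (extTT a b X U Y V).subst τ =
      (tsys a b).TT ((tsys a b).ten X (b.ext Y V)) U u V (.var (b.ch Y)) := by
  have hU := hu.term_sort
  have cX := Thy.ext_ctx hU
  have cY := Thy.ext_ctx hV
  have cX0 := hU.sort_ctx
  have cY0 := hV.sort_ctx
  have hfix : ∀ e ∈ U.args, ∀ w, b.Good (b.ext Y V) w →
      ((tsys a b).ten (a.ext X U) (b.ext Y V) e w).subst τ = (tsys a b).ten X (b.ext Y V) e w := by
    intro e he w gw
    have ge := Thy.sort_good hU e he
    rw [Sys.ten_pfx (s := tsys a b) cX cY (List.prefix_append _ _) List.prefix_rfl ge gw]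
    exact ten_fixed cX0 cY (fun p hp => forall_ext (a := b)
      (P := fun y => τ (p.1, y) = .var (p.1, y)) (h1 p hp) (h3 p hp)) ge gw
  refine tsys_TT_subst ?_ ?_ fun e he => hfix e he _ (Thy.ch_good hV)
  · exact fun e he w hw => hfix e he w ((Thy.sort_good hV w hw).pfx (List.prefix_append _ _))
  · intro w hw
    have gw := Thy.sort_good hV w hw
    rw [Sys.ten_pfx (s := tsys a b) cX0 cY List.prefix_rfl (List.prefix_append _ _)
      (.of_der hu) gw]
    rw [hVa] at hw
    obtain ⟨q, hq, rfl⟩ := mem_ctxVars.1 hw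
    rw [Sys.ten_var_var, Expr.subst_var]
    exact h2 q hq

end

section
variable {A B : Alphabet} {a : Thy A} {b : Thy B} {X : PreCtx A} {Y : PreCtx B}
  {U U' : SortE A} {V V' : SortE B} {u u' : Expr A} {v v' : Expr B}

/-- The substitution of `v` for the fresh variable of `Y`. -/
noncomputable def tauL (a : Thy A) (b : Thy B) (X : PreCtx A) (Y : PreCtx B) (v : Expr B) :
    (A.tensor B).Var → Expr (A.tensor B) :=
  lookupV (pairsL X (b.ch Y) (subL a b X Y v))

/-- The substitution of `u` for the fresh variable of `X`. -/
noncomputable def tauR (a : Thy A) (b : Thy B) (X : PreCtx A) (Y : PreCtx B) (u : Expr A) :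
    (A.tensor B).Var → Expr (A.tensor B) :=
  lookupV (pairsR (a.ch X) Y (subR a b X Y u))

/-- The substitution of `u` and `v` for the fresh variables of `X` and `Y`. -/
noncomputable def tauLR (a : Thy A) (b : Thy B) (X : PreCtx A) (Y : PreCtx B) (u : Expr A)
    (v : Expr B) : (A.tensor B).Var → Expr (A.tensor B) :=
  lookupV (pairsL X (b.ch Y) (subL a b X Y v) ++ pairsR (a.ch X) Y (subR a b X Y u))

theorem tauL_old (x : A.Var) : ∀ q ∈ Y, tauL a b X Y v (x, q.1) = .var (x, q.1) :=
  fun q hq => lookup_pairsL_not (z := (x, q.1)) (b.fresh Y q hq)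

theorem tauL_new : ∀ p ∈ X, tauL a b X Y v (p.1, b.ch Y) = (tsys a b).ten X Y (.var p.1) v :=
  fun _ hp => lookup_pairsL (G := fun x => (tsys a b).ten X Y (.var x) v)
    (fun _ hi => subL_eq hi) hp

theorem tauR_old (y : B.Var) : ∀ p ∈ X, tauR a b X Y u (p.1, y) = .var (p.1, y) :=
  fun p hp => lookup_pairsR_not (z := (p.1, y)) (a.fresh X p hp)

theorem tauR_new : ∀ q ∈ Y, tauR a b X Y u (a.ch X, q.1) = (tsys a b).ten X Y u (.var q.1) :=
  fun _ hq => lookup_pairsR (G := fun y => (tsys a b).ten X Y u (.var y))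
    (fun _ hj => subR_eq hj) hq

theorem tauLR_spec :
    (∀ p ∈ X, ∀ q ∈ Y, tauLR a b X Y u v (p.1, q.1) = .var (p.1, q.1)) ∧
    (∀ q ∈ Y, tauLR a b X Y u v (a.ch X, q.1) = (tsys a b).ten X Y u (.var q.1)) ∧
    (∀ p ∈ X, tauLR a b X Y u v (p.1, b.ch Y) = (tsys a b).ten X Y (.var p.1) v) :=
  lookup_pairs_append (a.fresh X) (b.fresh Y) (G := fun x => (tsys a b).ten X Y (.var x) v)
    (H := fun y => (tsys a b).ten X Y u (.var y)) (fun _ hi => subL_eq hi) (fun _ hj => subR_eq hj)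

/-- The tensor product of judgments in terms of the canonical operations. -/
inductive Nf (a : Thy A) (b : Thy B) : Judg A → Judg B → Judg (A.tensor B) → Prop where
  | ss {X : PreCtx A} {U : SortE A} {Y : PreCtx B} {V : SortE B} : Nf a b (.sort X U) (.sort Y V)
      (.sort ((tsys a b).tctxD X (a.ch X, U) Y (b.ch Y, V)) (extTT a b X U Y V))
  | st {X : PreCtx A} {U : SortE A} {Y : PreCtx B} {v : Expr B} {V : SortE B} :
      Nf a b (.sort X U) (.term Y v V)
      (.term ((tsys a b).tctx (a.ext X U) Y) ((tsys a b).ten (a.ext X U) Y (.var (a.ch X)) v)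
        ((extTT a b X U Y V).subst (tauL a b X Y v)))
  | ts {X : PreCtx A} {u : Expr A} {U : SortE A} {Y : PreCtx B} {V : SortE B} :
      Nf a b (.term X u U) (.sort Y V)
      (.term ((tsys a b).tctx X (b.ext Y V)) ((tsys a b).ten X (b.ext Y V) u (.var (b.ch Y)))
        ((extTT a b X U Y V).subst (tauR a b X Y u)))
  | tt {X : PreCtx A} {u : Expr A} {U : SortE A} {Y : PreCtx B} {v : Expr B} {V : SortE B} {e e' : Expr (A.tensor B)} :
      TTg a.ax b.ax false ⟨X, u, U⟩ ⟨Y, v, V⟩ e →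
      TTd a.ax b.ax false ⟨X, u, U⟩ ⟨Y, v, V⟩ e' → Nf a b (.term X u U) (.term Y v V)
      (.termEq ((tsys a b).tctx X Y) e e' ((extTT a b X U Y V).subst (tauLR a b X Y u v)))
  | sseq {X : PreCtx A} {U : SortE A} {Y : PreCtx B} {V V' : SortE B} :
      Nf a b (.sort X U) (.sortEq Y V V')
      (.sortEq ((tsys a b).tctxD X (a.ch X, U) Y (b.ch Y, V)) (extTT a b X U Y V)
        (extTT a b X U Y V'))
  | seqs {X : PreCtx A} {U U' : SortE A} {Y : PreCtx B} {V : SortE B} :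
      Nf a b (.sortEq X U U') (.sort Y V)
      (.sortEq ((tsys a b).tctxD X (a.ch X, U) Y (b.ch Y, V)) (extTT a b X U Y V)
        (extTT a b X U' Y V))
  | steq {X : PreCtx A} {U : SortE A} {Y : PreCtx B} {v v' : Expr B} {V : SortE B} :
      Nf a b (.sort X U) (.termEq Y v v' V)
      (.termEq ((tsys a b).tctx (a.ext X U) Y) ((tsys a b).ten (a.ext X U) Y (.var (a.ch X)) v)
        ((tsys a b).ten (a.ext X U) Y (.var (a.ch X)) v')
        ((extTT a b X U Y V).subst (tauL a b X Y v)))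
  | teqs {X : PreCtx A} {u u' : Expr A} {U : SortE A} {Y : PreCtx B} {V : SortE B} :
      Nf a b (.termEq X u u' U) (.sort Y V)
      (.termEq ((tsys a b).tctx X (b.ext Y V)) ((tsys a b).ten X (b.ext Y V) u (.var (b.ch Y)))
        ((tsys a b).ten X (b.ext Y V) u' (.var (b.ch Y)))
        ((extTT a b X U Y V).subst (tauR a b X Y u)))
  | seqt {X : PreCtx A} {U U' : SortE A} {Y : PreCtx B} {v : Expr B} {V : SortE B} :
      Nf a b (.sortEq X U U') (.term Y v V)
      (.termEq ((tsys a b).tctx (a.ext X U) Y) ((tsys a b).ten (a.ext X U) Y (.var (a.ch X)) v)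
        ((tsys a b).ten (a.ext X U') Y (.var (a.ch X)) v)
        ((extTT a b X U Y V).subst (tauL a b X Y v)))
  | tseq {X : PreCtx A} {u : Expr A} {U : SortE A} {Y : PreCtx B} {V V' : SortE B} :
      Nf a b (.term X u U) (.sortEq Y V V')
      (.termEq ((tsys a b).tctx X (b.ext Y V)) ((tsys a b).ten X (b.ext Y V) u (.var (b.ch Y)))
        ((tsys a b).ten X (b.ext Y V') u (.var (b.ch Y)))
        ((extTT a b X U Y V).subst (tauR a b X Y u)))

theorem TJudg.nf {J : Judg A} {J' : Judg B} {K : Judg (A.tensor B)}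
    (h : TJudg a.ax b.ax a.ch b.ch false J J' K) (hJ : Derivable a.ax J) (hJ' : Derivable b.ax J') :
    Nf a b J J' K := by
  cases h with
  | ss hZ hW =>
    rw [hZ.eq_tctx (Thy.ext_ctx hJ) (Thy.ext_ctx hJ'), tctx_dropLast, hW.eq_ext hJ hJ']
    exact .ss
  | st hZ he hW hg =>
    rw [hZ.eq_tctx (Thy.ext_ctx hJ) hJ'.term_sort.sort_ctx, he.eq_ten (adm_extL hJ hJ'),
      hW.eq_ext hJ hJ'.term_sort, pairsL_eq hJ.sort_ctx hJ' hg]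
    exact .st
  | ts hZ he hW hg =>
    rw [hZ.eq_tctx hJ.term_sort.sort_ctx (Thy.ext_ctx hJ'), he.eq_ten (adm_extR hJ hJ'),
      hW.eq_ext hJ.term_sort hJ', pairsR_eq hJ'.sort_ctx hJ hg]
    exact .ts
  | tt hZ he1 he2 hW hgx hgy =>
    rw [hZ.eq_tctx hJ.term_sort.sort_ctx hJ'.term_sort.sort_ctx, hW.eq_ext hJ.term_sort
      hJ'.term_sort, pairsL_eq hJ.term_sort.sort_ctx hJ' hgx,
      pairsR_eq hJ'.term_sort.sort_ctx hJ hgy]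
    exact .tt he1 he2
  | sseq hZ hW hW' =>
    rw [hZ.eq_tctx (Thy.ext_ctx hJ) (Thy.ext_ctx hJ'.seq_left), tctx_dropLast,
      hW.eq_ext hJ hJ'.seq_left, hW'.eq_ext hJ hJ'.seq_right]
    exact .sseq
  | seqs hZ hW hW' =>
    rw [hZ.eq_tctx (Thy.ext_ctx hJ.seq_left) (Thy.ext_ctx hJ'), tctx_dropLast,
      hW.eq_ext hJ.seq_left hJ', hW'.eq_ext hJ.seq_right hJ']
    exact .seqs
  | steq hZ he he' hW hg =>
    have h1 := hJ'.teq_left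
    rw [hZ.eq_tctx (Thy.ext_ctx hJ) h1.term_sort.sort_ctx, he.eq_ten (adm_extL hJ h1),
      he'.eq_ten (adm_extL hJ hJ'.teq_right), hW.eq_ext hJ h1.term_sort,
      pairsL_eq hJ.sort_ctx h1 hg]
    exact .steq
  | teqs hZ he he' hW hg =>
    have h1 := hJ.teq_left
    rw [hZ.eq_tctx h1.term_sort.sort_ctx (Thy.ext_ctx hJ'), he.eq_ten (adm_extR h1 hJ'),
      he'.eq_ten (adm_extR hJ.teq_right hJ'), hW.eq_ext h1.term_sort hJ',
      pairsR_eq hJ'.sort_ctx h1 hg]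
    exact .teqs
  | seqt hZ he he' hW hg =>
    have h1 := hJ.seq_left
    rw [hZ.eq_tctx (Thy.ext_ctx h1) hJ'.term_sort.sort_ctx, he.eq_ten (adm_extL h1 hJ'),
      he'.eq_ten (adm_extL hJ.seq_right hJ'), hW.eq_ext h1 hJ'.term_sort,
      pairsL_eq h1.sort_ctx hJ' hg]
    exact .seqt
  | tseq hZ he he' hW hg =>
    have h1 := hJ'.seq_left
    rw [hZ.eq_tctx hJ.term_sort.sort_ctx (Thy.ext_ctx h1), he.eq_ten (adm_extR hJ h1),
      he'.eq_ten (adm_extR hJ hJ'.seq_right), hW.eq_ext hJ.term_sort h1,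
      pairsR_eq h1.sort_ctx hJ hg]
    exact .tseq

theorem Nf.tjudg {J : Judg A} {J' : Judg B} {K : Judg (A.tensor B)}
    (h : Nf a b J J' K) (hJ : Derivable a.ax J) (hJ' : Derivable b.ax J') :
    TJudg a.ax b.ax a.ch b.ch false J J' K := by
  cases h with
  | @ss X U Y V =>
    rw [← tctx_dropLast]
    exact .ss (tctx_graph (Thy.ext_ctx hJ) (Thy.ext_ctx hJ')) (tso_ext hJ hJ')
  | st =>
    exact .st (tctx_graph (Thy.ext_ctx hJ) hJ'.term_sort.sort_ctx) (adm_extL hJ hJ').ttg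
      (tso_ext hJ hJ'.term_sort) (graph_subL hJ.sort_ctx hJ')
  | ts =>
    exact .ts (tctx_graph hJ.term_sort.sort_ctx (Thy.ext_ctx hJ')) (adm_extR hJ hJ').ttg
      (tso_ext hJ.term_sort hJ') (graph_subR hJ'.sort_ctx hJ)
  | tt he he' =>
    exact .tt (tctx_graph hJ.term_sort.sort_ctx hJ'.term_sort.sort_ctx) he he'
      (tso_ext hJ.term_sort hJ'.term_sort) (graph_subL hJ.term_sort.sort_ctx hJ')
      (graph_subR hJ'.term_sort.sort_ctx hJ)
  | @sseq X U Y V V' =>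
    rw [← tctx_dropLast]
    exact .sseq (tctx_graph (Thy.ext_ctx hJ) (Thy.ext_ctx hJ'.seq_left)) (tso_ext hJ hJ'.seq_left)
      (tso_ext hJ hJ'.seq_right)
  | @seqs X U U' Y V =>
    rw [← tctx_dropLast]
    exact .seqs (tctx_graph (Thy.ext_ctx hJ.seq_left) (Thy.ext_ctx hJ')) (tso_ext hJ.seq_left hJ')
      (tso_ext hJ.seq_right hJ')
  | steq =>
    have h1 := hJ'.teq_left
    exact .steq (tctx_graph (Thy.ext_ctx hJ) h1.term_sort.sort_ctx) (adm_extL hJ h1).ttg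
      (adm_extL hJ hJ'.teq_right).ttg (tso_ext hJ h1.term_sort) (graph_subL hJ.sort_ctx h1)
  | teqs =>
    have h1 := hJ.teq_left
    exact .teqs (tctx_graph h1.term_sort.sort_ctx (Thy.ext_ctx hJ')) (adm_extR h1 hJ').ttg
      (adm_extR hJ.teq_right hJ').ttg (tso_ext h1.term_sort hJ') (graph_subR hJ'.sort_ctx h1)
  | seqt =>
    have h1 := hJ.seq_left
    exact .seqt (tctx_graph (Thy.ext_ctx h1) hJ'.term_sort.sort_ctx) (adm_extL h1 hJ').ttg
      (adm_extL hJ.seq_right hJ').ttg (tso_ext h1 hJ'.term_sort) (graph_subL h1.sort_ctx hJ')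
  | tseq =>
    have h1 := hJ'.seq_left
    exact .tseq (tctx_graph hJ.term_sort.sort_ctx (Thy.ext_ctx h1)) (adm_extR hJ h1).ttg
      (adm_extR hJ hJ'.seq_right).ttg (tso_ext hJ.term_sort h1) (graph_subR h1.sort_ctx hJ)

end

section
variable {A B : Alphabet}

/-- The axioms of a theory are derivable and sort symbols are introduced once. -/
structure Thy.Axioms (T : Thy A) : Prop where
  der : ∀ J ∈ T.ax, Derivable T.ax J
  sort_unique : ∀ X X' S, introSort X S ∈ T.ax → introSort X' S ∈ T.ax → X = X'

theorem Thy.Axioms.sort_inj {T : Thy A} (hT : T.Axioms) {X X' : PreCtx A} {U U' : SortE A}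
    (h : .sort X U ∈ T.ax) (h' : .sort X' U' ∈ T.ax) (e : U.head = U'.head) :
    X = X' ∧ U = U' := by
  have e1 := T.pre.sort_shape _ _ h
  have e2 := T.pre.sort_shape _ _ h'
  obtain ⟨S, f⟩ := U
  obtain ⟨S', f'⟩ := U'
  obtain rfl : S = S' := e
  obtain rfl : f = _ := e1
  obtain rfl : f' = _ := e2
  obtain rfl := hT.sort_unique _ _ _ h h'
  exact ⟨rfl, rfl⟩

variable {a : Thy A} {b : Thy B} {X : PreCtx A} {Y : PreCtx B}
  {U U' : SortE A} {V V' : SortE B} {u u' : Expr A} {v v' : Expr B}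

theorem Nf.mem (ha : a.Axioms) (hb : b.Axioms) {J : Judg A} {J' : Judg B}
    {K : Judg (A.tensor B)} (h : Nf a b J J' K) (hJ : J ∈ a.ax) (hJ' : J' ∈ b.ax) :
    K ∈ (tsys a b).ax :=
  ⟨J, J', hJ, hJ', h.tjudg (ha.der J hJ) (hb.der J' hJ')⟩

theorem exists_nf (ha : a.Axioms) (hb : b.Axioms) {K : Judg (A.tensor B)}
    (h : K ∈ (tsys a b).ax) : ∃ J J', J ∈ a.ax ∧ J' ∈ b.ax ∧ Nf a b J J' K := by
  obtain ⟨J, J', hJ, hJ', h⟩ := h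
  exact ⟨J, J', hJ, hJ', h.nf (ha.der J hJ) (hb.der J' hJ')⟩

theorem ctxVars_tctx (X X' : PreCtx A) (Y Y' : PreCtx B) :
    gr true (ctxVars X) (ctxVars Y) ((tsys a b).ten X' Y') = ctxVars ((tsys a b).tctx X Y) := by
  rw [ctxVars, ctxVars, gr_map, ctxVars, Sys.tctx, map_gr]
  exact gr_congr fun p _ q _ => Sys.ten_var_var (tsys a b) _ _ _ _

theorem ctxVars_tctxD (X : PreCtx A) (p : A.Var × SortE A) (Y : PreCtx B) (q : B.Var × SortE B)
    (F : Expr A → Expr B → Expr (A.tensor B)) (hF : ∀ x y, F (.var x) (.var y) = .var (x, y)) :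
    grD true (ctxVars X) (.var p.1) (ctxVars Y) (.var q.1) F =
      ctxVars ((tsys a b).tctxD X p Y q) := by
  have := grD_map true X p Y q (fun p => .var p.1) (fun q => .var q.1) F
  rw [ctxVars, ctxVars, this, ctxVars, Sys.tctxD, map_grD]
  exact grD_congr (fun p _ q _ => hF _ _) fun p _ q _ => hF _ _

theorem ctxVars_ext {T : Thy A} (h : .sort X U ∈ T.ax) :
    U.args ++ [.var (T.ch X)] = ctxVars (T.ext X U) := by
  rw [T.pre.sort_shape _ _ h]
  simp [ctxVars]

theorem ten_st (hU : .sort X U ∈ a.ax) (hX : Derivable a.ax (.sort X U)) {t : B.TermSym}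
    (hY : Derivable b.ax (introTerm Y t V)) :
    (tsys a b).ten (a.ext X U) Y (.var (a.ch X)) (.app t (ctxVars Y)) =
      .app (.inl (U.head, t)) (ctxVars ((tsys a b).tctx (a.ext X U) Y)) := by
  refine (Sys.ten_left (s := tsys a b) (X := a.ext X U) (u := .var (a.ch X)) (Thy.ext_ctx hX)
    (Thy.ch_good hX) (.of_der hY) (.inr rfl)).trans ?_
  have : (tsys a b).a.cs (a.ext X U) (.var (a.ch X)) = U :=
    Thy.cs_var (T := a) (Thy.ext_ctx hX) (by simp)
  rw [this, Sys.L, ctxVars_ext hU, ← ctxVars_tctx]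
  rfl

theorem ten_right_ch {t : A.TermSym} {f : List (Expr A)}
    (hX : Derivable a.ax (.term X (.app t f) U)) (hY : Derivable b.ax (.sort Y V)) :
    (tsys a b).ten X (b.ext Y V) (.app t f) (.var (b.ch Y)) =
      (tsys a b).R ((tsys a b).ten X (b.ext Y V)) t f V (.var (b.ch Y)) := by
  refine (Sys.ten_right (s := tsys a b) (Y := b.ext Y V) (v := .var (b.ch Y)) (Thy.ext_ctx hY)
    (.of_der hX) (Thy.ch_good hY) (.inl ⟨_, rfl⟩)).trans ?_
  have : (tsys a b).b.cs (b.ext Y V) (.var (b.ch Y)) = V :=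
    Thy.cs_var (T := b) (Thy.ext_ctx hY) (by simp)
  rw [this]

theorem ten_ts {t : A.TermSym}
    (hX : Derivable a.ax (introTerm X t U)) (hV : .sort Y V ∈ b.ax)
    (hY : Derivable b.ax (.sort Y V)) :
    (tsys a b).ten X (b.ext Y V) (.app t (ctxVars X)) (.var (b.ch Y)) =
      .app (.inr (t, V.head)) (ctxVars ((tsys a b).tctx X (b.ext Y V))) := by
  rw [ten_right_ch hX hY, Sys.R, ctxVars_ext hV, ← ctxVars_tctx]
  rfl

theorem mem_term (ha : a.Axioms) (hb : b.Axioms) {Z : PreCtx (A.tensor B)}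
    {e : Expr (A.tensor B)} {W : SortE (A.tensor B)} (h : .term Z e W ∈ (tsys a b).ax) :
    (∃ X U Y t V, .sort X U ∈ a.ax ∧ introTerm Y t V ∈ b.ax ∧
      Z = (tsys a b).tctx (a.ext X U) Y ∧ e = .app (.inl (U.head, t)) (ctxVars Z) ∧
      W = (extTT a b X U Y V).subst (tauL a b X Y (.app t (ctxVars Y)))) ∨
    ∃ X t U Y V, introTerm X t U ∈ a.ax ∧ .sort Y V ∈ b.ax ∧
      Z = (tsys a b).tctx X (b.ext Y V) ∧ e = .app (.inr (t, V.head)) (ctxVars Z) ∧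
      W = (extTT a b X U Y V).subst (tauR a b X Y (.app t (ctxVars X))) := by
  obtain ⟨J, J', hJ, hJ', h⟩ := exists_nf ha hb h
  cases h with
  | @st X U Y v V =>
    obtain ⟨t, rfl⟩ := b.pre.term_shape _ _ _ hJ'
    exact .inl ⟨X, U, Y, t, V, hJ, hJ', rfl, ten_st hJ (ha.der _ hJ) (hb.der _ hJ'), rfl⟩
  | @ts X u U Y V =>
    obtain ⟨t, rfl⟩ := a.pre.term_shape _ _ _ hJ
    exact .inr ⟨X, t, U, Y, V, hJ, hJ', rfl, ten_ts (ha.der _ hJ) hJ' (hb.der _ hJ'), rfl⟩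

theorem tsys_pre (ha : a.Axioms) (hb : b.Axioms) : Pre (tsys a b).ax where
  sort_shape Z W h := by
    obtain ⟨J, J', hJ, hJ', h⟩ := exists_nf ha hb h
    cases h with
    | @ss X U Y V =>
      rw [← ctxVars_tctxD _ _ _ _ ((tsys a b).ten (a.ext X U) (b.ext Y V)) fun x y =>
        Sys.ten_var_var _ _ _ x y, ← a.pre.sort_shape _ _ hJ, ← b.pre.sort_shape _ _ hJ']
      rfl
  term_shape Z e W h := by
    rcases mem_term ha hb h with ⟨X, U, Y, t, V, -, -, -, he, -⟩ | ⟨X, t, U, Y, V, -, -, -, he, -⟩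
    · exact ⟨_, he⟩
    · exact ⟨_, he⟩
  term_unique Z t W Z' W' h h' := by
    rcases mem_term ha hb h with ⟨X, U, Y, r, V, h1, h2, e1, e2, e3⟩ |
      ⟨X, r, U, Y, V, h1, h2, e1, e2, e3⟩ <;>
    rcases mem_term ha hb h' with ⟨X', U', Y', r', V', h1', h2', e1', e2', e3'⟩ |
      ⟨X', r', U', Y', V', h1', h2', e1', e2', e3'⟩ <;>
    · simp only [Expr.app.injEq, and_true] at e2 e2'
      have e := e2.symm.trans e2'
      simp only [Sum.inl.injEq, Sum.inr.injEq, Prod.mk.injEq, reduceCtorEq] at e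
      try
        obtain ⟨e, rfl⟩ := e
        obtain ⟨rfl, rfl⟩ := ha.sort_inj h1 h1' e
        obtain ⟨rfl, rfl⟩ := b.pre.term_unique _ _ _ _ _ h2 h2'
        exact ⟨e1.trans e1'.symm, e3.trans e3'.symm⟩
      try
        obtain ⟨rfl, e⟩ := e
        obtain ⟨rfl, rfl⟩ := hb.sort_inj h2 h2' e
        obtain ⟨rfl, rfl⟩ := a.pre.term_unique _ _ _ _ _ h1 h1'
        exact ⟨e1.trans e1'.symm, e3.trans e3'.symm⟩

end

section
variable {A B : Alphabet} {a : Thy A} {b : Thy B} {X : PreCtx A} {Y : PreCtx B}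
  {U U' : SortE A} {V V' : SortE B} {u u' : Expr A} {v v' : Expr B}

theorem extTT_tauL (hU : .sort X U ∈ a.ax) (dU : Derivable a.ax (.sort X U))
    (hv : Derivable b.ax (.term Y v V)) :
    (extTT a b X U Y V).subst (tauL a b X Y v) =
      (tsys a b).TT ((tsys a b).ten (a.ext X U) Y) U (.var (a.ch X)) V v :=
  extTT_left dU (a.pre.sort_shape _ _ hU) hv (fun p _ => tauL_old p.1) (tauL_old _) tauL_new

theorem extTT_tauR (hu : Derivable a.ax (.term X u U)) (hV : .sort Y V ∈ b.ax)
    (dV : Derivable b.ax (.sort Y V)) :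
    (extTT a b X U Y V).subst (tauR a b X Y u) =
      (tsys a b).TT ((tsys a b).ten X (b.ext Y V)) U u V (.var (b.ch Y)) :=
  extTT_right hu dV (b.pre.sort_shape _ _ hV) (fun p hp q _ => tauR_old q.1 p hp) tauR_new
    (tauR_old _)

theorem term_of_mem {C : Alphabet} {Ax : Set (Judg C)} (hP : Pre Ax) {Z : PreCtx C} {e : Expr C}
    {W : SortE C} (h : .term Z e W ∈ Ax) (hW : Derivable Ax (.sort Z W)) :
    Derivable Ax (.term Z e W) :=
  .step (.tA h hW fun _ hi => der_vars hP hW.sort_ctx (List.getElem_mem hi))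

theorem ten_ext_left (dU : Derivable a.ax (.sort X U)) (hv : Derivable b.ax (.term Y v V)) :
    ∀ p ∈ X, (tsys a b).ten (a.ext X U) Y (.var p.1) v = (tsys a b).ten X Y (.var p.1) v :=
  fun p hp => Sys.ten_pfx (s := tsys a b) (Thy.ext_ctx dU) hv.term_sort.sort_ctx
    (List.prefix_append _ _) List.prefix_rfl (Thy.var_good dU.sort_ctx hp) (.of_der hv)

theorem ten_ext_right (hu : Derivable a.ax (.term X u U)) (dV : Derivable b.ax (.sort Y V)) :
    ∀ q ∈ Y, (tsys a b).ten X (b.ext Y V) u (.var q.1) = (tsys a b).ten X Y u (.var q.1) :=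
  fun p hp => Sys.ten_pfx (s := tsys a b) hu.term_sort.sort_ctx (Thy.ext_ctx dV)
    List.prefix_rfl (List.prefix_append _ _) (.of_der hu) (Thy.var_good dV.sort_ctx hp)

theorem tsys_half (ha : a.Axioms) (hb : b.Axioms) : (tsys a b).Half where
  st {X U Y v V} hU hv h := by
    have m := Nf.st.mem ha hb hU hv
    rw [extTT_tauL (a := a) (b := b) hU (ha.der _ hU) (hb.der _ hv)] at m
    exact term_of_mem (tsys_pre ha hb) m h
  seqs hU hV h h' := .step (.seqA (Nf.seqs.mem ha hb hU hV) h h')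
  seqt {X U U' Y v V} hU hv :=
    ⟨tauL a b X Y v, fun p _ => tauL_old p.1, tauL_old _, fun p hp =>
      (tauL_new p hp).trans (ten_ext_left (ha.der _ hU).seq_left (hb.der _ hv) p hp).symm,
      fun h h' => ⟨_, .step (.teqA (Nf.seqt.mem ha hb hU hv) h h')⟩⟩
  teqs {X u u' U Y V} hu hV h h' := by
    have m := Nf.teqs.mem ha hb hu hV
    rw [extTT_tauR (a := a) (b := b) (ha.der _ hu).teq_left hV (hb.der _ hV)] at m
    exact .step (.teqA m h h')

theorem tsys_half_swap (ha : a.Axioms) (hb : b.Axioms) : (tsys a b).swap.Half where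
  st {Y V X u U} hV hu := by
    rw [Sys.tctx_swap, Sys.ten_swap', Sys.TT_swap]
    intro h
    have m := Nf.ts.mem ha hb hu hV
    rw [extTT_tauR (a := a) (b := b) (ha.der _ hu) hV (hb.der _ hV)] at m
    exact term_of_mem (tsys_pre ha hb) m h
  seqs {Y V V' X U} hV hU := by
    rw [Sys.tctxD_swap, Sys.ten_swap', Sys.ten_swap', Sys.TT_swap, Sys.TT_swap]
    intro h h'
    exact .step (.seqA (Nf.sseq.mem ha hb hU hV) h h')
  seqt {Y V V' X u U} hV hu := by
    rw [Sys.tctx_swap, Sys.ten_swap', Sys.ten_swap', Sys.ten_swap', Sys.TT_swap]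
    exact ⟨tauR a b X Y u, fun q _ p hp => tauR_old q.1 p hp, tauR_old _, fun q hq =>
      (tauR_new q hq).trans (ten_ext_right (ha.der _ hu) (hb.der _ hV).seq_left q hq).symm,
      fun h h' => ⟨_, .step (.teqA (Nf.tseq.mem ha hb hu hV) h h')⟩⟩
  teqs {Y v v' V X U} hv hU := by
    rw [Sys.tctx_swap, Sys.ten_swap', Sys.TT_swap]
    intro h h'
    have m := Nf.steq.mem ha hb hU hv
    rw [extTT_tauL (a := a) (b := b) hU (ha.der _ hU) (hb.der _ hv).teq_left] at m
    exact .step (.teqA m h h')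

theorem cs_introTerm {T : Thy A} {t : A.TermSym} (h : introTerm X t U ∈ T.ax) :
    T.cs X (.app t (ctxVars X)) = U := by
  rw [Thy.cs_app h, sb_ctxVars, SortE.subst_id]

theorem canon_introTerm {T : Thy A} (hT : T.Axioms) {t : A.TermSym} (h : introTerm X t U ∈ T.ax) :
    CanonSort T.ax X (.app t (ctxVars X)) U := by
  have := (Thy.Good.of_der (hT.der _ h)).canon (hT.der _ h).term_sort.sort_ctx
  rwa [cs_introTerm h] at this

theorem R_subst_tauL (hX : Derivable a.ax (.ctx X)) {t : A.TermSym}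
    (hV : Derivable b.ax (.sort Y V)) :
    ((tsys a b).R ((tsys a b).ten X (b.ext Y V)) t (ctxVars X) V (.var (b.ch Y))).subst
      (tauL a b X Y v) = (tsys a b).R ((tsys a b).ten X Y) t (ctxVars X) V v := by
  rw [Sys.subst_R, Sys.R, Sys.R]
  congr 1
  refine List.flatMap_congr fun e he => ?_
  obtain ⟨p, hp, rfl⟩ := mem_ctxVars.1 he
  rw [List.map_append, List.map_append]
  refine congrArg₂ _ (List.map_congr_left fun w hw => ?_) ?_
  · have gw := Thy.sort_good hV w hw
    have ge := Thy.var_good hX hp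
    have e := Sys.ten_pfx (s := tsys a b) hX (Thy.ext_ctx hV) List.prefix_rfl
      (List.prefix_append _ _) ge gw
    refine (congrArg (Expr.subst _) e).trans ?_
    exact ten_fixed hX hV.sort_ctx (fun p _ => tauL_old p.1) ge gw
  · simp only [List.map_cons, List.map_nil]
    congr 1
    rw [Sys.ten_var_var, Expr.subst_var]
    exact tauL_new p hp

theorem tsys_full (ha : a.Axioms) (hb : b.Axioms) : (tsys a b).Full where
  pre := tsys_pre ha hb
  half := tsys_half ha hb
  half' := tsys_half_swap ha hb
  ss {X U Y V} hU hV h := .step (.sA (Nf.ss.mem ha hb hU hV) h fun _ hi =>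
    der_vars (tsys_pre ha hb) h (List.getElem_mem hi))
  tt {X t U Y r V} hu hv := by
    have du := ha.der _ hu
    have dv := hb.der _ hv
    have dU := du.term_sort
    have dV := dv.term_sort
    have cX := dU.sort_ctx
    have cY := dV.sort_ctx
    refine ⟨tauLR a b X Y (.app t (ctxVars X)) (.app r (ctxVars Y)), tauLR_spec.1, tauLR_spec.2.1,
      tauLR_spec.2.2, fun h h' => ⟨_, .step (.teqA (Nf.mem ha hb (.tt ?_ ?_) hu hv) h h')⟩⟩
    · have e := Sys.ten_left (s := tsys a b) cX (.of_der du) (.of_der dv) (.inr rfl)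
      have ec : (tsys a b).a.cs X (.app t (ctxVars X)) = U := cs_introTerm hu
      rw [ec] at e
      rw [← e]
      exact (Adm.canon cX cY List.prefix_rfl List.prefix_rfl (.of_der du) (canon_introTerm ha hu)
        (.of_der dv) (canon_introTerm hb hv)).ttg
    · have e := TTd.appapp_base (b.fresh Y) _ (adm_extR du dV).ttg _ (graph_subL cX dv)
      rw [ten_right_ch du dV] at e
      convert e using 1
      exact (R_subst_tauL cX dV).symm

end

section
variable {A B : Alphabet} {a : Thy A} {b : Thy B} {X X' : PreCtx A} {Y Y' : PreCtx B}
  {U U' : SortE A} {V V' : SortE B} {u u' : Expr A} {v v' : Expr B} {Δ : PreCtx (A.tensor B)}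

theorem Thy.arg_of_term (h : Derivable a.ax (.term X u U)) : ∃ n, a.Arg n X u U :=
  h.imp fun _ h => .inr ⟨X, List.prefix_rfl, h⟩

theorem Thy.arg_ch (h : Derivable a.ax (.sort X U)) : ∃ n, a.Arg n (a.ext X U) (.var (a.ch X)) U :=
  Thy.var_arg (p := (a.ch X, U)) (Thy.ext_ctx h) (by simp)

theorem in_tensor (ha : a.Axioms) (hb : b.Axioms) (hX : Derivable a.ax (.ctx X))
    (hY : Derivable b.ax (.ctx Y)) : (tsys a b).In X Y ((tsys a b).tctx X Y) := by
  obtain ⟨n, hn⟩ := a.exists_ctxAt hX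
  obtain ⟨m, hm⟩ := b.exists_ctxAt hY
  have := (tsys_full ha hb).cl n m
  exact Sys.in_tctx (s := tsys a b) (tsys_pre ha hb) this.srt hn hm

theorem in_tensorD (ha : a.Axioms) (hb : b.Axioms) (hU : Derivable a.ax (.sort X U))
    (hV : Derivable b.ax (.sort Y V)) :
    (tsys a b).In (a.ext X U) Y ((tsys a b).tctxD X (a.ch X, U) Y (b.ch Y, V)) ∧
      (tsys a b).In X (b.ext Y V) ((tsys a b).tctxD X (a.ch X, U) Y (b.ch Y, V)) := by
  obtain ⟨n, hn⟩ := hU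
  obtain ⟨m, hm⟩ := hV
  obtain ⟨-, h1, h2⟩ := Thy.CtxAt.snoc_ch hn.succ
  obtain ⟨-, h3, h4⟩ := Thy.CtxAt.snoc_ch hm.succ
  exact Sys.in_tctxD (s := tsys a b) (tsys_pre ha hb) ((tsys_full ha hb).cl _ _).srt
    ((tsys_full ha hb).cl _ _).srt h1 h2 h3 h4

theorem ten_der (ha : a.Axioms) (hb : b.Axioms) (i : (tsys a b).In X Y Δ)
    (hu : ∃ n, a.Arg n X u U) (hv : ∃ m, b.Arg m Y v V) :
    Derivable (tsys a b).ax
      (.term Δ ((tsys a b).ten X Y u v) ((tsys a b).TT ((tsys a b).ten X Y) U u V v)) := by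
  obtain ⟨n, hu⟩ := hu
  obtain ⟨m, hv⟩ := hv
  exact (((tsys_full ha hb).cl n m).amb i).typ hu hv

theorem extTT_conv (ha : a.Axioms) (hb : b.Axioms) {τ : (A.tensor B).Var → Expr (A.tensor B)}
    (hU : Derivable a.ax (.sort X U)) (hV : Derivable b.ax (.sort Y V)) (pX : X <+: X')
    (pY : Y <+: Y') (i : (tsys a b).In X' Y' Δ) (hu : ∃ n, a.Arg n X' u U)
    (hv : ∃ m, b.Arg m Y' v V) (hτ : ∀ p ∈ X, ∀ q ∈ Y, τ (p.1, q.1) = .var (p.1, q.1))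
    (hτx : ∀ q ∈ Y, τ (a.ch X, q.1) = (tsys a b).ten X' Y' u (.var q.1))
    (hτy : ∀ p ∈ X, τ (p.1, b.ch Y) = (tsys a b).ten X' Y' (.var p.1) v) :
    Derivable (tsys a b).ax (.sortEq Δ ((extTT a b X U Y V).subst τ)
      ((tsys a b).TT ((tsys a b).ten X' Y') U u V v)) := by
  have hd := (ten_der ha hb i hu hv).term_sort
  have cX' := Thy.ext_ctx hU
  have cY' := Thy.ext_ctx hV
  obtain ⟨n, hn⟩ := hU
  obtain ⟨m, hm⟩ := hV
  obtain ⟨n', hu⟩ := hu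
  obtain ⟨m', hv⟩ := hv
  have sU : a.SAt (max n n') X U := ⟨X, List.prefix_rfl, hn.mono (le_max_left _ _)⟩
  have sV : b.SAt (max m m') Y V := ⟨Y, List.prefix_rfl, hm.mono (le_max_left _ _)⟩
  exact Sys.final_sort (s := tsys a b) (tsys_pre ha hb)
    (((tsys_full ha hb).cl (max n n') (max m m')).amb i)
    ((Thy.CtxAt.of_sort hn.succ).mono (le_max_left _ _))
    ((Thy.CtxAt.of_sort hm.succ).mono (le_max_left _ _)) cX' cY' pX pY
    (hu.mono (le_max_right _ _)) (hv.mono (le_max_right _ _)) hd sU.args' sV.args' hτ hτx hτy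

theorem extTT_conv_left (ha : a.Axioms) (hb : b.Axioms) (hU : Derivable a.ax (.sort X U))
    (hv : Derivable b.ax (.term Y v V)) :
    Derivable (tsys a b).ax (.sortEq ((tsys a b).tctx (a.ext X U) Y)
      ((extTT a b X U Y V).subst (tauL a b X Y v))
      ((tsys a b).TT ((tsys a b).ten (a.ext X U) Y) U (.var (a.ch X)) V v)) := by
  refine extTT_conv ha hb hU hv.term_sort (List.prefix_append _ _) List.prefix_rfl
    (in_tensor ha hb (Thy.ext_ctx hU) hv.term_sort.sort_ctx) (Thy.arg_ch hU) (Thy.arg_of_term hv)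
    (fun p _ => tauL_old p.1) (fun q hq => ?_) fun p hp => ?_
  · rw [Sys.ten_var_var]
    exact tauL_old _ q hq
  · rw [ten_ext_left hU hv p hp]
    exact tauL_new p hp

theorem extTT_conv_right (ha : a.Axioms) (hb : b.Axioms) (hu : Derivable a.ax (.term X u U))
    (hV : Derivable b.ax (.sort Y V)) :
    Derivable (tsys a b).ax (.sortEq ((tsys a b).tctx X (b.ext Y V))
      ((extTT a b X U Y V).subst (tauR a b X Y u))
      ((tsys a b).TT ((tsys a b).ten X (b.ext Y V)) U u V (.var (b.ch Y)))) := by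
  refine extTT_conv ha hb hu.term_sort hV List.prefix_rfl (List.prefix_append _ _)
    (in_tensor ha hb hu.term_sort.sort_ctx (Thy.ext_ctx hV)) (Thy.arg_of_term hu) (Thy.arg_ch hV)
    (fun p hp q _ => tauR_old q.1 p hp) (fun q hq => ?_) fun p hp => ?_
  · rw [ten_ext_right hu hV q hq]
    exact tauR_new q hq
  · rw [Sys.ten_var_var]
    exact tauR_old _ p hp

theorem extTT_conv_both (ha : a.Axioms) (hb : b.Axioms) (hu : Derivable a.ax (.term X u U))
    (hv : Derivable b.ax (.term Y v V)) :
    Derivable (tsys a b).ax (.sortEq ((tsys a b).tctx X Y)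
      ((extTT a b X U Y V).subst (tauLR a b X Y u v))
      ((tsys a b).TT ((tsys a b).ten X Y) U u V v)) :=
  extTT_conv ha hb hu.term_sort hv.term_sort List.prefix_rfl List.prefix_rfl
    (in_tensor ha hb hu.term_sort.sort_ctx hv.term_sort.sort_ctx) (Thy.arg_of_term hu)
    (Thy.arg_of_term hv) tauLR_spec.1 tauLR_spec.2.1 tauLR_spec.2.2

theorem teq_retype {C : Alphabet} {Ax : Set (Judg C)} (hP : Pre Ax) {Z : PreCtx C} {e e' : Expr C}
    {W W' : SortE C} (h : TEq Ax Z e e') (he : Derivable Ax (.term Z e W))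
    (hW : Derivable Ax (.sortEq Z W' W)) : Derivable Ax (.termEq Z e e' W') :=
  (h.at_left hP he).teq_conv hW.ssymm

theorem tensor_seqs (ha : a.Axioms) (hb : b.Axioms) (hU : Derivable a.ax (.sortEq X U U'))
    (hV : Derivable b.ax (.sort Y V)) :
    Derivable (tsys a b).ax (.sortEq ((tsys a b).tctxD X (a.ch X, U) Y (b.ch Y, V))
      (extTT a b X U Y V) (extTT a b X U' Y V)) := by
  obtain ⟨i, j⟩ := in_tensorD ha hb hU.seq_left hV
  obtain ⟨m', hv⟩ := Thy.arg_ch hV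
  obtain ⟨n, hn⟩ := hU
  obtain ⟨m, hm⟩ := hV
  exact ((tsys_full ha hb).cl n (max m m')).seqS hn
    ⟨Y, List.prefix_rfl, hm.mono (le_max_left _ _)⟩ (List.prefix_append _ _)
    (hv.mono (le_max_right _ _)) i j

theorem tensor_sseq (ha : a.Axioms) (hb : b.Axioms) (hU : Derivable a.ax (.sort X U))
    (hV : Derivable b.ax (.sortEq Y V V')) :
    Derivable (tsys a b).ax (.sortEq ((tsys a b).tctxD X (a.ch X, U) Y (b.ch Y, V))
      (extTT a b X U Y V) (extTT a b X U Y V')) := by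
  obtain ⟨i, j⟩ := in_tensorD ha hb hU hV.seq_left
  obtain ⟨n', hu⟩ := Thy.arg_ch hU
  obtain ⟨n, hn⟩ := hU
  obtain ⟨m, hm⟩ := hV
  have := ((tsys_full ha hb).cl (max n n') m).seqS' (x := b.ch Y) hm
    ⟨X, List.prefix_rfl, hn.mono (le_max_left _ _)⟩ (List.prefix_append _ _)
    (hu.mono (le_max_right _ _)) j.swap i.swap
  rwa [Sys.ten_swap', Sys.ten_swap', Sys.TT_swap, Sys.TT_swap] at this

theorem Nf.der (ha : a.Axioms) (hb : b.Axioms) {J : Judg A} {J' : Judg B}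
    {K : Judg (A.tensor B)} (h : Nf a b J J' K) (hJ : Derivable a.ax J)
    (hJ' : Derivable b.ax J') : Derivable (tsys a b).ax K := by
  have hP := tsys_pre ha hb
  cases h with
  | ss => exact (tensor_seqs ha hb (.srefl hJ) hJ').seq_left
  | st =>
    exact (ten_der ha hb (in_tensor ha hb (Thy.ext_ctx hJ) hJ'.term_sort.sort_ctx)
      (Thy.arg_ch hJ) (Thy.arg_of_term hJ')).conv (extTT_conv_left ha hb hJ hJ').ssymm
  | ts =>
    exact (ten_der ha hb (in_tensor ha hb hJ.term_sort.sort_ctx (Thy.ext_ctx hJ'))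
      (Thy.arg_of_term hJ) (Thy.arg_ch hJ')).conv (extTT_conv_right ha hb hJ hJ').ssymm
  | tt he he' =>
    have i := in_tensor ha hb hJ.term_sort.sort_ctx hJ'.term_sort.sort_ctx
    have hd := ten_der ha hb i (Thy.arg_of_term hJ) (Thy.arg_of_term hJ')
    have hc := extTT_conv_both ha hb hJ hJ'
    obtain ⟨n, hn⟩ := hJ
    obtain ⟨m, hm⟩ := hJ'
    have am := ((tsys_full ha hb).cl n m).amb i
    have t1 := he.teq hP am (.of_term hn.succ) (.of_term hm.succ) (.inr ⟨_, List.prefix_rfl, hn⟩)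
      (.inr ⟨_, List.prefix_rfl, hm⟩)
    have t2 := he'.teq hP am (.of_term hn.succ) (.of_term hm.succ) (.inr ⟨_, List.prefix_rfl, hn⟩)
      (.inr ⟨_, List.prefix_rfl, hm⟩)
    have t3 := t1.symm.at_left hP hd
    exact teq_retype hP (t1.trans hP t2.symm) t3.teq_right hc
  | sseq => exact tensor_sseq ha hb hJ hJ'
  | seqs => exact tensor_seqs ha hb hJ hJ'
  | @steq X U Y v v' V =>
    have h1 := hJ'.teq_left
    have i := in_tensor ha hb (Thy.ext_ctx hJ) h1.term_sort.sort_ctx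
    refine teq_retype hP ?_ (ten_der ha hb i (Thy.arg_ch hJ) (Thy.arg_of_term h1))
      (extTT_conv_left ha hb hJ h1)
    obtain ⟨n, hu⟩ := Thy.arg_ch hJ
    obtain ⟨m, hm⟩ := hJ'
    have := ((tsys_full ha hb).cl n m).teqT' hm hu i.swap
    rwa [Sys.ten_swap'] at this
  | @teqs X u u' U Y V =>
    have h1 := hJ.teq_left
    have i := in_tensor ha hb h1.term_sort.sort_ctx (Thy.ext_ctx hJ')
    refine teq_retype hP ?_ (ten_der ha hb i (Thy.arg_of_term h1) (Thy.arg_ch hJ'))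
      (extTT_conv_right ha hb h1 hJ')
    obtain ⟨n, hn⟩ := hJ
    obtain ⟨m, hv⟩ := Thy.arg_ch hJ'
    exact ((tsys_full ha hb).cl n m).teqT hn hv i
  | @seqt X U U' Y v V =>
    have h1 := hJ.seq_left
    have i := in_tensor ha hb (Thy.ext_ctx h1) hJ'.term_sort.sort_ctx
    refine teq_retype hP ?_ (ten_der ha hb i (Thy.arg_ch h1) (Thy.arg_of_term hJ'))
      (extTT_conv_left ha hb h1 hJ')
    obtain ⟨n, hn⟩ := hJ
    obtain ⟨m, hv⟩ := Thy.arg_of_term hJ'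
    have := ((tsys_full ha hb).cl n m).seqT (x := a.ch X) hn hv i
    exact this
  | @tseq X u U Y V V' =>
    have h1 := hJ'.seq_left
    have i := in_tensor ha hb hJ.term_sort.sort_ctx (Thy.ext_ctx h1)
    refine teq_retype hP ?_ (ten_der ha hb i (Thy.arg_of_term hJ) (Thy.arg_ch h1))
      (extTT_conv_right ha hb hJ h1)
    obtain ⟨n, hu⟩ := Thy.arg_of_term hJ
    obtain ⟨m, hm⟩ := hJ'
    have := ((tsys_full ha hb).cl n m).seqT' (x := b.ch Y) hm hu i.swap
    rwa [Sys.ten_swap', Sys.ten_swap'] at this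

end

theorem TJudg.nonempty {A B : Alphabet} {TA : Set (Judg A)} {TB : Set (Judg B)}
    {chA : PreCtx A → A.Var} {chB : PreCtx B → B.Var} {b : Bool} {J : Judg A} {J' : Judg B}
    {K : Judg (A.tensor B)} (h : TJudg TA TB chA chB b J J' K) :
    Nonempty (SortE A) ∧ Nonempty (SortE B) := by
  cases h <;> exact ⟨⟨‹SortE A›⟩, ⟨‹SortE B›⟩⟩

/-- A generalized algebraic theory with a choice of fresh variables. -/
def Thy.ofGAT {A : Alphabet} {T : Set (Judg A)} (hT : IsGAT T) {ch : PreCtx A → A.Var}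
    (hch : FreshCh ch) (U : SortE A) : Thy A :=
  ⟨T, ch, U, hT.1.pre, hch⟩

theorem Thy.ofGAT_axioms {A : Alphabet} {T : Set (Judg A)} (hT : IsGAT T) {ch : PreCtx A → A.Var}
    (hch : FreshCh ch) (U : SortE A) : (Thy.ofGAT hT hch U).Axioms :=
  ⟨hT.2, fun _ _ S h h' => (hT.1.sort_intro S).unique h h'⟩

/-- If the pair `(𝔸,𝔹)` of generalized algebraic theories is
`h`-derivable, then it is `(h+1)`-derivable. -/
theorem hDerivable_succ
    (A B : Alphabet) (TA : Set (Judg A)) (TB : Set (Judg B))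
    (hA : IsGAT TA) (hB : IsGAT TB)
    (chA : PreCtx A → A.Var) (hchA : FreshCh chA)
    (chB : PreCtx B → B.Var) (hchB : FreshCh chB)
    (h : ℕ) (hder : hDerivable TA TB chA chB h) :
    hDerivable TA TB chA chB (h + 1) := by
  intro J J' K hJ hJ' _ hK
  obtain ⟨⟨U⟩, ⟨V⟩⟩ := hK.nonempty
  have h := TJudg.nf (a := .ofGAT hA hchA U) (b := .ofGAT hB hchB V) hK hJ hJ'
  exact h.der (Thy.ofGAT_axioms hA hchA U) (Thy.ofGAT_axioms hB hchB V) hJ hJ'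

end GATPaper
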